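/- The quotient (g_n : ℝ)/p_n tends to 5/2 as n → ∞. -/

import Mathlib

open Filter Pointwise

/-- `nthPrime n` is the `n`-th prime number (1-indexed): `nthPrime 1 = 2`, etc. -/
noncomputable def nthPrime (n : ℕ) : ℕ := Nat.nth Nat.Prime (n - 1)

/-- `S n` is the additive submonoid of `ℕ` generated by the primes `q ≥ nthPrime n`. -/
def S (n : ℕ) : AddSubmonoid ℕ :=
  AddSubmonoid.closure {q : ℕ | q.Prime ∧ nthPrime n ≤ q}

/-- `frob n` is the Frobenius number of `S n`: the largest natural number not in `S n`. -/
noncomputable def frob (n : ℕ) : ℕ := sSup {m : ℕ | m ∉ S n}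

/-- `genus n` is the number of natural numbers not in `S n`. -/
noncomputable def genus (n : ℕ) : ℕ := {m : ℕ | m ∉ S n}.ncard

/-- `atoms n` is the minimal generating set `S n \ {0} \ ((S n \ {0}) + (S n \ {0}))`. -/
def atoms (n : ℕ) : Set ℕ :=
  ((S n : Set ℕ) \ {0}) \ (((S n : Set ℕ) \ {0}) + ((S n : Set ℕ) \ {0}))

/-- `u n` is the largest atom of `S n`. -/
noncomputable def u (n : ℕ) : ℕ := sSup (atoms n)

/-- `e n` is the embedding dimension of `S n`: the number of atoms. -/
noncomputable def e (n : ℕ) : ℕ := (atoms n).ncard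

/-- The elementary symmetric polynomial of degree `k` in the values `x p`, `p ∈ B`. -/
noncomputable def elemSym (k : ℕ) (B : Finset ℕ) (x : ℕ → ℝ) : ℝ :=
  ∑ D ∈ B.powersetCard k, ∏ p ∈ D, x p

/-- The expansion of `∏ p ∈ B, (1 - x p)` truncated at degree `b`. -/
noncomputable def truncProd (b : ℕ) (B : Finset ℕ) (x : ℕ → ℝ) : ℝ :=
  ∑ k ∈ Finset.range (b + 1), (-1) ^ k * elemSym k B x

lemma elemSym_zero (B : Finset ℕ) (x : ℕ → ℝ) : elemSym 0 B x = 1 := by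
  simp [elemSym]

lemma elemSym_insert (k : ℕ) {a : ℕ} {B : Finset ℕ} (ha : a ∉ B) (x : ℕ → ℝ) :
    elemSym (k + 1) (insert a B) x = elemSym (k + 1) B x + x a * elemSym k B x := by
  unfold elemSym
  rw [Finset.powersetCard_succ_insert ha, Finset.sum_union, Finset.mul_sum]
  · congr 1
    rw [Finset.sum_image]
    · refine Finset.sum_congr rfl fun D hD => ?_
      rw [Finset.prod_insert]
      exact fun h => ha ((Finset.mem_powersetCard.1 hD).1 h)
    · intro D hD D' hD' h
      have h1 : a ∉ D := fun h => ha ((Finset.mem_powersetCard.1 hD).1 h)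
      have h2 : a ∉ D' := fun h => ha ((Finset.mem_powersetCard.1 hD').1 h)
      rw [← Finset.erase_insert h1, ← Finset.erase_insert h2]
      rw [h]
  · rw [Finset.disjoint_left]
    intro D hD hD'
    obtain ⟨D', -, rfl⟩ := Finset.mem_image.1 hD'
    exact ha ((Finset.mem_powersetCard.1 hD).1 (Finset.mem_insert_self _ _))

lemma truncProd_zero (B : Finset ℕ) (x : ℕ → ℝ) : truncProd 0 B x = 1 := by
  simp [truncProd, elemSym_zero]

lemma truncProd_succ (b : ℕ) (B : Finset ℕ) (x : ℕ → ℝ) :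
    truncProd (b + 1) B x = truncProd b B x + (-1) ^ (b + 1) * elemSym (b + 1) B x := by
  rw [truncProd, Finset.sum_range_succ, truncProd]

lemma truncProd_insert (b : ℕ) {a : ℕ} {B : Finset ℕ} (ha : a ∉ B) (x : ℕ → ℝ) :
    truncProd (b + 1) (insert a B) x = truncProd (b + 1) B x - x a * truncProd b B x := by
  induction b with
  | zero =>
    rw [truncProd_succ, truncProd_succ, truncProd_zero, truncProd_zero, elemSym_insert _ ha,
      elemSym_zero]
    ring
  | succ b ih =>
    rw [truncProd_succ, ih, elemSym_insert _ ha, truncProd_succ (b + 1) B, truncProd_succ b B]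
    ring

/-- The Bonferroni inequality, in the sign-normalised form. -/
lemma truncProd_sub_prod_nonneg (b : ℕ) (B : Finset ℕ) {x : ℕ → ℝ}
    (hx : ∀ p ∈ B, 0 ≤ x p) (hx1 : ∀ p ∈ B, x p ≤ 1) :
    0 ≤ (-1) ^ b * (truncProd b B x - ∏ p ∈ B, (1 - x p)) := by
  induction B using Finset.induction_on generalizing b with
  | empty =>
    have : truncProd b ∅ x = 1 := by
      induction b with
      | zero => exact truncProd_zero _ _
      | succ b ih => rw [truncProd_succ, ih, elemSym, Finset.powersetCard_eq_empty.2 (by simp)]; simp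
    simp [this]
  | insert a B ha ih =>
    have hB := fun p hp => hx p (Finset.mem_insert_of_mem hp)
    have hB1 := fun p hp => hx1 p (Finset.mem_insert_of_mem hp)
    have ha0 := hx a (Finset.mem_insert_self _ _)
    have ha1 := hx1 a (Finset.mem_insert_self _ _)
    have hp0 : 0 ≤ ∏ p ∈ B, (1 - x p) := Finset.prod_nonneg fun p hp => by linarith [hB1 p hp]
    rw [Finset.prod_insert ha]
    cases b with
    | zero =>
      have := ih 0 hB hB1
      rw [truncProd_zero] at this ⊢
      simp only [pow_zero, one_mul] at this ⊢
      nlinarith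
    | succ b =>
      rw [truncProd_insert _ ha]
      have h1 := ih b hB hB1
      have h2 := ih (b + 1) hB hB1
      have : (-1 : ℝ) ^ (b + 1) * (truncProd (b + 1) B x - x a * truncProd b B x -
          (1 - x a) * ∏ p ∈ B, (1 - x p)) =
          (-1) ^ (b + 1) * (truncProd (b + 1) B x - ∏ p ∈ B, (1 - x p)) +
          x a * ((-1) ^ b * (truncProd b B x - ∏ p ∈ B, (1 - x p))) := by ring
      rw [this]
      positivity

lemma prod_le_truncProd {b : ℕ} (hb : Even b) (B : Finset ℕ) {x : ℕ → ℝ}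
    (hx : ∀ p ∈ B, 0 ≤ x p) (hx1 : ∀ p ∈ B, x p ≤ 1) :
    ∏ p ∈ B, (1 - x p) ≤ truncProd b B x := by
  have := truncProd_sub_prod_nonneg b B hx hx1
  rw [hb.neg_one_pow] at this
  linarith

lemma truncProd_le_prod_add {b : ℕ} (hb : Even b) (B : Finset ℕ) {x : ℕ → ℝ}
    (hx : ∀ p ∈ B, 0 ≤ x p) (hx1 : ∀ p ∈ B, x p ≤ 1) :
    truncProd b B x ≤ ∏ p ∈ B, (1 - x p) + elemSym (b + 1) B x := by
  have := truncProd_sub_prod_nonneg (b + 1) B hx hx1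
  rw [truncProd_succ, hb.add_one.neg_one_pow] at this
  linarith

lemma elemSym_le_exp (m : ℕ) (B : Finset ℕ) {x : ℕ → ℝ} (hx : ∀ p ∈ B, 0 ≤ x p) {t : ℝ}
    (ht : 0 < t) : elemSym m B x ≤ t⁻¹ ^ m * Real.exp (t * ∑ p ∈ B, x p) := by
  have h1 : t ^ m * elemSym m B x ≤ ∏ p ∈ B, (1 + t * x p) := by
    rw [Finset.prod_one_add, elemSym, Finset.mul_sum]
    calc ∑ D ∈ B.powersetCard m, t ^ m * ∏ p ∈ D, x p
        = ∑ D ∈ B.powersetCard m, ∏ p ∈ D, (t * x p) := by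
          refine Finset.sum_congr rfl fun D hD => ?_
          rw [Finset.prod_mul_distrib, Finset.prod_const, (Finset.mem_powersetCard.1 hD).2]
      _ ≤ _ := by
          refine Finset.sum_le_sum_of_subset_of_nonneg ?_ ?_
          · intro D hD
            exact Finset.mem_powerset.2 (Finset.mem_powersetCard.1 hD).1
          · intro D hD _
            refine Finset.prod_nonneg fun p hp => mul_nonneg ht.le (hx p ?_)
            exact Finset.mem_powerset.1 hD hp
  have h2 : ∏ p ∈ B, (1 + t * x p) ≤ Real.exp (t * ∑ p ∈ B, x p) := by
    rw [Finset.mul_sum, Real.exp_sum]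
    refine Finset.prod_le_prod (fun p hp => ?_) fun p hp => ?_
    · have := hx p hp; positivity
    · rw [add_comm]; exact Real.add_one_le_exp _
  rw [inv_pow, inv_mul_eq_div, le_div_iff₀ (by positivity), mul_comm]
  exact h1.trans h2

lemma prod_sub_prod_le {ι : Type*} [DecidableEq ι] (s : Finset ι) {x y e : ι → ℝ}
    (hx : ∀ i ∈ s, 0 ≤ x i) (hxy : ∀ i ∈ s, x i ≤ y i) (he : ∀ i ∈ s, y i ≤ x i + e i) :
    ∏ i ∈ s, y i - ∏ i ∈ s, x i ≤ ∑ j ∈ s, ∏ i ∈ s, if i = j then e i else y i := by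
  induction s using Finset.induction_on with
  | empty => simp
  | insert a s ha ih =>
    have hx' := fun i hi => hx i (Finset.mem_insert_of_mem hi)
    have hxy' := fun i hi => hxy i (Finset.mem_insert_of_mem hi)
    have he' := fun i hi => he i (Finset.mem_insert_of_mem hi)
    have h := ih hx' hxy' he'
    have ha0 := hx a (Finset.mem_insert_self _ _)
    have ha1 := hxy a (Finset.mem_insert_self _ _)
    have ha2 := he a (Finset.mem_insert_self _ _)
    rw [Finset.prod_insert ha, Finset.prod_insert ha, Finset.sum_insert ha, Finset.prod_insert ha,
      if_pos rfl]
    have e1 : ∏ i ∈ s, (if i = a then e i else y i) = ∏ i ∈ s, y i :=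
      Finset.prod_congr rfl fun i hi => if_neg (by rintro rfl; exact ha hi)
    have e2 : ∑ j ∈ s, ∏ i ∈ insert a s, (if i = j then e i else y i) =
        y a * ∑ j ∈ s, ∏ i ∈ s, (if i = j then e i else y i) := by
      rw [Finset.mul_sum]
      refine Finset.sum_congr rfl fun j hj => ?_
      rw [Finset.prod_insert ha, if_neg (by rintro rfl; exact ha hj)]
    rw [e1, e2]
    have h3 : ∏ i ∈ s, x i ≤ ∏ i ∈ s, y i := Finset.prod_le_prod hx' hxy'
    have h4 : 0 ≤ ∏ i ∈ s, x i := Finset.prod_nonneg hx'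
    have h5 : (y a - x a) * ∏ i ∈ s, x i ≤ e a * ∏ i ∈ s, y i :=
      mul_le_mul (by linarith) h3 h4 (by linarith)
    have h6 := mul_le_mul_of_nonneg_left h (ha0.trans ha1)
    nlinarith

/-- `φ` is a multilinear form in the values `x p`, `p ∈ P`, with coefficients bounded by `K` and
supported on sets of product at most `M`. -/
def IsSieveForm (P : Finset ℕ) (K M : ℝ) (φ : (ℕ → ℝ) → ℝ) : Prop :=
  ∃ c : Finset ℕ → ℝ, (∀ D, |c D| ≤ K) ∧ (∀ D ⊆ P, c D ≠ 0 → ((∏ p ∈ D, p : ℕ) : ℝ) ≤ M) ∧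
    ∀ x, φ x = ∑ D ∈ P.powerset, c D * ∏ p ∈ D, x p

lemma sum_powerset_union {P Q : Finset ℕ} (h : Disjoint P Q) (f : Finset ℕ → ℝ) :
    ∑ D ∈ (P ∪ Q).powerset, f D = ∑ D ∈ P.powerset, ∑ D' ∈ Q.powerset, f (D ∪ D') := by
  rw [← Finset.sum_product']
  symm
  refine Finset.sum_nbij' (fun x => x.1 ∪ x.2) (fun D => (D ∩ P, D ∩ Q)) ?_ ?_ ?_ ?_ ?_
  · rintro ⟨D, D'⟩ hD
    simp only [Finset.mem_product, Finset.mem_powerset] at hD ⊢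
    exact Finset.union_subset_union hD.1 hD.2
  · intro D hD
    simp
  · rintro ⟨D, D'⟩ hD
    simp only [Finset.mem_product, Finset.mem_powerset] at hD
    have h1 : D ∩ Q = ∅ := Finset.disjoint_iff_inter_eq_empty.1 (h.mono_left hD.1)
    have h2 : D' ∩ P = ∅ := Finset.disjoint_iff_inter_eq_empty.1 (h.symm.mono_left hD.2)
    simp only [Finset.union_inter_distrib_right, h1, h2, Finset.inter_eq_left.2 hD.1,
      Finset.inter_eq_left.2 hD.2, Finset.union_empty, Finset.empty_union]
  · intro D hD
    simp only [Finset.mem_powerset] at hD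
    rw [← Finset.inter_union_distrib_left, Finset.inter_eq_left.2 hD]
  · intros; rfl

lemma IsSieveForm.mul {P Q : Finset ℕ} (h : Disjoint P Q) {K M M' : ℝ} {φ ψ : (ℕ → ℝ) → ℝ}
    (hM : 0 ≤ M) (hφ : IsSieveForm P K M φ) (hψ : IsSieveForm Q 1 M' ψ) :
    IsSieveForm (P ∪ Q) K (M * M') fun x => φ x * ψ x := by
  obtain ⟨c, hc, hcM, hcx⟩ := hφ
  obtain ⟨d, hd, hdM, hdx⟩ := hψ
  refine ⟨fun D => c (D ∩ P) * d (D ∩ Q), fun D => ?_, fun D hD hne => ?_, fun x => ?_⟩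
  · rw [abs_mul]
    calc _ ≤ K * 1 := mul_le_mul (hc _) (hd _) (abs_nonneg _) ((abs_nonneg _).trans (hc ∅))
      _ = K := mul_one K
  · have h1 := hcM (D ∩ P) Finset.inter_subset_right (left_ne_zero_of_mul hne)
    have h2 := hdM (D ∩ Q) Finset.inter_subset_right (right_ne_zero_of_mul hne)
    have h3 : D = (D ∩ P) ∪ (D ∩ Q) := by
      rw [← Finset.inter_union_distrib_left, Finset.inter_eq_left.2 hD]
    have h4 : Disjoint (D ∩ P) (D ∩ Q) :=
      h.mono Finset.inter_subset_right Finset.inter_subset_right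
    rw [h3, Finset.prod_union h4]
    push_cast at h1 h2 ⊢
    exact mul_le_mul h1 h2 (by positivity) hM
  · simp only [hcx, hdx]
    rw [sum_powerset_union h, Finset.sum_mul_sum]
    refine Finset.sum_congr rfl fun D hD => Finset.sum_congr rfl fun D' hD' => ?_
    rw [Finset.mem_powerset] at hD hD'
    have h1 : D ∩ Q = ∅ := Finset.disjoint_iff_inter_eq_empty.1 (h.mono_left hD)
    have h2 : D' ∩ P = ∅ := Finset.disjoint_iff_inter_eq_empty.1 (h.symm.mono_left hD')
    simp only [Finset.union_inter_distrib_right, h1, h2, Finset.inter_eq_left.2 hD,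
      Finset.inter_eq_left.2 hD', Finset.union_empty, Finset.empty_union]
    rw [Finset.prod_union (h.mono hD hD')]
    ring

lemma IsSieveForm.sub {P : Finset ℕ} {K K' M : ℝ} {φ ψ : (ℕ → ℝ) → ℝ}
    (hφ : IsSieveForm P K M φ) (hψ : IsSieveForm P K' M ψ) :
    IsSieveForm P (K + K') M fun x => φ x - ψ x := by
  obtain ⟨c, hc, hcM, hcx⟩ := hφ
  obtain ⟨d, hd, hdM, hdx⟩ := hψ
  refine ⟨fun D => c D - d D, fun D => ?_, fun D hD hne => ?_, fun x => ?_⟩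
  · exact (abs_sub _ _).trans (add_le_add (hc D) (hd D))
  · by_cases h : c D = 0
    · exact hdM D hD (by intro h'; simp [h, h'] at hne)
    · exact hcM D hD h
  · simp only [hcx, hdx]
    rw [← Finset.sum_sub_distrib]
    exact Finset.sum_congr rfl fun D _ => by ring

lemma IsSieveForm.mono {P : Finset ℕ} {K K' M M' : ℝ} {φ : (ℕ → ℝ) → ℝ}
    (hφ : IsSieveForm P K M φ) (hK : K ≤ K') (hM : M ≤ M') : IsSieveForm P K' M' φ := by
  obtain ⟨c, hc, hcM, hcx⟩ := hφ
  exact ⟨c, fun D => (hc D).trans hK, fun D hD h => (hcM D hD h).trans hM, hcx⟩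

lemma isSieveForm_card {B : Finset ℕ} {y : ℝ} (hy : 1 ≤ y) (hB : ∀ p ∈ B, (p : ℝ) ≤ y) {m : ℕ}
    (σ : ℕ → ℝ) (hσ : ∀ k, |σ k| ≤ 1) (h0 : ∀ k, m < k → σ k = 0) :
    IsSieveForm B 1 (y ^ m) fun x => ∑ D ∈ B.powerset, σ D.card * ∏ p ∈ D, x p := by
  refine ⟨fun D => σ D.card, fun D => hσ _, fun D hD h => ?_, fun x => rfl⟩
  have h1 : D.card ≤ m := by
    by_contra h2
    exact h (h0 _ (not_le.1 h2))
  push_cast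
  calc (∏ p ∈ D, (p : ℝ)) ≤ ∏ p ∈ D, y :=
        Finset.prod_le_prod (fun _ _ => by positivity) fun p hp => hB p (hD hp)
    _ = y ^ D.card := by rw [Finset.prod_const]
    _ ≤ y ^ m := pow_le_pow_right₀ hy h1

lemma elemSym_eq (m : ℕ) (B : Finset ℕ) (x : ℕ → ℝ) :
    elemSym m B x = ∑ D ∈ B.powerset, (if D.card = m then (1 : ℝ) else 0) * ∏ p ∈ D, x p := by
  simp only [elemSym, ite_mul, one_mul, zero_mul, ← Finset.sum_filter]
  rw [Finset.powersetCard_eq_filter]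

lemma isSieveForm_elemSym {B : Finset ℕ} {y : ℝ} (hy : 1 ≤ y) (hB : ∀ p ∈ B, (p : ℝ) ≤ y) (m : ℕ) :
    IsSieveForm B 1 (y ^ m) (elemSym m B) := by
  have := isSieveForm_card hy hB (m := m) (fun k => if k = m then 1 else 0)
    (fun k => by split_ifs <;> simp) (fun k hk => if_neg hk.ne')
  simpa only [← elemSym_eq] using this

lemma isSieveForm_truncProd {B : Finset ℕ} {y : ℝ} (hy : 1 ≤ y) (hB : ∀ p ∈ B, (p : ℝ) ≤ y)
    (m : ℕ) : IsSieveForm B 1 (y ^ m) (truncProd m B) := by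
  have := isSieveForm_card hy hB (m := m) (fun k => if k ≤ m then (-1) ^ k else 0)
    (fun k => by split_ifs <;> simp) (fun k hk => if_neg (not_le.2 hk))
  convert this using 1
  funext x
  simp only [truncProd, elemSym_eq, Finset.mul_sum]
  rw [Finset.sum_comm]
  refine Finset.sum_congr rfl fun D hD => ?_
  simp only [ite_mul, one_mul, zero_mul, mul_ite, mul_zero, Finset.sum_ite_eq, Finset.mem_range,
    Nat.lt_succ_iff]

lemma isSieveForm_prod {B : ℕ → Finset ℕ} {k : ℕ}
    (hB : ∀ i < k, ∀ j < k, i ≠ j → Disjoint (B i) (B j)) {M : ℕ → ℝ} (hM : ∀ i, 0 ≤ M i)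
    {ψ : ℕ → (ℕ → ℝ) → ℝ} (h : ∀ i < k, IsSieveForm (B i) 1 (M i) (ψ i)) :
    IsSieveForm ((Finset.range k).biUnion B) 1 (∏ i ∈ Finset.range k, M i)
      fun x => ∏ i ∈ Finset.range k, ψ i x := by
  induction k with
  | zero =>
    refine ⟨fun _ => 1, by simp, fun D hD _ => ?_, fun x => ?_⟩
    · simp only [Finset.range_zero, Finset.biUnion_empty, Finset.subset_empty] at hD
      simp [hD]
    · simp
  | succ k ih =>
    have h1 := ih (fun i hi j hj => hB i (by omega) j (by omega)) fun i hi => h i (by omega)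
    have h2 := h1.mul (Q := B k) ?_ (Finset.prod_nonneg fun i _ => hM i) (h k (by omega))
    · simpa only [Finset.prod_range_succ, Finset.range_add_one, Finset.biUnion_insert,
        Finset.union_comm, Finset.prod_insert Finset.notMem_range_self, mul_comm] using h2
    · rw [Finset.disjoint_biUnion_left]
      intro i hi
      rw [Finset.mem_range] at hi
      exact hB i (by omega) k (by omega) (by omega)

lemma isSieveForm_sum {P : Finset ℕ} {M : ℝ} {k : ℕ} {ψ : ℕ → (ℕ → ℝ) → ℝ}
    (h : ∀ i < k, IsSieveForm P 1 M (ψ i)) :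
    IsSieveForm P k M fun x => ∑ i ∈ Finset.range k, ψ i x := by
  induction k with
  | zero => exact ⟨fun _ => 0, by simp, by simp, by simp⟩
  | succ k ih =>
    obtain ⟨c, hc, hcM, hcx⟩ := ih fun i hi => h i (by omega)
    obtain ⟨d, hd, hdM, hdx⟩ := h k (by omega)
    refine ⟨fun D => c D + d D, fun D => ?_, fun D hD hne => ?_, fun x => ?_⟩
    · push_cast
      exact (abs_add_le _ _).trans (add_le_add (hc D) (hd D))
    · by_cases h : c D = 0
      · exact hdM D hD (by intro h'; simp [h, h'] at hne)
      · exact hcM D hD h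
    · simp only [Finset.sum_range_succ, hdx, hcx]
      rw [← Finset.sum_add_distrib]
      exact Finset.sum_congr rfl fun D _ => by ring

/-- Upper and lower bound sieve weights of Brun–Hooley type attached to disjoint blocks. -/
theorem exists_sieveForm {B : ℕ → Finset ℕ} {k : ℕ}
    (hB : ∀ i < k, ∀ j < k, i ≠ j → Disjoint (B i) (B j)) {y : ℕ → ℝ} (hy : ∀ i, 1 ≤ y i)
    (hBy : ∀ i, ∀ p ∈ B i, (p : ℝ) ≤ y i) (b : ℕ → ℕ) (hb : ∀ i, Even (b i)) {L : ℝ}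
    (hB2 : ∀ i, ∀ p ∈ B i, 2 ≤ p) (hL : ∀ i < k, ∑ p ∈ B i, (p : ℝ)⁻¹ ≤ L) :
    ∃ U V : (ℕ → ℝ) → ℝ,
      IsSieveForm ((Finset.range k).biUnion B) 1 (∏ i ∈ Finset.range k, y i ^ (b i + 1)) U ∧
      IsSieveForm ((Finset.range k).biUnion B) (k + 1)
        (∏ i ∈ Finset.range k, y i ^ (b i + 1)) V ∧
      (∀ x : ℕ → ℝ, (∀ p, 0 ≤ x p) → (∀ p, x p ≤ 1) →
        V x ≤ ∏ p ∈ (Finset.range k).biUnion B, (1 - x p) ∧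
        ∏ p ∈ (Finset.range k).biUnion B, (1 - x p) ≤ U x) ∧
      U (fun p => (p : ℝ)⁻¹) ≤ (∏ p ∈ (Finset.range k).biUnion B, (1 - (p : ℝ)⁻¹)) *
        Real.exp (∑ i ∈ Finset.range k, 4⁻¹ ^ (b i + 1) * Real.exp (6 * L)) ∧
      U (fun p => (p : ℝ)⁻¹) *
        (1 - ∑ i ∈ Finset.range k, 4⁻¹ ^ (b i + 1) * Real.exp (6 * L)) ≤
        V (fun p => (p : ℝ)⁻¹) := by
  set T : ℕ → (ℕ → ℝ) → ℝ := fun i => truncProd (b i) (B i) with hT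
  set F : ℕ → (ℕ → ℝ) → ℝ := fun i => elemSym (b i + 1) (B i) with hF
  have hdis : Set.PairwiseDisjoint (↑(Finset.range k)) B := by
    intro i hi j hj hij
    exact hB i (by simpa using hi) j (by simpa using hj) hij
  have hTf : ∀ i, IsSieveForm (B i) 1 (y i ^ (b i + 1)) (T i) := fun i =>
    (isSieveForm_truncProd (hy i) (hBy i) (b i)).mono le_rfl
      (pow_le_pow_right₀ (hy i) (Nat.le_succ _))
  have hFf : ∀ i, IsSieveForm (B i) 1 (y i ^ (b i + 1)) (F i) := fun i =>
    isSieveForm_elemSym (hy i) (hBy i) _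
  have hy0 : ∀ i, 0 ≤ y i ^ (b i + 1) := fun i => pow_nonneg (by linarith [hy i]) _
  have hUf := isSieveForm_prod hB hy0 (ψ := T) fun i _ => hTf i
  have hEf := isSieveForm_sum (P := (Finset.range k).biUnion B)
    (M := ∏ i ∈ Finset.range k, y i ^ (b i + 1))
    (ψ := fun j x => ∏ i ∈ Finset.range k, if i = j then F i x else T i x) (k := k) (by
      intro j _
      have := isSieveForm_prod hB hy0 (ψ := fun i x => if i = j then F i x else T i x)
        (fun i _ => by
          split_ifs
          · exact hFf i
          · exact hTf i)
      exact this)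
  have hVf := (hUf.sub hEf).mono (K' := k + 1) (by linarith) le_rfl
  refine ⟨_, _, hUf, hVf, ?_, ?_, ?_⟩
  · intro x hx0 hx1
    have hle : ∀ i, ∏ p ∈ B i, (1 - x p) ≤ T i x := fun i =>
      prod_le_truncProd (hb i) (B i) (fun p _ => hx0 p) fun p _ => hx1 p
    have h0 : ∀ i, 0 ≤ ∏ p ∈ B i, (1 - x p) := fun i =>
      Finset.prod_nonneg fun p _ => by linarith [hx1 p]
    rw [Finset.prod_biUnion hdis]
    refine ⟨?_, Finset.prod_le_prod (fun i _ => h0 i) fun i _ => hle i⟩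
    have := prod_sub_prod_le (Finset.range k) (x := fun i => ∏ p ∈ B i, (1 - x p))
      (y := fun i => T i x) (e := fun i => F i x) (fun i _ => h0 i) (fun i _ => hle i)
      (fun i _ => truncProd_le_prod_add (hb i) (B i) (fun p _ => hx0 p) fun p _ => hx1 p)
    linarith
  all_goals
    set x : ℕ → ℝ := fun p => (p : ℝ)⁻¹ with hx
    have hx0 : ∀ i, ∀ p ∈ B i, 0 ≤ x p := fun i p _ => by positivity
    have hxh : ∀ i, ∀ p ∈ B i, x p ≤ 1 / 2 := fun i p hp => by
      have : (2 : ℝ) ≤ p := by exact_mod_cast hB2 i p hp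
      rw [hx, one_div]
      exact inv_anti₀ (by norm_num) this
    have hx1 : ∀ i, ∀ p ∈ B i, x p ≤ 1 := fun i p hp => by linarith [hxh i p hp]
    have hle : ∀ i, ∏ p ∈ B i, (1 - x p) ≤ T i x := fun i =>
      prod_le_truncProd (hb i) (B i) (hx0 i) (hx1 i)
    have hlow : ∀ i < k, Real.exp (-2 * L) ≤ ∏ p ∈ B i, (1 - x p) := fun i hi => by
      calc Real.exp (-2 * L) ≤ Real.exp (∑ p ∈ B i, -2 * x p) := by
            rw [← Finset.mul_sum, Real.exp_le_exp]
            linarith [hL i hi]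
        _ = ∏ p ∈ B i, Real.exp (-2 * x p) := Real.exp_sum _ _
        _ ≤ _ := by
            refine Finset.prod_le_prod (fun _ _ => (Real.exp_pos _).le) fun p hp => ?_
            have h1 := hxh i p hp
            have h2 := hx0 i p hp
            have h3 : 0 < 1 - x p := by linarith
            rw [show -2 * x p = -(2 * x p) by ring, Real.exp_neg, inv_le_comm₀ (Real.exp_pos _) h3]
            refine le_trans ?_ (Real.add_one_le_exp _)
            rw [inv_le_iff_one_le_mul₀ h3]
            nlinarith
    have hFle : ∀ i < k, F i x ≤ (4⁻¹ ^ (b i + 1) * Real.exp (6 * L)) * ∏ p ∈ B i, (1 - x p) := by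
      intro i hi
      have h1 : F i x ≤ 4⁻¹ ^ (b i + 1) * Real.exp (4 * ∑ p ∈ B i, x p) :=
        elemSym_le_exp _ _ (hx0 i) (by norm_num)
      have h2 : Real.exp (4 * ∑ p ∈ B i, x p) ≤ Real.exp (4 * L) := by
        rw [Real.exp_le_exp]
        linarith [hL i hi]
      calc F i x ≤ 4⁻¹ ^ (b i + 1) * Real.exp (4 * L) := h1.trans (by gcongr)
        _ = 4⁻¹ ^ (b i + 1) * Real.exp (6 * L) * Real.exp (-2 * L) := by
            rw [mul_assoc, ← Real.exp_add]; ring_nf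
        _ ≤ _ := mul_le_mul_of_nonneg_left (hlow i hi) (by positivity)
    have h0 : ∀ i, 0 ≤ ∏ p ∈ B i, (1 - x p) := fun i =>
      Finset.prod_nonneg fun p hp => by linarith [hx1 i p hp]
  · rw [Finset.prod_biUnion hdis, Real.exp_sum, ← Finset.prod_mul_distrib]
    refine Finset.prod_le_prod (fun i _ => (h0 i).trans (hle i)) fun i hi => ?_
    rw [Finset.mem_range] at hi
    have h1 : T i x ≤ ∏ p ∈ B i, (1 - x p) + F i x :=
      truncProd_le_prod_add (hb i) (B i) (hx0 i) (hx1 i)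
    have h2 := hFle i hi
    have h3 := Real.add_one_le_exp (4⁻¹ ^ (b i + 1) * Real.exp (6 * L))
    nlinarith [h0 i]
  · rw [mul_sub, mul_one, Finset.mul_sum]
    refine sub_le_sub_left (Finset.sum_le_sum fun j hj => ?_) _
    have hj' := Finset.mem_range.1 hj
    rw [← Finset.mul_prod_erase _ _ hj, ← Finset.mul_prod_erase _ (fun i => T i x) hj, if_pos rfl]
    rw [Finset.prod_congr rfl (g := fun i => T i x)
      (fun i hi => if_neg (Finset.ne_of_mem_erase hi))]
    have h1 : 0 ≤ ∏ i ∈ (Finset.range k).erase j, T i x :=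
      Finset.prod_nonneg fun i _ => (h0 i).trans (hle i)
    have h2 : F j x ≤ (4⁻¹ ^ (b j + 1) * Real.exp (6 * L)) * T j x :=
      (hFle j hj').trans (mul_le_mul_of_nonneg_left (hle j) (by positivity))
    nlinarith

lemma sum_log_mul_div_le (n : ℕ) :
    ∑ p ∈ n.primesLE, Real.log p * (n / p : ℕ) ≤ n * Real.log n := by
  have h1 : ∀ k ∈ Finset.Ioc 0 n, ∑ p ∈ n.primesLE, (if p ∣ k then Real.log p else 0) ≤
      Real.log n := by
    intro k hk
    rw [Finset.mem_Ioc] at hk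
    calc ∑ p ∈ n.primesLE, (if p ∣ k then Real.log p else 0)
        = ∑ p ∈ k.primeFactors, Real.log p := by
          rw [← Finset.sum_filter]
          refine Finset.sum_congr ?_ fun _ _ => rfl
          ext p
          simp only [Finset.mem_filter, Nat.mem_primesLE, Nat.mem_primeFactors]
          constructor
          · rintro ⟨⟨_, h⟩, h'⟩
            exact ⟨h, h', by omega⟩
          · rintro ⟨h, h', _⟩
            exact ⟨⟨(Nat.le_of_dvd hk.1 h').trans hk.2, h⟩, h'⟩
      _ = Real.log (∏ p ∈ k.primeFactors, (p : ℝ)) := by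
          rw [Real.log_prod]
          intro p hp
          have := (Nat.prime_of_mem_primeFactors hp).pos
          positivity
      _ ≤ Real.log n := by
          apply Real.log_le_log
          · refine Finset.prod_pos fun p hp => ?_
            have := (Nat.prime_of_mem_primeFactors hp).pos
            positivity
          · have := (Nat.le_of_dvd hk.1 (Nat.prod_primeFactors_dvd k)).trans hk.2
            rw [← Nat.cast_prod]
            exact Nat.cast_le.2 this
  calc ∑ p ∈ n.primesLE, Real.log p * (n / p : ℕ)
      = ∑ p ∈ n.primesLE, ∑ k ∈ Finset.Ioc 0 n, (if p ∣ k then Real.log p else 0) := by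
        refine Finset.sum_congr rfl fun p _ => ?_
        rw [← Finset.sum_filter, Finset.sum_const, Nat.Ioc_filter_dvd_card_eq_div, nsmul_eq_mul,
          mul_comm]
    _ = ∑ k ∈ Finset.Ioc 0 n, ∑ p ∈ n.primesLE, (if p ∣ k then Real.log p else 0) :=
        Finset.sum_comm
    _ ≤ ∑ k ∈ Finset.Ioc 0 n, Real.log n := Finset.sum_le_sum h1
    _ = n * Real.log n := by simp

/-- An upper bound of Mertens. -/
lemma sum_log_div_le {n : ℕ} (hn : 0 < n) :
    ∑ p ∈ n.primesLE, Real.log p / p ≤ Real.log n + Real.log 4 := by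
  have hn' : (0 : ℝ) < n := by exact_mod_cast hn
  have h1 := sum_log_mul_div_le n
  have h2 : Chebyshev.theta n ≤ Real.log 4 * n := Chebyshev.theta_le_log4_mul_x hn'.le
  rw [Chebyshev.theta_eq_sum_primesLE_log] at h2
  have h3 : ∀ p ∈ n.primesLE, Real.log p / p * n ≤ Real.log p * (n / p : ℕ) + Real.log p := by
    intro p hp
    have hp' := (Nat.mem_primesLE.1 hp).2
    have h4 : (n : ℝ) / p ≤ (n / p : ℕ) + 1 := by
      rw [← Nat.floor_div_eq_div (K := ℝ)]
      exact (Nat.lt_floor_add_one _).le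
    have h5 : 0 ≤ Real.log p := Real.log_natCast_nonneg p
    calc Real.log p / p * n = Real.log p * (n / p) := by ring
      _ ≤ Real.log p * ((n / p : ℕ) + 1) := by gcongr
      _ = _ := by ring
  have h4 := Finset.sum_le_sum h3
  rw [Finset.sum_add_distrib, ← Finset.sum_mul] at h4
  refine le_of_mul_le_mul_right (h4.trans ?_) hn'
  nlinarith

lemma sum_inv_le_of_lt_sq {B : Finset ℕ} (hB : ∀ p ∈ B, p.Prime)
    (h : ∀ p ∈ B, ∀ w ∈ B, w < p ^ 2) : ∑ p ∈ B, (p : ℝ)⁻¹ ≤ 6 := by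
  rcases B.eq_empty_or_nonempty with rfl | hne
  · simp
  set w := B.max' hne with hw
  have hwB : w ∈ B := B.max'_mem hne
  have hw2 := (hB w hwB).two_le
  have hlw : Real.log 2 ≤ Real.log w := Real.log_le_log (by norm_num) (by exact_mod_cast hw2)
  have hl2 : 0 < Real.log 2 := Real.log_pos (by norm_num)
  have h1 : ∀ p ∈ B, (p : ℝ)⁻¹ ≤ 2 / Real.log w * (Real.log p / p) := by
    intro p hp
    have hp0 : (0 : ℝ) < p := by exact_mod_cast (hB p hp).pos
    have h2 : Real.log w ≤ 2 * Real.log p := by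
      rw [← Real.log_rpow hp0]
      apply Real.log_le_log (by positivity)
      exact_mod_cast (h p hp w hwB).le
    calc (p : ℝ)⁻¹ = 1 / Real.log w * (Real.log w) * (p : ℝ)⁻¹ := by
          rw [one_div, inv_mul_cancel₀ (by linarith), one_mul]
      _ ≤ 1 / Real.log w * (2 * Real.log p) * (p : ℝ)⁻¹ := by
          have : 0 < Real.log w := by linarith
          gcongr
      _ = _ := by ring
  calc ∑ p ∈ B, (p : ℝ)⁻¹ ≤ ∑ p ∈ B, 2 / Real.log w * (Real.log p / p) := Finset.sum_le_sum h1
    _ ≤ 2 / Real.log w * ∑ p ∈ w.primesLE, Real.log p / p := by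
        rw [← Finset.mul_sum]
        have : 0 < Real.log w := by linarith
        refine mul_le_mul_of_nonneg_left ?_ (by positivity)
        refine Finset.sum_le_sum_of_subset_of_nonneg ?_ fun p _ _ => ?_
        · intro p hp
          exact Nat.mem_primesLE.2 ⟨B.le_max' p hp, hB p hp⟩
        · exact div_nonneg (Real.log_natCast_nonneg p) (by positivity)
    _ ≤ 2 / Real.log w * (Real.log w + Real.log 4) := by
        have : 0 < Real.log w := by linarith
        gcongr
        exact sum_log_div_le (by omega)
    _ ≤ 6 := by
        have h0 : 0 < Real.log w := by linarith
        rw [show (4 : ℝ) = 2 ^ 2 by norm_num, Real.log_pow, div_mul_eq_mul_div, div_le_iff₀ h0]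
        push_cast
        linarith

lemma sum_levels_le (s k : ℕ) :
    ∑ i ∈ Finset.range k, ((2 * (s + i) + 1 : ℕ) : ℝ) * (1 / 2) ^ i ≤ 4 * s + 6 := by
  have : ∑ i ∈ Finset.range k, ((2 * (s + i) + 1 : ℕ) : ℝ) * (1 / 2) ^ i =
      4 * s + 6 - (4 * s + 4 * k + 6) * (1 / 2) ^ k := by
    induction k with
    | zero => simp
    | succ k ih =>
      rw [Finset.sum_range_succ, ih]
      push_cast
      ring
  rw [this]
  have : (0 : ℝ) ≤ (4 * s + 4 * k + 6) * (1 / 2) ^ k := by positivity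
  linarith

/-- The fundamental lemma of the sieve. -/
theorem fundamental_lemma : ∃ C : ℝ, 0 < C ∧ ∀ (s : ℕ) (z : ℝ) (P : Finset ℕ), 2 ≤ z →
    (∀ p ∈ P, p.Prime) → (∀ p ∈ P, (p : ℝ) ≤ z) →
    ∃ U V : (ℕ → ℝ) → ℝ,
      IsSieveForm P 1 (z ^ (4 * s + 6)) U ∧ IsSieveForm P z (z ^ (4 * s + 6)) V ∧
      (∀ x : ℕ → ℝ, (∀ p, 0 ≤ x p) → (∀ p, x p ≤ 1) →
        V x ≤ ∏ p ∈ P, (1 - x p) ∧ ∏ p ∈ P, (1 - x p) ≤ U x) ∧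
      U (fun p => (p : ℝ)⁻¹) ≤ (1 + C / 2 ^ s) * ∏ p ∈ P, (1 - (p : ℝ)⁻¹) ∧
      (1 - C / 2 ^ s) * ∏ p ∈ P, (1 - (p : ℝ)⁻¹) ≤ V (fun p => (p : ℝ)⁻¹) := by
  set C₀ : ℝ := Real.exp 36 with hC₀
  refine ⟨C₀ * Real.exp C₀, by positivity, fun s z P hz hP hPz => ?_⟩
  have hex : ∃ k : ℕ, z < 2 ^ 2 ^ k := by
    obtain ⟨k, hk⟩ := pow_unbounded_of_one_lt z (one_lt_two)
    refine ⟨k, hk.trans_le ?_⟩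
    exact pow_le_pow_right₀ one_le_two Nat.lt_two_pow_self.le
  classical
  set k := Nat.find hex with hk
  have hkz : z < 2 ^ 2 ^ k := Nat.find_spec hex
  have hkz' : (k : ℝ) + 1 ≤ z := by
    rcases Nat.eq_zero_or_pos k with h | h
    · rw [h]; norm_num; linarith
    · have h1 := Nat.find_min hex (m := k - 1) (by omega)
      rw [not_lt] at h1
      refine le_trans ?_ h1
      have h2 : k - 1 + 1 ≤ 2 ^ (k - 1) := Nat.lt_two_pow_self
      have h3 : 2 ^ (k - 1) + 1 ≤ 2 ^ 2 ^ (k - 1) := Nat.lt_two_pow_self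
      exact_mod_cast (show k + 1 ≤ 2 ^ 2 ^ (k - 1) by omega)
  set B : ℕ → Finset ℕ := fun j => P.filter fun p => (p : ℝ) ^ 2 ^ j ≤ z ∧ z < (p : ℝ) ^ 2 ^ (j + 1)
    with hB
  have hBP : ∀ j, ∀ p ∈ B j, p ∈ P := fun j p hp => (Finset.mem_filter.1 hp).1
  have hBl : ∀ j, ∀ p ∈ B j, (p : ℝ) ^ 2 ^ j ≤ z := fun j p hp => (Finset.mem_filter.1 hp).2.1
  have hBu : ∀ j, ∀ p ∈ B j, z < (p : ℝ) ^ 2 ^ (j + 1) := fun j p hp => (Finset.mem_filter.1 hp).2.2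
  have hdis' : ∀ i j, i < j → Disjoint (B i) (B j) := by
    intro i j hij
    rw [Finset.disjoint_left]
    intro p hi hj
    have h1 : (p : ℝ) ^ 2 ^ (i + 1) ≤ (p : ℝ) ^ 2 ^ j := by
      apply pow_le_pow_right₀
      · exact_mod_cast (hP p (hBP i p hi)).one_le
      · exact Nat.pow_le_pow_right (by norm_num) hij
    linarith [hBu i p hi, hBl j p hj]
  have hdis : ∀ i < k, ∀ j < k, i ≠ j → Disjoint (B i) (B j) := by
    intro i _ j _ hij
    rcases lt_or_gt_of_ne hij with h | h
    · exact hdis' i j h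
    · exact (hdis' j i h).symm
  have hunion : (Finset.range k).biUnion B = P := by
    ext p
    simp only [Finset.mem_biUnion, Finset.mem_range]
    constructor
    · rintro ⟨j, -, hj⟩
      exact hBP j p hj
    · intro hp
      have hp2 : (2 : ℝ) ≤ p := by exact_mod_cast (hP p hp).two_le
      have hex2 : ∃ j : ℕ, z < (p : ℝ) ^ 2 ^ (j + 1) := by
        refine ⟨k, hkz.trans_le ?_⟩
        refine (pow_le_pow_left₀ (by norm_num) hp2 _).trans ?_
        exact pow_le_pow_right₀ (by linarith) (Nat.pow_le_pow_right (by norm_num) (by omega))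
      have h1 : (p : ℝ) ^ 2 ^ Nat.find hex2 ≤ z := by
        rcases Nat.eq_zero_or_pos (Nat.find hex2) with h | h
        · rw [h]; simpa using hPz p hp
        · have := Nat.find_min hex2 (m := Nat.find hex2 - 1) (by omega)
          rwa [not_lt, Nat.sub_add_cancel h] at this
      refine ⟨Nat.find hex2, ?_, Finset.mem_filter.2 ⟨hp, h1, Nat.find_spec hex2⟩⟩
      by_contra! h
      have : (2 : ℝ) ^ 2 ^ k ≤ (p : ℝ) ^ 2 ^ Nat.find hex2 :=
        (pow_le_pow_left₀ (by norm_num) hp2 _).trans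
          (pow_le_pow_right₀ (by linarith) (Nat.pow_le_pow_right (by norm_num) h))
      linarith
  have hz0 : (0 : ℝ) < z := by linarith
  set y : ℕ → ℝ := fun j => z ^ ((1 / 2 : ℝ) ^ j) with hy
  have hy1 : ∀ i, 1 ≤ y i := fun i => Real.one_le_rpow (by linarith) (by positivity)
  have hBy : ∀ i, ∀ p ∈ B i, (p : ℝ) ≤ y i := by
    intro i p hp
    have h1 := hBl i p hp
    have h2 : ((p : ℝ) ^ 2 ^ i) ^ ((1 / 2 : ℝ) ^ i) ≤ y i :=
      Real.rpow_le_rpow (by positivity) h1 (by positivity)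
    rw [← Real.rpow_natCast, ← Real.rpow_mul (by positivity)] at h2
    push_cast at h2
    rwa [← mul_pow, show (2 : ℝ) * (1 / 2) = 1 by norm_num, one_pow, Real.rpow_one] at h2
  have hL : ∀ i < k, ∑ p ∈ B i, (p : ℝ)⁻¹ ≤ 6 := by
    intro i _
    refine sum_inv_le_of_lt_sq (fun p hp => hP p (hBP i p hp)) fun p hp w hw => ?_
    have h1 := (hBl i w hw).trans_lt (hBu i p hp)
    rw [pow_succ', pow_mul] at h1
    have := lt_of_pow_lt_pow_left₀ _ (by positivity) h1
    exact_mod_cast this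
  obtain ⟨U, V, hU, hV, hUV, hU1, hV1⟩ := exists_sieveForm (B := B) (k := k) hdis (y := y) hy1 hBy
    (fun i => 2 * (s + i)) (fun i => even_two_mul _) (L := 6)
    (fun i p hp => (hP p (hBP i p hp)).two_le) hL
  rw [hunion] at hU hV hUV hU1
  have hM : ∏ i ∈ Finset.range k, y i ^ (2 * (s + i) + 1) ≤ z ^ (4 * s + 6) := by
    have : ∀ i ∈ Finset.range k, y i ^ (2 * (s + i) + 1) =
        z ^ (((2 * (s + i) + 1 : ℕ) : ℝ) * (1 / 2) ^ i) := by
      intro i _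
      rw [hy, ← Real.rpow_natCast, ← Real.rpow_mul hz0.le, mul_comm]
    rw [Finset.prod_congr rfl this, ← Real.rpow_sum_of_pos hz0, ← Real.rpow_natCast]
    apply Real.rpow_le_rpow_of_exponent_le (by linarith)
    push_cast
    simpa using sum_levels_le s k
  set δ : ℝ := ∑ i ∈ Finset.range k, 4⁻¹ ^ (2 * (s + i) + 1) * Real.exp (6 * 6) with hδ
  have hδ0 : 0 ≤ δ := Finset.sum_nonneg fun i _ => by positivity
  have hδ1 : δ ≤ C₀ / 2 ^ s := by
    have h1 : ∀ i ∈ Finset.range k, (4⁻¹ : ℝ) ^ (2 * (s + i) + 1) * Real.exp (6 * 6) ≤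
        C₀ / 2 ^ s / 2 * (1 / 2) ^ i := by
      intro i _
      have h2 : (4⁻¹ : ℝ) ^ (2 * (s + i) + 1) ≤ (1 / 2) ^ (s + i + 1) := by
        rw [show (4⁻¹ : ℝ) = (1 / 2) ^ 2 by norm_num, ← pow_mul]
        exact pow_le_pow_of_le_one (by norm_num) (by norm_num) (by omega)
      calc (4⁻¹ : ℝ) ^ (2 * (s + i) + 1) * Real.exp (6 * 6)
          ≤ (1 / 2) ^ (s + i + 1) * Real.exp (6 * 6) := by gcongr
        _ = _ := by
          rw [hC₀, show (6 * 6 : ℝ) = 36 by norm_num, pow_add, pow_add]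
          simp only [one_div, inv_pow, pow_one]
          ring
    refine (Finset.sum_le_sum h1).trans ?_
    rw [← Finset.mul_sum]
    have h3 : ∑ i ∈ Finset.range k, (1 / 2 : ℝ) ^ i ≤ 2 := by
      rw [geom_sum_eq (by norm_num), div_le_iff_of_neg (by norm_num)]
      have : (0 : ℝ) ≤ (1 / 2) ^ k := by positivity
      linarith
    calc _ ≤ C₀ / 2 ^ s / 2 * 2 := by gcongr
      _ = _ := by ring
  have hδC : δ ≤ C₀ := hδ1.trans (div_le_self (by positivity) (one_le_pow₀ (by norm_num)))
  have hW : 0 ≤ ∏ p ∈ P, (1 - (p : ℝ)⁻¹) := Finset.prod_nonneg fun p hp => by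
    have : (p : ℝ)⁻¹ ≤ 1 := inv_le_one_of_one_le₀ (by exact_mod_cast (hP p hp).one_le)
    linarith
  have hexp : δ * Real.exp δ ≤ C₀ * Real.exp C₀ / 2 ^ s := by
    calc δ * Real.exp δ ≤ C₀ / 2 ^ s * Real.exp C₀ := by gcongr
      _ = _ := by ring
  have hexp1 : Real.exp δ ≤ 1 + δ * Real.exp δ := by
    have h1 := Real.add_one_le_exp (-δ)
    have h2 : Real.exp (-δ) * Real.exp δ = 1 := by rw [← Real.exp_add]; simp
    nlinarith [Real.exp_pos δ]
  have hx : ∏ p ∈ P, (1 - (p : ℝ)⁻¹) ≤ U fun p => (p : ℝ)⁻¹ := by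
    have := (hUV (fun p => (p : ℝ)⁻¹) (fun p => by positivity) fun p => Nat.cast_inv_le_one p).2
    simpa using this
  refine ⟨U, V, hU.mono le_rfl hM, hV.mono hkz' hM, hUV, ?_, ?_⟩
  · refine hU1.trans ?_
    rw [mul_comm]
    exact mul_le_mul_of_nonneg_right (by linarith) hW
  · refine le_trans ?_ hV1
    have : δ * (U fun p => (p : ℝ)⁻¹) ≤ δ * (Real.exp δ * ∏ p ∈ P, (1 - (p : ℝ)⁻¹)) := by
      rw [mul_comm (Real.exp δ)]
      exact mul_le_mul_of_nonneg_left hU1 hδ0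
    nlinarith

/-- The value at `D` of the product over the primes in `D`, as an indicator. -/
lemma prod_ite_one_zero (D : Finset ℕ) (q : ℕ → Prop) [DecidablePred q] :
    ∏ p ∈ D, (if q p then (1 : ℝ) else 0) = if ∀ p ∈ D, q p then 1 else 0 := by
  rw [Finset.prod_ite_zero]
  simp

lemma prod_one_sub_ite (P : Finset ℕ) (q : ℕ → Prop) [DecidablePred q] :
    ∏ p ∈ P, (1 - if q p then (1 : ℝ) else 0) = if ∀ p ∈ P, ¬ q p then 1 else 0 := by
  rw [← prod_ite_one_zero]
  refine Finset.prod_congr rfl fun p _ => ?_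
  by_cases h : q p <;> simp [h]

lemma injOn_prod_primes {P : Finset ℕ} (hP : ∀ p ∈ P, p.Prime) :
    Set.InjOn (fun D : Finset ℕ => ∏ p ∈ D, p) (P.powerset : Set (Finset ℕ)) := by
  intro D hD D' hD' h
  simp only [Finset.coe_powerset, Set.mem_preimage, Set.mem_powerset_iff, Finset.coe_subset]
    at hD hD'
  have := congrArg Nat.primeFactors h
  simpa [Nat.primeFactors_prod fun p hp => hP p (hD hp),
    Nat.primeFactors_prod fun p hp => hP p (hD' hp)] using this

/-- Evaluation of a sieve form on average over a weighted finite set. -/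
lemma IsSieveForm.abs_sum_sub_le {P : Finset ℕ} {K M : ℝ} {φ : (ℕ → ℝ) → ℝ}
    (hφ : IsSieveForm P K M φ) (hM : 0 ≤ M) (hP : ∀ p ∈ P, p.Prime) {ι : Type*} (A : Finset ι)
    (w : ι → ℝ) (q : ι → ℕ → Prop) [∀ n, DecidablePred (q n)] {X E : ℝ} (hE : 0 ≤ E)
    (h : ∀ D ⊆ P, ((∏ p ∈ D, p : ℕ) : ℝ) ≤ M →
      |∑ n ∈ A, (if ∀ p ∈ D, q n p then w n else 0) - X / (∏ p ∈ D, p : ℕ)| ≤ E) :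
    |∑ n ∈ A, w n * φ (fun p => if q n p then 1 else 0) - X * φ (fun p => (p : ℝ)⁻¹)| ≤
      K * M * E := by
  obtain ⟨c, hc, hcM, hcx⟩ := hφ
  have hK : 0 ≤ K := (abs_nonneg _).trans (hc ∅)
  simp only [hcx, prod_ite_one_zero, Finset.mul_sum]
  rw [Finset.sum_comm, ← Finset.sum_sub_distrib]
  set 𝒟 := P.powerset.filter fun D => c D ≠ 0 with h𝒟
  have h1 : ∀ D ∈ P.powerset, |∑ n ∈ A, w n * (c D * if ∀ p ∈ D, q n p then 1 else 0) -
      X * (c D * ∏ p ∈ D, (p : ℝ)⁻¹)| ≤ if c D ≠ 0 then K * E else 0 := by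
    intro D hD
    rw [Finset.mem_powerset] at hD
    have h2 : ∑ n ∈ A, w n * (c D * if ∀ p ∈ D, q n p then 1 else 0) -
        X * (c D * ∏ p ∈ D, (p : ℝ)⁻¹) =
        c D * (∑ n ∈ A, (if ∀ p ∈ D, q n p then w n else 0) - X / (∏ p ∈ D, p : ℕ)) := by
      rw [mul_sub, Finset.mul_sum]
      congr 1
      · refine Finset.sum_congr rfl fun n _ => ?_
        split_ifs <;> ring
      · push_cast
        rw [Finset.prod_inv_distrib]
        ring
    rw [h2, abs_mul]
    split_ifs with h3
    · exact mul_le_mul (hc D) (h D hD (hcM D hD h3)) (abs_nonneg _) hK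
    · rw [not_not] at h3
      simp [h3]
  refine (Finset.abs_sum_le_sum_abs _ _).trans ((Finset.sum_le_sum h1).trans ?_)
  rw [← Finset.sum_filter, Finset.sum_const, nsmul_eq_mul]
  have h3 : ((P.powerset.filter fun D => c D ≠ 0).card : ℝ) ≤ M := by
    have h4 : (P.powerset.filter fun D => c D ≠ 0).card ≤ (Finset.Ioc 0 ⌊M⌋₊).card := by
      refine Finset.card_le_card_of_injOn (fun D => ∏ p ∈ D, p) ?_
        ((injOn_prod_primes hP).mono fun D hD => ?_)
      · intro D hD
        simp only [Finset.coe_filter, Finset.mem_powerset, Set.mem_ofPred_eq] at hD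
        simp only [Finset.coe_Ioc, Set.mem_Ioc]
        exact ⟨Finset.prod_pos fun p hp => (hP p (hD.1 hp)).pos, Nat.le_floor (hcM D hD.1 hD.2)⟩
      · simp only [Finset.coe_filter, Set.mem_ofPred_eq] at hD
        exact_mod_cast hD.1
    rw [Nat.card_Ioc, Nat.sub_zero] at h4
    exact (Nat.cast_le.2 h4).trans (Nat.floor_le hM)
  calc _ ≤ M * (K * E) := mul_le_mul_of_nonneg_right h3 (by positivity)
    _ = _ := by ring

/-- The fundamental lemma applied to a weighted finite set. -/
theorem fundamental_lemma_count : ∃ C : ℝ, 0 < C ∧ ∀ (s : ℕ) (z : ℝ) (P : Finset ℕ), 2 ≤ z →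
    (∀ p ∈ P, p.Prime) → (∀ p ∈ P, (p : ℝ) ≤ z) → ∀ {ι : Type} (A : Finset ι)
    (w : ι → ℝ) (q : ι → ℕ → Prop) [∀ n, DecidablePred (q n)] (X E : ℝ), 0 ≤ X → 0 ≤ E →
    (∀ n ∈ A, 0 ≤ w n) →
    (∀ D ⊆ P, ((∏ p ∈ D, p : ℕ) : ℝ) ≤ z ^ (4 * s + 6) →
      |∑ n ∈ A, (if ∀ p ∈ D, q n p then w n else 0) - X / (∏ p ∈ D, p : ℕ)| ≤ E) →
    |∑ n ∈ A, (if ∀ p ∈ P, ¬ q n p then w n else 0) - X * ∏ p ∈ P, (1 - (p : ℝ)⁻¹)| ≤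
      C / 2 ^ s * (X * ∏ p ∈ P, (1 - (p : ℝ)⁻¹)) + z ^ (4 * s + 7) * E := by
  obtain ⟨C, hC, hFL⟩ := fundamental_lemma
  refine ⟨C, hC, fun s z P hz hP hPz ι A w q _ X E hX hE hw h => ?_⟩
  obtain ⟨U, V, hU, hV, hUV, hU1, hV1⟩ := hFL s z P hz hP hPz
  have hz0 : 0 < z := by linarith
  have h1 := hU.abs_sum_sub_le (by positivity) hP A w q hE h
  have h2 := hV.abs_sum_sub_le (by positivity) hP A w q hE h
  have h3 : ∀ n ∈ A, (if ∀ p ∈ P, ¬ q n p then w n else 0) ≤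
      w n * U (fun p => if q n p then 1 else 0) := by
    intro n hn
    have := (hUV (fun p => if q n p then 1 else 0) (fun p => by split_ifs <;> simp)
      (fun p => by split_ifs <;> simp)).2
    rw [prod_one_sub_ite] at this
    calc (if ∀ p ∈ P, ¬ q n p then w n else 0) = w n * (if ∀ p ∈ P, ¬ q n p then 1 else 0) := by
          split_ifs <;> simp
      _ ≤ _ := mul_le_mul_of_nonneg_left this (hw n hn)
  have h4 : ∀ n ∈ A, w n * V (fun p => if q n p then 1 else 0) ≤
      (if ∀ p ∈ P, ¬ q n p then w n else 0) := by
    intro n hn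
    have := (hUV (fun p => if q n p then 1 else 0) (fun p => by split_ifs <;> simp)
      (fun p => by split_ifs <;> simp)).1
    rw [prod_one_sub_ite] at this
    calc _ ≤ w n * (if ∀ p ∈ P, ¬ q n p then 1 else 0) :=
          mul_le_mul_of_nonneg_left this (hw n hn)
      _ = _ := by split_ifs <;> simp
  have h3' := Finset.sum_le_sum h3
  have h4' := Finset.sum_le_sum h4
  have h5 := mul_le_mul_of_nonneg_left hU1 hX
  have h6 := mul_le_mul_of_nonneg_left hV1 hX
  have h7 : z ^ (4 * s + 7) * E = z * z ^ (4 * s + 6) * E := by ring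
  have h8 : 1 * z ^ (4 * s + 6) * E ≤ z * z ^ (4 * s + 6) * E := by gcongr; linarith
  rw [abs_le] at h1 h2 ⊢
  rw [h7]
  constructor
  · linarith
  · linarith

/-- The primes up to `z` not dividing `q`. -/
noncomputable def sievePrimes (z : ℝ) (q : ℕ) : Finset ℕ :=
  ⌊z⌋₊.primesLE.filter fun p => ¬ p ∣ q

/-- The density `∏ p ∈ P, (1 - 1 / p)`. -/
noncomputable def sieveDensity (P : Finset ℕ) : ℝ := ∏ p ∈ P, (1 - (p : ℝ)⁻¹)

lemma mem_sievePrimes {z : ℝ} {q p : ℕ} :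
    p ∈ sievePrimes z q ↔ p.Prime ∧ (p : ℝ) ≤ z ∧ ¬ p ∣ q := by
  simp only [sievePrimes, Finset.mem_filter, Nat.mem_primesLE]
  constructor
  · rintro ⟨⟨h1, h2⟩, h3⟩
    exact ⟨h2, (Nat.le_floor_iff' h2.ne_zero).1 h1, h3⟩
  · rintro ⟨h2, h1, h3⟩
    exact ⟨⟨(Nat.le_floor_iff' h2.ne_zero).2 h1, h2⟩, h3⟩

lemma one_sub_inv_pos {p : ℕ} (hp : p.Prime) : 0 < 1 - (p : ℝ)⁻¹ := by
  have : (p : ℝ)⁻¹ < 1 := inv_lt_one_of_one_lt₀ (by exact_mod_cast hp.one_lt)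
  linarith

lemma one_sub_inv_le_one (p : ℕ) : 1 - (p : ℝ)⁻¹ ≤ 1 := by
  have : (0 : ℝ) ≤ (p : ℝ)⁻¹ := by positivity
  linarith

lemma sieveDensity_pos {P : Finset ℕ} (hP : ∀ p ∈ P, p.Prime) : 0 < sieveDensity P :=
  Finset.prod_pos fun p hp => one_sub_inv_pos (hP p hp)

lemma sieveDensity_le_one {P : Finset ℕ} (hP : ∀ p ∈ P, p.Prime) : sieveDensity P ≤ 1 :=
  Finset.prod_le_one (fun p hp => (one_sub_inv_pos (hP p hp)).le) fun p _ => one_sub_inv_le_one p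

lemma sieveDensity_anti {P Q : Finset ℕ} (hP : ∀ p ∈ Q, p.Prime) (h : P ⊆ Q) :
    sieveDensity Q ≤ sieveDensity P := by
  unfold sieveDensity
  rw [← Finset.prod_sdiff h]
  refine mul_le_of_le_one_left (sieveDensity_pos fun p hp => hP p (h hp)).le ?_
  exact sieveDensity_le_one fun p hp => hP p (Finset.mem_sdiff.1 hp).1

lemma sieveDensity_union {P Q : Finset ℕ} (h : Disjoint P Q) :
    sieveDensity (P ∪ Q) = sieveDensity P * sieveDensity Q := Finset.prod_union h

lemma log_mul_sieveDensity_primesLE_le (n : ℕ) :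
    Real.log (n + 1) * sieveDensity n.primesLE ≤ 1 := by
  set f : ℕ →* ℝ :=
    { toFun := fun n => (n : ℝ)⁻¹
      map_one' := by simp
      map_mul' := fun a b => by push_cast; rw [mul_inv] } with hf
  have hfp : ∀ {p : ℕ}, p.Prime → ‖f p‖ < 1 := fun {p} hp => by
    have h1 : ‖f p‖ = (p : ℝ)⁻¹ := by simp [hf]
    rw [h1]
    exact inv_lt_one_of_one_lt₀ (by exact_mod_cast hp.one_lt)
  obtain ⟨hs, hS⟩ := EulerProduct.summable_and_hasSum_smoothNumbers_prod_primesBelow_geometric hfp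
    (n + 1)
  have h1 : ∑ k ∈ Finset.Icc 1 n, (k : ℝ)⁻¹ ≤ ∏ p ∈ (n + 1).primesBelow, (1 - f p)⁻¹ := by
    rw [← hS.tsum_eq]
    have hinj : ∀ k ∈ Finset.Icc 1 n, k ∈ (n + 1).smoothNumbers := by
      intro k hk
      rw [Finset.mem_Icc] at hk
      exact Nat.mem_smoothNumbers_of_lt hk.1 (by omega)
    have h2 : Summable fun m : (n + 1).smoothNumbers => f m := hs.of_norm
    refine le_trans (le_of_eq ?_) (h2.sum_le_tsum
      ((Finset.Icc 1 n).subtype fun k => k ∈ (n + 1).smoothNumbers) fun k _ => ?_)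
    · rw [Finset.sum_subtype_of_mem (fun k => f k) hinj]
      rfl
    · exact inv_nonneg.2 (Nat.cast_nonneg _)
  have h2 := log_add_one_le_harmonic n
  rw [harmonic_eq_sum_Icc] at h2
  push_cast at h2
  have h3 : ∏ p ∈ (n + 1).primesBelow, (1 - f p)⁻¹ = (sieveDensity n.primesLE)⁻¹ := by
    rw [sieveDensity, ← Finset.prod_inv_distrib]
    rfl
  rw [h3] at h1
  rw [← le_div_iff₀ (sieveDensity_pos fun p hp => (Nat.mem_primesLE.1 hp).2), one_div]
  exact h2.trans h1

lemma div_totient_eq {q : ℕ} (hq : q ≠ 0) :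
    (q : ℝ) / q.totient = (sieveDensity q.primeFactors)⁻¹ := by
  have h1 := Nat.totient_eq_mul_prod_factors q
  have h2 : (q.totient : ℝ) = q * sieveDensity q.primeFactors := by
    have := congrArg (fun x : ℚ => (x : ℝ)) h1
    push_cast at this
    exact this
  have : (q : ℝ) ≠ 0 := by exact_mod_cast hq
  rw [h2, div_mul_eq_div_div, div_self this, one_div]

lemma log_mul_sieveDensity_sievePrimes_le {z : ℝ} (hz : 1 ≤ z) {q : ℕ} (hq : q ≠ 0) :
    Real.log z * sieveDensity (sievePrimes z q) ≤ q / q.totient := by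
  have h1 := log_mul_sieveDensity_primesLE_le ⌊z⌋₊
  have h2 : Real.log z ≤ Real.log (⌊z⌋₊ + 1) :=
    Real.log_le_log (by linarith) (Nat.lt_floor_add_one z).le
  have hpf : ∀ p ∈ q.primeFactors, p.Prime := fun p => Nat.prime_of_mem_primeFactors
  have hsp : ∀ p ∈ sievePrimes z q, p.Prime := fun p hp => (mem_sievePrimes.1 hp).1
  have hd : Disjoint (sievePrimes z q) q.primeFactors := by
    rw [Finset.disjoint_left]
    intro p hp hp'
    exact (mem_sievePrimes.1 hp).2.2 (Nat.dvd_of_mem_primeFactors hp')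
  have h3 : sieveDensity (sievePrimes z q) * sieveDensity q.primeFactors ≤
      sieveDensity ⌊z⌋₊.primesLE := by
    rw [← sieveDensity_union hd]
    refine sieveDensity_anti (fun p hp => ?_) fun p hp => ?_
    · rcases Finset.mem_union.1 hp with h | h
      · exact hsp p h
      · exact hpf p h
    · rw [Finset.mem_union]
      by_cases h : p ∣ q
      · right
        exact Nat.mem_primeFactors.2 ⟨(Nat.mem_primesLE.1 hp).2, h, hq⟩
      · left
        exact Finset.mem_filter.2 ⟨hp, h⟩
  rw [div_totient_eq hq, ← one_div, le_div_iff₀ (sieveDensity_pos hpf), mul_assoc]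
  calc _ ≤ Real.log (⌊z⌋₊ + 1) * sieveDensity ⌊z⌋₊.primesLE :=
        mul_le_mul h2 h3 (mul_pos (sieveDensity_pos hsp) (sieveDensity_pos hpf)).le
          (Real.log_nonneg (by norm_num))
    _ ≤ 1 := h1

lemma exp_neg_le_sieveDensity {P : Finset ℕ} (hP : ∀ p ∈ P, p.Prime) :
    Real.exp (-2 * ∑ p ∈ P, (p : ℝ)⁻¹) ≤ sieveDensity P := by
  rw [Finset.mul_sum, Real.exp_sum]
  refine Finset.prod_le_prod (fun _ _ => (Real.exp_pos _).le) fun p hp => ?_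
  have h1 : (p : ℝ)⁻¹ ≤ 1 / 2 := by
    rw [one_div]
    exact inv_anti₀ (by norm_num) (by exact_mod_cast (hP p hp).two_le)
  have h2 : (0 : ℝ) ≤ (p : ℝ)⁻¹ := by positivity
  have h3 := one_sub_inv_pos (hP p hp)
  rw [show -2 * (p : ℝ)⁻¹ = -(2 * (p : ℝ)⁻¹) by ring, Real.exp_neg,
    inv_le_comm₀ (Real.exp_pos _) h3]
  refine le_trans ?_ (Real.add_one_le_exp _)
  rw [inv_le_iff_one_le_mul₀ h3]
  nlinarith

lemma inv_sieveDensity_le_rpow {ε : ℝ} (hε : 0 < ε) : ∃ C : ℝ, 0 < C ∧ ∀ (P : Finset ℕ) (x : ℝ),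
    (∀ p ∈ P, p.Prime) → 0 < x → ∑ p ∈ P, Real.log p / p ≤ Real.log x + 2 →
    (sieveDensity P)⁻¹ ≤ C * x ^ ε := by
  set Y : ℕ := ⌈Real.exp (2 / ε)⌉₊ with hY
  have hY1 : Real.exp (2 / ε) ≤ Y := Nat.le_ceil _
  refine ⟨Real.exp (2 * (Y + 1) + 2 * ε), Real.exp_pos _, fun P x hP hx h => ?_⟩
  have h1 : ∀ p ∈ P, (p : ℝ)⁻¹ ≤ (if p ∈ Finset.range (Y + 1) then 1 else 0) +
      ε / 2 * (Real.log p / p) := by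
    intro p hp
    have hp0 : (0 : ℝ) < p := by exact_mod_cast (hP p hp).pos
    have hlog : 0 ≤ Real.log p := Real.log_natCast_nonneg p
    split_ifs with h2
    · have : (p : ℝ)⁻¹ ≤ 1 := Nat.cast_inv_le_one p
      have : 0 ≤ ε / 2 * (Real.log p / p) := by positivity
      linarith
    · rw [Finset.mem_range, not_lt] at h2
      have h3 : Real.exp (2 / ε) ≤ p := hY1.trans (by exact_mod_cast (by omega : Y ≤ p))
      have h4 : 2 / ε ≤ Real.log p := (Real.le_log_iff_exp_le hp0).2 h3
      rw [div_le_iff₀ hε] at h4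
      rw [zero_add, ← mul_div_assoc, ← one_div]
      gcongr
      linarith
  have h2 := Finset.sum_le_sum h1
  rw [Finset.sum_add_distrib, ← Finset.mul_sum] at h2
  have h3 : ∑ p ∈ P, (if p ∈ Finset.range (Y + 1) then (1 : ℝ) else 0) ≤ Y + 1 := by
    rw [← Finset.sum_filter, Finset.sum_const, nsmul_eq_mul, mul_one]
    have : (P.filter fun p => p ∈ Finset.range (Y + 1)).card ≤ (Finset.range (Y + 1)).card :=
      Finset.card_le_card fun p hp => (Finset.mem_filter.1 hp).2
    rw [Finset.card_range] at this
    exact_mod_cast this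
  have h4 : ε / 2 * ∑ p ∈ P, Real.log p / p ≤ ε / 2 * (Real.log x + 2) := by gcongr
  have h5 := exp_neg_le_sieveDensity hP
  rw [Real.rpow_def_of_pos hx, ← Real.exp_add, inv_le_comm₀ (sieveDensity_pos hP) (Real.exp_pos _),
    ← Real.exp_neg]
  refine le_trans (Real.exp_le_exp.2 ?_) h5
  linarith

lemma div_totient_le_rpow {ε : ℝ} (hε : 0 < ε) : ∃ C : ℝ, 0 < C ∧ ∀ q : ℕ, q ≠ 0 →
    (q : ℝ) / q.totient ≤ C * (q : ℝ) ^ ε := by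
  obtain ⟨C, hC, h⟩ := inv_sieveDensity_le_rpow hε
  refine ⟨C, hC, fun q hq => ?_⟩
  rw [div_totient_eq hq]
  have hq0 : (0 : ℝ) < q := by exact_mod_cast Nat.pos_of_ne_zero hq
  refine h _ _ (fun p => Nat.prime_of_mem_primeFactors) hq0 ?_
  calc ∑ p ∈ q.primeFactors, Real.log p / p ≤ ∑ p ∈ q.primeFactors, Real.log p := by
        refine Finset.sum_le_sum fun p hp => ?_
        exact div_le_self (Real.log_natCast_nonneg p)
          (by exact_mod_cast (Nat.prime_of_mem_primeFactors hp).one_le)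
    _ = Real.log (∏ p ∈ q.primeFactors, (p : ℝ)) := by
        rw [Real.log_prod]
        intro p hp
        have := (Nat.prime_of_mem_primeFactors hp).pos
        positivity
    _ ≤ Real.log q := by
        apply Real.log_le_log
        · refine Finset.prod_pos fun p hp => ?_
          have := (Nat.prime_of_mem_primeFactors hp).pos
          positivity
        · rw [← Nat.cast_prod]
          exact Nat.cast_le.2 (Nat.le_of_dvd (Nat.pos_of_ne_zero hq) (Nat.prod_primeFactors_dvd q))
    _ ≤ _ := by linarith

lemma inv_sieveDensity_primesLE_le_rpow {ε : ℝ} (hε : 0 < ε) : ∃ C : ℝ, 0 < C ∧ ∀ n : ℕ, n ≠ 0 →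
    (sieveDensity n.primesLE)⁻¹ ≤ C * (n : ℝ) ^ ε := by
  obtain ⟨C, hC, h⟩ := inv_sieveDensity_le_rpow hε
  refine ⟨C, hC, fun n hn => ?_⟩
  refine h _ _ (fun p hp => (Nat.mem_primesLE.1 hp).2)
    (by exact_mod_cast Nat.pos_of_ne_zero hn) ?_
  have := sum_log_div_le (Nat.pos_of_ne_zero hn)
  have h4 : Real.log 4 ≤ 2 := by
    rw [show (4 : ℝ) = 2 ^ 2 by norm_num, Real.log_pow]
    have := Real.log_two_lt_d9
    push_cast
    linarith
  linarith

/-- The number of terms of an arithmetic progression divisible by `d`. -/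
lemma abs_card_dvd_sub_le (b : ℤ) {q d : ℕ} (hd : 0 < d) (h : d.Coprime q) (J : ℕ) :
    |(((Finset.range J).filter fun k : ℕ => (d : ℤ) ∣ b + q * k).card : ℝ) - J / d| ≤ 1 := by
  obtain ⟨v, hv⟩ : ∃ v : ℤ, (d : ℤ) ∣ b + q * v := by
    have h1 : IsCoprime (q : ℤ) d := (Nat.isCoprime_iff_coprime.2 h).symm
    obtain ⟨x, y, hxy⟩ := h1
    refine ⟨-b * x, b * y, ?_⟩
    linear_combination -b * hxy
  have h2 : ((Finset.range J).filter fun k : ℕ => (d : ℤ) ∣ b + q * k).map Nat.castEmbedding =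
      (Finset.Ico (0 : ℤ) J).filter fun x => x ≡ v [ZMOD d] := by
    have key : ∀ k : ℤ, (d : ℤ) ∣ b + q * k ↔ k ≡ v [ZMOD d] := by
      intro k
      rw [Int.modEq_comm, Int.modEq_iff_dvd]
      constructor
      · intro hk
        have h3 : (d : ℤ) ∣ q * (k - v) := by
          have := dvd_sub hk hv
          rwa [show b + q * k - (b + q * v) = q * (k - v) by ring] at this
        exact (Nat.isCoprime_iff_coprime.2 h).dvd_of_dvd_mul_left h3
      · intro hk
        have : b + q * k = b + q * v + q * (k - v) := by ring
        rw [this]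
        exact dvd_add hv (hk.mul_left _)
    ext x
    simp only [Finset.mem_map, Finset.mem_filter, Finset.mem_range, Nat.castEmbedding_apply,
      Finset.mem_Ico]
    constructor
    · rintro ⟨k, ⟨hk, hk'⟩, rfl⟩
      exact ⟨⟨by omega, by omega⟩, (key _).1 hk'⟩
    · rintro ⟨⟨hx, hx'⟩, hk⟩
      lift x to ℕ using hx
      exact ⟨x, ⟨by omega, (key _).2 hk⟩, rfl⟩
  have h3 := Int.Ico_filter_modEq_card 0 (J : ℤ) (r := (d : ℤ)) (by exact_mod_cast hd) v
  rw [← h2, Finset.card_map] at h3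
  have hd' : (0 : ℚ) < d := by exact_mod_cast hd
  push_cast at h3
  set c := ((Finset.range J).filter fun k : ℕ => (d : ℤ) ∣ b + q * k).card with hc
  have h4 := Int.ceil_lt_add_one (((J : ℚ) - v) / d)
  have h5 := Int.le_ceil (((J : ℚ) - v) / d)
  have h6 := Int.ceil_lt_add_one (((0 : ℚ) - v) / d)
  have h7 := Int.le_ceil (((0 : ℚ) - v) / d)
  have h8 : ((J : ℚ) - v) / d = ((0 : ℚ) - v) / d + J / d := by ring
  have h9 : (0 : ℚ) ≤ J / d := by positivity
  have h10 : (0 : ℤ) ≤ ⌈((J : ℚ) - v) / d⌉ - ⌈((0 : ℚ) - v) / d⌉ := by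
    rw [sub_nonneg]
    apply Int.ceil_mono
    linarith
  rw [max_eq_left h10] at h3
  have h11 : (c : ℚ) = (⌈((J : ℚ) - v) / d⌉ : ℚ) - ⌈((0 : ℚ) - v) / d⌉ := by exact_mod_cast h3
  have h12 : |(c : ℚ) - J / d| ≤ 1 := by
    rw [abs_le]
    constructor <;> linarith
  have h13 := (Rat.cast_le (K := ℝ)).2 h12
  push_cast at h13
  exact h13

/-- The fundamental lemma for arithmetic progressions. -/
theorem fundamental_lemma_progression : ∃ C : ℝ, 0 < C ∧ ∀ (s : ℕ) (z : ℝ) (q : ℕ) (b : ℤ) (J : ℕ),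
    2 ≤ z →
    |(((Finset.range J).filter fun k : ℕ => ∀ p ∈ sievePrimes z q, ¬ (p : ℤ) ∣ b + q * k).card : ℝ) -
      J * sieveDensity (sievePrimes z q)| ≤
      C / 2 ^ s * (J * sieveDensity (sievePrimes z q)) + z ^ (4 * s + 7) := by
  obtain ⟨C, hC, hFL⟩ := fundamental_lemma_count
  refine ⟨C, hC, fun s z q b J hz => ?_⟩
  have := hFL s z (sievePrimes z q) hz (fun p hp => (mem_sievePrimes.1 hp).1)
    (fun p hp => (mem_sievePrimes.1 hp).2.1) (Finset.range J) (fun _ => 1)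
    (fun k p => (p : ℤ) ∣ b + q * k) J 1 (by positivity) zero_le_one (fun _ _ => zero_le_one) ?_
  · rw [← Finset.sum_filter, Finset.sum_const, nsmul_eq_mul, mul_one, mul_one] at this
    exact this
  · intro D hD _
    have hp : ∀ p ∈ D, p.Prime := fun p hp => (mem_sievePrimes.1 (hD hp)).1
    rw [← Finset.sum_filter, Finset.sum_const, nsmul_eq_mul, mul_one]
    have h1 := abs_card_dvd_sub_le b (q := q) (d := ∏ p ∈ D, p)
      (Finset.prod_pos fun p h => (hp p h).pos)
      (Nat.Coprime.prod_left fun p h => ((hp p h).coprime_iff_not_dvd).2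
        (mem_sievePrimes.1 (hD h)).2.2) J
    rw [Finset.filter_congr (q := fun k : ℕ => ((∏ p ∈ D, p : ℕ) : ℤ) ∣ b + q * k) fun k _ => ?_]
    · exact h1
    push_cast
    constructor
    · intro h
      refine Finset.prod_dvd_of_coprime (fun p hp' r hr hpr => ?_) h
      exact Nat.isCoprime_iff_coprime.2 ((Nat.coprime_primes (hp p hp') (hp r hr)).2 hpr)
    · intro h p hp'
      exact (Finset.dvd_prod_of_mem (fun p : ℕ => (p : ℤ)) hp').trans h

section WienerIkehara
open MeasureTheory Real Topology FourierTransform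

/-- A compactly supported window whose Fourier transform is nonpositive outside `[-1, 1]`. -/
noncomputable def minorantWindow (t : ℝ) : ℝ :=
  max 0 (1 - |t|) - Real.sin (2 * π * max 0 (1 - |t|)) / (2 * π)

theorem continuous_minorantWindow : Continuous minorantWindow := by
  unfold minorantWindow; fun_prop

theorem minorantWindow_neg (t : ℝ) : minorantWindow (-t) = minorantWindow t := by
  simp [minorantWindow]

theorem minorantWindow_zero : minorantWindow 0 = 1 := by
  simp [minorantWindow]

theorem minorantWindow_of_one_le {t : ℝ} (ht : 1 ≤ |t|) : minorantWindow t = 0 := by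
  simp [minorantWindow, max_eq_left (sub_nonpos.2 ht)]

theorem minorantWindow_of_mem {t : ℝ} (h0 : 0 ≤ t) (h1 : t ≤ 1) :
    minorantWindow t = 1 - t + Real.sin (2 * π * t) / (2 * π) := by
  rw [minorantWindow, abs_of_nonneg h0, max_eq_right (by linarith),
    show 2 * π * (1 - t) = 2 * π - 2 * π * t by ring, Real.sin_two_pi_sub]
  ring

theorem abs_minorantWindow_le (t : ℝ) : |minorantWindow t| ≤ 2 := by
  have h : 0 ≤ max 0 (1 - |t|) := le_max_left _ _
  have h' : max 0 (1 - |t|) ≤ 1 := max_le zero_le_one (by linarith [abs_nonneg t])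
  have h2 : |Real.sin (2 * π * max 0 (1 - |t|)) / (2 * π)| ≤ 1 := by
    rw [abs_div, abs_of_pos (show 0 < 2 * π by positivity), div_le_one (by positivity)]
    linarith [Real.abs_sin_le_one (2 * π * max 0 (1 - |t|)), pi_gt_three]
  rw [minorantWindow]
  have := abs_le.1 h2
  rw [abs_le]; constructor <;> linarith

theorem hasCompactSupport_minorantWindow : HasCompactSupport minorantWindow :=
  HasCompactSupport.intro (isCompact_Icc (a := (-1 : ℝ)) (b := 1)) fun t ht =>
    minorantWindow_of_one_le <| by
      rw [Set.mem_Icc, ← abs_le, not_le] at ht; exact ht.le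

theorem integrable_minorantWindow : Integrable minorantWindow :=
  continuous_minorantWindow.integrable_of_hasCompactSupport hasCompactSupport_minorantWindow

/-- The Fourier transform of `minorantWindow`. -/
noncomputable def minorantKernel (v : ℝ) : ℝ := ∫ t, minorantWindow t * Real.cos (2 * π * t * v)

theorem integrable_minorantWindow_mul_cexp (f : ℝ → ℂ) (hf : Continuous f) :
    Integrable fun t => (minorantWindow t : ℂ) * f t := by
  refine Continuous.integrable_of_hasCompactSupport
    ((Complex.continuous_ofReal.comp continuous_minorantWindow).mul hf) ?_
  exact (hasCompactSupport_minorantWindow.comp_left Complex.ofReal_zero).mul_right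

theorem fourier_minorantWindow (v : ℝ) :
    𝓕 (fun t => (minorantWindow t : ℂ)) v = (minorantKernel v : ℂ) := by
  rw [Real.fourier_real_eq_integral_exp_smul, minorantKernel]
  set F : ℝ → ℂ := fun t => Complex.exp (↑(-2 * π * t * v) * Complex.I) • (minorantWindow t : ℂ)
  have hF : Integrable F := by
    have := integrable_minorantWindow_mul_cexp
      (fun t => Complex.exp (↑(-2 * π * t * v) * Complex.I)) (by fun_prop)
    refine this.congr (.of_forall fun t => ?_)
    simp [F, mul_comm]
  have h1 : ∫ t, F t = ∫ t, F (-t) := (integral_neg_eq_self F volume).symm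
  have h2 : ∫ t, F t = ∫ t, (2⁻¹ : ℂ) * (F t + F (-t)) := by
    rw [integral_const_mul, integral_add hF hF.comp_neg, ← h1]; ring
  rw [h2, ← integral_complex_ofReal]
  congr 1 with t
  simp only [F, minorantWindow_neg, smul_eq_mul]
  push_cast
  rw [Complex.cos]
  ring_nf

theorem minorantKernel_eq_interval (v : ℝ) :
    minorantKernel v = 2 * ∫ t in (0 : ℝ)..1, minorantWindow t * Real.cos (2 * π * t * v) := by
  set f : ℝ → ℝ := fun t => minorantWindow t * Real.cos (2 * π * t * v)
  have hf : Continuous f := by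
    have := continuous_minorantWindow
    fun_prop
  have hs : Function.support f ⊆ Set.Ioc (-1) 1 := by
    intro t ht
    rw [Function.mem_support] at ht
    by_contra h
    refine ht ?_
    simp only [f]
    rw [minorantWindow_of_one_le, zero_mul]
    rw [Set.mem_Ioc, not_and_or] at h
    rcases h with h | h
    · rw [le_abs]; right; linarith
    · rw [le_abs]; left; linarith
  have h1 : minorantKernel v = ∫ t in (-1 : ℝ)..1, f t :=
    (intervalIntegral.integral_eq_integral_of_support_subset hs).symm
  rw [h1, ← intervalIntegral.integral_add_adjacent_intervals
    (hf.intervalIntegrable (-1) 0) (hf.intervalIntegrable 0 1)]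
  have h2 : ∫ t in (-1 : ℝ)..0, f t = ∫ t in (0 : ℝ)..1, f t := by
    have := intervalIntegral.integral_comp_neg (a := 0) (b := 1) f
    rw [neg_zero] at this
    rw [← this]
    congr 1 with t
    simp [f, minorantWindow_neg]
  rw [h2]; ring

theorem minorantKernel_eq {v : ℝ} (h0 : v ≠ 0) (h1 : v ≠ 1) (h2 : v ≠ -1) :
    minorantKernel v = (1 - Real.cos (2 * π * v)) / (2 * π ^ 2 * v ^ 2 * (1 - v ^ 2)) := by
  have h1' : v - 1 ≠ 0 := sub_ne_zero.2 h1
  have h2' : v + 1 ≠ 0 := fun h => h2 (by linarith)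
  have hpi := pi_ne_zero
  set H : ℝ → ℝ := fun t => (1 - t + Real.sin (2 * π * t) / (2 * π)) *
    Real.sin (2 * π * v * t) / (2 * π * v) + 1 / (2 * π * v) *
    (-(Real.cos (2 * π * v * t) / (2 * π * v)) +
      Real.cos (2 * π * (v + 1) * t) / (4 * π * (v + 1)) +
      Real.cos (2 * π * (v - 1) * t) / (4 * π * (v - 1)))
  have hH : ∀ t, HasDerivAt H ((1 - t + Real.sin (2 * π * t) / (2 * π)) *
      Real.cos (2 * π * t * v)) t := by
    intro t
    have hs : ∀ c : ℝ, HasDerivAt (fun t : ℝ => Real.sin (c * t)) (Real.cos (c * t) * c) t :=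
      fun c => by simpa using ((hasDerivAt_id t).const_mul c).sin
    have hc : ∀ c : ℝ, HasDerivAt (fun t : ℝ => Real.cos (c * t)) (-Real.sin (c * t) * c) t :=
      fun c => by simpa using ((hasDerivAt_id t).const_mul c).cos
    have := (((((hasDerivAt_id t).const_sub 1).add ((hs (2 * π)).div_const (2 * π))).mul
      (hs (2 * π * v))).div_const (2 * π * v)).add
      (((((hc (2 * π * v)).div_const (2 * π * v)).neg.add
        ((hc (2 * π * (v + 1))).div_const (4 * π * (v + 1)))).add
        ((hc (2 * π * (v - 1))).div_const (4 * π * (v - 1)))).const_mul (1 / (2 * π * v)))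
    convert! this using 1
    have e1 : 2 * π * (v + 1) * t = 2 * π * v * t + 2 * π * t := by ring
    have e2 : 2 * π * (v - 1) * t = 2 * π * v * t - 2 * π * t := by ring
    have e3 : 2 * π * t * v = 2 * π * v * t := by ring
    rw [e1, e2, e3, Real.sin_add, Real.sin_sub]
    simp only [id, Pi.add_apply]
    field_simp
    ring
  rw [minorantKernel_eq_interval]
  have e : ∫ t in (0 : ℝ)..1, minorantWindow t * Real.cos (2 * π * t * v) =
      ∫ t in (0 : ℝ)..1, (1 - t + Real.sin (2 * π * t) / (2 * π)) * Real.cos (2 * π * t * v) := by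
    refine intervalIntegral.integral_congr fun t ht => ?_
    rw [Set.uIcc_of_le zero_le_one] at ht
    simp only [minorantWindow_of_mem ht.1 ht.2]
  rw [e, intervalIntegral.integral_eq_sub_of_hasDerivAt (fun t _ => hH t)
    (by apply Continuous.intervalIntegrable; fun_prop)]
  have c1 : Real.cos (2 * π * (v + 1)) = Real.cos (2 * π * v) := by
    rw [show 2 * π * (v + 1) = 2 * π * v + 2 * π by ring, Real.cos_add_two_pi]
  have c2 : Real.cos (2 * π * (v - 1)) = Real.cos (2 * π * v) := by
    rw [show 2 * π * (v - 1) = 2 * π * v - 2 * π by ring, Real.cos_sub_two_pi]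
  simp only [H, mul_one, mul_zero, Real.cos_zero, Real.sin_zero, Real.sin_two_pi, c1, c2]
  have h3 : (1 - v ^ 2) ≠ 0 := by
    rw [show 1 - v ^ 2 = -((v - 1) * (v + 1)) by ring]
    exact neg_ne_zero.2 (mul_ne_zero h1' h2')
  rw [show (1 - v ^ 2) = -((v - 1) * (v + 1)) by ring]
  field_simp
  ring

theorem minorantKernel_nonpos {v : ℝ} (hv : 1 < |v|) : minorantKernel v ≤ 0 := by
  have hv2 : 1 < v ^ 2 := by rw [← sq_abs]; nlinarith
  rw [minorantKernel_eq]
  · exact div_nonpos_of_nonneg_of_nonpos (by linarith [Real.cos_le_one (2 * π * v)])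
      (mul_nonpos_of_nonneg_of_nonpos (by positivity) (by linarith))
  · rintro rfl; norm_num at hv2
  · rintro rfl; norm_num at hv2
  · rintro rfl; norm_num at hv2

theorem abs_minorantKernel_le_four (v : ℝ) : |minorantKernel v| ≤ 4 := by
  rw [minorantKernel_eq_interval, abs_mul, abs_two]
  have := intervalIntegral.norm_integral_le_of_norm_le_const (a := 0) (b := 1) (C := 2)
    (f := fun t => minorantWindow t * Real.cos (2 * π * t * v)) fun t _ => by
      rw [Real.norm_eq_abs, abs_mul]
      exact (mul_le_mul (abs_minorantWindow_le t) (Real.abs_cos_le_one _) (abs_nonneg _)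
        zero_le_two).trans_eq (mul_one _)
  rw [Real.norm_eq_abs] at this
  norm_num at this ⊢
  linarith

theorem abs_minorantKernel_le (v : ℝ) : |minorantKernel v| ≤ 20 * (1 + v ^ 2)⁻¹ := by
  rw [← div_eq_mul_inv, le_div_iff₀ (by positivity)]
  by_cases hv : |v| < 2
  · have : v ^ 2 < 4 := by rw [← sq_abs]; nlinarith [abs_nonneg v]
    nlinarith [abs_minorantKernel_le_four v, abs_nonneg (minorantKernel v)]
  · have hv2 : 4 ≤ v ^ 2 := by rw [← sq_abs]; nlinarith
    rw [minorantKernel_eq, abs_div]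
    · have h1 : |1 - Real.cos (2 * π * v)| ≤ 2 := by
        rw [abs_le]
        constructor <;> linarith [Real.cos_le_one (2 * π * v), Real.neg_one_le_cos (2 * π * v)]
      have hpi : 9 ≤ π ^ 2 := by nlinarith [pi_gt_three]
      rw [abs_mul, abs_of_nonneg (show 0 ≤ 2 * π ^ 2 * v ^ 2 by positivity),
        abs_of_neg (show 1 - v ^ 2 < 0 by linarith), div_mul_eq_mul_div,
        div_le_iff₀ (mul_pos (by positivity) (by linarith))]
      calc |1 - Real.cos (2 * π * v)| * (1 + v ^ 2) ≤ 2 * (1 + v ^ 2) := by gcongr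
        _ ≤ 20 * (2 * 9 * v ^ 2 * -(1 - v ^ 2)) := by nlinarith
        _ ≤ _ := by
          have : 0 ≤ -(1 - v ^ 2) := by linarith
          gcongr
    · rintro rfl; norm_num at hv2
    · rintro rfl; norm_num at hv2
    · rintro rfl; norm_num at hv2

theorem continuous_minorantKernel : Continuous minorantKernel := by
  unfold minorantKernel
  refine continuous_of_dominated (bound := fun t => |minorantWindow t|) (fun v => ?_)
    (fun v => .of_forall fun t => ?_) integrable_minorantWindow.abs (.of_forall fun t => ?_)
  · exact (continuous_minorantWindow.mul (by fun_prop)).aestronglyMeasurable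
  · rw [Real.norm_eq_abs, abs_mul]
    exact mul_le_of_le_one_right (abs_nonneg _) (Real.abs_cos_le_one _)
  · fun_prop

theorem integrable_minorantKernel : Integrable minorantKernel :=
  (integrable_inv_one_add_sq.const_mul 20).mono'
    continuous_minorantKernel.aestronglyMeasurable (.of_forall abs_minorantKernel_le)

theorem integral_minorantKernel : ∫ v, minorantKernel v = 1 := by
  have hc : Continuous fun t => (minorantWindow t : ℂ) :=
    Complex.continuous_ofReal.comp continuous_minorantWindow
  have hF : 𝓕 (fun t => (minorantWindow t : ℂ)) = fun v => (minorantKernel v : ℂ) :=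
    funext fourier_minorantWindow
  have h := MeasureTheory.Integrable.fourierInv_fourier_eq (v := (0 : ℝ))
    integrable_minorantWindow.ofReal (by rw [hF]; exact integrable_minorantKernel.ofReal)
    hc.continuousAt
  rw [hF, Real.fourierInv_eq] at h
  simp only [inner_zero_right, one_smul, minorantWindow_zero, AddChar.map_zero_eq_one] at h
  rw [integral_complex_ofReal] at h
  exact_mod_cast h

end WienerIkehara

section WienerIkehara
open MeasureTheory Real Topology FourierTransform ArithmeticFunction

theorem minorantKernel_eq_integral_cexp (v : ℝ) : (minorantKernel v : ℂ) =
    ∫ t : ℝ, (minorantWindow t : ℂ) * Complex.exp (-(2 * π * t * v) * Complex.I) := by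
  rw [← fourier_minorantWindow, Real.fourier_real_eq_integral_exp_smul]
  congr 1 with t
  rw [smul_eq_mul, mul_comm]
  congr 2
  push_cast
  ring

theorem integral_minorantWindow_mul_inv {δ : ℝ} (hδ : 0 < δ) (h T : ℝ) :
    ∫ t : ℝ, (minorantWindow t : ℂ) * (Complex.exp (2 * π * t * T / h * Complex.I) *
        (1 / (δ + 2 * π * t / h * Complex.I))) =
      ((∫ u in Set.Ioi (0 : ℝ), Real.exp (-δ * u) * minorantKernel ((u - T) / h) : ℝ) : ℂ) := by
  set F : ℝ → ℝ → ℂ := fun t u => (minorantWindow t : ℂ) *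
    (Complex.exp (2 * π * t * T / h * Complex.I) *
      Complex.exp (-(δ + 2 * π * t / h * Complex.I) * u))
  have hF : Integrable (Function.uncurry F) (volume.prod (volume.restrict (Set.Ioi 0))) := by
    have hb : Integrable (fun p : ℝ × ℝ => |minorantWindow p.1| * Real.exp (-δ * p.2))
        (volume.prod (volume.restrict (Set.Ioi 0))) :=
      integrable_minorantWindow.abs.mul_prod (integrableOn_exp_mul_Ioi (by linarith) 0)
    refine hb.mono' (Continuous.aestronglyMeasurable ?_) (.of_forall fun p => ?_)
    · have := Complex.continuous_ofReal.comp continuous_minorantWindow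
      have h2 : Continuous fun p : ℝ × ℝ => (minorantWindow p.1 : ℂ) := this.comp continuous_fst
      simp only [F, Function.uncurry_def]
      fun_prop
    · simp only [F, Function.uncurry_def]
      rw [norm_mul, norm_mul, Complex.norm_exp, Complex.norm_exp, Complex.norm_real,
        Real.norm_eq_abs]
      apply le_of_eq
      have e1 : (2 * π * p.1 * T / h * Complex.I : ℂ).re = 0 := by
        rw [show (2 * π * p.1 * T / h * Complex.I : ℂ) =
          ((2 * π * p.1 * T / h : ℝ) : ℂ) * Complex.I by push_cast; ring]
        simp only [Complex.re_ofReal_mul, Complex.I_re, mul_zero]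
      have e2 : (-(δ + 2 * π * p.1 / h * Complex.I : ℂ) * p.2).re = -δ * p.2 := by
        rw [show -(δ + 2 * π * p.1 / h * Complex.I : ℂ) * p.2 =
          ((-δ * p.2 : ℝ) : ℂ) + ((-(2 * π * p.1 / h * p.2) : ℝ) : ℂ) * Complex.I by
            push_cast; ring]
        simp only [Complex.add_re, Complex.ofReal_re, Complex.re_ofReal_mul, Complex.I_re,
          mul_zero, add_zero]
      rw [e1, e2, Real.exp_zero, one_mul]
  have h1 : ∀ t : ℝ, ∫ u in Set.Ioi (0 : ℝ), F t u = (minorantWindow t : ℂ) *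
      (Complex.exp (2 * π * t * T / h * Complex.I) *
        (1 / (δ + 2 * π * t / h * Complex.I))) := by
    intro t
    simp only [F]
    rw [integral_const_mul, integral_const_mul, integral_exp_mul_complex_Ioi]
    · rw [Complex.ofReal_zero, mul_zero, Complex.exp_zero, neg_div_neg_eq]
    · rw [show -(δ + 2 * π * t / h * Complex.I : ℂ) =
          ((-δ : ℝ) : ℂ) + ((-(2 * π * t / h) : ℝ) : ℂ) * Complex.I by push_cast; ring]
      simp only [Complex.add_re, Complex.ofReal_re, Complex.re_ofReal_mul, Complex.I_re,
          mul_zero, add_zero]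
      linarith
  simp_rw [← h1]
  rw [integral_integral_swap hF, ← integral_complex_ofReal]
  congr 1 with u
  rw [Complex.ofReal_mul, minorantKernel_eq_integral_cexp, ← integral_const_mul]
  congr 1 with t
  simp only [F]
  rw [← Complex.exp_add, Complex.ofReal_exp, mul_left_comm, ← Complex.exp_add]
  congr 2
  push_cast
  ring

theorem hasSum_residueClass_mul_minorantKernel {q : ℕ} [NeZero q] {a : ZMod q} (ha : IsUnit a)
    {σ h : ℝ} (hσ : 1 < σ) (T : ℝ) :
    HasSum (fun n : ℕ => vonMangoldt.residueClass a n / (n : ℝ) ^ σ *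
        minorantKernel ((Real.log n - T) / h))
      ((q.totient : ℝ)⁻¹ * (∫ u in Set.Ioi (0 : ℝ), Real.exp (-(σ - 1) * u) *
          minorantKernel ((u - T) / h)) +
        (∫ t : ℝ, (minorantWindow t : ℂ) * (Complex.exp (2 * π * t * T / h * Complex.I) *
          vonMangoldt.LFunctionResidueClassAux a (σ + 2 * π * t / h * Complex.I))).re) := by
  set f : ℕ → ℂ := fun n => (vonMangoldt.residueClass a n : ℂ)
  have hf0 : f 0 = 0 := by simp [f, vonMangoldt.residueClass_apply_zero]
  set s : ℝ → ℂ := fun t => σ + 2 * π * t / h * Complex.I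
  have hs : ∀ t, (s t).re = σ := by
    intro t
    simp only [s]
    rw [show (2 * π * t / h * Complex.I : ℂ) =
          ((2 * π * t / h : ℝ) : ℂ) * Complex.I by push_cast; ring]
    simp only [Complex.add_re, Complex.ofReal_re, Complex.re_ofReal_mul, Complex.I_re,
      mul_zero, add_zero]
  have hsc : Continuous s := by simp only [s]; fun_prop
  set ex : ℝ → ℂ := fun t => Complex.exp (2 * π * t * T / h * Complex.I)
  have hexc : Continuous ex := by simp only [ex]; fun_prop
  have hex : ∀ t, ‖ex t‖ = 1 := by
    intro t
    simp only [ex]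
    rw [show (2 * π * t * T / h * Complex.I : ℂ) =
          ((2 * π * t * T / h : ℝ) : ℂ) * Complex.I by push_cast; ring]
    exact Complex.norm_exp_ofReal_mul_I _
  have hsum : ∀ t, LSeriesSummable f (s t) := fun t =>
    LSeriesSummable_of_abscissaOfAbsConv_lt_re <|
      (vonMangoldt.abscissaOfAbsConv_residueClass_le_one a).trans_lt <| by
        rw [hs]; exact_mod_cast hσ
  set F : ℕ → ℝ → ℂ := fun n t => (minorantWindow t : ℂ) * (ex t * LSeries.term f (s t) n)
  have hterm : ∀ n, Continuous fun t => LSeries.term f (s t) n := by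
    intro n
    simp only [LSeries.term_def]
    split_ifs with hn
    · exact continuous_const
    · refine continuous_const.div (hsc.const_cpow (.inl (by exact_mod_cast hn))) fun t => ?_
      rw [Complex.cpow_ne_zero_iff]
      left; exact_mod_cast hn
  have hF : ∀ n, Integrable (F n) := fun n =>
    integrable_minorantWindow_mul_cexp _ (hexc.mul (hterm n))
  have hFn : ∀ n t, ‖F n t‖ = |minorantWindow t| * ‖LSeries.term f (s 0) n‖ := by
    intro n t
    simp only [F]
    rw [norm_mul, norm_mul, hex, one_mul, Complex.norm_real, Real.norm_eq_abs,
      LSeries.norm_term_eq, LSeries.norm_term_eq, hs, hs]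
  have hFs : Summable fun n => ∫ t, ‖F n t‖ := by
    simp only [hFn, integral_mul_const]
    exact (hsum 0).norm.mul_left _
  have key := hasSum_integral_of_summable_integral_norm hF hFs
  have e1 : ∀ n, ∫ t, F n t = ((vonMangoldt.residueClass a n / (n : ℝ) ^ σ *
        minorantKernel ((Real.log n - T) / h) : ℝ) : ℂ) := by
    intro n
    rcases Nat.eq_zero_or_pos n with rfl | hn
    · simp [F, LSeries.term_def, vonMangoldt.residueClass_apply_zero]
    · rw [Complex.ofReal_mul, minorantKernel_eq_integral_cexp, ← integral_const_mul]
      congr 1 with t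
      have hn0 : (n : ℂ) ≠ 0 := by exact_mod_cast hn.ne'
      have hn1 : (0 : ℝ) < n := by exact_mod_cast hn
      simp only [F, LSeries.term_def, if_neg hn.ne', f, ex, s]
      rw [Complex.cpow_add _ _ hn0, mul_left_comm]
      rw [show Complex.exp (-(2 * π * t * ↑((Real.log n - T) / h)) * Complex.I) =
        Complex.exp (2 * π * t * T / h * Complex.I) / (n : ℂ) ^ (2 * π * t / h * Complex.I : ℂ) by
          rw [Complex.cpow_def_of_ne_zero hn0, ← Complex.exp_sub, ← Complex.natCast_log]
          congr 1; push_cast; ring]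
      push_cast [Complex.ofReal_cpow hn1.le]
      field_simp
  have hAux : ∀ t, vonMangoldt.LFunctionResidueClassAux a (s t) =
      LSeries f (s t) - (q.totient : ℂ)⁻¹ / (s t - 1) := fun t =>
    vonMangoldt.eqOn_LFunctionResidueClassAux ha (x := s t) (by
      rw [Set.mem_ofPred_eq, hs]; exact hσ)
  have hst : ∀ t, s t - 1 = ((σ - 1 : ℝ) : ℂ) + 2 * π * t / h * Complex.I := fun t => by
    simp only [s]; push_cast; ring
  have hst0 : ∀ t, s t - 1 ≠ 0 := fun t h0 => by
    have := congrArg Complex.re h0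
    rw [Complex.sub_re, hs] at this
    simp at this
    linarith
  have hAuxc : Continuous fun t => vonMangoldt.LFunctionResidueClassAux a (s t) :=
    (vonMangoldt.continuousOn_LFunctionResidueClassAux a).comp_continuous hsc fun t => by
      rw [Set.mem_ofPred_eq, hs]; exact hσ.le
  have e2 : ∫ t, ∑' n, F n t = (q.totient : ℂ)⁻¹ *
      ((∫ u in Set.Ioi (0 : ℝ), Real.exp (-(σ - 1) * u) * minorantKernel ((u - T) / h) : ℝ) : ℂ) +
      ∫ t : ℝ, (minorantWindow t : ℂ) * (ex t * vonMangoldt.LFunctionResidueClassAux a (s t)) := by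
    rw [← integral_minorantWindow_mul_inv (by linarith), ← integral_const_mul, ← integral_add]
    · congr 1 with t
      simp only [F, tsum_mul_left]
      change _ * (_ * LSeries f (s t)) = _
      rw [hAux, hst]
      ring
    · refine (integrable_minorantWindow_mul_cexp _ (hexc.mul ?_)).const_mul _
      refine continuous_const.div (by fun_prop) fun t => ?_
      rw [← hst]; exact hst0 t
    · exact integrable_minorantWindow_mul_cexp _ (hexc.mul hAuxc)
  simp only [e1] at key
  rw [e2] at key
  have := Complex.hasSum_re key
  simp only [Complex.ofReal_re, Complex.add_re] at this
  convert! this using 2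
  rw [← Complex.ofReal_natCast, ← Complex.ofReal_inv, Complex.re_ofReal_mul, Complex.ofReal_re]

end WienerIkehara

section WienerIkehara
open MeasureTheory Real Topology FourierTransform ArithmeticFunction

theorem exists_norm_residueClassAux_le {q : ℕ} [NeZero q] (a : ZMod q) (h : ℝ) :
    ∃ M : ℝ, ∀ σ ∈ Set.Icc (1 : ℝ) 2, ∀ t ∈ Set.Icc (-1 : ℝ) 1,
      ‖vonMangoldt.LFunctionResidueClassAux a (σ + 2 * π * t / h * Complex.I)‖ ≤ M := by
  have hc : ContinuousOn (fun p : ℝ × ℝ =>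
      vonMangoldt.LFunctionResidueClassAux a (p.1 + 2 * π * p.2 / h * Complex.I))
      (Set.Icc (1 : ℝ) 2 ×ˢ Set.Icc (-1 : ℝ) 1) := by
    refine (vonMangoldt.continuousOn_LFunctionResidueClassAux a).comp
      (by fun_prop) fun p hp => ?_
    rw [Set.mem_ofPred_eq, show (2 * π * p.2 / h * Complex.I : ℂ) =
          ((2 * π * p.2 / h : ℝ) : ℂ) * Complex.I by push_cast; ring]
    simp only [Complex.add_re, Complex.ofReal_re, Complex.re_ofReal_mul, Complex.I_re,
      mul_zero, add_zero]
    exact hp.1.1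
  obtain ⟨M, hM⟩ := (isCompact_Icc.prod isCompact_Icc).exists_bound_of_continuousOn hc
  exact ⟨M, fun σ hσ t ht => hM (σ, t) ⟨hσ, ht⟩⟩

/-- The integers `n ≥ 1` with `|log n - T| ≤ h`. -/
noncomputable def logWindow (T h : ℝ) : Finset ℕ :=
  (Finset.Icc 1 ⌊Real.exp (T + h)⌋₊).filter fun n => |Real.log n - T| ≤ h

theorem mem_logWindow {T h : ℝ} {n : ℕ} : n ∈ logWindow T h ↔ 1 ≤ n ∧ |Real.log n - T| ≤ h := by
  rw [logWindow, Finset.mem_filter, Finset.mem_Icc]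
  refine ⟨fun h => ⟨h.1.1, h.2⟩, fun h => ⟨⟨h.1, ?_⟩, h.2⟩⟩
  have hn : (0 : ℝ) < n := by exact_mod_cast h.1
  rw [Nat.le_floor_iff (Real.exp_pos _).le, ← Real.log_le_iff_le_exp hn]
  linarith [(abs_le.1 h.2).2]

theorem integrable_minorantKernel_comp {h : ℝ} (hh : 0 < h) (T : ℝ) :
    Integrable fun u => minorantKernel ((u - T) / h) :=
  (integrable_minorantKernel.comp_div hh.ne').comp_sub_right T

theorem minorant_le_sum_residueClass {q : ℕ} [NeZero q] {a : ZMod q} (ha : IsUnit a)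
    {h : ℝ} (hh : 0 < h) (T : ℝ) :
    (q.totient : ℝ)⁻¹ * (∫ u in Set.Ioi (0 : ℝ), minorantKernel ((u - T) / h)) +
        (∫ t : ℝ, (minorantWindow t : ℂ) * (Complex.exp (2 * π * t * T / h * Complex.I) *
          vonMangoldt.LFunctionResidueClassAux a (1 + 2 * π * t / h * Complex.I))).re ≤
      4 * ∑ n ∈ logWindow T h, vonMangoldt.residueClass a n / n := by
  have hσ : ∀ σ : ℝ, 1 < σ → (q.totient : ℝ)⁻¹ * (∫ u in Set.Ioi (0 : ℝ),
      Real.exp (-(σ - 1) * u) * minorantKernel ((u - T) / h)) +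
      (∫ t : ℝ, (minorantWindow t : ℂ) * (Complex.exp (2 * π * t * T / h * Complex.I) *
          vonMangoldt.LFunctionResidueClassAux a (σ + 2 * π * t / h * Complex.I))).re ≤
      4 * ∑ n ∈ logWindow T h, vonMangoldt.residueClass a n / n := by
    intro σ hσ
    refine hasSum_le (g := fun n => if n ∈ logWindow T h then
      4 * (vonMangoldt.residueClass a n / n) else 0) (fun n => ?_)
      (hasSum_residueClass_mul_minorantKernel ha hσ T) ?_
    · rcases Nat.eq_zero_or_pos n with rfl | hn
      · rw [vonMangoldt.residueClass_apply_zero]; simp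
      have hn1 : (1 : ℝ) ≤ n := by exact_mod_cast hn
      have ha0 := vonMangoldt.residueClass_nonneg a n
      have hpow : (n : ℝ) ≤ (n : ℝ) ^ σ := by
        simpa using Real.rpow_le_rpow_of_exponent_le hn1 hσ.le
      split_ifs with hw
      · rw [mul_comm 4]
        calc _ ≤ vonMangoldt.residueClass a n / (n : ℝ) ^ σ * 4 := by
              have := (abs_le.1 (abs_minorantKernel_le_four ((Real.log n - T) / h))).2
              gcongr
          _ ≤ _ := by gcongr
      · rw [mem_logWindow, not_and, not_le] at hw
        refine mul_nonpos_of_nonneg_of_nonpos (by positivity) (minorantKernel_nonpos ?_)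
        rw [abs_div, abs_of_pos hh, one_lt_div hh]
        exact hw hn
    · have e : 4 * ∑ n ∈ logWindow T h, vonMangoldt.residueClass a n / n =
          ∑ n ∈ logWindow T h, if n ∈ logWindow T h then
            4 * (vonMangoldt.residueClass a n / n) else 0 := by
        rw [Finset.mul_sum]
        exact Finset.sum_congr rfl fun n hn => by rw [if_pos hn]
      rw [e]
      exact hasSum_sum_of_ne_finset_zero fun n hn => if_neg hn
  refine le_of_tendsto (f := fun σ : ℝ => (q.totient : ℝ)⁻¹ * (∫ u in Set.Ioi (0 : ℝ),
      Real.exp (-(σ - 1) * u) * minorantKernel ((u - T) / h)) +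
      (∫ t : ℝ, (minorantWindow t : ℂ) * (Complex.exp (2 * π * t * T / h * Complex.I) *
          vonMangoldt.LFunctionResidueClassAux a (σ + 2 * π * t / h * Complex.I))).re)
    (x := 𝓝[>] (1 : ℝ)) ?_ (eventually_mem_nhdsWithin.mono hσ)
  refine (Tendsto.const_mul _ ?_).add ((Complex.continuous_re.tendsto _).comp ?_)
  · refine tendsto_integral_filter_of_dominated_convergence
      (fun u => |minorantKernel ((u - T) / h)|) ?_ ?_
      (integrable_minorantKernel_comp hh T).abs.integrableOn ?_
    · refine .of_forall fun σ => Continuous.aestronglyMeasurable ?_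
      have := continuous_minorantKernel
      fun_prop
    · filter_upwards [eventually_mem_nhdsWithin] with σ hσ
      filter_upwards [ae_restrict_mem measurableSet_Ioi] with u hu
      rw [Real.norm_eq_abs, abs_mul, Real.abs_exp]
      refine mul_le_of_le_one_left (abs_nonneg _) (Real.exp_le_one_iff.2 ?_)
      exact mul_nonpos_of_nonpos_of_nonneg (by linarith [Set.mem_Ioi.1 hσ]) (le_of_lt hu)
    · refine .of_forall fun u => ?_
      have hc : Continuous fun σ : ℝ => Real.exp (-(σ - 1) * u) * minorantKernel ((u - T) / h) := by
        fun_prop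
      have := hc.tendsto 1
      simp only [sub_self, neg_zero, zero_mul, Real.exp_zero, one_mul] at this
      exact this.mono_left nhdsWithin_le_nhds
  · obtain ⟨M, hM⟩ := exists_norm_residueClassAux_le a h
    have hre : ∀ σ t : ℝ, ((σ : ℂ) + 2 * π * t / h * Complex.I).re = σ := by
      intro σ t
      rw [show (2 * π * t / h * Complex.I : ℂ) =
          ((2 * π * t / h : ℝ) : ℂ) * Complex.I by push_cast; ring]
      simp only [Complex.add_re, Complex.ofReal_re, Complex.re_ofReal_mul, Complex.I_re,
        mul_zero, add_zero]
    have hnorm : ∀ t : ℝ, ‖Complex.exp (2 * π * t * T / h * Complex.I)‖ = 1 := by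
      intro t
      rw [show (2 * π * t * T / h * Complex.I : ℂ) =
          ((2 * π * t * T / h : ℝ) : ℂ) * Complex.I by push_cast; ring]
      exact Complex.norm_exp_ofReal_mul_I _
    refine tendsto_integral_filter_of_dominated_convergence
      (fun t => |minorantWindow t| * M) ?_ ?_ (integrable_minorantWindow.abs.mul_const M) ?_
    · filter_upwards [eventually_mem_nhdsWithin] with σ hσ
      have h1 : Continuous fun t : ℝ => vonMangoldt.LFunctionResidueClassAux a
          (σ + 2 * π * t / h * Complex.I) :=
        (vonMangoldt.continuousOn_LFunctionResidueClassAux a).comp_continuous (by fun_prop)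
          fun t => by rw [Set.mem_ofPred_eq, hre]; exact (Set.mem_Ioi.1 hσ).le
      have h2 := Complex.continuous_ofReal.comp continuous_minorantWindow
      exact (h2.mul (Continuous.mul (by fun_prop) h1)).aestronglyMeasurable
    · have h2 : Set.Ioo (1 : ℝ) 2 ∈ 𝓝[>] (1 : ℝ) := Ioo_mem_nhdsGT one_lt_two
      filter_upwards [h2] with σ hσ
      refine .of_forall fun t => ?_
      rw [norm_mul, norm_mul, hnorm, one_mul, Complex.norm_real, Real.norm_eq_abs]
      by_cases ht : 1 ≤ |t|
      · simp [minorantWindow_of_one_le ht]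
      · gcongr
        exact hM σ ⟨hσ.1.le, hσ.2.le⟩ t (abs_le.1 (not_le.1 ht).le)
    · refine .of_forall fun t => ?_
      refine Tendsto.const_mul _ (Tendsto.const_mul _ ?_)
      have hcw := vonMangoldt.continuousOn_LFunctionResidueClassAux a
        (((1 : ℝ) : ℂ) + 2 * π * t / h * Complex.I) (by rw [Set.mem_ofPred_eq, hre])
      have : Tendsto (fun σ : ℝ => (σ : ℂ) + 2 * π * t / h * Complex.I) (𝓝[>] (1 : ℝ))
          (𝓝[{s : ℂ | 1 ≤ s.re}] (((1 : ℝ) : ℂ) + 2 * π * t / h * Complex.I)) := by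
        refine tendsto_nhdsWithin_iff.2 ⟨?_, ?_⟩
        · have hc : Continuous fun σ : ℝ => (σ : ℂ) + 2 * π * t / h * Complex.I := by fun_prop
          exact (hc.tendsto 1).mono_left nhdsWithin_le_nhds
        · filter_upwards [eventually_mem_nhdsWithin] with σ hσ
          rw [hre]; exact (Set.mem_Ioi.1 hσ).le
      have := hcw.tendsto.comp this
      rw [Complex.ofReal_one] at this
      exact this

theorem tendsto_integral_minorantKernel {h : ℝ} (hh : 0 < h) :
    Tendsto (fun T : ℝ => ∫ u in Set.Ioi (0 : ℝ), minorantKernel ((u - T) / h)) atTop (𝓝 h) := by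
  have h1 : ∀ T : ℝ, ∫ u in Set.Ioi (0 : ℝ), minorantKernel ((u - T) / h) =
      h * ∫ v, (Set.Ioi (-(T / h))).indicator minorantKernel v := by
    intro T
    rw [← integral_indicator measurableSet_Ioi]
    have e : (Set.Ioi (0 : ℝ)).indicator (fun u => minorantKernel ((u - T) / h)) =
        fun u => (Set.Ioi (-(T / h))).indicator minorantKernel ((u - T) / h) := by
      ext u
      simp only [Set.indicator, Set.mem_Ioi]
      refine if_congr ?_ rfl rfl
      rw [← neg_div, div_lt_div_iff_of_pos_right hh]
      constructor <;> intro <;> linarith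
    rw [e, integral_sub_right_eq_self (fun u => (Set.Ioi (-(T / h))).indicator minorantKernel (u / h)),
      Measure.integral_comp_div, abs_of_pos hh, smul_eq_mul]
  simp_rw [h1]
  suffices H : Tendsto (fun T : ℝ => ∫ v, (Set.Ioi (-(T / h))).indicator minorantKernel v) atTop
      (𝓝 (∫ v, minorantKernel v)) by
    have := H.const_mul h
    rwa [integral_minorantKernel, mul_one] at this
  refine tendsto_integral_filter_of_dominated_convergence (fun v => |minorantKernel v|) ?_ ?_
    integrable_minorantKernel.abs ?_
  · exact .of_forall fun T =>
      continuous_minorantKernel.aestronglyMeasurable.indicator measurableSet_Ioi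
  · exact .of_forall fun T => .of_forall fun v => norm_indicator_le_norm_self _ _
  · refine .of_forall fun v => tendsto_const_nhds.congr' ?_
    filter_upwards [eventually_gt_atTop (-(v * h))] with T hT
    rw [Set.indicator_of_mem]
    rw [Set.mem_Ioi, neg_lt, lt_div_iff₀ hh]
    linarith

theorem eventually_le_sum_residueClass {q : ℕ} [NeZero q] {a : ZMod q} (ha : IsUnit a)
    {h : ℝ} (hh : 0 < h) : ∀ᶠ T : ℝ in atTop, (q.totient : ℝ)⁻¹ * h / 8 ≤
      ∑ n ∈ logWindow T h, vonMangoldt.residueClass a n / n := by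
  have hA : 0 < (q.totient : ℝ)⁻¹ := by
    have := Nat.totient_pos.2 (NeZero.pos q)
    positivity
  have h1 := (tendsto_integral_minorantKernel hh).const_mul (q.totient : ℝ)⁻¹
  have h2 : Tendsto (fun T : ℝ => ∫ t : ℝ, (minorantWindow t : ℂ) *
      (Complex.exp (2 * π * t * T / h * Complex.I) *
          vonMangoldt.LFunctionResidueClassAux a (1 + 2 * π * t / h * Complex.I))) atTop (𝓝 0) := by
    have hc : Tendsto (fun T : ℝ => -(T / h)) atTop (cocompact ℝ) :=
      (tendsto_neg_atTop_atBot.comp (tendsto_id.atTop_div_const hh)).mono_right atBot_le_cocompact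
    refine ((Real.tendsto_integral_exp_smul_cocompact fun t : ℝ => (minorantWindow t : ℂ) *
      vonMangoldt.LFunctionResidueClassAux a (1 + 2 * π * t / h * Complex.I)).comp hc).congr
      fun T => ?_
    simp only [Function.comp]
    congr 1 with t
    rw [Circle.smul_def, Real.fourierChar_apply, smul_eq_mul, mul_left_comm]
    congr 3
    push_cast
    ring
  have h3 := h1.add ((Complex.continuous_re.tendsto _).comp h2)
  rw [Complex.zero_re, add_zero] at h3
  filter_upwards [h3.eventually_const_lt (show (q.totient : ℝ)⁻¹ * h / 2 < _ by
    have := mul_pos hA hh; linarith)] with T hT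
  have := minorant_le_sum_residueClass ha hh T
  simp only [Function.comp] at hT
  linarith

theorem exists_sum_log_progression_ge : ∃ c : ℝ, 0 < c ∧ ∀ W b : ℕ, 0 < W → b.Coprime W →
    ∀ η : ℝ, 0 < η → η ≤ 1 → ∀ᶠ y : ℝ in atTop, c * η * y / W.totient ≤
      ∑ p ∈ (Finset.Ioc ⌊y⌋₊ ⌊(1 + η) * y⌋₊).filter (fun p => p.Prime ∧ p ≡ b [MOD W]),
        Real.log p := by
  refine ⟨1 / 96, by norm_num, fun W b hW hb η hη hη1 => ?_⟩
  have : NeZero W := ⟨hW.ne'⟩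
  have ha : IsUnit (b : ZMod W) := (ZMod.isUnit_iff_coprime b W).2 hb
  set h : ℝ := η / 6
  have hh : 0 < h := by positivity
  have hT : Tendsto (fun y : ℝ => Real.log y + 3 / 2 * h) atTop atTop :=
    tendsto_atTop_add_const_right _ _ Real.tendsto_log_atTop
  set A : ℝ := (W.totient : ℝ)⁻¹
  have hA : 0 < A := by
    have := Nat.totient_pos.2 hW
    positivity
  have hsq : ∀ᶠ y : ℝ in atTop, 2 * √(2 * y) * Real.log (2 * y) ≤ A * h / 16 * y := by
    have h1 : (fun x : ℝ => Real.log x) =o[atTop] fun x => x ^ (1 / 2 : ℝ) :=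
      isLittleO_log_rpow_atTop (by norm_num)
    have h2 : Tendsto (fun y : ℝ => 2 * y) atTop atTop := tendsto_id.const_mul_atTop two_pos
    have h3 := h2.eventually (h1.def (show 0 < A * h / 64 by positivity))
    filter_upwards [h3, eventually_ge_atTop 1] with y hy hy1
    rw [← Real.sqrt_eq_rpow, Real.norm_eq_abs, Real.norm_eq_abs, abs_of_nonneg (Real.sqrt_nonneg _)]
      at hy
    have h4 := (le_abs_self _).trans hy
    have h5 : √(2 * y) * √(2 * y) = 2 * y := Real.mul_self_sqrt (by linarith)
    calc _ ≤ 2 * √(2 * y) * (A * h / 64 * √(2 * y)) := by gcongr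
      _ = A * h / 32 * (√(2 * y) * √(2 * y)) := by ring
      _ = _ := by rw [h5]; ring
  filter_upwards [hT.eventually (eventually_le_sum_residueClass ha hh), hsq,
    eventually_ge_atTop 1] with y hy hy2 hy1
  have hy0 : 0 < y := by linarith
  set B := logWindow (Real.log y + 3 / 2 * h) h
  have hB : ∀ n ∈ B, y < n ∧ (n : ℝ) ≤ (1 + η) * y := by
    intro n hn
    rw [mem_logWindow] at hn
    have hn0 : (0 : ℝ) < n := by exact_mod_cast hn.1
    obtain ⟨h1, h2⟩ := abs_le.1 hn.2
    refine ⟨(Real.log_lt_log_iff hy0 hn0).1 (by linarith), ?_⟩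
    rw [← Real.log_le_log_iff hn0 (by positivity), Real.log_mul (by positivity) hy0.ne']
    have h3 := Real.one_sub_inv_le_log_of_pos (show 0 < 1 + η by linarith)
    have h4 : η / 2 ≤ 1 - (1 + η)⁻¹ := by
      rw [show 1 - (1 + η)⁻¹ = η / (1 + η) by field_simp; ring]
      gcongr; linarith
    have h5 : h = η / 6 := rfl
    linarith
  have h1 : ∑ n ∈ B, vonMangoldt.residueClass (b : ZMod W) n / n ≤
      (∑ n ∈ B, vonMangoldt.residueClass (b : ZMod W) n) / y := by
    rw [Finset.sum_div]
    refine Finset.sum_le_sum fun n hn => ?_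
    have := vonMangoldt.residueClass_nonneg (b : ZMod W) n
    gcongr
    exact (hB n hn).1.le
  set P := (Finset.Ioc ⌊y⌋₊ ⌊(1 + η) * y⌋₊).filter (fun p => p.Prime ∧ p ≡ b [MOD W])
  have h2 : ∑ n ∈ B, vonMangoldt.residueClass (b : ZMod W) n ≤ ∑ p ∈ P, Real.log p +
      (Chebyshev.psi (2 * y) - Chebyshev.theta (2 * y)) := by
    rw [← Finset.sum_filter_add_sum_filter_not B Nat.Prime]
    refine add_le_add ?_ ?_
    · rw [← Finset.sum_filter_add_sum_filter_not _ (fun n : ℕ => n ≡ b [MOD W])]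
      have : ∑ n ∈ (B.filter Nat.Prime).filter (fun n => ¬ n ≡ b [MOD W]),
          vonMangoldt.residueClass (b : ZMod W) n = 0 := by
        refine Finset.sum_eq_zero fun n hn => ?_
        rw [vonMangoldt.residueClass, Set.indicator_of_notMem]
        change ¬ (n : ZMod W) = b
        rw [ZMod.natCast_eq_natCast_iff]
        exact (Finset.mem_filter.1 hn).2
      rw [this, add_zero]
      calc _ ≤ ∑ n ∈ (B.filter Nat.Prime).filter (fun n => n ≡ b [MOD W]), Real.log n := by
            refine Finset.sum_le_sum fun n hn => ?_
            rw [← vonMangoldt_apply_prime (Finset.mem_filter.1 (Finset.mem_filter.1 hn).1).2]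
            exact vonMangoldt.residueClass_le _ _
        _ ≤ _ := by
            refine Finset.sum_le_sum_of_subset_of_nonneg (fun n hn => ?_) fun n hn _ =>
              Real.log_natCast_nonneg _
            rw [Finset.mem_filter, Finset.mem_filter] at hn
            have := hB n hn.1.1
            rw [Finset.mem_filter, Finset.mem_Ioc, Nat.floor_lt hy0.le,
              Nat.le_floor_iff (by positivity)]
            exact ⟨this, hn.1.2, hn.2⟩
    · rw [Chebyshev.psi, Chebyshev.theta, Finset.sum_filter (s := Finset.Ioc 0 ⌊2 * y⌋₊), ← Finset.sum_sub_distrib]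
      calc _ ≤ ∑ n ∈ B, (Λ n - if n.Prime then Real.log n else 0) := by
            rw [Finset.sum_filter]
            refine Finset.sum_le_sum fun n _ => ?_
            by_cases hp : n.Prime
            · simp [hp, vonMangoldt_apply_prime hp]
            · simpa [hp] using vonMangoldt.residueClass_le _ _
        _ ≤ _ := by
            refine Finset.sum_le_sum_of_subset_of_nonneg (fun n hn => ?_) fun n hn _ => ?_
            · have := hB n hn
              rw [Finset.mem_Ioc, Nat.le_floor_iff (by positivity)]
              refine ⟨(mem_logWindow.1 hn).1, this.2.trans (by nlinarith)⟩
            · by_cases hp : n.Prime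
              · simp [hp, vonMangoldt_apply_prime hp]
              · simp [hp]
  have h3 : Chebyshev.psi (2 * y) - Chebyshev.theta (2 * y) ≤ A * h / 16 * y :=
    (Chebyshev.psi_sub_theta_le (by linarith)).trans hy2
  have h4 := hy.trans h1
  rw [le_div_iff₀ hy0] at h4
  have h5 : 1 / 96 * η * y / W.totient = A * h / 16 * y := by
    simp only [A, h]; ring
  rw [h5]
  linarith

end WienerIkehara

section ExponentialSums
open Real

/-- The additive character `x ↦ exp (2πix)`. -/
noncomputable def eC (x : ℝ) : ℂ := Complex.exp (2 * π * x * Complex.I)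

theorem eC_add (x y : ℝ) : eC (x + y) = eC x * eC y := by
  rw [eC, eC, eC, ← Complex.exp_add]; congr 1; push_cast; ring

theorem eC_zero : eC 0 = 1 := by simp [eC]

theorem norm_eC (x : ℝ) : ‖eC x‖ = 1 := by
  rw [eC, show (2 * π * x * Complex.I : ℂ) = ((2 * π * x : ℝ) : ℂ) * Complex.I by push_cast; ring]
  exact Complex.norm_exp_ofReal_mul_I _

theorem eC_intCast (n : ℤ) : eC n = 1 := by
  rw [eC, Complex.exp_eq_one_iff]
  exact ⟨n, by push_cast; ring⟩

theorem eC_natCast_mul (n : ℕ) (x : ℝ) : eC (n * x) = eC x ^ n := by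
  rw [eC, eC, ← Complex.exp_nat_mul]; congr 1; push_cast; ring

theorem conj_eC (x : ℝ) : (starRingEnd ℂ) (eC x) = eC (-x) := by
  rw [eC, eC, ← Complex.exp_conj]
  simp [map_mul, Complex.conj_ofReal, Complex.conj_ofNat]

theorem norm_eC_sub_one_le (x : ℝ) : ‖eC x - 1‖ ≤ 7 * |x| := by
  have := Real.norm_exp_I_mul_ofReal_sub_one_le (x := 2 * π * x)
  rw [eC, show (2 * π * x * Complex.I : ℂ) = Complex.I * ((2 * π * x : ℝ) : ℂ) by
    push_cast; ring]
  refine this.trans ?_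
  rw [Real.norm_eq_abs, abs_mul, abs_of_pos (by positivity)]
  gcongr
  linarith [pi_lt_d2]

theorem four_mul_norm_le_norm_eC_sub_one (x : ℝ) : 4 * ‖(x : UnitAddCircle)‖ ≤ ‖eC x - 1‖ := by
  set y := x - round x
  have h1 : eC x = eC y := by
    rw [show x = y + ((round x : ℤ) : ℝ) by simp [y], eC_add, eC_intCast, mul_one]
  have hy : |y| ≤ 1 / 2 := abs_sub_round x
  rw [UnitAddCircle.norm_eq, h1, eC, show (2 * π * y * Complex.I : ℂ) =
    Complex.I * ((2 * π * y : ℝ) : ℂ) by push_cast; ring, Complex.norm_exp_I_mul_ofReal_sub_one,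
    Real.norm_eq_abs, abs_mul, abs_two, show 2 * π * y / 2 = π * y by ring]
  have h2 := Real.mul_abs_le_abs_sin (x := π * y) (by
    rw [abs_mul, abs_of_pos pi_pos]; nlinarith [pi_pos])
  rw [abs_mul, abs_of_pos pi_pos, ← mul_assoc, div_mul_cancel₀ _ pi_ne_zero] at h2
  change 4 * |y| ≤ _
  linarith

theorem norm_sum_Ioc_eC_le_card (u v : ℕ) (α : ℝ) :
    ‖∑ m ∈ Finset.Ioc u v, eC (m * α)‖ ≤ (v - u : ℕ) := by
  refine (norm_sum_le _ _).trans ?_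
  simp [norm_eC]

theorem norm_sum_Ioc_eC_mul_le (u v : ℕ) (α : ℝ) :
    ‖∑ m ∈ Finset.Ioc u v, eC (m * α)‖ * (2 * ‖(α : UnitAddCircle)‖) ≤ 1 := by
  rcases le_total v u with h | h
  · simp [Finset.Ioc_eq_empty_of_le h]
  have h1 : (∑ m ∈ Finset.Ioc u v, eC (m * α)) * (eC α - 1) =
      eC ((v + 1 : ℕ) * α) - eC ((u + 1 : ℕ) * α) := by
    rw [Finset.sum_mul]
    induction v, h using Nat.le_induction with
    | base => simp
    | succ n hn ih =>
      rw [Finset.sum_Ioc_succ_top (by omega), ih]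
      have : eC ((n + 1 + 1 : ℕ) * α) = eC ((n + 1 : ℕ) * α) * eC α := by
        rw [← eC_add]; congr 1; push_cast; ring
      rw [this]; ring
  have h2 : ‖∑ m ∈ Finset.Ioc u v, eC (m * α)‖ * ‖eC α - 1‖ ≤ 2 := by
    rw [← norm_mul, h1]
    refine (norm_sub_le _ _).trans ?_
    rw [norm_eC, norm_eC]; norm_num
  nlinarith [four_mul_norm_le_norm_eC_sub_one α, norm_nonneg (∑ m ∈ Finset.Ioc u v, eC (m * α)),
    mul_le_mul_of_nonneg_left (four_mul_norm_le_norm_eC_sub_one α)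
      (norm_nonneg (∑ m ∈ Finset.Ioc u v, eC (m * α)))]

theorem sum_Ioc_filter_dvd_eC {d : ℕ} (hd : 0 < d) (u v : ℕ) (α : ℝ) :
    ∑ m ∈ (Finset.Ioc u v).filter (d ∣ ·), eC (m * α) =
      ∑ m ∈ Finset.Ioc (u / d) (v / d), eC (m * (d * α)) := by
  symm
  refine Finset.sum_nbij' (fun m => d * m) (fun m => m / d) ?_ ?_ ?_ ?_ ?_
  · intro m hm
    rw [Finset.mem_Ioc, Nat.div_lt_iff_lt_mul hd, Nat.le_div_iff_mul_le hd] at hm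
    simp only [Finset.mem_filter, Finset.mem_Ioc, dvd_mul_right, and_true]
    rw [mul_comm]; exact hm
  · intro m hm
    simp only [Finset.mem_filter, Finset.mem_Ioc] at hm
    obtain ⟨h, k, rfl⟩ := hm
    rw [Nat.mul_div_cancel_left _ hd, Finset.mem_Ioc, Nat.div_lt_iff_lt_mul hd,
      Nat.le_div_iff_mul_le hd, mul_comm k]
    exact h
  · intro m _; exact Nat.mul_div_cancel_left _ hd
  · intro m hm; exact Nat.mul_div_cancel' (Finset.mem_filter.1 hm).2
  · intro m _; congr 1; push_cast; ring

theorem inv_le_norm_div {a : ℤ} {q : ℕ} (hq : 0 < q) (h : ¬ (q : ℤ) ∣ a) :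
    1 / (q : ℝ) ≤ ‖((a / q : ℝ) : UnitAddCircle)‖ := by
  have hq' : (0 : ℝ) < q := by exact_mod_cast hq
  rw [UnitAddCircle.norm_eq, div_le_iff₀ hq']
  generalize round (a / q : ℝ) = r
  have : |(a / q : ℝ) - r| * q = |((a - r * q : ℤ) : ℝ)| := by
    rw [← abs_of_pos hq', ← abs_mul, abs_of_pos hq', sub_mul, div_mul_cancel₀ _ hq'.ne']
    push_cast; rfl
  rw [this, ← Int.cast_abs]
  exact_mod_cast Int.one_le_abs fun h0 => h ⟨r, by linarith⟩

theorem sum_moebius_filter_dvd {q : ℕ} (hq : q ≠ 0) (m : ℕ) :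
    ∑ d ∈ q.divisors.filter (· ∣ m), (ArithmeticFunction.moebius d : ℤ) =
      if m.Coprime q then 1 else 0 := by
  have h : q.divisors.filter (· ∣ m) = (m.gcd q).divisors := by
    ext d
    rw [Finset.mem_filter, Nat.mem_divisors, Nat.mem_divisors, Nat.dvd_gcd_iff]
    have : m.gcd q ≠ 0 := Nat.gcd_ne_zero_right hq
    tauto
  rw [h, ← ArithmeticFunction.coe_mul_zeta_apply, ArithmeticFunction.moebius_mul_coe_zeta,
    ArithmeticFunction.one_apply]

/-- Exponential sums over an interval restricted to integers coprime to `q`. -/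
theorem norm_sum_coprime_le {a : ℤ} {q : ℕ} (hq : 0 < q) (haq : IsCoprime a q) {β : ℝ}
    (hβ : q * |β| ≤ 1 / 2) (u v : ℕ) :
    ‖∑ m ∈ (Finset.Ioc u v).filter (Nat.Coprime · q), eC (m * (a / q + β))‖ ≤
      q ^ 2 + ‖∑ m ∈ Finset.Ioc (u / q) (v / q), eC (m * (q * β))‖ := by
  set α : ℝ := a / q + β
  have hq' : (0 : ℝ) < q := by exact_mod_cast hq
  have h1 : ∑ m ∈ (Finset.Ioc u v).filter (Nat.Coprime · q), eC (m * α) =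
      ∑ d ∈ q.divisors, (ArithmeticFunction.moebius d : ℂ) *
        ∑ m ∈ (Finset.Ioc u v).filter (d ∣ ·), eC (m * α) := by
    simp_rw [Finset.mul_sum, Finset.sum_filter]
    rw [Finset.sum_comm]
    refine Finset.sum_congr rfl fun m _ => ?_
    have := congrArg (fun x : ℤ => (x : ℂ)) (sum_moebius_filter_dvd hq.ne' m)
    simp only [Int.cast_sum] at this
    calc _ = ((if m.Coprime q then (1 : ℤ) else 0 : ℤ) : ℂ) * eC (m * α) := by split_ifs <;> simp
      _ = _ := by
        rw [← this, Finset.sum_mul, Finset.sum_filter]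
  have hmu : ∀ d : ℕ, ‖(ArithmeticFunction.moebius d : ℂ)‖ ≤ 1 := fun d => by
    rw [Complex.norm_intCast]
    exact_mod_cast ArithmeticFunction.abs_moebius_le_one
  have hdα : ∀ d ∈ q.properDivisors, ‖∑ m ∈ Finset.Ioc (u / d) (v / d), eC (m * (d * α))‖ ≤ q := by
    intro d hd
    rw [Nat.mem_properDivisors] at hd
    obtain ⟨⟨e, rfl⟩, hlt⟩ := hd
    have hd0 : 0 < d := pos_of_mul_pos_left hq (Nat.zero_le e)
    have he0 : 0 < e := pos_of_mul_pos_right hq (Nat.zero_le d)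
    have hd' : (0 : ℝ) < d := by exact_mod_cast hd0
    have he' : (0 : ℝ) < e := by exact_mod_cast he0
    have hne : ¬ (e : ℤ) ∣ a := by
      intro hea
      have h2 : (e : ℤ) ∣ 1 := by
        have := haq.isUnit_of_dvd' hea (by push_cast; exact dvd_mul_left _ _)
        exact this.dvd
      have : e = 1 := by exact_mod_cast Int.eq_one_of_dvd_one (by positivity) h2
      rw [this, mul_one] at hlt
      exact lt_irrefl _ hlt
    have h3 := inv_le_norm_div he0 hne
    have h4 : (d : ℝ) * α = a / e + d * β := by
      simp only [α]; push_cast; field_simp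
    have h5 : 1 / (2 * e : ℝ) ≤ ‖((d * α : ℝ) : UnitAddCircle)‖ := by
      have h6 : ‖((a / e : ℝ) : UnitAddCircle)‖ ≤ ‖((d * α : ℝ) : UnitAddCircle)‖ + |d * β| := by
        have : ((a / e : ℝ) : UnitAddCircle) = ((d * α : ℝ) : UnitAddCircle) -
            ((d * β : ℝ) : UnitAddCircle) := by
          rw [h4, ← AddCircle.coe_sub]; congr 1; ring
        rw [this]
        refine (norm_sub_le _ _).trans ?_
        gcongr
        rw [UnitAddCircle.norm_eq]
        simpa using round_le (d * β) 0
      have h7 : |d * β| ≤ 1 / (2 * e : ℝ) := by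
        rw [abs_mul, abs_of_pos hd', le_div_iff₀ (by positivity)]
        push_cast at hβ
        nlinarith
      have h8 : 1 / (e : ℝ) = 1 / (2 * e : ℝ) + 1 / (2 * e : ℝ) := by field_simp; norm_num
      linarith
    have h9 := norm_sum_Ioc_eC_mul_le (u / d) (v / d) (d * α)
    have h10 : ‖∑ m ∈ Finset.Ioc (u / d) (v / d), eC (m * (d * α))‖ * (2 * (1 / (2 * e : ℝ))) ≤ 1 :=
      le_trans (by gcongr) h9
    rw [show (2 : ℝ) * (1 / (2 * e)) = 1 / e by field_simp, mul_one_div, div_le_one he'] at h10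
    refine h10.trans ?_
    exact_mod_cast Nat.le_mul_of_pos_left e hd0
  rw [h1, ← Nat.cons_self_properDivisors hq.ne', Finset.sum_cons]
  refine (norm_add_le _ _).trans ?_
  rw [add_comm]
  refine add_le_add ?_ ?_
  · refine (norm_sum_le _ _).trans ?_
    calc _ ≤ ∑ d ∈ q.properDivisors, (q : ℝ) := by
          refine Finset.sum_le_sum fun d hd => ?_
          have hd0 : 0 < d := Nat.pos_of_mem_properDivisors hd
          rw [norm_mul, sum_Ioc_filter_dvd_eC hd0]
          exact (mul_le_of_le_one_left (norm_nonneg _) (hmu d)).trans (hdα d hd)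
      _ ≤ _ := by
          rw [Finset.sum_const, nsmul_eq_mul, sq]
          gcongr
          calc q.properDivisors.card ≤ (Finset.range q).card := by
                refine Finset.card_le_card fun d hd => ?_
                rw [Finset.mem_range]
                exact (Nat.mem_properDivisors.1 hd).2
            _ = q := Finset.card_range q
  · rw [norm_mul, sum_Ioc_filter_dvd_eC hq]
    refine (mul_le_of_le_one_left (norm_nonneg _) (hmu q)).trans (le_of_eq ?_)
    congr 1
    refine Finset.sum_congr rfl fun m _ => ?_
    have : (m : ℝ) * (q * α) = m * (q * β) + ((m * a : ℤ) : ℝ) := by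
      simp only [α]; push_cast; field_simp; ring
    rw [this, eC_add, eC_intCast, mul_one]

end ExponentialSums

section RoughSums
open Real

/-- `n` has no prime factor `≤ z`. -/
def IsRough (z : ℝ) (n : ℕ) : Prop := ∀ p : ℕ, p.Prime → (p : ℝ) ≤ z → ¬ p ∣ n

noncomputable instance (z : ℝ) : DecidablePred (IsRough z) := fun _ => Classical.dec _

theorem norm_sum_Ioc_sub_sum_shift_le {F : ℕ → ℂ} (hF : ∀ n, ‖F n‖ ≤ 1) (u v h : ℕ) :
    ‖∑ m ∈ Finset.Ioc u v, F m - ∑ m ∈ Finset.Ioc u v, F (m + h)‖ ≤ 2 * h := by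
  rcases le_total v u with huv | huv
  · simp [Finset.Ioc_eq_empty_of_le huv]
  have key : ∀ G : ℕ → ℂ, (∀ n, ‖G n‖ ≤ 1) →
      ‖∑ m ∈ Finset.Ioc u v, G m - ∑ m ∈ Finset.Ioc u v, G (m + 1)‖ ≤ 2 := by
    intro G hG
    have : ∑ m ∈ Finset.Ioc u v, G m - ∑ m ∈ Finset.Ioc u v, G (m + 1) = G (u + 1) - G (v + 1) := by
      induction v, huv using Nat.le_induction with
      | base => simp
      | succ n hn ih =>
        rw [Finset.sum_Ioc_succ_top (by omega), Finset.sum_Ioc_succ_top (by omega)]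
        linear_combination ih
    rw [this]
    refine (norm_sub_le _ _).trans ?_
    linarith [hG (u + 1), hG (v + 1)]
  induction h with
  | zero => simp
  | succ h ih =>
    have h1 := key (fun n => F (n + h)) fun n => hF _
    have h2 : ∑ m ∈ Finset.Ioc u v, F (m + 1 + h) = ∑ m ∈ Finset.Ioc u v, F (m + (h + 1)) :=
      Finset.sum_congr rfl fun m _ => by rw [add_assoc, add_comm 1 h]
    rw [h2] at h1
    calc _ = ‖(∑ m ∈ Finset.Ioc u v, F m - ∑ m ∈ Finset.Ioc u v, F (m + h)) +
        (∑ m ∈ Finset.Ioc u v, F (m + h) - ∑ m ∈ Finset.Ioc u v, F (m + (h + 1)))‖ := by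
          congr 1; ring
      _ ≤ 2 * h + 2 := (norm_add_le _ _).trans (add_le_add ih h1)
      _ = _ := by push_cast; ring

theorem isRough_progression_iff {z : ℝ} {q m : ℕ} (hm : m.Coprime q) (k : ℕ) :
    IsRough z (m + q * k) ↔ ∀ p ∈ sievePrimes z q, ¬ (p : ℤ) ∣ (m : ℤ) + q * k := by
  constructor
  · intro h p hp
    rw [mem_sievePrimes] at hp
    exact_mod_cast h p hp.1 hp.2.1
  · intro h p hp hpz hpd
    by_cases hpq : p ∣ q
    · have h1 : p ∣ m := by
        rwa [Nat.dvd_add_left (hpq.mul_right k)] at hpd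
      exact hp.one_lt.ne' (Nat.eq_one_of_dvd_coprimes hm h1 hpq)
    · refine h p ?_ (by exact_mod_cast hpd)
      rw [mem_sievePrimes]
      exact ⟨hp, hpz, hpq⟩

/-- Exponential sums over rough numbers at a frequency near `a / q` are controlled by the
corresponding sums over integers coprime to `q`. -/
theorem norm_sum_rough_le : ∃ C : ℝ, 0 < C ∧ ∀ (s : ℕ) (z : ℝ) (q : ℕ) (a : ℤ) (β : ℝ) (u v J : ℕ),
    2 ≤ z → 0 < q → (q : ℝ) ≤ z → u ≤ v → 0 < J →
    ‖∑ m ∈ (Finset.Ioc u v).filter (IsRough z), eC (m * (a / q + β))‖ ≤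
      sieveDensity (sievePrimes z q) *
        ‖∑ m ∈ (Finset.Ioc u v).filter (Nat.Coprime · q), eC (m * (a / q + β))‖ +
      ((v : ℝ) - u) * (C / 2 ^ s * sieveDensity (sievePrimes z q) + z ^ (4 * s + 7) / J +
        7 * (q * J * |β|)) + 2 * (q * J) := by
  obtain ⟨C, hC, H⟩ := fundamental_lemma_progression
  refine ⟨C, hC, fun s z q a β u v J hz hq hqz huv hJ => ?_⟩
  set V := sieveDensity (sievePrimes z q)
  set α : ℝ := a / q + β
  have hq' : (0 : ℝ) < q := by exact_mod_cast hq
  have hJ' : (0 : ℝ) < J := by exact_mod_cast hJ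
  have hz0 : 0 < z := by linarith
  have hV : 0 ≤ V := (sieveDensity_pos fun p hp => (mem_sievePrimes.1 hp).1).le
  set F : ℕ → ℂ := fun m => if IsRough z m then eC (m * α) else 0
  have hF : ∀ m, ‖F m‖ ≤ 1 := fun m => by
    simp only [F]; split_ifs <;> simp [norm_eC]
  rw [Finset.sum_filter]
  have hlen : ((Finset.Ioc u v).card : ℝ) = (v : ℝ) - u := by
    rw [Nat.card_Ioc, Nat.cast_sub huv]
  -- averaging over shifts by multiples of `q`
  have h1 : ‖(J : ℂ) * ∑ m ∈ Finset.Ioc u v, F m -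
      ∑ m ∈ Finset.Ioc u v, ∑ k ∈ Finset.range J, F (m + q * k)‖ ≤ J * (2 * (q * J)) := by
    have hc : (J : ℂ) * ∑ m ∈ Finset.Ioc u v, F m =
        ∑ _k ∈ Finset.range J, ∑ m ∈ Finset.Ioc u v, F m := by
      rw [Finset.sum_const, Finset.card_range, nsmul_eq_mul]
    rw [Finset.sum_comm (s := Finset.Ioc u v), hc, ← Finset.sum_sub_distrib]
    refine (norm_sum_le_of_le (f := fun _ => _) (n := fun _ => 2 * ((q : ℝ) * J)) _ fun k hk => ?_).trans ?_
    · refine (norm_sum_Ioc_sub_sum_shift_le hF u v (q * k)).trans ?_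
      have : (k : ℝ) ≤ J := by exact_mod_cast (Finset.mem_range.1 hk).le
      push_cast
      gcongr
    · rw [Finset.sum_const, Finset.card_range, nsmul_eq_mul]
  -- evaluating each window
  have h2 : ∀ m ∈ Finset.Ioc u v, ‖∑ k ∈ Finset.range J, F (m + q * k) -
      (if m.Coprime q then ((J * V : ℝ) : ℂ) * eC (m * α) else 0)‖ ≤
      J * (C / 2 ^ s * V + z ^ (4 * s + 7) / J + 7 * (q * J * |β|)) := by
    intro m _
    set R := (Finset.range J).filter fun k => IsRough z (m + q * k)
    have e1 : ∑ k ∈ Finset.range J, F (m + q * k) =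
        eC (m * α) * ∑ k ∈ R, eC (k * (q * β)) := by
      simp only [F, R]
      rw [Finset.mul_sum, Finset.sum_filter]
      refine Finset.sum_congr rfl fun k _ => ?_
      split_ifs
      · have : ((m + q * k : ℕ) : ℝ) * α = m * α + k * (q * β) + ((k * a : ℤ) : ℝ) := by
          simp only [α]; push_cast; field_simp; ring
        rw [this, eC_add, eC_add, eC_intCast, mul_one]
      · rfl
    have e2 : ‖∑ k ∈ Finset.range J, F (m + q * k) - (R.card : ℂ) * eC (m * α)‖ ≤
        J * (7 * (q * J * |β|)) := by
      rw [e1, mul_comm (R.card : ℂ), ← mul_sub, norm_mul, norm_eC, one_mul, Finset.cast_card,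
        ← Finset.sum_sub_distrib]
      calc _ ≤ ∑ k ∈ R, 7 * (q * J * |β|) := by
            refine norm_sum_le_of_le _ fun k hk => (norm_eC_sub_one_le _).trans ?_
            have : (k : ℝ) ≤ J := by
              exact_mod_cast (Finset.mem_range.1 (Finset.mem_filter.1 hk).1).le
            rw [abs_mul, abs_mul, abs_of_nonneg (Nat.cast_nonneg k), abs_of_pos hq']
            nlinarith [mul_le_mul_of_nonneg_right this (mul_nonneg hq'.le (abs_nonneg β))]
        _ ≤ _ := by
            rw [Finset.sum_const, nsmul_eq_mul]
            gcongr
            exact_mod_cast (Finset.card_filter_le _ _).trans_eq (Finset.card_range J)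
    have e3 : ‖(R.card : ℂ) * eC (m * α) -
        (if m.Coprime q then ((J * V : ℝ) : ℂ) * eC (m * α) else 0)‖ ≤
        J * (C / 2 ^ s * V + z ^ (4 * s + 7) / J) := by
      have hJz : J * (C / 2 ^ s * V + z ^ (4 * s + 7) / J) =
          C / 2 ^ s * (J * V) + z ^ (4 * s + 7) := by
        field_simp
      rw [hJz]
      split_ifs with hm
      · have hR : R = (Finset.range J).filter
            fun k : ℕ => ∀ p ∈ sievePrimes z q, ¬ (p : ℤ) ∣ (m : ℤ) + q * k :=
          Finset.filter_congr fun k _ => isRough_progression_iff hm k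
        rw [← sub_mul, norm_mul, norm_eC, mul_one, hR, ← Complex.ofReal_natCast,
          ← Complex.ofReal_sub, Complex.norm_real, Real.norm_eq_abs]
        exact H s z q m J hz
      · have hR : R = ∅ := by
          rw [Finset.filter_eq_empty_iff]
          intro k _ hk
          obtain ⟨p, hp, hpg⟩ := Nat.exists_prime_and_dvd hm
          have hpq := hpg.trans (Nat.gcd_dvd_right m q)
          refine hk p hp ?_ (dvd_add (hpg.trans (Nat.gcd_dvd_left m q)) (hpq.mul_right k))
          exact le_trans (by exact_mod_cast Nat.le_of_dvd hq hpq) hqz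
        rw [hR, Finset.card_empty, Nat.cast_zero, zero_mul, sub_zero, norm_zero]
        positivity
    calc _ ≤ _ := norm_sub_le_norm_sub_add_norm_sub _ ((R.card : ℂ) * eC (m * α)) _
      _ ≤ _ := add_le_add e2 e3
      _ = _ := by ring
  have h3 : ‖∑ m ∈ Finset.Ioc u v, ∑ k ∈ Finset.range J, F (m + q * k) -
      ((J * V : ℝ) : ℂ) * ∑ m ∈ (Finset.Ioc u v).filter (Nat.Coprime · q), eC (m * α)‖ ≤
      ((v : ℝ) - u) * (J * (C / 2 ^ s * V + z ^ (4 * s + 7) / J + 7 * (q * J * |β|))) := by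
    rw [Finset.mul_sum, Finset.sum_filter, ← Finset.sum_sub_distrib, ← hlen]
    exact (norm_sum_le_of_le _ h2).trans_eq (by rw [Finset.sum_const, nsmul_eq_mul])
  have h4 : J * ‖∑ m ∈ Finset.Ioc u v, F m‖ ≤ J * (2 * (q * J)) +
      (((v : ℝ) - u) * (J * (C / 2 ^ s * V + z ^ (4 * s + 7) / J + 7 * (q * J * |β|))) +
      J * V * ‖∑ m ∈ (Finset.Ioc u v).filter (Nat.Coprime · q), eC (m * α)‖) := by
    have h5 := norm_le_insert' ((J : ℂ) * ∑ m ∈ Finset.Ioc u v, F m)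
      (∑ m ∈ Finset.Ioc u v, ∑ k ∈ Finset.range J, F (m + q * k))
    have h6 := norm_le_insert' (∑ m ∈ Finset.Ioc u v, ∑ k ∈ Finset.range J, F (m + q * k))
      (((J * V : ℝ) : ℂ) * ∑ m ∈ (Finset.Ioc u v).filter (Nat.Coprime · q), eC (m * α))
    rw [norm_mul, Complex.norm_natCast] at h5
    rw [norm_mul, Complex.norm_real, Real.norm_of_nonneg (by positivity)] at h6
    linarith
  refine le_of_mul_le_mul_left (h4.trans_eq ?_) hJ'
  ring

/-- A Brun–Titchmarsh bound for rough numbers in arithmetic progressions. -/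
theorem card_rough_progression_le : ∃ C : ℝ, 0 < C ∧ ∀ (z : ℝ) (g : ℕ) (b : ℤ) (u v : ℕ),
    2 ^ 32 ≤ z → 0 < g → u ≤ v → z ^ (1 / 2 : ℝ) ≤ ((v : ℝ) - u) / g →
    (((Finset.Ioc u v).filter fun l => IsRough z l ∧ (g : ℤ) ∣ l - b).card : ℝ) ≤
      C * (g / g.totient) * (((v : ℝ) - u) / g) / Real.log z := by
  obtain ⟨C, hC, H⟩ := fundamental_lemma_progression
  refine ⟨64 * (1 + C) + 64, by positivity, fun z g b u v hz hg huv hzg => ?_⟩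
  have hg' : (0 : ℝ) < g := by exact_mod_cast hg
  have hz0 : 0 < z := lt_of_lt_of_le (by norm_num) hz
  have hz1 : 1 < z := lt_of_lt_of_le (by norm_num) hz
  set y : ℝ := z ^ (1 / 32 : ℝ)
  have hy2 : 2 ≤ y := by
    calc (2 : ℝ) = ((2 : ℝ) ^ (32 : ℕ)) ^ (1 / 32 : ℝ) := by
          rw [← Real.rpow_natCast, ← Real.rpow_mul (by norm_num)]; norm_num
      _ ≤ y := Real.rpow_le_rpow (by norm_num) hz (by norm_num)
  have hyz : y ≤ z := by
    calc y ≤ z ^ (1 : ℝ) := Real.rpow_le_rpow_of_exponent_le hz1.le (by norm_num)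
      _ = z := Real.rpow_one z
  have hlogy : Real.log y = Real.log z / 32 := by
    rw [Real.log_rpow hz0]; ring
  have hlogz : 0 < Real.log z := Real.log_pos hz1
  set X : ℝ := ((v : ℝ) - u) / g
  have hX1 : 1 ≤ X := le_trans (Real.one_le_rpow hz1.le (by norm_num)) hzg
  set J : ℕ := ⌊X⌋₊ + 1
  have hJ : (J : ℝ) ≤ 2 * X := by
    simp only [J]; push_cast
    linarith [Nat.floor_le (show 0 ≤ X by linarith)]
  set b' : ℤ := u + 1 + (b - (u + 1)) % g
  have hgz : (g : ℤ) ≠ 0 := by exact_mod_cast hg.ne'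
  have hb0 := Int.emod_nonneg (b - (u + 1)) hgz
  have hb1 := Int.emod_lt_of_pos (b - (u + 1)) (by exact_mod_cast hg : (0 : ℤ) < g)
  have hbb : (g : ℤ) ∣ b - b' := by
    have : b - b' = b - (u + 1) - (b - (u + 1)) % g := by simp only [b']; ring
    rw [this]; exact Int.dvd_self_sub_emod
  set T := (Finset.range J).filter fun k : ℕ => ∀ p ∈ sievePrimes y g, ¬ (p : ℤ) ∣ b' + g * k
  have hcard : ((Finset.Ioc u v).filter fun l => IsRough z l ∧ (g : ℤ) ∣ l - b).card ≤ T.card := by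
    have key : ∀ l ∈ (Finset.Ioc u v).filter (fun l => IsRough z l ∧ (g : ℤ) ∣ l - b),
        (l : ℤ) = b' + g * ((((l : ℤ) - b') / g).toNat : ℕ) ∧
          (((l : ℤ) - b') / g).toNat < J := by
      intro l hl
      simp only [Finset.mem_filter, Finset.mem_Ioc] at hl
      obtain ⟨⟨hul, hlv⟩, hr, hd⟩ := hl
      have hd' : (g : ℤ) ∣ l - b' := by
        have := dvd_add hd hbb
        rwa [sub_add_sub_cancel] at this
      obtain ⟨k, hk⟩ := hd'
      have hk0 : 0 ≤ k := by
        by_contra hneg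
        have h1 : (g : ℤ) * k ≤ g * (-1) := by
          apply mul_le_mul_of_nonneg_left (by omega) (by positivity)
        have h2 : (u : ℤ) < l := by exact_mod_cast hul
        omega
      lift k to ℕ using hk0
      rw [hk, Int.mul_ediv_cancel_left _ hgz, Int.toNat_natCast]
      refine ⟨by linarith, ?_⟩
      simp only [J]
      rw [Nat.lt_add_one_iff, Nat.le_floor_iff (by linarith), le_div_iff₀ hg']
      have h2 : (g : ℤ) * k ≤ v - u := by
        have : (l : ℤ) ≤ v := by exact_mod_cast hlv
        omega
      have h3 : ((g : ℝ) * k) ≤ v - u := by exact_mod_cast h2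
      linarith
    refine Finset.card_le_card_of_injOn (fun l : ℕ => (((l : ℤ) - b') / g).toNat) ?_ ?_
    · intro l hl
      obtain ⟨h1, h2⟩ := key l hl
      simp only [T, Finset.coe_filter, Finset.mem_range, Set.mem_ofPred_eq]
      refine ⟨h2, fun p hp => ?_⟩
      rw [← h1]
      rw [mem_sievePrimes] at hp
      have hl' := (Finset.mem_filter.1 hl).2.1 p hp.1 (hp.2.1.trans hyz)
      exact_mod_cast hl'
    · intro l hl l' hl' he
      have h1 := (key l hl).1
      have h2 := (key l' hl').1
      simp only at he
      rw [he, ← h2] at h1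
      exact_mod_cast h1
  have h1 := H 1 y g b' J hy2
  set V := sieveDensity (sievePrimes y g)
  have hV0 : 0 ≤ V :=
    (sieveDensity_pos fun p hp => (mem_sievePrimes.1 hp).1).le
  have hV : V ≤ 32 * (g / g.totient) / Real.log z := by
    have := log_mul_sieveDensity_sievePrimes_le (show 1 ≤ y by linarith) hg.ne'
    rw [hlogy] at this
    rw [le_div_iff₀ hlogz]
    linarith
  have hgt : (1 : ℝ) ≤ g / g.totient := by
    rw [one_le_div (by exact_mod_cast Nat.totient_pos.2 hg)]
    exact_mod_cast Nat.totient_le g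
  have hy11 : y ^ (4 * 1 + 7) ≤ 64 * X / Real.log z := by
    have e1 : y ^ (4 * 1 + 7) = z ^ (11 / 32 : ℝ) := by
      rw [← Real.rpow_natCast, ← Real.rpow_mul hz0.le]; norm_num
    have e2 : Real.log z ≤ 64 * z ^ (5 / 32 : ℝ) := by
      have := Real.log_le_rpow_div hz0.le (show (0 : ℝ) < 5 / 32 by norm_num)
      have h0 : 0 ≤ z ^ (5 / 32 : ℝ) := by positivity
      linarith [show z ^ (5 / 32 : ℝ) / (5 / 32) = z ^ (5 / 32 : ℝ) * (32 / 5) by ring]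
    rw [e1, le_div_iff₀ hlogz]
    calc z ^ (11 / 32 : ℝ) * Real.log z ≤ z ^ (11 / 32 : ℝ) * (64 * z ^ (5 / 32 : ℝ)) := by gcongr
      _ = 64 * z ^ (1 / 2 : ℝ) := by
        rw [mul_left_comm, ← Real.rpow_add hz0]; norm_num
      _ ≤ 64 * X := by gcongr
  have h2 : (T.card : ℝ) ≤ J * V + C / 2 ^ 1 * (J * V) + y ^ (4 * 1 + 7) := by
    linarith [(abs_le.1 h1).2]
  have h3 : J * V ≤ 2 * X * (32 * (g / g.totient) / Real.log z) := by gcongr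
  calc _ ≤ (T.card : ℝ) := by exact_mod_cast hcard
    _ ≤ (1 + C) * (J * V) + y ^ (4 * 1 + 7) := by
      have : 0 ≤ C * (J * V) := by positivity
      have h4 : C / 2 ^ 1 * (J * V) = C * (J * V) / 2 := by ring
      have h5 : (1 + C) * (J * V) = J * V + C * (J * V) := by ring
      rw [h4] at h2
      rw [h5]
      refine h2.trans ?_
      gcongr
      linarith
    _ ≤ (1 + C) * (2 * X * (32 * (g / g.totient) / Real.log z)) +
        64 * X / Real.log z * (g / g.totient) := by
      gcongr
      exact hy11.trans (le_mul_of_one_le_right (by positivity) hgt)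
    _ = _ := by ring

end RoughSums

section RoughInterval
open Real

theorem norm_sum_Ioc_eC_mul_abs_le (u v : ℕ) {α : ℝ} (hα : |α| ≤ 1 / 2) :
    ‖∑ m ∈ Finset.Ioc u v, eC (m * α)‖ * (2 * |α|) ≤ 1 := by
  have h := norm_sum_Ioc_eC_mul_le u v α
  rwa [(AddCircle.norm_coe_eq_abs_iff (1 : ℝ) one_ne_zero).2 (by simpa using hα)] at h

theorem norm_sum_Ioc_div_le {q u v : ℕ} {β δ X : ℝ} (hq : 0 < q) (huv : u ≤ v)
    (hX : (v : ℝ) - u ≤ X) (hqβ : q * |β| ≤ 1 / 2) (hX0 : 0 ≤ X) (hδ0 : 0 ≤ δ)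
    (hδ : 1 ≤ δ * q ∨ 1 ≤ δ * (q * (X * |β|))) :
    ‖∑ m ∈ Finset.Ioc (u / q) (v / q), eC (m * (q * β))‖ ≤ X * δ + 1 := by
  have hq' : (0 : ℝ) < q := by exact_mod_cast hq
  rcases hδ with hδ | hδ
  · refine (norm_sum_Ioc_eC_le_card (u / q) (v / q) (q * β)).trans ?_
    have e3 : v / q < u / q + (v - u) / q + 2 := by
      rw [Nat.div_lt_iff_lt_mul hq]
      have h1 := Nat.lt_div_mul_add hq (a := u)
      have h2 := Nat.lt_div_mul_add hq (a := v - u)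
      have h3 := Nat.sub_add_cancel huv
      have h4 : (u / q + (v - u) / q + 2) * q = u / q * q + q + ((v - u) / q * q + q) := by ring
      omega
    have e4 : ((v / q - u / q : ℕ) : ℝ) ≤ ((v - u) / q : ℕ) + 1 := by
      have : v / q - u / q ≤ (v - u) / q + 1 := by
        generalize v / q = x1 at *; generalize u / q = x2 at *
        generalize (v - u) / q = x3 at *; omega
      exact_mod_cast this
    have e5 : (((v - u) / q : ℕ) : ℝ) ≤ X / q := by
      refine Nat.cast_div_le.trans ?_
      rw [Nat.cast_sub huv]
      gcongr
    have e6 : X / q ≤ X * δ := by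
      rw [div_le_iff₀ hq', mul_assoc]
      exact le_mul_of_one_le_right hX0 hδ
    linarith
  · have e1 := norm_sum_Ioc_eC_mul_abs_le (u / q) (v / q) (α := q * β)
      (by rwa [abs_mul, Nat.abs_cast])
    rw [abs_mul, Nat.abs_cast] at e1
    set Y := ‖∑ m ∈ Finset.Ioc (u / q) (v / q), eC (m * (q * β))‖
    have hY : 0 ≤ Y := norm_nonneg _
    have hb : 0 ≤ Y * (q * |β|) := by positivity
    calc Y ≤ Y * (δ * (q * (X * |β|))) := le_mul_of_one_le_right hY hδ
      _ = X * δ * (Y * (q * |β|)) := by ring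
      _ ≤ X * δ * 1 := by gcongr; linarith
      _ ≤ _ := by linarith

/-- Exponential sums over rough numbers in an interval, in the form used for Type I and Type II
estimates. -/
theorem norm_sum_rough_interval_le : ∃ C : ℝ, 0 < C ∧ ∀ (s : ℕ) (z N X δ : ℝ) (q : ℕ) (a : ℤ)
    (β : ℝ) (u v : ℕ), 2 ≤ z → 1 ≤ N → z ^ (4 * s + 7) ≤ N ^ (1 / 8 : ℝ) → 0 < q → IsCoprime a q →
    (q : ℝ) ^ 8 ≤ z → u ≤ v → (v : ℝ) - u ≤ X → N ^ (1 / 2 : ℝ) ≤ 8 * X →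
    |β| ≤ N ^ (-(3 / 8) : ℝ) → 0 ≤ δ → (1 ≤ δ * q ∨ 1 ≤ δ * (q * (X * |β|))) →
    ‖∑ m ∈ (Finset.Ioc u v).filter (IsRough z), eC (m * (a / q + β))‖ ≤
      C * (q / q.totient) * (X / Real.log z) * (δ + 1 / 2 ^ s + 1 / z) := by
  obtain ⟨C, hC, H⟩ := norm_sum_rough_le
  refine ⟨C + 200, by positivity,
    fun s z N X δ q a β u v hz hN hzN hq haq hqz huv hX hNX hβ hδ0 hδ => ?_⟩
  have hq1 : (1 : ℝ) ≤ q := by exact_mod_cast hq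
  have hz0 : 0 < z := by linarith
  have hN0 : 0 < N := by linarith
  have hlogz : 0 < Real.log z := Real.log_pos (by linarith)
  have hlogz' : Real.log z ≤ z := (Real.log_le_sub_one_of_pos hz0).trans (by linarith)
  have hqz1 : (q : ℝ) ≤ z := le_trans (le_self_pow₀ hq1 (by norm_num)) hqz
  have hqt : (1 : ℝ) ≤ q / q.totient := by
    rw [one_le_div (by exact_mod_cast Nat.totient_pos.2 hq)]
    exact_mod_cast Nat.totient_le q
  have hX0 : 0 < X := by
    have : 0 < N ^ (1 / 2 : ℝ) := by positivity
    linarith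
  set w : ℝ := N ^ (1 / 8 : ℝ) with hw
  have hw1 : 1 ≤ w := Real.one_le_rpow hN (by norm_num)
  have hw0 : 0 < w := by linarith
  have hzw : z ^ 7 ≤ w := le_trans (pow_le_pow_right₀ (by linarith) (by omega)) hzN
  have hw2 : N ^ (1 / 4 : ℝ) = w ^ 2 := by
    rw [hw, ← Real.rpow_natCast, ← Real.rpow_mul hN0.le]; norm_num
  have hw4 : N ^ (1 / 2 : ℝ) = w ^ 4 := by
    rw [hw, ← Real.rpow_natCast, ← Real.rpow_mul hN0.le]; norm_num
  have hw3 : N ^ (-(3 / 8) : ℝ) = 1 / w ^ 3 := by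
    rw [hw, ← Real.rpow_natCast, ← Real.rpow_mul hN0.le, Real.rpow_neg hN0.le]; norm_num
  rw [hw4] at hNX
  rw [hw3] at hβ
  set J : ℕ := ⌈w ^ 2⌉₊
  have hJ1 : w ^ 2 ≤ J := Nat.le_ceil _
  have hw21 : 1 ≤ w ^ 2 := one_le_pow₀ hw1
  have hJ2 : (J : ℝ) ≤ 2 * w ^ 2 := by
    have := Nat.ceil_lt_add_one (show 0 ≤ w ^ 2 by positivity)
    linarith
  have hJ0 : 0 < J := by
    have : (0 : ℝ) < J := by linarith
    exact_mod_cast this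
  have hJ0' : (0 : ℝ) < J := by exact_mod_cast hJ0
  have hmain := H s z q a β u v J hz hq hqz1 huv hJ0
  set V := sieveDensity (sievePrimes z q)
  have hP : ∀ p ∈ sievePrimes z q, p.Prime := fun p hp => (mem_sievePrimes.1 hp).1
  have hV0 : 0 ≤ V := (sieveDensity_pos hP).le
  have hV1 : V ≤ 1 := sieveDensity_le_one hP
  have hV : V ≤ (q / q.totient) / Real.log z := by
    rw [le_div_iff₀ hlogz, mul_comm]
    exact log_mul_sieveDensity_sievePrimes_le (by linarith) hq.ne'
  -- the size of the error terms
  have hzz : z ≤ z ^ 7 := le_self_pow₀ (by linarith) (by norm_num)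
  have hz3 : z * Real.log z * z ≤ w := by
    calc z * Real.log z * z ≤ z * z * z := by gcongr
      _ = z ^ 3 := by ring
      _ ≤ z ^ 7 := pow_le_pow_right₀ (by linarith) (by norm_num)
      _ ≤ w := hzw
  have herr : ∀ t : ℝ, 0 ≤ t → t ≤ z → t * (X / w) ≤ X / Real.log z * (1 / z) := by
    intro t ht0 ht
    rw [mul_div_assoc', div_mul_div_comm, div_le_div_iff₀ hw0 (by positivity), mul_one]
    calc t * X * (Real.log z * z) ≤ z * X * (Real.log z * z) := by gcongr
      _ = X * (z * Real.log z * z) := by ring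
      _ ≤ X * w := by gcongr
  have hqβ : q * |β| ≤ 1 / 2 := by
    have : q * |β| ≤ w * (1 / w ^ 3) := by
      gcongr
      exact (hqz1.trans hzz).trans hzw
    refine this.trans ?_
    have h2 : (2 : ℝ) ≤ w := (hz.trans hzz).trans hzw
    rw [mul_one_div, div_le_div_iff₀ (by positivity) (by norm_num)]
    nlinarith [pow_pos hw0 2]
  have hXw : w ^ 3 ≤ 8 * (X / w) := by
    rw [mul_div_assoc', le_div_iff₀ hw0]
    linarith [show w ^ 3 * w = w ^ 4 by ring]
  have hcop : ‖∑ m ∈ (Finset.Ioc u v).filter (Nat.Coprime · q), eC (m * (a / q + β))‖ ≤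
      X * δ + 16 * (X / w) := by
    have h1 := norm_sum_coprime_le hq haq hqβ u v
    have hq2 : (q : ℝ) ^ 2 ≤ 8 * (X / w) := by
      calc (q : ℝ) ^ 2 ≤ q ^ 8 := pow_le_pow_right₀ hq1 (by norm_num)
        _ ≤ w := hqz.trans (hzz.trans hzw)
        _ ≤ w ^ 3 := le_self_pow₀ hw1 (by norm_num)
        _ ≤ _ := hXw
    have h2 := norm_sum_Ioc_div_le hq huv hX hqβ hX0.le hδ0 hδ
    have e3 : 1 ≤ 8 * (X / w) := (one_le_pow₀ hw1).trans hXw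
    linarith
  have h1 : V * (X * δ) ≤ (q / q.totient) * (X / Real.log z) * δ := by
    calc V * (X * δ) ≤ (q / q.totient) / Real.log z * (X * δ) := by gcongr
      _ = _ := by ring
  have h2 : X * (C / 2 ^ s * V) ≤ C * ((q / q.totient) * (X / Real.log z) * (1 / 2 ^ s)) := by
    calc X * (C / 2 ^ s * V) ≤ X * (C / 2 ^ s * ((q / q.totient) / Real.log z)) := by gcongr
      _ = _ := by ring
  have h3 : X * (z ^ (4 * s + 7) / J) ≤ X / w := by
    calc X * (z ^ (4 * s + 7) / J) ≤ X * (w / w ^ 2) := by gcongr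
      _ = X / w := by field_simp
  have h4 : X * (7 * (q * J * |β|)) ≤ 14 * (q * (X / w)) := by
    calc X * (7 * (q * J * |β|)) ≤ X * (7 * (q * (2 * w ^ 2) * (1 / w ^ 3))) := by gcongr
      _ = 14 * (q * (X / w)) := by field_simp; ring
  have h5 : 2 * ((q : ℝ) * J) ≤ 32 * (q * (X / w)) := by
    have : w ^ 2 ≤ w ^ 3 := pow_le_pow_right₀ hw1 (by norm_num)
    calc 2 * ((q : ℝ) * J) ≤ 2 * (q * (2 * (8 * (X / w)))) := by
          gcongr; exact hJ2.trans (by linarith)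
      _ = _ := by ring
  have h6 : V * (16 * (X / w)) ≤ 16 * (1 * (X / w)) := by
    rw [mul_left_comm]; gcongr
  have h7 := herr 1 (by norm_num) (by linarith)
  have h8 := herr q (by linarith) hqz1
  set T := X / Real.log z * (1 / z)
  have hT : T ≤ (q / q.totient) * (X / Real.log z) * (1 / z) := by
    rw [mul_assoc]; exact le_mul_of_one_le_left (by positivity) hqt
  have hE : 0 ≤ C / 2 ^ s * V + z ^ (4 * s + 7) / J + 7 * (q * J * |β|) := by positivity
  calc _ ≤ _ := hmain
    _ ≤ V * (X * δ + 16 * (X / w)) +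
        X * (C / 2 ^ s * V + z ^ (4 * s + 7) / J + 7 * (q * J * |β|)) + 2 * (q * J) := by gcongr
    _ ≤ (q / q.totient) * (X / Real.log z) * δ +
        C * ((q / q.totient) * (X / Real.log z) * (1 / 2 ^ s)) +
        63 * ((q / q.totient) * (X / Real.log z) * (1 / z)) := by
      rw [mul_add V, mul_add X, mul_add X]
      have aux : ∀ t₁ t₂ t₃ t₄ t₅ t₆ y₁ y₂ y k₁ k₂ k₃ : ℝ, t₁ ≤ k₁ → t₂ ≤ k₂ → t₃ ≤ y₁ →
          t₄ ≤ 14 * y₂ → t₅ ≤ 32 * y₂ → t₆ ≤ 16 * (1 * y₁) → 1 * y₁ ≤ y → y₂ ≤ y → y ≤ k₃ →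
          t₁ + t₆ + (t₂ + t₃ + t₄) + t₅ ≤ k₁ + k₂ + 63 * k₃ := by
        intros; linarith
      exact aux _ _ _ _ _ _ _ _ _ _ _ _ h1 h2 h3 h4 h5 h6 h7 h8 hT
    _ ≤ _ := by
      set Z := (q / q.totient) * (X / Real.log z)
      have hZ : 0 ≤ Z := by positivity
      have i1 : 0 ≤ Z * δ := by positivity
      have i2 : 0 ≤ Z * (1 / 2 ^ s) := by positivity
      have i3 : 0 ≤ Z * (1 / z) := by positivity
      have : (C + 200) * (q / q.totient) * (X / Real.log z) * (δ + 1 / 2 ^ s + 1 / z) =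
        (C + 200) * (Z * δ) + (C + 200) * (Z * (1 / 2 ^ s)) + (C + 200) * (Z * (1 / z)) := by
        simp only [Z]; ring
      rw [this]
      have j1 : 0 ≤ C * (Z * δ) := by positivity
      have j2 : 0 ≤ C * (Z * (1 / z)) := by positivity
      linarith only [i1, i2, i3, j1, j2]

end RoughInterval

section Bilinear
open Real

/-- The Cauchy–Schwarz inequality for bilinear exponential sums. -/
theorem norm_bilinear_sq_le (A B : Finset ℕ) (P : ℕ → ℕ → Prop) [∀ m l, Decidable (P m l)]
    (f g : ℕ → ℂ) (hf : ∀ m, ‖f m‖ ≤ 1) (hg : ∀ l, ‖g l‖ ≤ 1) (α : ℝ) (A' : Finset ℕ) (hA : A ⊆ A') :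
    ‖∑ m ∈ A, ∑ l ∈ B with P m l, f m * g l * eC (m * (l * α))‖ ^ 2 ≤
      A.card * ∑ l ∈ B, ∑ l' ∈ B,
        ‖∑ m ∈ A' with P m l ∧ P m l', eC (m * (((l : ℤ) - l' : ℤ) * α))‖ := by
  set G : ℕ → ℂ := fun m => ∑ l ∈ B with P m l, g l * eC (m * (l * α))
  have h1 : ‖∑ m ∈ A, ∑ l ∈ B with P m l, f m * g l * eC (m * (l * α))‖ ≤ ∑ m ∈ A, ‖G m‖ := by
    refine norm_sum_le_of_le _ fun m _ => ?_
    simp only [mul_assoc, ← Finset.mul_sum, norm_mul]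
    exact mul_le_of_le_one_left (norm_nonneg _) (hf m)
  have h2 : (∑ m ∈ A, ‖G m‖) ^ 2 ≤ A.card * ∑ m ∈ A', ‖G m‖ ^ 2 :=
    (sq_sum_le_card_mul_sum_sq).trans (by
      gcongr)
  have h3 : ((∑ m ∈ A', ‖G m‖ ^ 2 : ℝ) : ℂ) = ∑ l ∈ B, ∑ l' ∈ B,
      g l * (starRingEnd ℂ) (g l') *
        ∑ m ∈ A' with P m l ∧ P m l', eC (m * (((l : ℤ) - l' : ℤ) * α)) := by
    push_cast
    have h4 : ∀ m ∈ A', ((‖G m‖ : ℂ) ^ 2) = ∑ l ∈ B, ∑ l' ∈ B,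
        if P m l ∧ P m l' then g l * (starRingEnd ℂ) (g l') *
          eC (m * (((l : ℤ) - l' : ℤ) * α)) else 0 := by
      intro m _
      rw [← Complex.mul_conj']
      simp only [G, map_sum, Finset.sum_filter, apply_ite (starRingEnd ℂ), map_zero]
      rw [Finset.sum_mul_sum]
      refine Finset.sum_congr rfl fun l _ => Finset.sum_congr rfl fun l' _ => ?_
      by_cases hl : P m l <;> by_cases hl' : P m l' <;> simp only [hl, hl', and_self, and_true,
        and_false, if_true, if_false, mul_zero, zero_mul]
      rw [map_mul, conj_eC, mul_mul_mul_comm, ← eC_add]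
      congr 2
      push_cast; ring
    rw [Finset.sum_congr rfl h4, Finset.sum_comm]
    refine Finset.sum_congr rfl fun l _ => ?_
    rw [Finset.sum_comm]
    refine Finset.sum_congr rfl fun l' _ => ?_
    rw [Finset.mul_sum, Finset.sum_filter]
    simp only [Int.cast_sub, Int.cast_natCast]
  have h5 : ∑ m ∈ A', ‖G m‖ ^ 2 ≤ ∑ l ∈ B, ∑ l' ∈ B,
      ‖∑ m ∈ A' with P m l ∧ P m l', eC (m * (((l : ℤ) - l' : ℤ) * α))‖ := by
    have h6 : 0 ≤ ∑ m ∈ A', ‖G m‖ ^ 2 := Finset.sum_nonneg fun _ _ => by positivity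
    rw [← Real.norm_of_nonneg h6, ← Complex.norm_real, h3]
    refine norm_sum_le_of_le _ fun l _ => norm_sum_le_of_le _ fun l' _ => ?_
    rw [norm_mul, norm_mul, RCLike.norm_conj]
    exact mul_le_of_le_one_left (norm_nonneg _)
      (mul_le_one₀ (hg l) (norm_nonneg _) (hg l'))
  calc _ ≤ (∑ m ∈ A, ‖G m‖) ^ 2 := by gcongr
    _ ≤ _ := h2.trans (by gcongr)

theorem card_divisors_le_two_mul_sqrt (q : ℕ) : (q.divisors.card : ℝ) ≤ 2 * √q := by
  have h : q.divisors ⊆ Finset.Ioc 0 q.sqrt ∪ (Finset.Ioc 0 q.sqrt).image (q / ·) := by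
    intro d hd
    obtain ⟨⟨k, rfl⟩, h0⟩ := Nat.mem_divisors.1 hd
    have hd0 : 0 < d := Nat.pos_of_ne_zero fun h => by simp [h] at h0
    have hk0 : 0 < k := Nat.pos_of_ne_zero fun h => by simp [h] at h0
    simp only [Finset.mem_union, Finset.mem_image, Finset.mem_Ioc, Nat.le_sqrt]
    rcases le_total d k with h | h
    · exact Or.inl ⟨hd0, Nat.mul_le_mul_left d h⟩
    · exact Or.inr ⟨k, ⟨hk0, Nat.mul_le_mul_right k h⟩, Nat.mul_div_cancel _ hk0⟩
  have h1 := (Finset.card_le_card h).trans (Finset.card_union_le _ _)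
  have h2 := (Finset.card_image_le (s := Finset.Ioc 0 q.sqrt) (f := (q / ·)))
  rw [Nat.card_Ioc] at h1 h2
  have h3 : q.divisors.card ≤ 2 * q.sqrt := by omega
  have h4 : (q.sqrt : ℝ) ≤ √q := Real.nat_sqrt_le_real_sqrt
  calc (q.divisors.card : ℝ) ≤ 2 * q.sqrt := by exact_mod_cast h3
    _ ≤ _ := by gcongr

theorem exists_reduced_fraction {a : ℤ} {q : ℕ} (hq : 0 < q) (haq : IsCoprime a q) (h : ℤ) :
    ∃ (a' : ℤ) (q' : ℕ), 0 < q' ∧ IsCoprime a' q' ∧ q' * Int.gcd h q = q ∧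
      (h : ℝ) * (a / q) = a' / q' := by
  set g := Int.gcd h q
  have hg : 0 < g := Int.gcd_pos_of_ne_zero_right _ (by exact_mod_cast hq.ne')
  obtain ⟨q', hq'⟩ : g ∣ q := by exact_mod_cast Int.gcd_dvd_right h q
  obtain ⟨h', hh'⟩ : (g : ℤ) ∣ h := Int.gcd_dvd_left h q
  have hq'0 : 0 < q' := Nat.pos_of_ne_zero fun h => by subst h; omega
  have hcop : IsCoprime h' (q' : ℤ) := by
    have h1 : Int.gcd h q = g * Int.gcd h' q' := by
      conv_lhs => rw [hh', hq', Nat.cast_mul, Int.gcd_mul_left, Int.natAbs_natCast]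
    rw [Int.isCoprime_iff_gcd_eq_one]
    have : g * Int.gcd h' q' = g * 1 := by rw [← h1, mul_one]
    exact Nat.eq_of_mul_eq_mul_left hg this
  refine ⟨h' * a, q', hq'0, hcop.mul_left ?_, by rw [mul_comm, ← hq'], ?_⟩
  · refine haq.of_isCoprime_of_dvd_right ⟨g, ?_⟩
    rw [hq']; push_cast; ring
  · have e1 : (h : ℝ) = g * h' := by exact_mod_cast hh'
    have e2 : (q : ℝ) = g * q' := by exact_mod_cast hq'
    have : (g : ℝ) ≠ 0 := by positivity
    have : (q' : ℝ) ≠ 0 := by positivity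
    rw [e1, e2]; push_cast; field_simp

/-- Admissible parameters: sifting limit `z`, sieve depth `s`, scale `N` and conductor `R`. -/
structure SieveRange (s : ℕ) (z N R : ℝ) : Prop where
  le_z : 2 ^ 32 ≤ z
  one_le_N : 1 ≤ N
  one_le_R : 1 ≤ R
  level : z ^ (4 * s + 7) ≤ N ^ (1 / 8 : ℝ)
  pow_le_z : R ^ 16 ≤ z
  sq_le : R ^ 2 ≤ 2 ^ s

namespace SieveRange
variable {s : ℕ} {z N R : ℝ}

theorem z_pos (h : SieveRange s z N R) : 0 < z := lt_of_lt_of_le (by norm_num) h.le_z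

theorem one_lt_z (h : SieveRange s z N R) : 1 < z := lt_of_lt_of_le (by norm_num) h.le_z

theorem log_pos (h : SieveRange s z N R) : 0 < Real.log z := Real.log_pos h.one_lt_z

theorem z_le (h : SieveRange s z N R) : z ≤ N ^ (1 / 8 : ℝ) :=
  (le_self_pow₀ h.one_lt_z.le (by omega)).trans h.level

theorem two_mul_le (h : SieveRange s z N R) : 2 * R ≤ z := by
  have h1 := h.one_le_R
  have h2 := h.le_z
  rcases le_total R 2 with h3 | h3
  · linarith
  · calc 2 * R ≤ R * R := by gcongr
      _ = R ^ 2 := by ring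
      _ ≤ R ^ 16 := pow_le_pow_right₀ h1 (by norm_num)
      _ ≤ z := h.pow_le_z

theorem R_le (h : SieveRange s z N R) : R ≤ z ^ (1 / 16 : ℝ) := by
  have := h.one_le_R
  calc R = (R ^ 16) ^ (1 / 16 : ℝ) := by
        rw [← Real.rpow_natCast, ← Real.rpow_mul (by linarith)]; norm_num
    _ ≤ _ := Real.rpow_le_rpow (by positivity) h.pow_le_z (by norm_num)

end SieveRange

/-- The inner sum in the bilinear estimate. -/
theorem norm_sum_rough_difference_le : ∃ C : ℝ, 0 < C ∧ ∀ (s : ℕ) (z N R M D δ : ℝ) (q : ℕ) (a h : ℤ)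
    (β : ℝ) (u v : ℕ), SieveRange s z N R → 0 < q → IsCoprime a q → R = q * max 1 (N * |β|) →
    D ≤ M → N ≤ 4 * (M * D) → M * D ≤ 4 * N → 0 < D → |(h : ℝ)| ≤ D → (v : ℝ) - u ≤ M → 0 ≤ δ →
    (Int.gcd h q ≤ δ * q ∨ 1 ≤ δ * (M * |h * β|)) →
    ‖∑ m ∈ (Finset.Ioc u v).filter (IsRough z), eC (m * (h * (a / q + β)))‖ ≤
      C * (M / Real.log z) * R ^ (1 / 16 : ℝ) * (δ + 1 / R ^ 2) := by
  obtain ⟨C, hC, H⟩ := norm_sum_rough_interval_le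
  obtain ⟨C', hC', H'⟩ := div_totient_le_rpow (ε := 1 / 16) (by norm_num)
  refine ⟨2 * C * C', by positivity, fun s z N R M D δ q a h β u v hS hq haq hR hDM hN1 hN2 hD0 hhD
    huv hδ0 hδ => ?_⟩
  have hz0 := hS.z_pos
  have hR1 := hS.one_le_R
  have hN0 : 0 < N := lt_of_lt_of_le one_pos hS.one_le_N
  have hM0 : 0 < M := hD0.trans_le hDM
  have hlog := hS.log_pos
  have hRz : 1 / z ≤ 1 / R ^ 2 := by
    refine one_div_le_one_div_of_le (by positivity) (le_trans ?_ hS.pow_le_z)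
    exact pow_le_pow_right₀ hR1 (by norm_num)
  have hRs : 1 / (2 : ℝ) ^ s ≤ 1 / R ^ 2 := one_div_le_one_div_of_le (by positivity) hS.sq_le
  have hqR : (q : ℝ) ≤ R := by
    rw [hR]; exact le_mul_of_one_le_right (Nat.cast_nonneg q) (le_max_left _ _)
  rcases le_total v u with hvu | hvu
  · rw [Finset.Ioc_eq_empty_of_le hvu]
    simp only [Finset.filter_empty, Finset.sum_empty, norm_zero]
    positivity
  obtain ⟨a', q', hq'0, hcop, hgq, hfr⟩ := exists_reduced_fraction hq haq h
  have hq'q : q' ≤ q := Nat.le_of_dvd hq ⟨_, hgq.symm⟩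
  have hq'R : (q' : ℝ) ≤ R := le_trans (by exact_mod_cast hq'q) hqR
  have hq'1 : (1 : ℝ) ≤ q' := by exact_mod_cast hq'0
  have hsum : ∀ m : ℕ, eC (m * (h * (a / q + β))) = eC (m * (a' / q' + h * β)) := fun m => by
    rw [mul_add (h : ℝ), hfr]
  simp only [hsum]
  have hq8 : (q' : ℝ) ^ 8 ≤ z := by
    calc (q' : ℝ) ^ 8 ≤ R ^ 8 := by gcongr
      _ ≤ R ^ 16 := pow_le_pow_right₀ hR1 (by norm_num)
      _ ≤ z := hS.pow_le_z
  have hNh : N ^ (1 / 2 : ℝ) * N ^ (1 / 2 : ℝ) = N := by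
    rw [← Real.rpow_add hN0]; norm_num
  have hNM : N ^ (1 / 2 : ℝ) ≤ 8 * M := by
    have : 0 ≤ N ^ (1 / 2 : ℝ) := by positivity
    by_contra! hc
    nlinarith
  have hβR : N * |β| ≤ R := by
    rw [hR]
    calc N * |β| ≤ 1 * max 1 (N * |β|) := by rw [one_mul]; exact le_max_right _ _
      _ ≤ _ := by
        gcongr
        exact_mod_cast hq
  have hhβ : |h * β| ≤ N ^ (-(3 / 8) : ℝ) := by
    have hD2 : D ≤ 2 * N ^ (1 / 2 : ℝ) := by
      have : 0 ≤ N ^ (1 / 2 : ℝ) := by positivity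
      by_contra! hc
      nlinarith
    have e1 : N * |h * β| ≤ N * N ^ (-(3 / 8) : ℝ) := by
      rw [abs_mul]
      calc N * (|(h : ℝ)| * |β|) = |(h : ℝ)| * (N * |β|) := by ring
        _ ≤ 2 * N ^ (1 / 2 : ℝ) * R := by gcongr; exact hhD.trans hD2
        _ = N ^ (1 / 2 : ℝ) * (2 * R) := by ring
        _ ≤ N ^ (1 / 2 : ℝ) * N ^ (1 / 8 : ℝ) := by
          gcongr; exact hS.two_mul_le.trans hS.z_le
        _ = N ^ (1 : ℝ) * N ^ (-(3 / 8) : ℝ) := by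
          rw [← Real.rpow_add hN0, ← Real.rpow_add hN0]; norm_num
        _ = _ := by rw [Real.rpow_one]
    exact le_of_mul_le_mul_left e1 hN0
  have hδ' : 1 ≤ δ * q' ∨ 1 ≤ δ * (q' * (M * |h * β|)) := by
    rcases hδ with hδ | hδ
    · left
      have hg : (0 : ℝ) < Int.gcd h q := by
        exact_mod_cast Int.gcd_pos_of_ne_zero_right h (by exact_mod_cast hq.ne')
      have e1 : (q : ℝ) = q' * Int.gcd h q := by exact_mod_cast hgq.symm
      rw [e1] at hδ
      refine le_of_mul_le_mul_right ?_ hg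
      linarith
    · right
      exact hδ.trans (mul_le_mul_of_nonneg_left (le_mul_of_one_le_left (by positivity) hq'1) hδ0)
  have hmain := H s z N M δ q' a' (h * β) u v (by linarith [hS.le_z]) hS.one_le_N hS.level hq'0 hcop
    hq8 hvu huv hNM hhβ hδ0 hδ'
  have htot : (q' : ℝ) / q'.totient ≤ C' * R ^ (1 / 16 : ℝ) :=
    (H' q' hq'0.ne').trans (by gcongr)
  calc _ ≤ _ := hmain
    _ ≤ C * (C' * R ^ (1 / 16 : ℝ)) * (M / Real.log z) * (2 * (δ + 1 / R ^ 2)) := by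
      gcongr
      linarith
    _ = _ := by ring

theorem card_rough_dvd_sub_le : ∃ C : ℝ, 0 < C ∧ ∀ (z X : ℝ) (g : ℕ) (b : ℤ) (u v : ℕ),
    2 ^ 32 ≤ z → 0 < g → (v : ℝ) - u ≤ X → z ^ (1 / 2 : ℝ) ≤ X / g →
    (((Finset.Ioc u v).filter fun l => IsRough z l ∧ (g : ℤ) ∣ l - b).card : ℝ) ≤
      C * (g / g.totient) * (X / g / Real.log z) := by
  obtain ⟨C, hC, H⟩ := card_rough_progression_le
  refine ⟨2 * C, by positivity, fun z X g b u v hz hg hX hzX => ?_⟩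
  have hz1 : 1 < z := lt_of_lt_of_le (by norm_num) hz
  have hlog := Real.log_pos hz1
  have hg1 : (1 : ℝ) ≤ g := by exact_mod_cast hg
  have hX1 : 1 ≤ X := by
    have h1 : 1 ≤ X / g := (Real.one_le_rpow hz1.le (by norm_num)).trans hzX
    rw [one_le_div (by linarith)] at h1
    linarith
  have h := H z g b u (u + ⌈X⌉₊) hz hg (by omega) (hzX.trans (by
    push_cast; rw [add_sub_cancel_left]; gcongr; exact Nat.le_ceil X))
  have h2 : ((⌈X⌉₊ : ℕ) : ℝ) ≤ 2 * X := by
    linarith [Nat.ceil_lt_add_one (show 0 ≤ X by linarith)]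
  simp only [Nat.cast_add, add_sub_cancel_left] at h
  calc _ ≤ (((Finset.Ioc u (u + ⌈X⌉₊)).filter fun l => IsRough z l ∧ (g : ℤ) ∣ l - b).card : ℝ) := by
        gcongr
        have : (v : ℝ) ≤ ((u + ⌈X⌉₊ : ℕ) : ℝ) := by push_cast; linarith [Nat.le_ceil X]
        exact_mod_cast this
    _ ≤ C * (g / g.totient) * ((2 * X) / g) / Real.log z := h.trans (by gcongr)
    _ = _ := by ring

theorem card_rough_le : ∃ C : ℝ, 0 < C ∧ ∀ (z X : ℝ) (u v : ℕ),
    2 ^ 32 ≤ z → (v : ℝ) - u ≤ X → z ^ (1 / 2 : ℝ) ≤ X →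
    (((Finset.Ioc u v).filter (IsRough z)).card : ℝ) ≤ C * (X / Real.log z) := by
  obtain ⟨C, hC, H⟩ := card_rough_dvd_sub_le
  refine ⟨C, hC, fun z X u v hz hX hzX => ?_⟩
  simpa using H z X 1 0 u v hz one_pos hX (by simpa using hzX)

end Bilinear

section Cell
open Real

theorem IsRough.pos {z : ℝ} (hz : 2 ≤ z) {n : ℕ} (h : IsRough z n) : 0 < n :=
  Nat.pos_of_ne_zero fun h0 => h 2 Nat.prime_two (by exact_mod_cast hz) (h0 ▸ dvd_zero 2)

theorem filter_mul_mem_Ioc (N u v : ℕ) {l l' : ℕ} (hl : 0 < l) (hl' : 0 < l') (p : ℕ → Prop)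
    [DecidablePred p] :
    ((Finset.Ioc u v).filter p).filter
        (fun m => (N < m * l ∧ m * l ≤ 4 * N) ∧ (N < m * l' ∧ m * l' ≤ 4 * N)) =
      (Finset.Ioc (max u (max (N / l) (N / l')))
        (min v (min (4 * N / l) (4 * N / l')))).filter p := by
  ext m
  simp only [Finset.mem_filter, Finset.mem_Ioc, max_lt_iff, le_min_iff,
    Nat.div_lt_iff_lt_mul hl, Nat.div_lt_iff_lt_mul hl', Nat.le_div_iff_mul_le hl,
    Nat.le_div_iff_mul_le hl']
  tauto

set_option maxHeartbeats 1000000 in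
/-- One row of the bilinear form. -/
theorem sum_norm_sum_rough_difference_le : ∃ C : ℝ, 0 < C ∧ ∀ (s : ℕ) (z N R M D : ℝ) (q : ℕ)
    (a : ℤ) (β : ℝ) (u' v' l : ℕ) (U V : ℕ → ℕ), SieveRange s z N R → 0 < q → IsCoprime a q →
    R = q * max 1 (N * |β|) → D ≤ M → N ≤ 4 * (M * D) → M * D ≤ 4 * N → z ≤ 2 * D →
    (v' : ℝ) - u' ≤ D → (∀ l', (V l' : ℝ) - U l' ≤ M) → l ∈ (Finset.Ioc u' v').filter (IsRough z) →
    ∑ l' ∈ (Finset.Ioc u' v').filter (IsRough z), ‖∑ m ∈ (Finset.Ioc (U l') (V l')).filter (IsRough z),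
        eC (m * (((l : ℤ) - l' : ℤ) * (a / q + β)))‖ ≤
      C * (M / Real.log z) * (D / Real.log z) * R ^ (-(1 / 8) : ℝ) := by
  obtain ⟨C₁, hC₁, H₁⟩ := norm_sum_rough_difference_le
  obtain ⟨C₂, hC₂, H₂⟩ := card_rough_le
  obtain ⟨C₃, hC₃, H₃⟩ := card_rough_dvd_sub_le
  obtain ⟨C₄, hC₄, H₄⟩ := div_totient_le_rpow (ε := 1 / 16) (by norm_num)
  refine ⟨32 * C₂ + (C₁ * C₂ + C₁ * (2 * C₃ * C₄)) + (C₂ * (3 * C₂) + 5 * C₁ * C₂), by positivity,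
    fun s z N R M D q a β u' v' l U V hS hq haq hR hDM hN1 hN2 hzD hD hM hl => ?_⟩
  set B := (Finset.Ioc u' v').filter (IsRough z)
  set I : ℕ → ℝ := fun l' => ‖∑ m ∈ (Finset.Ioc (U l') (V l')).filter (IsRough z),
        eC (m * (((l : ℤ) - l' : ℤ) * (a / q + β)))‖
  have hz0 := hS.z_pos
  have hz1 := hS.one_lt_z
  have hR1 := hS.one_le_R
  have hR0 : 0 < R := by linarith
  have hN0 : 0 < N := lt_of_lt_of_le one_pos hS.one_le_N
  have hD0 : 0 < D := by linarith
  have hM0 : 0 < M := hD0.trans_le hDM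
  have hlog := hS.log_pos
  have hRz := hS.R_le
  have hzh : z ^ (1 / 2 : ℝ) * z ^ (1 / 2 : ℝ) = z := by
    rw [← Real.rpow_add hz0]; norm_num
  have hzh2 : 2 ≤ z ^ (1 / 2 : ℝ) := by
    by_contra! hc
    have : 0 ≤ z ^ (1 / 2 : ℝ) := by positivity
    nlinarith [hS.le_z]
  have hzhD : z ^ (1 / 2 : ℝ) ≤ D := by nlinarith
  have hqR : (q : ℝ) ≤ R := by
    rw [hR]; exact le_mul_of_one_le_right (Nat.cast_nonneg q) (le_max_left _ _)
  have hq1 : (1 : ℝ) ≤ q := by exact_mod_cast hq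
  have hI : ∀ l', I l' ≤ C₂ * (M / Real.log z) := fun l' => by
    refine (norm_sum_le _ _).trans ?_
    simp only [norm_eC, Finset.sum_const, nsmul_eq_mul, mul_one]
    exact H₂ z M _ _ hS.le_z (hM l') (hzhD.trans hDM)
  have hB : (B.card : ℝ) ≤ C₂ * (D / Real.log z) := by
    exact H₂ z D _ _ hS.le_z hD hzhD
  have hdist : ∀ l' ∈ B, |(((l : ℤ) - l' : ℤ) : ℝ)| ≤ D := by
    intro l' hl'
    simp only [B, Finset.mem_filter, Finset.mem_Ioc] at hl hl'
    have h1 : (u' : ℝ) ≤ l := by exact_mod_cast hl.1.1.le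
    have h2 : (l : ℝ) ≤ v' := by exact_mod_cast hl.1.2
    have h3 : (u' : ℝ) ≤ l' := by exact_mod_cast hl'.1.1.le
    have h4 : (l' : ℝ) ≤ v' := by exact_mod_cast hl'.1.2
    push_cast
    rw [abs_le]; constructor <;> linarith
  set K := (M / Real.log z) * (D / Real.log z)
  have hK0 : 0 ≤ K := by positivity
  set r := R ^ (-(1 / 8) : ℝ)
  have hr0 : 0 < r := by positivity
  have hR2 : R ^ (1 / 16 : ℝ) * (1 / R ^ 2) ≤ r := by
    rw [one_div (R ^ 2), ← Real.rpow_natCast R 2, ← Real.rpow_neg hR0.le, ← Real.rpow_add hR0]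
    exact Real.rpow_le_rpow_of_exponent_le hR1 (by norm_num)
  -- the diagonal term
  have hdiag : I l ≤ 32 * C₂ * (K * r) := by
    refine (hI l).trans ?_
    have h1 : Real.log z ≤ 4 * z ^ (1 / 4 : ℝ) := by
      have := Real.log_le_rpow_div hz0.le (show (0 : ℝ) < 1 / 4 by norm_num)
      linarith [show z ^ (1 / 4 : ℝ) / (1 / 4) = 4 * z ^ (1 / 4 : ℝ) by ring]
    have h2 : z ^ (-(1 / 4) : ℝ) ≤ r := by
      have : z ^ (-(1 / 4) : ℝ) ≤ z ^ (1 / 16 * -(1 / 8) : ℝ) :=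
        Real.rpow_le_rpow_of_exponent_le hz1.le (by norm_num)
      refine this.trans ?_
      rw [Real.rpow_mul hz0.le]
      exact Real.rpow_le_rpow_of_nonpos hR0 hRz (by norm_num)
    have h3 : 1 ≤ 32 * ((D / Real.log z) * r) := by
      have h4 : z ^ (1 / 4 : ℝ) * z ^ (-(1 / 4) : ℝ) = 1 := by
        rw [← Real.rpow_add hz0]; norm_num
      have h5 : z ^ (1 / 4 : ℝ) ≤ 8 * (D / Real.log z) := by
        rw [mul_div_assoc', le_div_iff₀ hlog]
        have h6 : z ^ (1 / 4 : ℝ) * z ^ (1 / 4 : ℝ) ≤ z ^ (1 : ℝ) := by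
          rw [← Real.rpow_add hz0]
          exact Real.rpow_le_rpow_of_exponent_le hz1.le (by norm_num)
        rw [Real.rpow_one] at h6
        have : 0 ≤ z ^ (1 / 4 : ℝ) := by positivity
        nlinarith
      have h7 : z ^ (1 / 4 : ℝ) * z ^ (-(1 / 4) : ℝ) ≤ 8 * (D / Real.log z) * r := by gcongr
      have : 0 ≤ D / Real.log z * r := by positivity
      linarith
    calc C₂ * (M / Real.log z) ≤ C₂ * (M / Real.log z) * (32 * ((D / Real.log z) * r)) :=
          le_mul_of_one_le_right (by positivity) h3
      _ = _ := by simp only [K]; ring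
  have hsplit : ∑ l' ∈ B, I l' = I l + ∑ l' ∈ B.erase l, I l' :=
    (Finset.add_sum_erase _ _ hl).symm
  suffices hoff : ∑ l' ∈ B.erase l, I l' ≤
      ((C₁ * C₂ + C₁ * (2 * C₃ * C₄)) + (C₂ * (3 * C₂) + 5 * C₁ * C₂)) * (K * r) by
    rw [hsplit]
    calc _ ≤ _ := add_le_add hdiag hoff
      _ = _ := by simp only [K]; ring
  by_cases hqcase : R ^ (1 / 2 : ℝ) ≤ q
  · -- large denominator
    have hrow : ∀ l' ∈ B.erase l, I l' ≤ C₁ * (M / Real.log z) * R ^ (1 / 16 : ℝ) *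
        ((Int.gcd ((l : ℤ) - l') q : ℝ) / q + 1 / R ^ 2) := by
      intro l' hl'
      refine H₁ s z N R M D _ q a _ β _ _ hS hq haq hR hDM hN1 hN2 hD0
        (hdist l' (Finset.mem_of_mem_erase hl')) (hM l') (by positivity) (Or.inl ?_)
      rw [div_mul_cancel₀ _ (by positivity)]
    have hgcd : ∑ l' ∈ B.erase l, ((Int.gcd ((l : ℤ) - l') q : ℝ) / q) ≤
        (2 * C₃ * C₄) * (D / Real.log z) * R ^ (-(3 / 16) : ℝ) := by
      have h1 : ∑ l' ∈ B.erase l, ((Int.gcd ((l : ℤ) - l') q : ℝ) / q) ≤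
          ∑ g ∈ q.divisors, ∑ l' ∈ B.filter (fun l' : ℕ => (g : ℤ) ∣ (l' : ℤ) - l), ((g : ℝ) / q) := by
        have h2 : ∑ l' ∈ B.erase l, ((Int.gcd ((l : ℤ) - l') q : ℝ) / q) ≤
            ∑ l' ∈ B, ((Int.gcd ((l : ℤ) - l') q : ℝ) / q) :=
          Finset.sum_le_sum_of_subset_of_nonneg (Finset.erase_subset _ _) fun _ _ _ => by positivity
        refine h2.trans ?_
        simp only [Finset.sum_filter]
        rw [Finset.sum_comm]
        refine Finset.sum_le_sum fun l' _ => ?_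
        set g := Int.gcd ((l : ℤ) - l') q
        have hgq : g ∈ q.divisors := by
          rw [Nat.mem_divisors]
          exact ⟨Int.natCast_dvd_natCast.1 (Int.gcd_dvd_right ((l : ℤ) - l') q), hq.ne'⟩
        have hgl : (g : ℤ) ∣ l' - l := by
          rw [← neg_sub, dvd_neg]; exact Int.gcd_dvd_left _ _
        refine le_trans ?_ (Finset.single_le_sum (f := fun g : ℕ =>
          if (g : ℤ) ∣ (l' : ℤ) - l then (g : ℝ) / q else 0) (fun g _ => ?_) hgq)
        · simp only [if_pos hgl]; exact le_refl _
        · split_ifs <;> positivity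
      have h3 : ∀ g ∈ q.divisors, ∑ l' ∈ B.filter (fun l' : ℕ => (g : ℤ) ∣ (l' : ℤ) - l), ((g : ℝ) / q) ≤
          C₃ * C₄ * R ^ (1 / 16 : ℝ) * (D / Real.log z) / q := by
        intro g hg
        have hgq := Nat.dvd_of_mem_divisors hg
        have hg0 : 0 < g := Nat.pos_of_dvd_of_pos hgq hq
        have hg0' : (0 : ℝ) < g := by exact_mod_cast hg0
        have hgR : (g : ℝ) ≤ R := le_trans (by exact_mod_cast Nat.le_of_dvd hq hgq) hqR
        have hzg : z ^ (1 / 2 : ℝ) ≤ D / g := by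
          rw [le_div_iff₀ hg0']
          have e1 : z ^ (1 / 2 : ℝ) * (2 * g) ≤ z := by
            have e2 : 2 * (g : ℝ) ≤ z ^ (1 / 2 : ℝ) := by
              have e3 : (g : ℝ) ≤ z ^ (1 / 4 : ℝ) := (hgR.trans hRz).trans
                (Real.rpow_le_rpow_of_exponent_le hz1.le (by norm_num))
              have e4 : (2 : ℝ) ≤ z ^ (1 / 4 : ℝ) := by
                calc (2 : ℝ) = (2 ^ 4 : ℝ) ^ (1 / 4 : ℝ) := by
                      rw [← Real.rpow_natCast, ← Real.rpow_mul (by norm_num)]; norm_num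
                  _ ≤ _ := Real.rpow_le_rpow (by norm_num)
                    (le_trans (by norm_num) hS.le_z) (by norm_num)
              calc 2 * (g : ℝ) ≤ z ^ (1 / 4 : ℝ) * z ^ (1 / 4 : ℝ) := by gcongr
                _ = _ := by rw [← Real.rpow_add hz0]; norm_num
            calc z ^ (1 / 2 : ℝ) * (2 * g) ≤ z ^ (1 / 2 : ℝ) * z ^ (1 / 2 : ℝ) := by gcongr
              _ = z := hzh
          linarith
        have hcard := H₃ z D g l u' v' hS.le_z hg0 hD hzg
        rw [← Finset.filter_filter] at hcard
        have htot : (g : ℝ) / g.totient ≤ C₄ * R ^ (1 / 16 : ℝ) :=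
          (H₄ g hg0.ne').trans (by gcongr)
        rw [Finset.sum_const, nsmul_eq_mul]
        calc _ ≤ C₃ * (C₄ * R ^ (1 / 16 : ℝ)) * (D / g / Real.log z) * ((g : ℝ) / q) := by
              gcongr
              exact hcard.trans (by gcongr)
          _ = _ := by field_simp
      have h4 : (q.divisors.card : ℝ) ≤ 2 * √q := card_divisors_le_two_mul_sqrt q
      have h5 : √q / q ≤ R ^ (-(1 / 4) : ℝ) := by
        have e1 : R ^ (1 / 4 : ℝ) ≤ √q := by
          calc R ^ (1 / 4 : ℝ) = √(R ^ (1 / 2 : ℝ)) := by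
                rw [Real.sqrt_eq_rpow, ← Real.rpow_mul hR0.le]; norm_num
            _ ≤ √q := Real.sqrt_le_sqrt hqcase
        rw [Real.sqrt_div_self, Real.rpow_neg hR0.le]
        exact inv_anti₀ (by positivity) e1
      calc _ ≤ _ := h1
        _ ≤ ∑ g ∈ q.divisors, C₃ * C₄ * R ^ (1 / 16 : ℝ) * (D / Real.log z) / q :=
          Finset.sum_le_sum h3
        _ ≤ 2 * √q * (C₃ * C₄ * R ^ (1 / 16 : ℝ) * (D / Real.log z) / q) := by
          rw [Finset.sum_const, nsmul_eq_mul]; gcongr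
        _ = 2 * C₃ * C₄ * (D / Real.log z) * (R ^ (1 / 16 : ℝ) * (√q / q)) := by ring
        _ ≤ 2 * C₃ * C₄ * (D / Real.log z) * (R ^ (1 / 16 : ℝ) * R ^ (-(1 / 4) : ℝ)) := by gcongr
        _ = _ := by rw [← Real.rpow_add hR0]; norm_num
    have hsum2 : ∑ l' ∈ B.erase l, (1 / R ^ 2) ≤ C₂ * (D / Real.log z) * (1 / R ^ 2) := by
      rw [Finset.sum_const, nsmul_eq_mul]
      gcongr
      exact le_trans (by exact_mod_cast Finset.card_erase_le) hB
    have hr3 : R ^ (1 / 16 : ℝ) * R ^ (-(3 / 16) : ℝ) = r := by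
      rw [← Real.rpow_add hR0]; norm_num [r]
    calc _ ≤ ∑ l' ∈ B.erase l, C₁ * (M / Real.log z) * R ^ (1 / 16 : ℝ) *
          ((Int.gcd ((l : ℤ) - l') q : ℝ) / q + 1 / R ^ 2) := Finset.sum_le_sum hrow
      _ ≤ C₁ * (M / Real.log z) * R ^ (1 / 16 : ℝ) * ((2 * C₃ * C₄) * (D / Real.log z) *
          R ^ (-(3 / 16) : ℝ) + C₂ * (D / Real.log z) * (1 / R ^ 2)) := by
        rw [← Finset.mul_sum, Finset.sum_add_distrib]
        gcongr
      _ = C₁ * (2 * C₃ * C₄) * (K * (R ^ (1 / 16 : ℝ) * R ^ (-(3 / 16) : ℝ))) +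
          C₁ * C₂ * (K * (R ^ (1 / 16 : ℝ) * (1 / R ^ 2))) := by simp only [K]; ring
      _ ≤ C₁ * (2 * C₃ * C₄) * (K * r) + C₁ * C₂ * (K * r) := by rw [hr3]; gcongr
      _ ≤ _ := by
        have : 0 ≤ (C₂ * (3 * C₂) + 5 * C₁ * C₂) * (K * r) := by positivity
        linarith
  · -- large archimedean part
    push Not at hqcase
    set κ := R ^ (-(1 / 4) : ℝ)
    have hκ0 : 0 < κ := by positivity
    have hκr : κ ≤ r := Real.rpow_le_rpow_of_exponent_le hR1 (by norm_num)
    have hβ : R ^ (1 / 2 : ℝ) ≤ N * |β| := by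
      have h1 : R ^ (1 / 2 : ℝ) * R ^ (1 / 2 : ℝ) = R := by
        rw [← Real.rpow_add hR0]; norm_num
      have h0 : 1 ≤ R ^ (1 / 2 : ℝ) := Real.one_le_rpow hR1 (by norm_num)
      have h2 : R ^ (1 / 2 : ℝ) ≤ max 1 (N * |β|) := by
        by_contra! hc
        have : q * max 1 (N * |β|) < R ^ (1 / 2 : ℝ) * R ^ (1 / 2 : ℝ) :=
          mul_lt_mul hqcase hc.le (by positivity) (by positivity)
        rw [h1, ← hR] at this
        exact lt_irrefl _ this
      rcases le_max_iff.1 h2 with h3 | h3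
      · have h4 : R ≤ 1 := by nlinarith
        have h5 : R = 1 := le_antisymm h4 hR1
        rw [h5, Real.one_rpow] at hqcase
        linarith
      · exact h3
    have hκD : z ^ (1 / 2 : ℝ) ≤ κ * D := by
      have h1 : z ^ (-(1 / 64) : ℝ) ≤ κ := by
        rw [show (-(1 / 64) : ℝ) = 1 / 16 * -(1 / 4) by norm_num, Real.rpow_mul hz0.le]
        exact Real.rpow_le_rpow_of_nonpos hR0 hRz (by norm_num)
      have h2 : 2 * z ^ (1 / 2 : ℝ) ≤ z ^ (-(1 / 64) : ℝ) * z := by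
        have e1 : (2 : ℝ) ≤ z ^ (31 / 64 : ℝ) := by
          calc (2 : ℝ) ≤ (2 ^ 32 : ℝ) ^ (31 / 64 : ℝ) := by
                rw [← Real.rpow_natCast, ← Real.rpow_mul (by norm_num)]
                calc (2 : ℝ) = 2 ^ (1 : ℝ) := by norm_num
                  _ ≤ _ := Real.rpow_le_rpow_of_exponent_le (by norm_num) (by norm_num)
            _ ≤ _ := Real.rpow_le_rpow (by norm_num) hS.le_z (by norm_num)
        calc 2 * z ^ (1 / 2 : ℝ) ≤ z ^ (31 / 64 : ℝ) * z ^ (1 / 2 : ℝ) := by gcongr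
          _ = z ^ (-(1 / 64) : ℝ) * z ^ (1 : ℝ) := by
            rw [← Real.rpow_add hz0, ← Real.rpow_add hz0]; norm_num
          _ = _ := by rw [Real.rpow_one]
      have h3 : z ^ (-(1 / 64) : ℝ) * z ≤ κ * (2 * D) := by gcongr
      linarith
    set k := ⌊κ * D⌋₊
    have hk : (k : ℝ) ≤ κ * D := Nat.floor_le (by positivity)
    have hnear : ((B.filter fun l' : ℕ => |(((l : ℤ) - l' : ℤ) : ℝ)| ≤ κ * D).card : ℝ) ≤
        C₂ * (3 * (κ * D) / Real.log z) := by
      refine le_trans ?_ (H₂ z (3 * (κ * D)) (l - 1 - k) (l + k) hS.le_z ?_ (by linarith))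
      · have : B.filter (fun l' : ℕ => |(((l : ℤ) - l' : ℤ) : ℝ)| ≤ κ * D) ⊆
            (Finset.Ioc (l - 1 - k) (l + k)).filter (IsRough z) := by
          intro l' hl'
          simp only [B, Finset.mem_filter, Finset.mem_Ioc] at hl' ⊢
          refine ⟨?_, hl'.1.2⟩
          have h1 : ((l : ℤ) - l').natAbs ≤ k := by
            refine Nat.le_floor ?_
            rw [Nat.cast_natAbs, Int.cast_abs]; exact hl'.2
          have h2 := hl'.1.1.1
          have h3 := hl'.1.2.pos (by linarith [hS.le_z])
          omega
        exact_mod_cast Finset.card_le_card this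
      · have : l + k ≤ (l - 1 - k) + (2 * k + 1) := by omega
        have h1 : ((l + k : ℕ) : ℝ) ≤ ((l - 1 - k : ℕ) : ℝ) + (2 * k + 1) := by exact_mod_cast this
        linarith
    have hfar : ∀ l' ∈ B.erase l, ¬ |(((l : ℤ) - l' : ℤ) : ℝ)| ≤ κ * D →
        I l' ≤ C₁ * (M / Real.log z) * R ^ (1 / 16 : ℝ) * (4 * κ + 1 / R ^ 2) := by
      intro l' hl' hd
      push Not at hd
      refine H₁ s z N R M D _ q a _ β _ _ hS hq haq hR hDM hN1 hN2 hD0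
        (hdist l' (Finset.mem_of_mem_erase hl')) (hM l') (by positivity) (Or.inr ?_)
      rw [abs_mul]
      have h1 : κ * κ * R ^ (1 / 2 : ℝ) = 1 := by
        rw [← Real.rpow_add hR0, ← Real.rpow_add hR0]; norm_num
      calc (1 : ℝ) = κ * κ * R ^ (1 / 2 : ℝ) := h1.symm
        _ ≤ κ * κ * (N * |β|) := by gcongr
        _ ≤ κ * κ * (4 * (M * D) * |β|) := by gcongr
        _ = 4 * κ * (M * (κ * D * |β|)) := by ring
        _ ≤ _ := by gcongr
    have hR4 : R ^ (1 / 16 : ℝ) * κ ≤ r := by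
      rw [← Real.rpow_add hR0]
      exact Real.rpow_le_rpow_of_exponent_le hR1 (by norm_num)
    have hfar' : ∀ l' ∈ B.erase l, ¬ |(((l : ℤ) - l' : ℤ) : ℝ)| ≤ κ * D →
        I l' ≤ 5 * C₁ * (M / Real.log z) * r := by
      intro l' hl' hd
      refine (hfar l' hl' hd).trans ?_
      calc C₁ * (M / Real.log z) * R ^ (1 / 16 : ℝ) * (4 * κ + 1 / R ^ 2)
          = C₁ * (M / Real.log z) *
              (4 * (R ^ (1 / 16 : ℝ) * κ) + R ^ (1 / 16 : ℝ) * (1 / R ^ 2)) := by ring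
        _ ≤ C₁ * (M / Real.log z) * (4 * r + r) := by gcongr
        _ = _ := by ring
    rw [← Finset.sum_filter_add_sum_filter_not (B.erase l)
      fun l' : ℕ => |(((l : ℤ) - l' : ℤ) : ℝ)| ≤ κ * D]
    have hs1 : ∑ l' ∈ (B.erase l).filter (fun l' : ℕ => |(((l : ℤ) - l' : ℤ) : ℝ)| ≤ κ * D), I l' ≤
        C₂ * (3 * C₂) * (K * r) := by
      calc _ ≤ ∑ l' ∈ (B.erase l).filter (fun l' : ℕ => |(((l : ℤ) - l' : ℤ) : ℝ)| ≤ κ * D), C₂ * (M / Real.log z) :=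
            Finset.sum_le_sum fun l' _ => hI l'
        _ ≤ C₂ * (3 * (κ * D) / Real.log z) * (C₂ * (M / Real.log z)) := by
          rw [Finset.sum_const, nsmul_eq_mul]
          gcongr
          refine le_trans ?_ hnear
          gcongr
          exact Finset.erase_subset _ _
        _ = C₂ * (3 * C₂) * (K * κ) := by simp only [K]; ring
        _ ≤ _ := by gcongr
    have hs2 : ∑ l' ∈ (B.erase l).filter (fun l' : ℕ => ¬ |(((l : ℤ) - l' : ℤ) : ℝ)| ≤ κ * D), I l' ≤
        5 * C₁ * C₂ * (K * r) := by
      calc _ ≤ ∑ l' ∈ (B.erase l).filter (fun l' : ℕ => ¬ |(((l : ℤ) - l' : ℤ) : ℝ)| ≤ κ * D),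
            5 * C₁ * (M / Real.log z) * r := Finset.sum_le_sum fun l' hl' =>
              hfar' l' (Finset.mem_filter.1 hl').1 (Finset.mem_filter.1 hl').2
        _ ≤ C₂ * (D / Real.log z) * (5 * C₁ * (M / Real.log z) * r) := by
          rw [Finset.sum_const, nsmul_eq_mul]
          gcongr
          refine le_trans ?_ hB
          gcongr
          exact (Finset.filter_subset _ _).trans (Finset.erase_subset _ _)
        _ = _ := by simp only [K]; ring
    have : 0 ≤ (C₁ * C₂ + C₁ * (2 * C₃ * C₄)) * (K * r) := by positivity
    linarith

end Cell

section CellSum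
open Real

/-- The `z`-rough numbers in `[2 ^ i, 2 ^ (i + 1))`. -/
noncomputable def dyadicRough (z : ℝ) (i : ℕ) : Finset ℕ :=
  (Finset.Ioc (2 ^ i - 1) (2 ^ (i + 1) - 1)).filter (IsRough z)

theorem mem_dyadicRough {z : ℝ} {i m : ℕ} :
    m ∈ dyadicRough z i ↔ (2 ^ i ≤ m ∧ m < 2 ^ (i + 1)) ∧ IsRough z m := by
  have h1 : 0 < 2 ^ i := by positivity
  have h2 : 0 < 2 ^ (i + 1) := by positivity
  simp only [dyadicRough, Finset.mem_filter, Finset.mem_Ioc]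
  refine and_congr_left fun _ => ?_
  omega

/-- The part of a bilinear sum over the dyadic cell `(j, i)`. -/
noncomputable def cellSum (z : ℝ) (N : ℕ) (α : ℝ) (j i : ℕ) (f g : ℕ → ℂ) : ℂ :=
  ∑ m ∈ dyadicRough z j, ∑ l ∈ dyadicRough z i with N < m * l ∧ m * l ≤ 4 * N,
    f m * g l * eC (m * (l * α))

theorem cellSum_comm (z : ℝ) (N : ℕ) (α : ℝ) (j i : ℕ) (f g : ℕ → ℂ) :
    cellSum z N α j i f g = cellSum z N α i j g f := by
  simp only [cellSum, Finset.sum_filter]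
  rw [Finset.sum_comm]
  refine Finset.sum_congr rfl fun l _ => Finset.sum_congr rfl fun m _ => ?_
  rw [mul_comm m l, mul_comm (f m), mul_left_comm (m : ℝ)]

theorem cast_dyadic_sub (i : ℕ) : ((2 ^ (i + 1) - 1 : ℕ) : ℝ) - ((2 ^ i - 1 : ℕ) : ℝ) = 2 ^ i := by
  rw [Nat.cast_sub Nat.one_le_two_pow, Nat.cast_sub Nat.one_le_two_pow]
  push_cast; ring

theorem norm_cellSum_le : ∃ C : ℝ, 0 < C ∧ ∀ (s : ℕ) (z R : ℝ) (N i j q : ℕ) (a : ℤ) (β : ℝ)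
    (f g : ℕ → ℂ), SieveRange s z N R → 0 < q → IsCoprime a q → R = q * max 1 (N * |β|) → i ≤ j →
    N ≤ 4 * 2 ^ (i + j) → 2 ^ (i + j) ≤ 4 * N → z ≤ 2 * 2 ^ i →
    (∀ m, ‖f m‖ ≤ 1) → (∀ l, ‖g l‖ ≤ 1) →
    ‖cellSum z N (a / q + β) j i f g‖ ≤ C * (N / Real.log z ^ 2) * R ^ (-(1 / 16) : ℝ) := by
  obtain ⟨C₁, hC₁, H₁⟩ := sum_norm_sum_rough_difference_le
  obtain ⟨C₂, hC₂, H₂⟩ := card_rough_le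
  refine ⟨4 * √(C₂ ^ 2 * C₁), by positivity, fun s z R N i j q a β f g hS hq haq hR hij hN1 hN2 hzD hf hg => ?_⟩
  have hz0 := hS.z_pos
  have hR0 : 0 < R := one_pos.trans_le hS.one_le_R
  have hlog := hS.log_pos
  have hDM : (2 : ℝ) ^ i ≤ 2 ^ j := pow_le_pow_right₀ (by norm_num) hij
  have hN1' : (N : ℝ) ≤ 4 * (2 ^ j * 2 ^ i) := by
    rw [← pow_add, add_comm j]; exact_mod_cast hN1
  have hN2' : (2 : ℝ) ^ j * 2 ^ i ≤ 4 * N := by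
    rw [← pow_add, add_comm j]; exact_mod_cast hN2
  have hz2 := hS.le_z
  have hzh : z ^ (1 / 2 : ℝ) ≤ 2 ^ i := by
    have h1 : z ^ (1 / 2 : ℝ) * z ^ (1 / 2 : ℝ) = z := by
      rw [← Real.rpow_add hz0]; norm_num
    have h0 : 0 ≤ z ^ (1 / 2 : ℝ) := by positivity
    have h2 : 2 ≤ z ^ (1 / 2 : ℝ) := by
      by_contra! hc; nlinarith
    nlinarith
  have hA : ((dyadicRough z j).card : ℝ) ≤ C₂ * (2 ^ j / Real.log z) :=
    H₂ z _ _ _ hS.le_z (cast_dyadic_sub j).le (hzh.trans hDM)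
  have hB : ((dyadicRough z i).card : ℝ) ≤ C₂ * (2 ^ i / Real.log z) :=
    H₂ z _ _ _ hS.le_z (cast_dyadic_sub i).le hzh
  set K : ℝ := C₁ * (2 ^ j / Real.log z) * (2 ^ i / Real.log z) * R ^ (-(1 / 8) : ℝ)
  have hrow : ∀ l ∈ dyadicRough z i, ∑ l' ∈ dyadicRough z i,
      ‖∑ m ∈ dyadicRough z j with (N < m * l ∧ m * l ≤ 4 * N) ∧ (N < m * l' ∧ m * l' ≤ 4 * N),
        eC (m * (((l : ℤ) - l' : ℤ) * (a / q + β)))‖ ≤ K := by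
    intro l hl
    refine le_trans (le_of_eq (Finset.sum_congr rfl fun l' hl' => ?_))
      (H₁ s z N R (2 ^ j) (2 ^ i) q a β (2 ^ i - 1) (2 ^ (i + 1) - 1) l
        (fun l' => max (2 ^ j - 1) (max (N / l) (N / l')))
        (fun l' => min (2 ^ (j + 1) - 1) (min (4 * N / l) (4 * N / l'))) hS hq haq hR hDM hN1' hN2'
        hzD (cast_dyadic_sub i).le (fun l' => ?_) hl)
    · rw [dyadicRough, filter_mul_mem_Ioc]
      · exact (mem_dyadicRough.1 hl).2.pos (by linarith)
      · exact (mem_dyadicRough.1 hl').2.pos (by linarith)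
    · rw [← cast_dyadic_sub j]
      gcongr
      · exact min_le_left _ _
      · exact le_max_left _ _
  have hsq := norm_bilinear_sq_le (dyadicRough z j) (dyadicRough z i)
    (fun m l => N < m * l ∧ m * l ≤ 4 * N) f g hf hg (a / q + β) _ subset_rfl
  have hR8 : R ^ (-(1 / 8) : ℝ) = (R ^ (-(1 / 16) : ℝ)) ^ 2 := by
    rw [sq, ← Real.rpow_add hR0]; norm_num
  refine abs_le_of_sq_le_sq' ?_ (by positivity) |>.2
  calc _ ≤ _ := hsq
    _ ≤ (dyadicRough z j).card * ((dyadicRough z i).card * K) := by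
      gcongr
      refine (Finset.sum_le_sum hrow).trans ?_
      rw [Finset.sum_const, nsmul_eq_mul]
    _ ≤ C₂ * (2 ^ j / Real.log z) * (C₂ * (2 ^ i / Real.log z) * K) := by gcongr
    _ = C₂ ^ 2 * C₁ * ((2 ^ j * 2 ^ i) / Real.log z ^ 2 * R ^ (-(1 / 16) : ℝ)) ^ 2 := by
      simp only [K, hR8]; ring
    _ ≤ C₂ ^ 2 * C₁ * ((4 * N) / Real.log z ^ 2 * R ^ (-(1 / 16) : ℝ)) ^ 2 := by gcongr
    _ = (4 * √(C₂ ^ 2 * C₁) * (N / Real.log z ^ 2) * R ^ (-(1 / 16) : ℝ)) ^ 2 := by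
      rw [mul_pow, mul_pow, mul_pow, mul_pow, Real.sq_sqrt (by positivity)]; ring

end CellSum

section Identity
open Real ArithmeticFunction

/-- The exponential sum over the primes in `(N, 4 * N]` with logarithmic weights. -/
noncomputable def primeExpSum (N : ℕ) (α : ℝ) : ℂ :=
  ∑ p ∈ (Finset.Ioc N (4 * N)).filter Nat.Prime, (Real.log p : ℂ) * eC (p * α)

/-- The exponential sum over the `z`-rough numbers in `(N, 4 * N]` with logarithmic weights. -/
noncomputable def roughExpSum (z : ℝ) (N : ℕ) (α : ℝ) : ℂ :=
  ∑ n ∈ (Finset.Ioc N (4 * N)).filter (IsRough z), (Real.log n : ℂ) * eC (n * α)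

/-- Pairs of `z`-rough numbers whose product lies in `(N, 4 * N]`. -/
noncomputable def roughPairs (z : ℝ) (N : ℕ) : Finset (ℕ × ℕ) :=
  ((Finset.Ioc 0 (4 * N)).filter (IsRough z) ×ˢ (Finset.Ioc 0 (4 * N)).filter (IsRough z)).filter
    fun x => N < x.1 * x.2 ∧ x.1 * x.2 ≤ 4 * N

theorem IsRough.mul {z : ℝ} {m n : ℕ} (hm : IsRough z m) (hn : IsRough z n) : IsRough z (m * n) :=
  fun p hp hpz h => (hp.dvd_mul.1 h).elim (hm p hp hpz) (hn p hp hpz)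

theorem IsRough.of_dvd {z : ℝ} {m n : ℕ} (hn : IsRough z n) (h : m ∣ n) : IsRough z m :=
  fun p hp hpz hpm => hn p hp hpz (hpm.trans h)

theorem IsRough.lt {z : ℝ} {n : ℕ} (hn : IsRough z n) (h : n ≠ 1) (h0 : 0 < n) : z < n := by
  by_contra! hc
  exact hn _ (Nat.minFac_prime h) (le_trans (by exact_mod_cast Nat.minFac_le h0) hc) n.minFac_dvd

theorem isRough_one {z : ℝ} : IsRough z 1 := fun _ hp _ h => hp.one_lt.ne' (Nat.dvd_one.1 h)

theorem Nat.Prime.isRough {z : ℝ} {p : ℕ} (hp : p.Prime) (h : z < p) : IsRough z p := by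
  intro q hq hqz hqp
  rw [(Nat.prime_dvd_prime_iff_eq hq hp).1 hqp] at hqz
  linarith

theorem mem_roughPairs {z : ℝ} {N : ℕ} {x : ℕ × ℕ} : x ∈ roughPairs z N ↔
    ((x.1 ∈ Finset.Ioc 0 (4 * N) ∧ IsRough z x.1) ∧ x.2 ∈ Finset.Ioc 0 (4 * N) ∧ IsRough z x.2) ∧
      N < x.1 * x.2 ∧ x.1 * x.2 ≤ 4 * N := by
  simp [roughPairs]

theorem roughExpSum_eq (z : ℝ) (N : ℕ) (α : ℝ) :
    roughExpSum z N α = ∑ x ∈ roughPairs z N, (Λ x.2 : ℂ) * eC (x.1 * (x.2 * α)) := by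
  rw [roughExpSum, ← Finset.sum_fiberwise_of_maps_to (s := roughPairs z N)
    (t := (Finset.Ioc N (4 * N)).filter (IsRough z)) (g := fun x => x.1 * x.2)]
  · refine Finset.sum_congr rfl fun n hn => ?_
    rw [Finset.mem_filter, Finset.mem_Ioc] at hn
    have hn0 : n ≠ 0 := by omega
    have h1 : (roughPairs z N).filter (fun x => x.1 * x.2 = n) = n.divisorsAntidiagonal := by
      ext x
      rw [Finset.mem_filter, mem_roughPairs, Nat.mem_divisorsAntidiagonal]
      refine ⟨fun h => ⟨h.2, hn0⟩, fun h => ⟨?_, h.1⟩⟩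
      have hx := h.1
      have d1 : x.1 ∣ n := ⟨_, hx.symm⟩
      have d2 : x.2 ∣ n := ⟨x.1, by rw [← hx, mul_comm]⟩
      simp only [Finset.mem_Ioc, hx]
      have e1 := Nat.le_of_dvd (Nat.pos_of_ne_zero hn0) d1
      have e2 := Nat.le_of_dvd (Nat.pos_of_ne_zero hn0) d2
      have e3 := Nat.pos_of_dvd_of_pos d1 (Nat.pos_of_ne_zero hn0)
      have e4 := Nat.pos_of_dvd_of_pos d2 (Nat.pos_of_ne_zero hn0)
      exact ⟨⟨⟨⟨e3, by omega⟩, hn.2.of_dvd d1⟩, ⟨e4, by omega⟩, hn.2.of_dvd d2⟩, by omega⟩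
    rw [h1, ← vonMangoldt_sum, Complex.ofReal_sum, Finset.sum_mul]
    have h2 := Nat.sum_divisorsAntidiagonal' (n := n) (fun m l => (Λ l : ℂ) * eC ((m : ℝ) * (l * α)))
    rw [h2]
    refine Finset.sum_congr rfl fun l hl => ?_
    congr 2
    rw [← mul_assoc, ← Nat.cast_mul, Nat.div_mul_cancel (Nat.dvd_of_mem_divisors hl)]
  · intro x hx
    rw [mem_roughPairs] at hx
    rw [Finset.mem_filter, Finset.mem_Ioc]
    exact ⟨hx.2, hx.1.1.2.mul hx.1.2.2⟩

theorem norm_primeExpSum_sub_sum_le {z : ℝ} {N : ℕ} (hz : z ≤ N) (hN : 1 ≤ N) (α : ℝ) :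
    ‖primeExpSum N α - ∑ n ∈ (Finset.Ioc N (4 * N)).filter (IsRough z), (Λ n : ℂ) * eC (n * α)‖ ≤
      2 * √(4 * N) * Real.log (4 * N) := by
  have h1 : primeExpSum N α = ∑ n ∈ ((Finset.Ioc N (4 * N)).filter (IsRough z)).filter Nat.Prime,
      (Λ n : ℂ) * eC (n * α) := by
    rw [primeExpSum]
    refine Finset.sum_congr ?_ fun p hp => ?_
    · ext p
      simp only [Finset.mem_filter, Finset.mem_Ioc]
      refine ⟨fun h => ⟨⟨h.1, h.2.isRough (hz.trans_lt (by exact_mod_cast h.1.1))⟩, h.2⟩,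
        fun h => ⟨h.1.1, h.2⟩⟩
    · rw [vonMangoldt_apply_prime (Finset.mem_filter.1 hp).2]
  rw [h1, norm_sub_rev, ← Finset.sum_filter_add_sum_filter_not _ Nat.Prime, add_sub_cancel_left]
  have h2 := Chebyshev.psi_sub_theta_le (x := 4 * N) (by
    have : (1 : ℝ) ≤ N := by exact_mod_cast hN
    linarith)
  refine le_trans ?_ h2
  rw [Chebyshev.psi_sub_theta_eq_sum_not_prime]
  refine (norm_sum_le _ _).trans ?_
  have h3 : ⌊(4 * N : ℝ)⌋₊ = 4 * N := by exact_mod_cast Nat.floor_natCast (R := ℝ) (4 * N)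
  rw [h3]
  simp only [norm_mul, norm_eC, mul_one, Complex.norm_real, Real.norm_eq_abs,
    abs_of_nonneg vonMangoldt_nonneg]
  refine Finset.sum_le_sum_of_subset_of_nonneg (fun n hn => ?_) fun _ _ _ => vonMangoldt_nonneg
  simp only [Finset.mem_filter, Finset.mem_Ioc] at hn ⊢
  exact ⟨⟨by omega, hn.1.1.2⟩, hn.2⟩

/-- The dyadic cells `(j, i)` that meet the pairs with product in `(N, 4 * N]`. -/
def dyadicCells (N : ℕ) : Finset (ℕ × ℕ) :=
  (Finset.range (Nat.log 2 (4 * N) + 1) ×ˢ Finset.range (Nat.log 2 (4 * N) + 1)).filter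
    fun c => 1 ≤ c.1 ∧ 1 ≤ c.2 ∧ N ≤ 4 * 2 ^ (c.1 + c.2) ∧ 2 ^ (c.1 + c.2) ≤ 4 * N

theorem card_dyadicCells_le {N : ℕ} (hN : 1 ≤ N) :
    (dyadicCells N).card ≤ 5 * (Nat.log 2 (4 * N) + 1) := by
  set t := Nat.log 2 N
  have h1 : 2 ^ t ≤ N := Nat.pow_log_le_self 2 (by omega)
  have h2 : N < 2 ^ (t + 1) := Nat.lt_pow_succ_log_self (by norm_num) N
  have h3 : (dyadicCells N).card ≤
      (Finset.range (Nat.log 2 (4 * N) + 1) ×ˢ Finset.Icc (t - 2) (t + 2)).card := by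
    refine Finset.card_le_card_of_injOn (fun c => (c.1, c.1 + c.2)) (fun c hc => ?_) ?_
    · simp only [dyadicCells, Finset.coe_filter, Finset.mem_product, Finset.mem_range] at hc
      obtain ⟨⟨hc1, -⟩, -, -, hc2, hc3⟩ := hc
      simp only [Finset.coe_product, Set.mem_prod, Finset.mem_coe, Finset.mem_range,
        Finset.mem_Icc]
      refine ⟨hc1, ?_, ?_⟩
      · have : 2 ^ t ≤ 2 ^ (c.1 + c.2 + 2) := by rw [pow_add]; omega
        have := (Nat.pow_le_pow_iff_right (by norm_num : 1 < 2)).1 this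
        omega
      · have : 2 ^ (c.1 + c.2) < 2 ^ (t + 3) := by
          have e : 2 ^ (t + 3) = 4 * 2 ^ (t + 1) := by ring
          omega
        have := (Nat.pow_lt_pow_iff_right (by norm_num : 1 < 2)).1 this
        omega
    · rintro ⟨a, b⟩ _ ⟨c, d⟩ _ h
      simp only [Prod.mk.injEq] at h ⊢
      omega
  refine h3.trans ?_
  rw [Finset.card_product, Finset.card_range, Nat.card_Icc, mul_comm]
  gcongr
  omega

theorem norm_primeExpSum_sub_roughExpSum_le {z E : ℝ} {N : ℕ} (hz2 : 2 ≤ z) (hz : z ≤ N) (hE : 0 ≤ E) (α : ℝ)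
    (hcell : ∀ i j (f g : ℕ → ℂ), i ≤ j → N ≤ 4 * 2 ^ (i + j) → 2 ^ (i + j) ≤ 4 * N →
      z ≤ 2 * 2 ^ i → (∀ m, ‖f m‖ ≤ 1) → (∀ l, ‖g l‖ ≤ 1) → ‖cellSum z N α j i f g‖ ≤ E) :
    ‖primeExpSum N α - roughExpSum z N α‖ ≤ 2 * √(4 * N) * Real.log (4 * N) +
      5 * (Nat.log 2 (4 * N) + 1) * (Real.log (4 * N) * E) := by
  have hN : 1 ≤ N := by
    have : (2 : ℝ) ≤ N := hz2.trans hz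
    have : 2 ≤ N := by exact_mod_cast this
    omega
  have hL : 0 < Real.log (4 * N) := Real.log_pos (by
    have : (1 : ℝ) ≤ N := by exact_mod_cast hN
    linarith)
  set F : ℕ × ℕ → ℂ := fun x => (Λ x.2 : ℂ) * eC (x.1 * (x.2 * α))
  have hone : ∑ x ∈ (roughPairs z N).filter (fun x => x.1 = 1), F x =
      ∑ n ∈ (Finset.Ioc N (4 * N)).filter (IsRough z), (Λ n : ℂ) * eC (n * α) := by
    refine (Finset.sum_nbij' (fun n => (1, n)) (fun x => x.2) ?_ ?_ ?_ ?_ ?_).symm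
    · intro n hn
      rw [Finset.mem_filter, Finset.mem_Ioc] at hn
      simp only [Finset.mem_filter, mem_roughPairs, Finset.mem_Ioc, one_mul, and_true]
      exact ⟨⟨⟨by omega, isRough_one⟩, by omega, hn.2⟩, hn.1⟩
    · rintro ⟨m, n⟩ hn
      simp only [Finset.mem_filter, mem_roughPairs, Finset.mem_Ioc] at hn ⊢
      obtain ⟨hn, rfl⟩ := hn
      exact ⟨by simpa using hn.2, hn.1.2.2⟩
    · intro n _; rfl
    · rintro ⟨m, n⟩ hn
      exact Prod.ext (Finset.mem_filter.1 hn).2.symm rfl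
    · intro n _; simp [F]
  have htwo : ∑ x ∈ (roughPairs z N).filter (fun x => ¬ x.1 = 1), F x =
      ∑ x ∈ (roughPairs z N).filter (fun x => x.1 ≠ 1 ∧ x.2 ≠ 1), F x := by
    rw [← Finset.filter_filter, Finset.sum_filter_of_ne (p := fun x : ℕ × ℕ => x.2 ≠ 1)]
    intro x _ hx h1
    simp [F, h1] at hx
  have hdec : ∑ x ∈ (roughPairs z N).filter (fun x => x.1 ≠ 1 ∧ x.2 ≠ 1), F x =
      ∑ c ∈ dyadicCells N, cellSum z N α c.1 c.2 1
        (fun l => if l ≤ 4 * N then ((Λ l / Real.log (4 * N) : ℝ) : ℂ) else 0) * Real.log (4 * N) := by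
    rw [← Finset.sum_fiberwise_of_maps_to (t := dyadicCells N)
      (g := fun x => (Nat.log 2 x.1, Nat.log 2 x.2))]
    · refine Finset.sum_congr rfl fun c hc => ?_
      simp only [dyadicCells, Finset.mem_filter] at hc
      rw [cellSum, Finset.sum_mul]
      simp only [Finset.sum_mul, Pi.one_apply, one_mul]
      rw [← Finset.sum_finset_product']
      rotate_left
      · exact ((dyadicRough z c.1) ×ˢ (dyadicRough z c.2)).filter
          (fun x => N < x.1 * x.2 ∧ x.1 * x.2 ≤ 4 * N)
      · intro x; simp only [Finset.mem_filter, Finset.mem_product]; tauto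
      refine Finset.sum_congr ?_ fun x hx => ?_
      · ext x
        simp only [Finset.mem_filter, mem_roughPairs, Finset.mem_product, mem_dyadicRough,
          Prod.ext_iff]
        constructor
        · rintro ⟨⟨⟨⟨⟨h1, h2⟩, h3, h4⟩, h5⟩, h6, h7⟩, h8, h9⟩
          rw [Finset.mem_Ioc] at h1 h3
          refine ⟨⟨⟨?_, h2⟩, ?_, h4⟩, h5⟩
          · exact (Nat.log_eq_iff (Or.inr ⟨by norm_num, by omega⟩)).1 h8
          · exact (Nat.log_eq_iff (Or.inr ⟨by norm_num, by omega⟩)).1 h9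
        · rintro ⟨⟨⟨h1, h2⟩, h3, h4⟩, h5⟩
          have p1 : 2 ^ 1 ≤ 2 ^ c.1 := Nat.pow_le_pow_right (by norm_num) hc.2.1
          have p2 : 2 ^ 1 ≤ 2 ^ c.2 := Nat.pow_le_pow_right (by norm_num) hc.2.2.1
          refine ⟨⟨⟨⟨⟨?_, h2⟩, ?_, h4⟩, h5⟩, by omega, by omega⟩, ?_, ?_⟩
          · rw [Finset.mem_Ioc]; constructor; · omega
            nlinarith
          · rw [Finset.mem_Ioc]; constructor; · omega
            nlinarith
          · exact (Nat.log_eq_iff (Or.inr ⟨by norm_num, by omega⟩)).2 h1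
          · exact (Nat.log_eq_iff (Or.inr ⟨by norm_num, by omega⟩)).2 h3
      · have hx2 : x.2 ≤ 4 * N := by
          simp only [Finset.mem_filter, Finset.mem_product, mem_dyadicRough] at hx
          have h1 : 0 < 2 ^ c.1 := by positivity
          have h2 : 1 * x.2 ≤ x.1 * x.2 := Nat.mul_le_mul_right _ (by omega)
          omega
        simp only [F, if_pos hx2]
        push_cast
        have : (Real.log (4 * N) : ℂ) ≠ 0 := by exact_mod_cast hL.ne'
        field_simp
    · intro x hx
      simp only [Finset.mem_filter, mem_roughPairs, Finset.mem_Ioc] at hx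
      obtain ⟨⟨⟨⟨h1, -⟩, h2, -⟩, h3⟩, h4, h5⟩ := hx
      have a1 := Nat.pow_log_le_self 2 (x := x.1) (by omega)
      have a2 := Nat.lt_pow_succ_log_self (by norm_num : 1 < 2) x.1
      have b1 := Nat.pow_log_le_self 2 (x := x.2) (by omega)
      have b2 := Nat.lt_pow_succ_log_self (by norm_num : 1 < 2) x.2
      simp only [dyadicCells, Finset.mem_filter, Finset.mem_product, Finset.mem_range,
        Nat.lt_succ_iff]
      refine ⟨⟨Nat.log_mono_right h1.2, Nat.log_mono_right h2.2⟩,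
        Nat.log_pos (by norm_num) (by omega), Nat.log_pos (by norm_num) (by omega), ?_, ?_⟩
      · have : x.1 * x.2 ≤ 2 ^ (Nat.log 2 x.1 + 1) * 2 ^ (Nat.log 2 x.2 + 1) :=
          Nat.mul_le_mul a2.le b2.le
        rw [pow_succ, pow_succ] at this
        rw [pow_add]; nlinarith
      · rw [pow_add]; exact (Nat.mul_le_mul a1 b1).trans h3.2
  have hg : ∀ l, ‖(fun l => if l ≤ 4 * N then ((Λ l / Real.log (4 * N) : ℝ) : ℂ) else 0 : ℕ → ℂ) l‖ ≤ 1 := by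
    intro l
    simp only
    split_ifs with h
    · rw [Complex.norm_real, Real.norm_eq_abs, abs_of_nonneg (div_nonneg vonMangoldt_nonneg hL.le),
        div_le_one hL]
      rcases Nat.eq_zero_or_pos l with rfl | hl
      · simpa using hL.le
      · exact vonMangoldt_le_log.trans (Real.log_le_log (by exact_mod_cast hl) (by exact_mod_cast h))
    · simp
  have hcell' : ∀ c ∈ dyadicCells N, ∀ f g : ℕ → ℂ, (∀ m, ‖f m‖ ≤ 1) → (∀ l, ‖g l‖ ≤ 1) →
      c.2 ≤ c.1 → ‖cellSum z N α c.1 c.2 f g‖ ≤ E := by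
    intro c hc f g hf hg hle
    simp only [dyadicCells, Finset.mem_filter] at hc
    by_cases hzi : z ≤ 2 * 2 ^ c.2
    · exact hcell _ _ f g hle (by rw [add_comm]; exact hc.2.2.2.1) (by rw [add_comm]; exact hc.2.2.2.2) hzi hf hg
    · have : dyadicRough z c.2 = ∅ := by
        refine Finset.eq_empty_of_forall_notMem fun l hl => ?_
        rw [mem_dyadicRough] at hl
        have p2 : 2 ^ 1 ≤ 2 ^ c.2 := Nat.pow_le_pow_right (by norm_num) hc.2.2.1
        have h1 := hl.2.lt (by omega) (by omega)
        have h2 : (l : ℝ) < 2 ^ (c.2 + 1) := by exact_mod_cast hl.1.2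
        rw [pow_succ] at h2
        linarith
      simp [cellSum, this, hE]
  have hmain : ‖∑ x ∈ (roughPairs z N).filter (fun x => x.1 ≠ 1 ∧ x.2 ≠ 1), F x‖ ≤
      5 * (Nat.log 2 (4 * N) + 1) * (Real.log (4 * N) * E) := by
    rw [hdec]
    refine (norm_sum_le_of_le (dyadicCells N) (n := fun _ => Real.log (4 * N) * E) fun c hc => ?_).trans ?_
    · rw [norm_mul, Complex.norm_real, Real.norm_eq_abs, abs_of_pos hL, mul_comm]
      gcongr
      rcases le_total c.2 c.1 with h | h
      · exact hcell' c hc _ _ (by simp) hg h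
      · rw [cellSum_comm]
        refine hcell' c.swap ?_ _ _ hg (by simp) h
        simp only [dyadicCells, Finset.mem_filter, Finset.mem_product, Prod.fst_swap,
          Prod.snd_swap] at hc ⊢
        rw [add_comm c.2]
        tauto
    · rw [Finset.sum_const, nsmul_eq_mul]
      gcongr
      exact_mod_cast card_dyadicCells_le hN
  have hT : roughExpSum z N α = ∑ n ∈ (Finset.Ioc N (4 * N)).filter (IsRough z),
      (Λ n : ℂ) * eC (n * α) + ∑ x ∈ (roughPairs z N).filter (fun x => x.1 ≠ 1 ∧ x.2 ≠ 1), F x := by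
    rw [roughExpSum_eq, ← hone, ← htwo, Finset.sum_filter_add_sum_filter_not]
  rw [hT, ← sub_sub]
  exact (norm_sub_le _ _).trans (add_le_add (norm_primeExpSum_sub_sum_le hz hN α) hmain)

end Identity

section LogFree
open Real

theorem norm_roughExpSum_le (z : ℝ) {N : ℕ} (hN : 1 ≤ N) (α : ℝ) :
    ‖roughExpSum z N α‖ ≤
      Real.log N * ‖∑ n ∈ (Finset.Ioc N (4 * N)).filter (IsRough z), eC (n * α)‖ +
        2 * ((Finset.Ioc N (4 * N)).filter (IsRough z)).card := by
  have hN0 : (0 : ℝ) < N := by exact_mod_cast hN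
  have h1 : roughExpSum z N α =
      Real.log N * ∑ n ∈ (Finset.Ioc N (4 * N)).filter (IsRough z), eC (n * α) +
      ∑ n ∈ (Finset.Ioc N (4 * N)).filter (IsRough z),
        ((Real.log n - Real.log N : ℝ) : ℂ) * eC (n * α) := by
    rw [Finset.mul_sum, ← Finset.sum_add_distrib, roughExpSum]
    refine Finset.sum_congr rfl fun n _ => ?_
    push_cast; ring
  rw [h1]
  refine (norm_add_le _ _).trans (add_le_add (le_of_eq ?_) ?_)
  · rw [norm_mul, Complex.norm_real, Real.norm_of_nonneg (Real.log_natCast_nonneg N)]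
  · refine (norm_sum_le_of_le _ (n := fun _ => (2 : ℝ)) fun n hn => ?_).trans (le_of_eq ?_)
    · rw [Finset.mem_filter, Finset.mem_Ioc] at hn
      have hn1 : (N : ℝ) ≤ n := by exact_mod_cast hn.1.1.le
      have hn2 : (n : ℝ) ≤ 4 * N := by exact_mod_cast hn.1.2
      rw [norm_mul, norm_eC, mul_one, Complex.norm_real, Real.norm_of_nonneg
        (sub_nonneg.2 (Real.log_le_log hN0 hn1))]
      have h2 := Real.log_le_log (hN0.trans_le hn1) hn2
      rw [Real.log_mul (by norm_num) hN0.ne'] at h2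
      have h3 : Real.log 4 ≤ 2 := by
        rw [show (4 : ℝ) = 2 ^ 2 by norm_num, Real.log_pow]
        have := Real.log_two_lt_d9
        push_cast; linarith
      linarith
    · rw [Finset.sum_const, nsmul_eq_mul, mul_comm]

theorem natLog_two_add_one_le {N : ℕ} (hN : 4 ≤ N) : (Nat.log 2 (4 * N) + 1 : ℝ) ≤ 5 * Real.log N := by
  have hN0 : (0 : ℝ) < N := by positivity
  have h1 : ((2 ^ Nat.log 2 (4 * N) : ℕ) : ℝ) ≤ ((4 * N : ℕ) : ℝ) := by
    exact_mod_cast Nat.pow_log_le_self 2 (x := 4 * N) (by omega)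
  push_cast at h1
  have h2 := Real.log_le_log (by positivity) h1
  rw [Real.log_pow, Real.log_mul (by norm_num) hN0.ne'] at h2
  have h3 : Real.log 4 = 2 * Real.log 2 := by
    rw [show (4 : ℝ) = 2 ^ 2 by norm_num, Real.log_pow]; push_cast; ring
  have h4 : Real.log 4 ≤ Real.log N := Real.log_le_log (by norm_num) (by exact_mod_cast hN)
  have h5 := Real.log_two_gt_d9
  nlinarith

theorem log_four_mul_le {N : ℕ} (hN : 4 ≤ N) : Real.log (4 * N) ≤ 2 * Real.log N := by
  have h4 : Real.log 4 ≤ Real.log N := Real.log_le_log (by norm_num) (by exact_mod_cast hN)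
  rw [Real.log_mul (by norm_num) (by positivity)]
  linarith

/-- Admissible sieve parameters for the log-free bound. -/
theorem exists_sieveRange : ∀ᶠ N : ℕ in atTop, ∀ R : ℝ, 1 ≤ R → R ≤ Real.log N ^ 8 →
    ∃ (s : ℕ) (z : ℝ), SieveRange s z N R ∧ z ≤ N ∧
      Real.log N ≤ 128 * (1 + Real.log R) * Real.log z ∧ (1 + Real.log R) ^ 2 ≤ Real.log N := by
  have h1 : ∀ᶠ N : ℕ in atTop, 1 ≤ Real.log N :=
    (Real.tendsto_log_atTop.comp tendsto_natCast_atTop_atTop).eventually_ge_atTop 1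
  have h2 : ∀ᶠ L : ℝ in atTop, 8192 * (1 + 8 * Real.log L) ^ 2 ≤ L := by
    have a1 : (fun L : ℝ => Real.log L ^ 2) =o[atTop] id := isLittleO_pow_log_id_atTop
    have a2 := a1.bound (c := 1 / (8192 * 2 * 128)) (by norm_num)
    filter_upwards [a2, eventually_ge_atTop (8192 * 4 : ℝ)] with L hL hL1
    simp only [Real.norm_eq_abs, id, abs_of_nonneg (sq_nonneg (Real.log L)),
      abs_of_pos (show 0 < L by linarith)] at hL
    nlinarith [sq_nonneg (1 - 8 * Real.log L)]
  have h3 := (Real.tendsto_log_atTop.comp tendsto_natCast_atTop_atTop).eventually h2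
  filter_upwards [h1, h3, eventually_ge_atTop 1] with N hL1 hL2 hN1 R hR1 hR2
  simp only [Function.comp] at hL2
  set L := Real.log N
  have hN0 : (0 : ℝ) < N := by exact_mod_cast hN1
  have hR0 : 0 < R := by linarith
  have hr0 : 0 ≤ Real.log R := Real.log_nonneg hR1
  have hrL : Real.log R ≤ 8 * Real.log L := by
    have := Real.log_le_log hR0 hR2
    rwa [Real.log_pow] at this
  set r := Real.log R
  set s := ⌈4 * r⌉₊
  have hs1 : 4 * r ≤ s := Nat.le_ceil _
  have hs2 : (s : ℝ) < 4 * r + 1 := Nat.ceil_lt_add_one (by positivity)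
  set w : ℝ := 8 * (4 * s + 7)
  have hw0 : 0 < w := by positivity
  have hw : w ≤ 128 * (1 + r) := by simp only [w]; linarith
  have hsq : 8192 * (1 + r) ^ 2 ≤ L := by
    refine le_trans ?_ hL2
    gcongr
  have hlogz : Real.log ((N : ℝ) ^ (1 / w)) = L / w := by
    rw [Real.log_rpow hN0]; ring
  have hz0 : 0 < (N : ℝ) ^ (1 / w) := by positivity
  have hLw : 64 * (1 + r) ≤ L / w := by
    rw [le_div_iff₀ hw0]
    calc 64 * (1 + r) * w ≤ 64 * (1 + r) * (128 * (1 + r)) := by gcongr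
      _ = 8192 * (1 + r) ^ 2 := by ring
      _ ≤ L := hsq
  refine ⟨s, (N : ℝ) ^ (1 / w), ⟨?_, by exact_mod_cast hN1, hR1, ?_, ?_, ?_⟩, ?_, ?_, ?_⟩
  · rw [← Real.log_le_log_iff (by norm_num) hz0, hlogz, Real.log_pow]
    have := Real.log_two_lt_d9
    push_cast; linarith
  · rw [← Real.rpow_natCast, ← Real.rpow_mul hN0.le]
    apply le_of_eq
    congr 1
    push_cast
    simp only [w]
    have : (4 * (s : ℝ) + 7) ≠ 0 := by positivity
    field_simp
  · rw [← Real.log_le_log_iff (by positivity) hz0, hlogz, Real.log_pow]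
    change ((16 : ℕ) : ℝ) * r ≤ _
    push_cast; linarith
  · rw [← Real.log_le_log_iff (by positivity) (by positivity), Real.log_pow, Real.log_pow]
    change ((2 : ℕ) : ℝ) * r ≤ _
    have := Real.log_two_gt_d9
    push_cast
    nlinarith
  · calc (N : ℝ) ^ (1 / w) ≤ (N : ℝ) ^ (1 : ℝ) := by
          refine Real.rpow_le_rpow_of_exponent_le (by exact_mod_cast hN1) ?_
          rw [div_le_one hw0]
          have : (0 : ℝ) ≤ s := by positivity
          simp only [w]; linarith
      _ = N := Real.rpow_one _
  · rw [hlogz]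
    calc L = w * (L / w) := by field_simp
      _ ≤ 128 * (1 + r) * (L / w) := by gcongr
  · nlinarith

/-- A pointwise bound on the prime exponential sum without logarithmic loss. -/
theorem norm_primeExpSum_le : ∃ C : ℝ, 0 < C ∧ ∀ᶠ N : ℕ in atTop, ∀ (q : ℕ) (a : ℤ) (β R : ℝ),
    0 < q → IsCoprime a q → R = q * max 1 (N * |β|) → R ≤ Real.log N ^ 8 →
    ‖primeExpSum N (a / q + β)‖ ≤ C * N * R ^ (-(1 / 32) : ℝ) := by
  obtain ⟨C₁, hC₁, H₁⟩ := norm_cellSum_le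
  obtain ⟨C₂, hC₂, H₂⟩ := card_rough_le
  obtain ⟨C₃, hC₃, H₃⟩ := norm_sum_rough_interval_le
  obtain ⟨C₄, hC₄, H₄⟩ := div_totient_le_rpow (ε := 1 / 16) (by norm_num)
  have e1 : ∀ᶠ N : ℕ in atTop, Real.log N ^ 8 ≤ (N : ℝ) ^ (5 / 8 : ℝ) := by
    have a1 := (isLittleO_log_rpow_rpow_atTop (s := 5 / 8) 8 (by norm_num)).bound (c := 1) one_pos
    filter_upwards [tendsto_natCast_atTop_atTop.eventually a1, eventually_ge_atTop 1] with N h hN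
    rw [one_mul, Real.norm_of_nonneg (Real.rpow_nonneg (Real.log_natCast_nonneg N) _),
      Real.norm_of_nonneg (by positivity)] at h
    exact_mod_cast h
  have e2 : ∀ᶠ N : ℕ in atTop, 8 * √N * Real.log N ^ 2 ≤ N := by
    have a1 := (isLittleO_log_rpow_rpow_atTop (s := 1 / 2) 2 (by norm_num)).bound (c := 1 / 8)
      (by norm_num)
    filter_upwards [tendsto_natCast_atTop_atTop.eventually a1, eventually_ge_atTop 1] with N h hN
    rw [Real.norm_of_nonneg (Real.rpow_nonneg (Real.log_natCast_nonneg N) _),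
      Real.norm_of_nonneg (by positivity), ← Real.sqrt_eq_rpow] at h
    have h' : Real.log N ^ 2 ≤ 1 / 8 * √N := by exact_mod_cast h
    calc 8 * √(N : ℝ) * Real.log N ^ 2 ≤ 8 * √N * (1 / 8 * √N) := by gcongr
      _ = √N * √N := by ring
      _ = N := Real.mul_self_sqrt (Nat.cast_nonneg N)
  have e3 : ∀ᶠ N : ℕ in atTop, 1 ≤ Real.log N :=
    (Real.tendsto_log_atTop.comp tendsto_natCast_atTop_atTop).eventually_ge_atTop 1
  refine ⟨1 + 50 * C₁ * (128 ^ 2 * 65 ^ 2) + C₃ * C₄ * 9 * 128 * 65 + 2 * (C₂ * 3 * 128),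
    by positivity, ?_⟩
  filter_upwards [exists_sieveRange, e1, e2, e3, eventually_ge_atTop 4] with N hex he1 he2 he3 hN4
    q a β R hq haq hR hRL
  have hq1 : (1 : ℝ) ≤ q := by exact_mod_cast hq
  have hR1 : 1 ≤ R := by
    rw [hR]; exact one_le_mul_of_one_le_of_one_le hq1 (le_max_left _ _)
  have hR0 : 0 < R := by linarith
  obtain ⟨s, z, hS, hzN, hLz, hrL⟩ := hex R hR1 hRL
  have hz0 := hS.z_pos
  have hlog := hS.log_pos
  have hN0 : (0 : ℝ) < N := by positivity
  have hqR : (q : ℝ) ≤ R := by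
    rw [hR]; exact le_mul_of_one_le_right (Nat.cast_nonneg q) (le_max_left _ _)
  have hNβ : N * |β| ≤ R := by
    rw [hR]
    calc N * |β| ≤ max 1 (N * |β|) := le_max_right _ _
      _ ≤ _ := le_mul_of_one_le_left (by positivity) hq1
  set L := Real.log N
  set r := Real.log R
  have hr0 : 0 ≤ r := Real.log_nonneg hR1
  have hL0 : 0 < L := by linarith
  set ρ := R ^ (-(1 / 32) : ℝ)
  have hρ0 : 0 < ρ := by positivity
  have hrR : 1 + r ≤ 65 * R ^ (1 / 64 : ℝ) := by
    have h1 := Real.log_le_rpow_div hR0.le (show (0 : ℝ) < 1 / 64 by norm_num)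
    have h2 : 1 ≤ R ^ (1 / 64 : ℝ) := Real.one_le_rpow hR1 (by norm_num)
    have h3 : R ^ (1 / 64 : ℝ) / (1 / 64) = 64 * R ^ (1 / 64 : ℝ) := by ring
    simp only [r]; linarith
  have hLz' : L / Real.log z ≤ 128 * (1 + r) := by
    rw [div_le_iff₀ hlog]; exact hLz
  have hsqrtL : 1 / √L ≤ ρ := by
    have h1 : R ^ (1 / 32 : ℝ) ≤ √L := by
      have h2 : R ^ (1 / 32 : ℝ) ≤ (L ^ 8) ^ (1 / 32 : ℝ) :=
        Real.rpow_le_rpow hR0.le hRL (by norm_num)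
      refine h2.trans ?_
      rw [← Real.rpow_natCast, ← Real.rpow_mul hL0.le, Real.sqrt_eq_rpow]
      exact Real.rpow_le_rpow_of_exponent_le he3 (by norm_num)
    simp only [ρ]
    rw [Real.rpow_neg hR0.le, one_div]
    exact inv_anti₀ (by positivity) h1
  have hLsq : √L * √L = L := Real.mul_self_sqrt hL0.le
  have hsL0 : 0 < √L := Real.sqrt_pos.2 hL0
  have hsL1 : 1 ≤ √L := Real.one_le_sqrt.2 he3
  have hr1 : 1 + r ≤ √L := Real.le_sqrt_of_sq_le hrL
  -- the bilinear part
  have hB : ‖primeExpSum N (a / q + β) - roughExpSum z N (a / q + β)‖ ≤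
      N * ρ + 50 * C₁ * (128 ^ 2 * 65 ^ 2) * (N * ρ) := by
    refine (norm_primeExpSum_sub_roughExpSum_le (E := C₁ * (N / Real.log z ^ 2) *
      R ^ (-(1 / 16) : ℝ)) (le_trans (by norm_num) hS.le_z) hzN (by positivity) _
      fun i j f g hij h1 h2 h3 hf hg => H₁ s z R N i j q a β f g hS hq haq hR hij
        (by exact_mod_cast h1) (by exact_mod_cast h2) h3 hf hg).trans (add_le_add ?_ ?_)
    · have h1 : √(4 * N : ℝ) = 2 * √N := by
        rw [Real.sqrt_mul (by norm_num), show (4 : ℝ) = 2 ^ 2 by norm_num,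
          Real.sqrt_sq (by norm_num)]
      calc 2 * √(4 * N : ℝ) * Real.log (4 * N) ≤ 2 * (2 * √N) * (2 * L) := by
            rw [h1]; gcongr; exact log_four_mul_le hN4
        _ = 8 * √N * L ^ 2 * (1 / L) := by field_simp; ring
        _ ≤ N * (1 / √L) := by
          gcongr
          nlinarith
        _ ≤ N * ρ := by gcongr
    · have hl4 : 0 ≤ Real.log (4 * N) := Real.log_nonneg (by linarith [hS.one_le_N])
      calc 5 * (Nat.log 2 (4 * N) + 1 : ℝ) * (Real.log (4 * N) * (C₁ * (N / Real.log z ^ 2) *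
            R ^ (-(1 / 16) : ℝ)))
          ≤ 5 * (5 * L) * ((2 * L) * (C₁ * (N / Real.log z ^ 2) * R ^ (-(1 / 16) : ℝ))) := by
            gcongr
            · exact natLog_two_add_one_le hN4
            · exact log_four_mul_le hN4
        _ = 50 * C₁ * N * (L / Real.log z) ^ 2 * R ^ (-(1 / 16) : ℝ) := by ring
        _ ≤ 50 * C₁ * N * (128 * (65 * R ^ (1 / 64 : ℝ))) ^ 2 * R ^ (-(1 / 16) : ℝ) := by
          gcongr
          exact hLz'.trans (by gcongr)
        _ = 50 * C₁ * (128 ^ 2 * 65 ^ 2) * (N * (R ^ (1 / 64 : ℝ) * R ^ (1 / 64 : ℝ) *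
            R ^ (-(1 / 16) : ℝ))) := by ring
        _ = _ := by
          rw [← Real.rpow_add hR0, ← Real.rpow_add hR0]; norm_num [ρ]
  -- the linear part
  have hsum : ‖∑ n ∈ (Finset.Ioc N (4 * N)).filter (IsRough z), eC (n * (a / q + β))‖ ≤
      C₃ * (C₄ * R ^ (1 / 16 : ℝ)) * (3 * N / Real.log z) * (3 * R ^ (-1 : ℝ)) := by
    have h1 := H₃ s z N (3 * N) (1 / R) q a β N (4 * N) (le_trans (by norm_num) hS.le_z)
      hS.one_le_N hS.level hq haq ?_ (by omega) ?_ ?_ ?_ (by positivity) ?_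
    · refine h1.trans ?_
      have h2 : (q : ℝ) / q.totient ≤ C₄ * R ^ (1 / 16 : ℝ) :=
        (H₄ q hq.ne').trans (by gcongr)
      have h3 : 1 / R + 1 / 2 ^ s + 1 / z ≤ 3 * R ^ (-1 : ℝ) := by
        rw [Real.rpow_neg_one]
        have a1 : 1 / (2 : ℝ) ^ s ≤ R⁻¹ := by
          rw [one_div]
          exact inv_anti₀ hR0 (le_trans (by nlinarith) hS.sq_le)
        have a2 : 1 / z ≤ R⁻¹ := by
          rw [one_div]
          exact inv_anti₀ hR0 ((le_self_pow₀ hR1 (by norm_num)).trans hS.pow_le_z)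
        rw [one_div R]; linarith
      gcongr
    · calc (q : ℝ) ^ 8 ≤ R ^ 8 := by gcongr
        _ ≤ R ^ 16 := pow_le_pow_right₀ hR1 (by norm_num)
        _ ≤ z := hS.pow_le_z
    · push_cast; linarith
    · calc (N : ℝ) ^ (1 / 2 : ℝ) ≤ (N : ℝ) ^ (1 : ℝ) :=
            Real.rpow_le_rpow_of_exponent_le hS.one_le_N (by norm_num)
        _ ≤ _ := by rw [Real.rpow_one]; linarith
    · have h1 : N * |β| ≤ (N : ℝ) ^ (5 / 8 : ℝ) := hNβ.trans (hRL.trans he1)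
      have h2 : (N : ℝ) ^ (5 / 8 : ℝ) = N * (N : ℝ) ^ (-(3 / 8) : ℝ) := by
        nth_rewrite 2 [← Real.rpow_one (N : ℝ)]
        rw [← Real.rpow_add hN0]; norm_num
      rw [h2] at h1
      exact le_of_mul_le_mul_left h1 hN0
    · rcases le_total 1 (N * |β|) with h | h
      · right
        rw [max_eq_right h] at hR
        rw [one_div, ← div_eq_inv_mul, le_div_iff₀ hR0, one_mul, hR]
        gcongr
        linarith
      · left
        rw [max_eq_left h, mul_one] at hR
        rw [one_div, ← hR, inv_mul_cancel₀ hR0.ne']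
  have hcard : (((Finset.Ioc N (4 * N)).filter (IsRough z)).card : ℝ) ≤
      C₂ * (3 * N / Real.log z) := by
    refine H₂ z _ _ _ hS.le_z (by push_cast; linarith) ?_
    have : z ^ (1 / 2 : ℝ) ≤ z ^ (1 : ℝ) :=
      Real.rpow_le_rpow_of_exponent_le hS.one_lt_z.le (by norm_num)
    rw [Real.rpow_one] at this
    linarith
  have hT : ‖roughExpSum z N (a / q + β)‖ ≤
      C₃ * C₄ * 9 * 128 * 65 * (N * ρ) + 2 * (C₂ * 3 * 128) * (N * ρ) := by
    refine (norm_roughExpSum_le z (by omega) _).trans (add_le_add ?_ ?_)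
    · calc L * _ ≤ L * (C₃ * (C₄ * R ^ (1 / 16 : ℝ)) * (3 * N / Real.log z) *
            (3 * R ^ (-1 : ℝ))) := by gcongr
        _ = C₃ * C₄ * 9 * N * (L / Real.log z) * (R ^ (1 / 16 : ℝ) * R ^ (-1 : ℝ)) := by ring
        _ ≤ C₃ * C₄ * 9 * N * (128 * (65 * R ^ (1 / 64 : ℝ))) *
            (R ^ (1 / 16 : ℝ) * R ^ (-1 : ℝ)) := by
          gcongr
          exact hLz'.trans (by gcongr)
        _ = C₃ * C₄ * 9 * 128 * 65 * (N * (R ^ (1 / 64 : ℝ) *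
            (R ^ (1 / 16 : ℝ) * R ^ (-1 : ℝ)))) := by ring
        _ ≤ _ := by
          gcongr
          rw [← Real.rpow_add hR0, ← Real.rpow_add hR0]
          exact Real.rpow_le_rpow_of_exponent_le hR1 (by norm_num)
    · calc 2 * (((Finset.Ioc N (4 * N)).filter (IsRough z)).card : ℝ)
          ≤ 2 * (C₂ * (3 * N / Real.log z)) := by gcongr
        _ = 2 * (C₂ * 3) * N * (L / Real.log z) * (1 / L) := by field_simp
        _ ≤ 2 * (C₂ * 3) * N * (128 * √L) * (1 / L) := by
          gcongr
          exact hLz'.trans (by gcongr)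
        _ = 2 * (C₂ * 3 * 128) * (N * (√L / L)) := by ring
        _ = 2 * (C₂ * 3 * 128) * (N * (1 / √L)) := by
          rw [Real.sqrt_div_self', one_div]
        _ ≤ _ := by gcongr
  have h := norm_le_norm_sub_add (primeExpSum N (a / q + β)) (roughExpSum z N (a / q + β))
  refine h.trans ((add_le_add hB hT).trans (le_of_eq ?_))
  ring

end LogFree

section Spacing
open Real

theorem sum_ite_zero_div_le {q : ℕ} (hq : 0 < q) (M : ℝ) :
    ∑ r ∈ Finset.range q, (if r = 0 then M else (q : ℝ) / (2 * r)) ≤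
      M + q / 2 * (1 + Real.log q) := by
  obtain ⟨n, rfl⟩ : ∃ n, q = n + 1 := ⟨q - 1, by omega⟩
  rw [Finset.sum_range_succ']
  have h1 : ∑ k ∈ Finset.range n, (if k + 1 = 0 then M else ((n + 1 : ℕ) : ℝ) / (2 * (k + 1 : ℕ))) =
      (n + 1 : ℕ) / 2 * (harmonic n : ℝ) := by
    rw [harmonic]
    push_cast
    rw [Finset.mul_sum]
    refine Finset.sum_congr rfl fun k _ => ?_
    field_simp
  rw [h1, if_pos rfl, add_comm]
  have h2 := harmonic_le_one_add_log n
  have h3 : Real.log n ≤ Real.log (n + 1 : ℕ) := by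
    rcases Nat.eq_zero_or_pos n with rfl | hn
    · simp
    · exact Real.log_le_log (by exact_mod_cast hn) (by exact_mod_cast Nat.le_succ n)
  gcongr
  linarith

theorem card_le_three_of_near {q : ℕ} {a : ℤ} {α : ℝ} (hq : 0 < q) (haq : IsCoprime a q)
    (hα : |α - a / q| ≤ 1 / q ^ 2) {γ : ℝ} {b : ℕ} {T : Finset ℕ} (hT : T ⊆ Finset.Ioc b (b + q))
    (h : ∀ k ∈ T, ∀ k' ∈ T, |Int.fract (k * α + γ) - Int.fract (k' * α + γ)| < 1 / q) :
    T.card ≤ 3 := by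
  classical
  have hq' : (0 : ℝ) < q := by exact_mod_cast hq
  rcases T.eq_empty_or_nonempty with rfl | ⟨k₀, hk₀⟩
  · simp
  refine (Finset.card_le_card_of_injOn (t := ({0, 1, -1} : Finset (ZMod q)))
    (fun k : ℕ => ((((k : ℤ) - k₀) * a : ℤ) : ZMod q)) ?_ ?_).trans Finset.card_le_three
  · intro k hk
    have h1 := h k hk k₀ hk₀
    have hkb := Finset.mem_Ioc.1 (hT hk)
    have hkb₀ := Finset.mem_Ioc.1 (hT hk₀)
    set n : ℤ := ⌊k * α + γ⌋ - ⌊k₀ * α + γ⌋ with hn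
    have h2 : |((k : ℝ) - k₀) * α - n| < 1 / q := by
      convert h1 using 2
      simp only [Int.fract, hn]; push_cast; ring
    have h3 : |(k : ℝ) - k₀| < q := by
      have e1 : (k : ℝ) < k₀ + q := by exact_mod_cast (show k < k₀ + q by omega)
      have e2 : (k₀ : ℝ) < k + q := by exact_mod_cast (show k₀ < k + q by omega)
      rw [abs_lt]; constructor <;> linarith
    have h4 : |((k : ℝ) - k₀) * (α - a / q)| ≤ 1 / q := by
      rw [abs_mul]
      calc _ ≤ (q : ℝ) * (1 / q ^ 2) := by gcongr
        _ = 1 / q := by field_simp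
    have h5 : |((((k : ℤ) - k₀) * a - n * q : ℤ) : ℝ)| < 2 := by
      have e : ((((k : ℤ) - k₀) * a - n * q : ℤ) : ℝ) =
          q * ((((k : ℝ) - k₀) * α - n) - ((k : ℝ) - k₀) * (α - a / q)) := by
        push_cast; field_simp; ring
      rw [e, abs_mul, abs_of_pos hq']
      calc _ ≤ (q : ℝ) * (|((k : ℝ) - k₀) * α - n| + |((k : ℝ) - k₀) * (α - a / q)|) := by
            gcongr; exact abs_sub _ _
        _ < q * (1 / q + 1 / q) := mul_lt_mul_of_pos_left (add_lt_add_of_lt_of_le h2 h4) hq'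
        _ = 2 := by field_simp; norm_num
    have h6 : |((k : ℤ) - k₀) * a - n * q| < 2 := by
      rw [← Int.cast_abs] at h5
      exact_mod_cast h5
    have h7 : ((((k : ℤ) - k₀) * a : ℤ) : ZMod q) = ((((k : ℤ) - k₀) * a - n * q : ℤ) : ZMod q) := by
      push_cast; simp
    simp only [Finset.coe_insert, Finset.coe_singleton, Set.mem_insert_iff, Set.mem_singleton_iff]
    rw [h7]
    rw [abs_lt] at h6
    obtain h | h | h : ((k : ℤ) - k₀) * a - n * q = 0 ∨ ((k : ℤ) - k₀) * a - n * q = 1 ∨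
        ((k : ℤ) - k₀) * a - n * q = -1 := by omega
    · left; rw [h]; simp
    · right; left; rw [h]; simp
    · right; right; rw [h]; simp
  · intro k hk k' hk' hkk
    have hkb := Finset.mem_Ioc.1 (hT hk)
    have hkb' := Finset.mem_Ioc.1 (hT hk')
    simp only at hkk
    rw [ZMod.intCast_eq_intCast_iff_dvd_sub] at hkk
    have e : ((k' : ℤ) - k₀) * a - (k - k₀) * a = ((k' : ℤ) - k) * a := by ring
    rw [e] at hkk
    have h1 : (q : ℤ) ∣ (k' : ℤ) - k := haq.symm.dvd_of_dvd_mul_right hkk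
    have h2 : (k' : ℤ) - k = 0 := Int.eq_zero_of_abs_lt_dvd h1 (by rw [abs_lt]; omega)
    omega

/-- A block of `q` consecutive terms of a sequence bounded by `min M (1 / (2 ‖k α + γ‖))`. -/
theorem sum_block_le {q : ℕ} {a : ℤ} {α : ℝ} (hq : 0 < q) (haq : IsCoprime a q)
    (hα : |α - a / q| ≤ 1 / q ^ 2) (γ : ℝ) (b : ℕ) {g : ℕ → ℝ} {M : ℝ} (hM : 0 ≤ M)
    (hg : ∀ k ∈ Finset.Ioc b (b + q), g k ≤ M)
    (hg' : ∀ k ∈ Finset.Ioc b (b + q), g k * (2 * ‖((k * α + γ : ℝ) : UnitAddCircle)‖) ≤ 1) :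
    ∑ k ∈ Finset.Ioc b (b + q), g k ≤ 6 * M + 3 * q * (1 + Real.log q) := by
  have hq' : (0 : ℝ) < q := by exact_mod_cast hq
  set h₁ : ℕ → ℝ := fun r => if r = 0 then M else (q : ℝ) / (2 * r) with hh₁
  have hh0 : ∀ r, 0 ≤ h₁ r := fun r => by simp only [h₁]; split_ifs <;> positivity
  set r : ℕ → ℕ := fun k => ⌊q * Int.fract (k * α + γ)⌋₊
  have hr1 : ∀ k : ℕ, (r k : ℝ) ≤ q * Int.fract (k * α + γ) := fun k =>
    Nat.floor_le (mul_nonneg hq'.le (Int.fract_nonneg _))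
  have hr2 : ∀ k : ℕ, q * Int.fract (k * α + γ) < r k + 1 := fun k => Nat.lt_floor_add_one _
  have hrq : ∀ k, r k < q := fun k => by
    have h1 : q * Int.fract (k * α + γ) < q * 1 := by
      gcongr; exact Int.fract_lt_one _
    have : (r k : ℝ) < q := by linarith [hr1 k]
    exact_mod_cast this
  have hb : ∀ k ∈ Finset.Ioc b (b + q), g k ≤ h₁ (r k) + h₁ (q - 1 - r k) := by
    intro k hk
    by_cases h0 : r k = 0
    · have : h₁ (r k) = M := by simp only [h₁]; rw [if_pos h0]
      linarith [hg k hk, hh0 (q - 1 - r k)]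
    by_cases h0' : q - 1 - r k = 0
    · have : h₁ (q - 1 - r k) = M := by simp only [h₁]; rw [if_pos h0']
      linarith [hg k hk, hh0 (r k)]
    have e1 : h₁ (r k) = q / (2 * r k) := by simp only [h₁]; rw [if_neg h0]
    have e2 : h₁ (q - 1 - r k) = q / (2 * (q - 1 - r k : ℕ)) := by simp only [h₁]; rw [if_neg h0']
    have p1 : (0 : ℝ) < r k := by exact_mod_cast Nat.pos_of_ne_zero h0
    have p2 : (0 : ℝ) < (q - 1 - r k : ℕ) := by exact_mod_cast Nat.pos_of_ne_zero h0'
    have c : ((q - 1 - r k : ℕ) : ℝ) = q - 1 - r k := by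
      have := hrq k
      rw [Nat.cast_sub (by omega), Nat.cast_sub (by omega)]; norm_num
    have hgk := hg' k hk
    rw [UnitAddCircle.norm_eq, abs_sub_round_eq_min] at hgk
    set t := Int.fract ((k : ℝ) * α + γ)
    have t1 : (r k : ℝ) ≤ q * t := hr1 k
    have t2 : q * t < r k + 1 := hr2 k
    rcases le_total t (1 - t) with ht | ht
    · rw [min_eq_left ht] at hgk
      have : g k ≤ q / (2 * r k) := by
        by_cases hgk0 : g k ≤ 0
        · exact hgk0.trans (by positivity)
        push Not at hgk0
        rw [le_div_iff₀ (by positivity)]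
        calc g k * (2 * r k) ≤ g k * (2 * (q * t)) := by gcongr
          _ = q * (g k * (2 * t)) := by ring
          _ ≤ q * 1 := by gcongr
          _ = q := mul_one _
      linarith [hh0 (q - 1 - r k)]
    · rw [min_eq_right ht] at hgk
      have : g k ≤ q / (2 * (q - 1 - r k : ℕ)) := by
        by_cases hgk0 : g k ≤ 0
        · exact hgk0.trans (by positivity)
        push Not at hgk0
        rw [le_div_iff₀ (by positivity)]
        calc g k * (2 * (q - 1 - r k : ℕ)) ≤ g k * (2 * (q * (1 - t))) := by
              gcongr; rw [c]; linarith
          _ = q * (g k * (2 * (1 - t))) := by ring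
          _ ≤ q * 1 := by gcongr
          _ = q := mul_one _
      linarith [hh0 (r k)]
  have hfib : ∀ n, ((Finset.Ioc b (b + q)).filter (fun k => r k = n)).card ≤ 3 := by
    intro n
    refine card_le_three_of_near hq haq hα (γ := γ) (Finset.filter_subset _ _) fun k hk k' hk' => ?_
    have e1 := (Finset.mem_filter.1 hk).2
    have e2 := (Finset.mem_filter.1 hk').2
    have a1 := hr1 k; have a2 := hr2 k; have a3 := hr1 k'; have a4 := hr2 k'
    rw [e1] at a1 a2
    rw [e2] at a3 a4
    rw [abs_lt, ← neg_div]
    constructor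
    · rw [div_lt_iff₀ hq']; linarith
    · rw [lt_div_iff₀ hq']; linarith
  calc _ ≤ ∑ k ∈ Finset.Ioc b (b + q), (h₁ (r k) + h₁ (q - 1 - r k)) := Finset.sum_le_sum hb
    _ = ∑ n ∈ Finset.range q, ∑ k ∈ (Finset.Ioc b (b + q)).filter (fun k => r k = n),
        (h₁ (r k) + h₁ (q - 1 - r k)) :=
      (Finset.sum_fiberwise_of_maps_to (fun k _ => Finset.mem_range.2 (hrq k)) _).symm
    _ ≤ ∑ n ∈ Finset.range q, 3 * (h₁ n + h₁ (q - 1 - n)) := by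
      refine Finset.sum_le_sum fun n _ => ?_
      rw [Finset.sum_congr rfl (g := fun _ => h₁ n + h₁ (q - 1 - n)) fun k hk => by
        rw [(Finset.mem_filter.1 hk).2], Finset.sum_const, nsmul_eq_mul]
      have := hfib n
      have h3 : (((Finset.Ioc b (b + q)).filter (fun k => r k = n)).card : ℝ) ≤ 3 := by
        exact_mod_cast this
      exact mul_le_mul_of_nonneg_right h3 (add_nonneg (hh0 _) (hh0 _))
    _ = 6 * ∑ n ∈ Finset.range q, h₁ n := by
      rw [← Finset.mul_sum, Finset.sum_add_distrib, Finset.sum_range_reflect]; ring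
    _ ≤ 6 * (M + q / 2 * (1 + Real.log q)) := by
      gcongr; exact sum_ite_zero_div_le hq M
    _ = _ := by ring

theorem sum_blocks_le {q : ℕ} {a : ℤ} {α : ℝ} (hq : 0 < q) (haq : IsCoprime a q)
    (hα : |α - a / q| ≤ 1 / q ^ 2) (γ : ℝ) (u B : ℕ) {g : ℕ → ℝ} {M : ℕ → ℝ} (hM : ∀ b, 0 ≤ M b)
    (hg : ∀ b < B, ∀ k ∈ Finset.Ioc (u + b * q) (u + b * q + q), g k ≤ M b)
    (hg' : ∀ k, g k * (2 * ‖((k * α + γ : ℝ) : UnitAddCircle)‖) ≤ 1) :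
    ∑ k ∈ Finset.Ioc u (u + B * q), g k ≤
      ∑ b ∈ Finset.range B, (6 * M b + 3 * q * (1 + Real.log q)) := by
  induction B with
  | zero => simp
  | succ B ih =>
    rw [Finset.sum_range_succ, ← Finset.sum_Ioc_consecutive g (Nat.le_add_right u (B * q))
      (show u + B * q ≤ u + (B + 1) * q by nlinarith)]
    refine add_le_add (ih fun b hb => hg b (by omega)) ?_
    rw [show u + (B + 1) * q = u + B * q + q by ring]
    exact sum_block_le hq haq hα γ _ (hM B) (hg B (by omega)) fun k _ => hg' k

end Spacing

section TypeI
open Real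

theorem forall_dvd_iff_prod_dvd {D : Finset ℕ} (hD : ∀ p ∈ D, p.Prime) (n : ℕ) :
    (∀ p ∈ D, p ∣ n) ↔ (∏ p ∈ D, p) ∣ n :=
  ⟨fun h => Finset.prod_primes_dvd n (fun p hp => (hD p hp).prime) h,
    fun h _ hp => (Finset.dvd_prod_of_mem _ hp).trans h⟩

theorem isRough_iff_sievePrimes {z : ℝ} {n : ℕ} :
    IsRough z n ↔ ∀ p ∈ sievePrimes z 1, ¬ p ∣ n := by
  constructor
  · intro h p hp
    rw [mem_sievePrimes] at hp
    exact h p hp.1 hp.2.1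
  · intro h p hp hpz
    exact h p (mem_sievePrimes.2 ⟨hp, hpz, hp.not_dvd_one⟩)

theorem abs_card_filter_dvd_sub_le {d u v : ℕ} (hd : 0 < d) (huv : u ≤ v) :
    |(((Finset.Ioc u v).filter (d ∣ ·)).card : ℝ) - ((v : ℝ) - u) / d| ≤ 1 := by
  have h : ((Finset.Ioc u v).filter (d ∣ ·)).card = v / d - u / d := by
    have h1 := sum_Ioc_filter_dvd_eC hd u v 0
    simp only [mul_zero, eC_zero, Finset.sum_const, nsmul_eq_mul, mul_one, Nat.card_Ioc] at h1
    exact_mod_cast h1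
  have hd' : (0 : ℝ) < d := by exact_mod_cast hd
  rw [h, Nat.cast_sub (Nat.div_le_div_right huv), sub_div]
  have a1 := Nat.cast_div_le (α := ℝ) (m := v) (n := d)
  have a2 := Nat.cast_div_le (α := ℝ) (m := u) (n := d)
  have a0 : ∀ w : ℕ, (w : ℝ) / d < (w / d : ℕ) + 1 := fun w => by
    rw [← Nat.floor_div_eq_div (K := ℝ)]; exact Nat.lt_floor_add_one _
  have a3 := a0 v
  have a4 := a0 u
  rw [abs_le]; constructor <;> linarith

/-- Exponential sums over rough numbers are bounded by complete sums over progressions. -/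
theorem norm_sum_rough_le_sum_dvd : ∃ C : ℝ, 0 < C ∧ ∀ (s : ℕ) (z : ℝ) (u v : ℕ) (α : ℝ), 2 ≤ z →
    u ≤ v → ‖∑ n ∈ (Finset.Ioc u v).filter (IsRough z), eC (n * α)‖ ≤
      ∑ d ∈ Finset.Ioc 0 ⌊z ^ (4 * s + 6)⌋₊, ‖∑ m ∈ Finset.Ioc (u / d) (v / d), eC (m * (d * α))‖ +
        C / 2 ^ s * ((v : ℝ) - u) + 2 * z ^ (4 * s + 7) := by
  obtain ⟨C₁, hC₁, H₁⟩ := fundamental_lemma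
  obtain ⟨C₂, hC₂, H₂⟩ := fundamental_lemma_count
  refine ⟨C₁ + C₂, by positivity, fun s z u v α hz huv => ?_⟩
  have hz0 : 0 < z := by linarith
  set P := sievePrimes z 1
  set A := Finset.Ioc u v
  set X : ℝ := (v : ℝ) - u
  have hX : 0 ≤ X := sub_nonneg.2 (by exact_mod_cast huv)
  have hP : ∀ p ∈ P, p.Prime := fun p hp => (mem_sievePrimes.1 hp).1
  have hPz : ∀ p ∈ P, (p : ℝ) ≤ z := fun p hp => (mem_sievePrimes.1 hp).2.1
  obtain ⟨U, _, hU, -, hUV, hU1, -⟩ := H₁ s z P hz hP hPz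
  have hlevel : ∀ D ⊆ P, ((∏ p ∈ D, p : ℕ) : ℝ) ≤ z ^ (4 * s + 6) →
      |∑ n ∈ A, (if ∀ p ∈ D, p ∣ n then (1 : ℝ) else 0) - X / (∏ p ∈ D, p : ℕ)| ≤ 1 := by
    intro D hD _
    rw [← Finset.sum_filter, Finset.sum_const, nsmul_eq_mul, mul_one,
      Finset.filter_congr fun n _ => forall_dvd_iff_prod_dvd (fun p hp => hP p (hD hp)) n]
    exact abs_card_filter_dvd_sub_le (Finset.prod_pos fun p hp => (hP p (hD hp)).pos) huv
  have h1 := hU.abs_sum_sub_le (by positivity) hP A (fun _ => 1) (fun n p => p ∣ n) zero_le_one hlevel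
  have h2 := H₂ s z P hz hP hPz A (fun _ => 1) (fun n p => p ∣ n) X 1 hX zero_le_one
    (fun _ _ => zero_le_one) hlevel
  set V : ℝ := ∏ p ∈ P, (1 - (p : ℝ)⁻¹)
  have hV0 : 0 ≤ V := (sieveDensity_pos hP).le
  have hV1 : V ≤ 1 := sieveDensity_le_one hP
  set φ : ℕ → ℝ := fun n => U (fun p => if p ∣ n then 1 else 0)
  set ψ : ℕ → ℝ := fun n => if ∀ p ∈ P, ¬ p ∣ n then 1 else 0
  have hψφ : ∀ n, ψ n ≤ φ n := by
    intro n
    have := (hUV (fun p => if p ∣ n then 1 else 0) (fun p => by split_ifs <;> simp)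
      (fun p => by split_ifs <;> simp)).2
    rwa [prod_one_sub_ite] at this
  have hsub : ∑ n ∈ A, (φ n - ψ n) ≤ (C₁ + C₂) / 2 ^ s * X + 2 * z ^ (4 * s + 7) := by
    rw [Finset.sum_sub_distrib]
    have a1 := (abs_le.1 h1).2
    have a2 := (abs_le.1 h2).1
    simp only [one_mul, mul_one] at a1 a2
    have a3 : X * U (fun p => (p : ℝ)⁻¹) ≤ X * ((1 + C₁ / 2 ^ s) * V) := by gcongr
    have a4 : z ^ (4 * s + 6) ≤ z ^ (4 * s + 7) := pow_le_pow_right₀ (by linarith) (by omega)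
    have a5 : (C₁ + C₂) / 2 ^ s * (X * V) ≤ (C₁ + C₂) / 2 ^ s * X :=
      mul_le_mul_of_nonneg_left (mul_le_of_le_one_right hX hV1) (by positivity)
    have a6 : X * ((1 + C₁ / 2 ^ s) * V) + C₂ / 2 ^ s * (X * V) - X * V =
        (C₁ + C₂) / 2 ^ s * (X * V) := by ring
    linarith only [a1, a2, a3, a4, a5, a6]
  have hmain : ‖∑ n ∈ A, (φ n : ℂ) * eC (n * α)‖ ≤
      ∑ d ∈ Finset.Ioc 0 ⌊z ^ (4 * s + 6)⌋₊, ‖∑ m ∈ Finset.Ioc (u / d) (v / d), eC (m * (d * α))‖ := by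
    obtain ⟨c, hc, hcM, hcx⟩ := hU
    set 𝒟 := P.powerset.filter fun D => c D ≠ 0
    have e1 : ∑ n ∈ A, (φ n : ℂ) * eC (n * α) = ∑ D ∈ 𝒟, (c D : ℂ) *
        ∑ m ∈ Finset.Ioc (u / ∏ p ∈ D, p) (v / ∏ p ∈ D, p), eC (m * ((∏ p ∈ D, p : ℕ) * α)) := by
      rw [Finset.sum_filter_of_ne (p := fun D => c D ≠ 0) (fun D _ h h0 => h (by rw [h0]; simp))]
      simp only [φ, hcx, prod_ite_one_zero]
      push_cast
      simp only [Finset.sum_mul]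
      rw [Finset.sum_comm]
      refine Finset.sum_congr rfl fun D hD => ?_
      have hDP := Finset.mem_powerset.1 hD
      have := sum_Ioc_filter_dvd_eC (Finset.prod_pos fun p hp => (hP p (hDP hp)).pos) u v α
      push_cast at this
      rw [← this, Finset.sum_filter, Finset.mul_sum]
      refine Finset.sum_congr rfl fun n _ => ?_
      simp only [forall_dvd_iff_prod_dvd (fun p hp => hP p (hDP hp)) n]
      split_ifs <;> simp
    rw [e1]
    refine (norm_sum_le_of_le _ (n := fun D => ‖∑ m ∈ Finset.Ioc (u / ∏ p ∈ D, p) (v / ∏ p ∈ D, p),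
      eC (m * ((∏ p ∈ D, p : ℕ) * α))‖) fun D _ => ?_).trans ?_
    · rw [norm_mul, Complex.norm_real, Real.norm_eq_abs]
      exact mul_le_of_le_one_left (norm_nonneg _) (hc D)
    · have hinj : Set.InjOn (fun D : Finset ℕ => ∏ p ∈ D, p) 𝒟 :=
        (injOn_prod_primes hP).mono (by
          intro D hD
          exact (Finset.mem_filter.1 hD).1)
      rw [← Finset.sum_image (g := fun D : Finset ℕ => ∏ p ∈ D, p)
        (f := fun d => ‖∑ m ∈ Finset.Ioc (u / d) (v / d), eC (m * (d * α))‖) hinj]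
      refine Finset.sum_le_sum_of_subset_of_nonneg ?_ fun _ _ _ => norm_nonneg _
      intro d hd
      obtain ⟨D, hD, rfl⟩ := Finset.mem_image.1 hd
      rw [Finset.mem_filter, Finset.mem_powerset] at hD
      rw [Finset.mem_Ioc]
      exact ⟨Finset.prod_pos fun p hp => (hP p (hD.1 hp)).pos, Nat.le_floor (hcM D hD.1 hD.2)⟩
  have e0 : ∑ n ∈ A.filter (IsRough z), eC (n * α) =
      ∑ n ∈ A, (φ n : ℂ) * eC (n * α) - ∑ n ∈ A, ((φ n - ψ n : ℝ) : ℂ) * eC (n * α) := by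
    rw [← Finset.sum_sub_distrib, Finset.sum_filter]
    refine Finset.sum_congr rfl fun n _ => ?_
    simp only [isRough_iff_sievePrimes, ψ]
    split_ifs <;> push_cast <;> ring
  rw [e0]
  refine (norm_sub_le _ _).trans ?_
  rw [add_assoc]
  refine add_le_add hmain (le_trans ?_ hsub)
  refine norm_sum_le_of_le _ fun n _ => ?_
  rw [norm_mul, norm_eC, mul_one, Complex.norm_real, Real.norm_of_nonneg (sub_nonneg.2 (hψφ n))]

end TypeI

section MinorArcs
open Real

theorem inv_two_mul_le_norm_mul {q k : ℕ} {a : ℤ} {α : ℝ} (hq : 0 < q) (haq : IsCoprime a q)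
    (hα : |α - a / q| ≤ 1 / q ^ 2) (hk : 0 < k) (hkq : 2 * k ≤ q) :
    1 / (2 * q : ℝ) ≤ ‖((k * α : ℝ) : UnitAddCircle)‖ := by
  have hq' : (0 : ℝ) < q := by exact_mod_cast hq
  have h1 : 1 / (q : ℝ) ≤ ‖(((k * a : ℤ) / q : ℝ) : UnitAddCircle)‖ := by
    refine inv_le_norm_div hq fun hd => ?_
    have h2 : (q : ℤ) ∣ k := haq.symm.dvd_of_dvd_mul_right hd
    have := Int.le_of_dvd (by exact_mod_cast hk) h2
    omega
  have h2 : ‖((k * (α - a / q) : ℝ) : UnitAddCircle)‖ ≤ 1 / (2 * q) := by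
    rw [UnitAddCircle.norm_eq]
    refine (round_le _ 0).trans ?_
    rw [Int.cast_zero, sub_zero, abs_mul, Nat.abs_cast]
    have h3 : (k : ℝ) ≤ q / 2 := by
      rw [le_div_iff₀ two_pos]; exact_mod_cast (by omega : k * 2 ≤ q)
    calc _ ≤ (q : ℝ) / 2 * (1 / q ^ 2) := by gcongr
      _ = 1 / (2 * q) := by field_simp
  have h3 : (((k * a : ℤ) / q : ℝ) : UnitAddCircle) =
      ((k * α : ℝ) : UnitAddCircle) - ((k * (α - a / q) : ℝ) : UnitAddCircle) := by
    rw [← AddCircle.coe_sub]; congr 1; push_cast; ring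
  rw [h3] at h1
  have h4 := h1.trans (norm_sub_le _ _)
  have h5 : 1 / (q : ℝ) = 1 / (2 * q) + 1 / (2 * q) := by field_simp; norm_num
  linarith

theorem sum_norm_sum_dvd_le {q : ℕ} {a : ℤ} {α : ℝ} (hq : 0 < q) (haq : IsCoprime a q)
    (hα : |α - a / q| ≤ 1 / q ^ 2) (N y : ℕ) :
    ∑ d ∈ Finset.Ioc 0 y, ‖∑ m ∈ Finset.Ioc (N / d) (4 * N / d), eC (m * (d * α))‖ ≤
      (y + q) * (15 + 3 * Real.log q) + 36 * (N / q) * (1 + Real.log (y + 1)) := by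
  have hq' : (0 : ℝ) < q := by exact_mod_cast hq
  have hq1 : (1 : ℝ) ≤ q := by exact_mod_cast hq
  set g : ℕ → ℝ := fun d => ‖∑ m ∈ Finset.Ioc (N / d) (4 * N / d), eC (m * (d * α))‖
  set B := y / q + 1
  have hyB : y ≤ 0 + B * q := by
    have := Nat.lt_div_mul_add hq (a := y)
    simp only [B]; nlinarith
  have h1 := sum_blocks_le hq haq hα 0 0 B (g := g)
    (M := fun b => q + 6 * N / (q * (b + 1 : ℕ)) + 1) (fun b => by positivity) ?_ ?_
  rotate_left
  · intro b _ k hk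
    rw [Finset.mem_Ioc, zero_add] at hk
    have hk0 : 0 < k := by omega
    have hk' : (0 : ℝ) < k := by exact_mod_cast hk0
    by_cases h2k : 2 * k ≤ q
    · have h2 := norm_sum_Ioc_eC_mul_le (N / k) (4 * N / k) (k * α)
      have h3 := inv_two_mul_le_norm_mul hq haq hα hk0 h2k
      have h4 : g k * (1 / q) ≤ 1 := by
        calc g k * (1 / q) = g k * (2 * (1 / (2 * q))) := by congr 1; field_simp
          _ ≤ g k * (2 * ‖((k * α : ℝ) : UnitAddCircle)‖) := by gcongr
          _ ≤ 1 := h2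
      rw [mul_one_div, div_le_one hq'] at h4
      have : 0 ≤ 6 * (N : ℝ) / (q * (b + 1 : ℕ)) := by positivity
      linarith
    · have h2 : g k ≤ (4 * N / k - N / k : ℕ) := norm_sum_Ioc_eC_le_card _ _ _
      have h3 : ((4 * N / k - N / k : ℕ) : ℝ) ≤ 3 * N / k + 1 := by
        have e1 : ((4 * N / k : ℕ) : ℝ) ≤ 4 * N / k := by
          exact_mod_cast Nat.cast_div_le (α := ℝ) (m := 4 * N) (n := k)
        have e2 : (N : ℝ) / k < (N / k : ℕ) + 1 := by
          rw [← Nat.floor_div_eq_div (K := ℝ)]; exact Nat.lt_floor_add_one _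
        rw [Nat.cast_sub (Nat.div_le_div_right (by omega))]
        have e3 : 4 * (N : ℝ) / k = 3 * N / k + N / k := by ring
        linarith
      have h4 : (q * (b + 1 : ℕ) : ℝ) ≤ 2 * k := by
        have : q * (b + 1) ≤ 2 * k := by
          rcases Nat.eq_zero_or_pos b with rfl | hb
          · omega
          · nlinarith
        exact_mod_cast this
      have h5 : 3 * (N : ℝ) / k ≤ 6 * N / (q * (b + 1 : ℕ)) := by
        calc 3 * (N : ℝ) / k = 6 * N / (2 * k) := by field_simp; ring
          _ ≤ _ := by gcongr
      linarith
  · intro k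
    rw [add_zero]
    exact norm_sum_Ioc_eC_mul_le _ _ _
  have hB1 : (B : ℝ) * q ≤ y + q := by
    have := Nat.div_mul_le_self y q
    have h : B * q ≤ y + q := by simp only [B]; nlinarith
    exact_mod_cast h
  have hBy : (B : ℝ) ≤ y + 1 := by
    have : y / q ≤ y := Nat.div_le_self _ _
    have h : B ≤ y + 1 := by omega
    exact_mod_cast h
  have hlq : 0 ≤ Real.log q := Real.log_nonneg hq1
  have hharm : ∑ b ∈ Finset.range B, (((b + 1 : ℕ) : ℝ))⁻¹ ≤ 1 + Real.log (y + 1) := by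
    have := harmonic_le_one_add_log B
    have e : (harmonic B : ℝ) = ∑ b ∈ Finset.range B, (((b + 1 : ℕ) : ℝ))⁻¹ := by
      simp [harmonic]
    rw [e] at this
    have h0 : (0 : ℝ) < B := by simp only [B]; positivity
    linarith [Real.log_le_log h0 hBy]
  calc ∑ d ∈ Finset.Ioc 0 y, g d ≤ ∑ d ∈ Finset.Ioc 0 (0 + B * q), g d :=
        Finset.sum_le_sum_of_subset_of_nonneg (Finset.Ioc_subset_Ioc_right hyB)
          fun _ _ _ => norm_nonneg _
    _ ≤ _ := h1
    _ = B * (6 * q + 6 + 3 * q * (1 + Real.log q)) +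
        36 * (N / q) * ∑ b ∈ Finset.range B, (((b + 1 : ℕ) : ℝ))⁻¹ := by
      rw [Finset.mul_sum, ← nsmul_eq_mul, ← Finset.card_range B, ← Finset.sum_const,
        Finset.card_range, ← Finset.sum_add_distrib]
      refine Finset.sum_congr rfl fun b _ => ?_
      field_simp; ring
    _ ≤ B * (12 * q + 3 * q * (1 + Real.log q)) + 36 * (N / q) * (1 + Real.log (y + 1)) := by
      gcongr; linarith
    _ = B * q * (15 + 3 * Real.log q) + 36 * (N / q) * (1 + Real.log (y + 1)) := by ring
    _ ≤ _ := by gcongr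

theorem norm_cellSum_sq_le {q : ℕ} {a : ℤ} {α z : ℝ} (hq : 0 < q) (haq : IsCoprime a q)
    (hα : |α - a / q| ≤ 1 / q ^ 2) (hz : 2 ≤ z) (N j i : ℕ) {f g : ℕ → ℂ}
    (hf : ∀ m, ‖f m‖ ≤ 1) (hg : ∀ l, ‖g l‖ ≤ 1) :
    ‖cellSum z N α j i f g‖ ^ 2 ≤ (2 ^ j * 2 ^ i) * (6 * (2 ^ j * 2 ^ i) / q + 6 * 2 ^ j +
      3 * (2 ^ i + q) * (1 + Real.log q)) := by
  have hq' : (0 : ℝ) < q := by exact_mod_cast hq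
  have hlq : 0 ≤ Real.log q := Real.log_natCast_nonneg q
  have hcard : ∀ i, ((dyadicRough z i).card : ℝ) ≤ 2 ^ i := fun i => by
    have h1 : (dyadicRough z i).card ≤ 2 ^ (i + 1) - 1 - (2 ^ i - 1) :=
      (Finset.card_filter_le _ _).trans (Nat.card_Ioc _ _).le
    have h2 : 2 ^ (i + 1) - 1 - (2 ^ i - 1) = 2 ^ i := by
      rw [pow_succ]; have := Nat.one_le_two_pow (n := i); omega
    rw [h2] at h1
    exact_mod_cast h1
  set A' := Finset.Ioc (2 ^ j - 1) (2 ^ (j + 1) - 1)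
  have hsq := norm_bilinear_sq_le (dyadicRough z j) (dyadicRough z i)
    (fun m l => N < m * l ∧ m * l ≤ 4 * N) f g hf hg α A' (Finset.filter_subset _ _)
  set row : ℝ := 6 * (2 ^ j * 2 ^ i) / q + 6 * 2 ^ j + 3 * (2 ^ i + q) * (1 + Real.log q)
  have hrow : ∀ l ∈ dyadicRough z i, ∑ l' ∈ dyadicRough z i,
      ‖∑ m ∈ A' with (N < m * l ∧ m * l ≤ 4 * N) ∧ (N < m * l' ∧ m * l' ≤ 4 * N),
        eC (m * (((l : ℤ) - l' : ℤ) * α))‖ ≤ row := by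
    intro l hl
    set U : ℕ → ℕ := fun l' => max (2 ^ j - 1) (max (N / l) (N / l'))
    set V : ℕ → ℕ := fun l' => min (2 ^ (j + 1) - 1) (min (4 * N / l) (4 * N / l'))
    set G : ℕ → ℝ := fun l' => ‖∑ m ∈ Finset.Ioc (U l') (V l'), eC (m * (((l : ℤ) - l' : ℤ) * α))‖
    have e1 : ∀ l' ∈ dyadicRough z i,
        ‖∑ m ∈ A' with (N < m * l ∧ m * l ≤ 4 * N) ∧ (N < m * l' ∧ m * l' ≤ 4 * N),
          eC (m * (((l : ℤ) - l' : ℤ) * α))‖ = G l' := by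
      intro l' hl'
      have := filter_mul_mem_Ioc N (2 ^ j - 1) (2 ^ (j + 1) - 1)
        ((mem_dyadicRough.1 hl).2.pos hz) ((mem_dyadicRough.1 hl').2.pos hz) (fun _ => True)
      simp only [Finset.filter_true] at this
      simp only [A', this, G, U, V]
    rw [Finset.sum_congr rfl e1]
    set B := 2 ^ i / q + 1
    have hB : 2 ^ i ≤ B * q := by
      have := Nat.lt_div_mul_add hq (a := 2 ^ i)
      simp only [B]; nlinarith
    have h1 := sum_blocks_le hq haq hα (-(l * α)) (2 ^ i - 1) B (g := G)
      (M := fun _ => 2 ^ j) (fun b => by positivity) ?_ ?_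
    rotate_left
    · intro b _ k _
      refine (norm_sum_Ioc_eC_le_card _ _ _).trans ?_
      have h1 : U k ≥ 2 ^ j - 1 := le_max_left _ _
      have h2 : V k ≤ 2 ^ (j + 1) - 1 := min_le_left _ _
      have h3 : V k - U k ≤ 2 ^ j := by
        rw [pow_succ] at h2; have := Nat.one_le_two_pow (n := j); omega
      exact_mod_cast h3
    · intro k
      have h1 := norm_sum_Ioc_eC_mul_le (U k) (V k) (((l : ℤ) - k : ℤ) * α)
      have h2 : ((k * α + -(l * α) : ℝ) : UnitAddCircle) =
          -((((l : ℤ) - k : ℤ) * α : ℝ) : UnitAddCircle) := by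
        rw [← AddCircle.coe_neg]; congr 1; push_cast; ring
      rw [h2, norm_neg]
      exact h1
    have hB1 : (B : ℝ) * q ≤ 2 ^ i + q := by
      have := Nat.div_mul_le_self (2 ^ i) q
      have h : B * q ≤ 2 ^ i + q := by simp only [B]; nlinarith
      exact_mod_cast h
    have hB2 : (B : ℝ) ≤ 2 ^ i / q + 1 := by
      rw [div_add_one hq'.ne', le_div_iff₀ hq']; exact hB1
    calc ∑ l' ∈ dyadicRough z i, G l' ≤ ∑ l' ∈ Finset.Ioc (2 ^ i - 1) (2 ^ i - 1 + B * q), G l' := by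
          refine Finset.sum_le_sum_of_subset_of_nonneg ?_ fun _ _ _ => norm_nonneg _
          refine (Finset.filter_subset _ _).trans (Finset.Ioc_subset_Ioc_right ?_)
          rw [pow_succ]; have := Nat.one_le_two_pow (n := i); omega
      _ ≤ _ := h1
      _ = B * (6 * 2 ^ j) + 3 * (B * q) * (1 + Real.log q) := by
        rw [Finset.sum_const, Finset.card_range, nsmul_eq_mul]; ring
      _ ≤ (2 ^ i / q + 1) * (6 * 2 ^ j) + 3 * (2 ^ i + q) * (1 + Real.log q) := by gcongr
      _ = row := by simp only [row]; ring
  have hrow0 : 0 ≤ row := by positivity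
  calc _ ≤ _ := hsq
    _ ≤ (2 ^ j) * (2 ^ i * row) := by
      refine mul_le_mul (hcard j) ?_ (Finset.sum_nonneg fun _ _ => Finset.sum_nonneg fun _ _ =>
        norm_nonneg _) (by positivity)
      refine (Finset.sum_le_sum hrow).trans ?_
      rw [Finset.sum_const, nsmul_eq_mul]
      exact mul_le_mul_of_nonneg_right (hcard i) hrow0
    _ = _ := by ring

end MinorArcs

section MinorArcs
open Real

theorem eventually_log_pow_le {k : ℕ} {s c : ℝ} (hs : 0 < s) (hc : 0 < c) :
    ∀ᶠ N : ℕ in atTop, Real.log N ^ k ≤ c * (N : ℝ) ^ s := by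
  have a1 := (isLittleO_log_rpow_rpow_atTop (s := s) k hs).bound hc
  filter_upwards [tendsto_natCast_atTop_atTop.eventually a1] with N h
  rw [Real.norm_of_nonneg (Real.rpow_nonneg (Real.log_natCast_nonneg N) _),
    Real.norm_of_nonneg (by positivity)] at h
  exact_mod_cast h

set_option maxHeartbeats 800000 in
/-- The prime exponential sum at a frequency whose rational approximation has a denominator
that is neither small nor large. -/
theorem norm_primeExpSum_minor_le : ∃ C : ℝ, 0 < C ∧ ∀ᶠ N : ℕ in atTop, ∀ (q : ℕ) (a : ℤ) (α : ℝ),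
    0 < q → IsCoprime a q → |α - a / q| ≤ 1 / q ^ 2 → Real.log N ^ 8 ≤ q → q ≤ N / Real.log N ^ 8 →
    ‖primeExpSum N α‖ ≤ C * N * Real.log N ^ (-(3 / 4) : ℝ) := by
  obtain ⟨C₁, hC₁, H₁⟩ := norm_sum_rough_le_sum_dvd
  obtain ⟨C₂, hC₂, H₂⟩ := card_rough_le
  have e1 : ∀ᶠ N : ℕ in atTop, Real.log N ^ 8 ≤ 1 / 2 * (N : ℝ) ^ (1 / 2 : ℝ) :=
    eventually_log_pow_le (by norm_num) (by norm_num)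
  have e3 : ∀ᶠ N : ℕ in atTop, 1 ≤ Real.log N :=
    (Real.tendsto_log_atTop.comp tendsto_natCast_atTop_atTop).eventually_ge_atTop 1
  have e4 : ∀ᶠ N : ℕ in atTop, 1 + 8 * Real.log (Real.log N) ≤ Real.log N ^ (1 / 4 : ℝ) := by
    have h : ∀ᶠ L : ℝ in atTop, 1 + 8 * Real.log L ≤ L ^ (1 / 4 : ℝ) := by
      have a1 := (isLittleO_log_rpow_atTop (r := 1 / 4) (by norm_num)).bound
        (c := 1 / 16) (by norm_num)
      have a2 := (tendsto_rpow_atTop (y := 1 / 4) (by norm_num)).eventually_ge_atTop 2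
      filter_upwards [a1, a2, eventually_ge_atTop 1] with L h1 h2 h3
      rw [Real.norm_of_nonneg (Real.log_nonneg h3), Real.norm_of_nonneg (by positivity)] at h1
      linarith
    exact (Real.tendsto_log_atTop.comp tendsto_natCast_atTop_atTop).eventually h
  refine ⟨8 + 950 + (110 + 3 * C₁) + 768 * C₂, by positivity, ?_⟩
  filter_upwards [exists_sieveRange, e1, e3, e4, eventually_ge_atTop 4] with N hex he1 he3 he4 hN4
    q a α hq haq hα hLq hqN
  set L := Real.log N
  have hL0 : 0 < L := by linarith
  have hN0 : (0 : ℝ) < N := by positivity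
  have hN1 : (1 : ℝ) ≤ N := by exact_mod_cast (by omega : 1 ≤ N)
  have hq' : (0 : ℝ) < q := by exact_mod_cast hq
  have hL1 : ∀ k : ℕ, 1 ≤ L ^ k := fun k => one_le_pow₀ he3
  obtain ⟨s, z, hS, hzN, hLz, -⟩ := hex (L ^ 8) (hL1 8) le_rfl
  have hz2 : 2 ≤ z := le_trans (by norm_num) hS.le_z
  have hz0 := hS.z_pos
  have hlogz := hS.log_pos
  have hzL : L ^ 8 ≤ z := (le_self_pow₀ (hL1 8) (by norm_num)).trans hS.pow_le_z
  have hqN' : (q : ℝ) ≤ N := hqN.trans (div_le_self hN0.le (hL1 8))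
  have hlq : Real.log q ≤ L := Real.log_le_log hq' hqN'
  have hlq0 : 0 ≤ Real.log q := Real.log_natCast_nonneg q
  have hhalf : (N : ℝ) ^ (1 / 2 : ℝ) * (N : ℝ) ^ (1 / 2 : ℝ) = N := by
    rw [← Real.rpow_add hN0]; norm_num
  have hh0 : 0 < (N : ℝ) ^ (1 / 2 : ℝ) := by positivity
  have hroot : 2 * (N : ℝ) ^ (1 / 2 : ℝ) ≤ N / L ^ 8 := by
    rw [le_div_iff₀ (by positivity)]
    nlinarith
  have hsqrt : √(N : ℝ) = (N : ℝ) ^ (1 / 2 : ℝ) := Real.sqrt_eq_rpow _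
  have hdiv : ∀ k, k ≤ 8 → (N : ℝ) / L ^ 8 * L ^ k = N / L ^ (8 - k) := fun k hk => by
    rw [div_mul_eq_mul_div, div_eq_div_iff (by positivity) (by positivity), mul_assoc, ← pow_add]
    congr 2; omega
  have hdivle : ∀ k, 1 ≤ k → (N : ℝ) / L ^ k ≤ N / L := fun k hk => by
    gcongr
    exact le_self_pow₀ he3 (by omega)
  have hNL : (N : ℝ) / L ≤ N * L ^ (-(3 / 4) : ℝ) := by
    rw [div_eq_mul_inv, ← Real.rpow_neg_one]
    gcongr
    norm_num
  -- the bilinear part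
  have hB : ‖primeExpSum N α - roughExpSum z N α‖ ≤ (8 + 950) * (N * L ^ (-(3 / 4) : ℝ)) := by
    refine (norm_primeExpSum_sub_roughExpSum_le (E := 19 * N / L ^ 3) hz2 hzN (by positivity) _
      fun i j f g hij h1 h2 h3 hf hg => ?_).trans ?_
    · refine abs_le_of_sq_le_sq' ?_ (by positivity) |>.2
      have hMD : (2 : ℝ) ^ j * 2 ^ i ≤ 4 * N := by
        rw [← pow_add, add_comm j]; exact_mod_cast h2
      have hDM : (2 : ℝ) ^ i ≤ 2 ^ j := pow_le_pow_right₀ (by norm_num) hij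
      have hD0 : (0 : ℝ) < 2 ^ i := by positivity
      have hD : (2 : ℝ) ^ i ≤ N / L ^ 8 := by
        refine le_trans ?_ hroot
        refine abs_le_of_sq_le_sq' ?_ (by positivity) |>.2
        calc ((2 : ℝ) ^ i) ^ 2 = 2 ^ i * 2 ^ i := sq _
          _ ≤ 2 ^ j * 2 ^ i := by gcongr
          _ ≤ 4 * N := hMD
          _ = 4 * ((N : ℝ) ^ (1 / 2 : ℝ) * (N : ℝ) ^ (1 / 2 : ℝ)) := by rw [hhalf]
          _ = _ := by ring
      have hM : (2 : ℝ) ^ j ≤ 8 * (N / L ^ 8) := by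
        rw [← mul_div_assoc, le_div_iff₀ (by positivity)]
        calc (2 : ℝ) ^ j * L ^ 8 ≤ 2 ^ j * (2 * 2 ^ i) := by gcongr; exact hzL.trans h3
          _ = 2 * (2 ^ j * 2 ^ i) := by ring
          _ ≤ 2 * (4 * N) := by gcongr
          _ = _ := by ring
      have hMDq : 6 * ((2 : ℝ) ^ j * 2 ^ i) / q ≤ 24 * (N / L ^ 8) := by
        calc 6 * ((2 : ℝ) ^ j * 2 ^ i) / q ≤ 6 * (4 * N) / L ^ 8 := by gcongr
          _ = _ := by ring
      have hX : 0 ≤ N / L ^ 8 := by positivity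
      calc _ ≤ _ := norm_cellSum_sq_le hq haq hα hz2 N j i hf hg
        _ ≤ (4 * N) * (24 * (N / L ^ 8) + 6 * (8 * (N / L ^ 8)) +
            3 * (N / L ^ 8 + N / L ^ 8) * (1 + L)) := by gcongr
        _ ≤ (4 * N) * (84 * (N / L ^ 8 * L ^ 1)) := by
          have := mul_nonneg hX (sub_nonneg.2 he3)
          gcongr; linarith only [this]
        _ = 336 * (N ^ 2 / L ^ 7) := by rw [hdiv 1 (by norm_num)]; ring
        _ ≤ 361 * (N ^ 2 / L ^ 6) := by
          gcongr
          · norm_num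
          · norm_num
        _ = (19 * N / L ^ 3) ^ 2 := by ring
    · have h1 : √(4 * N : ℝ) = 2 * √N := by
        rw [Real.sqrt_mul (by norm_num), show (4 : ℝ) = 2 ^ 2 by norm_num,
          Real.sqrt_sq (by norm_num)]
      have hl4 : 0 ≤ Real.log (4 * N) := Real.log_nonneg (by linarith)
      have h2 : √(N : ℝ) * L ≤ N / L := by
        calc √(N : ℝ) * L ≤ (N / L ^ 8) * L ^ 1 := by
              rw [pow_one, hsqrt]; gcongr; linarith
          _ = N / L ^ 7 := hdiv 1 (by norm_num)
          _ ≤ _ := hdivle 7 (by norm_num)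
      calc _ ≤ 2 * (2 * √N) * (2 * L) + 5 * (5 * L) * ((2 * L) * (19 * N / L ^ 3)) := by
            rw [h1]; gcongr
            · exact log_four_mul_le hN4
            · exact natLog_two_add_one_le hN4
            · exact log_four_mul_le hN4
        _ = 8 * (√N * L) + 950 * (N / L) := by field_simp; ring
        _ ≤ 8 * (N / L) + 950 * (N / L) := by gcongr
        _ = (8 + 950) * (N / L) := by ring
        _ ≤ _ := by gcongr
  -- the linear part
  have hsum : ‖∑ n ∈ (Finset.Ioc N (4 * N)).filter (IsRough z), eC (n * α)‖ ≤
      (110 + 3 * C₁) * (N / L ^ 7) := by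
    have hlev7 : z ^ (4 * s + 7) ≤ (N : ℝ) ^ (1 / 2 : ℝ) :=
      hS.level.trans (Real.rpow_le_rpow_of_exponent_le hN1 (by norm_num))
    have hlev6 : z ^ (4 * s + 6) ≤ (N : ℝ) ^ (1 / 2 : ℝ) :=
      (pow_le_pow_right₀ (by linarith) (by omega)).trans hlev7
    set y := ⌊z ^ (4 * s + 6)⌋₊
    have hy : (y : ℝ) ≤ (N : ℝ) ^ (1 / 2 : ℝ) := (Nat.floor_le (by positivity)).trans hlev6
    have hNL8 : (N : ℝ) / L ^ 8 ≤ N := div_le_self hN0.le (hL1 8)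
    have hh1 : 1 ≤ (N : ℝ) ^ (1 / 2 : ℝ) := Real.one_le_rpow hN1 (by norm_num)
    have hy1 : (y : ℝ) + 1 ≤ N := by linarith
    have hly : Real.log (y + 1) ≤ L := Real.log_le_log (by positivity) hy1
    have hly0 : 0 ≤ Real.log ((y : ℝ) + 1) := Real.log_nonneg (by linarith [(Nat.cast_nonneg y : (0 : ℝ) ≤ y)])
    have hX : 0 ≤ N / L ^ 8 := by positivity
    have hyX : (y : ℝ) ≤ N / L ^ 8 := by linarith
    have hqX : (N : ℝ) / q ≤ N / L ^ 8 := by gcongr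
    have h7 : N / L ^ 8 * L = N / L ^ 7 := by
      have := hdiv 1 (by norm_num)
      rwa [pow_one] at this
    have h87 : N / L ^ 8 ≤ N / L ^ 7 := by rw [← h7]; exact le_mul_of_one_le_right hX he3
    have h2s : C₁ / 2 ^ s * ((4 * N : ℕ) - N : ℝ) ≤ 3 * C₁ * (N / L ^ 7) := by
      have h1 : L ^ 7 ≤ 2 ^ s := by
        refine le_trans ?_ hS.sq_le
        rw [← pow_mul]
        exact pow_le_pow_right₀ he3 (by norm_num)
      calc C₁ / 2 ^ s * ((4 * N : ℕ) - N : ℝ) = 3 * C₁ * (N / 2 ^ s) := by push_cast; ring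
        _ ≤ _ := by gcongr
    have hmain := sum_norm_sum_dvd_le hq haq hα N y
    have hmain' : (y + q) * (15 + 3 * Real.log q) + 36 * (N / q) * (1 + Real.log (y + 1)) ≤
        108 * (N / L ^ 7) := by
      calc _ ≤ (N / L ^ 8 + N / L ^ 8) * (15 + 3 * L) + 36 * (N / L ^ 8) * (1 + L) := by gcongr
        _ ≤ 108 * (N / L ^ 8 * L) := by linarith only [mul_nonneg hX (sub_nonneg.2 he3)]
        _ = _ := by rw [h7]
    calc _ ≤ _ := H₁ s z N (4 * N) α hz2 (by omega)
      _ ≤ 108 * (N / L ^ 7) + 3 * C₁ * (N / L ^ 7) + 2 * (N / L ^ 7) :=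
        add_le_add (add_le_add (hmain.trans hmain') h2s) (by linarith)
      _ = _ := by ring
  have hcard : (((Finset.Ioc N (4 * N)).filter (IsRough z)).card : ℝ) ≤
      C₂ * (3 * N / Real.log z) := by
    refine H₂ z _ _ _ hS.le_z (by push_cast; linarith) ?_
    have : z ^ (1 / 2 : ℝ) ≤ z ^ (1 : ℝ) :=
      Real.rpow_le_rpow_of_exponent_le hS.one_lt_z.le (by norm_num)
    rw [Real.rpow_one] at this
    linarith
  have hT : ‖roughExpSum z N α‖ ≤ (110 + 3 * C₁) * (N * L ^ (-(3 / 4) : ℝ)) +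
      768 * C₂ * (N * L ^ (-(3 / 4) : ℝ)) := by
    refine (norm_roughExpSum_le z (by omega) _).trans (add_le_add ?_ ?_)
    · calc L * _ ≤ L * ((110 + 3 * C₁) * (N / L ^ 7)) := by gcongr
        _ = (110 + 3 * C₁) * (N / L ^ 6) := by field_simp
        _ ≤ (110 + 3 * C₁) * (N / L) := by
          have := hdivle 6 (by norm_num)
          gcongr
        _ ≤ _ := by gcongr
    · have hLz' : L / Real.log z ≤ 128 * L ^ (1 / 4 : ℝ) := by
        rw [div_le_iff₀ hlogz]
        refine hLz.trans ?_
        gcongr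
        rw [Real.log_pow]
        exact_mod_cast he4
      calc 2 * (((Finset.Ioc N (4 * N)).filter (IsRough z)).card : ℝ)
          ≤ 2 * (C₂ * (3 * N / Real.log z)) := by gcongr
        _ = 6 * C₂ * N * (L / Real.log z) * L⁻¹ := by field_simp; ring
        _ ≤ 6 * C₂ * N * (128 * L ^ (1 / 4 : ℝ)) * L⁻¹ := by gcongr
        _ = 768 * C₂ * (N * (L ^ (1 / 4 : ℝ) * L ^ (-1 : ℝ))) := by rw [Real.rpow_neg_one]; ring
        _ = _ := by rw [← Real.rpow_add hL0]; norm_num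
  have h := norm_le_norm_sub_add (primeExpSum N α) (roughExpSum z N α)
  refine h.trans ((add_le_add hB hT).trans (le_of_eq ?_))
  ring

end MinorArcs

section Parseval
open Real ComplexConjugate

theorem eC_eq_one_iff {x : ℝ} : eC x = 1 ↔ ∃ n : ℤ, x = n := by
  rw [eC, Complex.exp_eq_one_iff]
  refine exists_congr fun n => ?_
  have h : (2 * π * Complex.I : ℂ) ≠ 0 := Complex.two_pi_I_ne_zero
  rw [show (2 * π * x * Complex.I : ℂ) = x * (2 * π * Complex.I) by ring, mul_left_inj' h]
  norm_cast

theorem sum_range_eC_div {M : ℕ} (hM : 0 < M) (x : ℤ) :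
    ∑ n ∈ Finset.range M, eC (n * (x / M)) = if (M : ℤ) ∣ x then (M : ℂ) else 0 := by
  have hM' : (M : ℝ) ≠ 0 := by exact_mod_cast hM.ne'
  simp only [eC_natCast_mul]
  split_ifs with h
  · obtain ⟨y, rfl⟩ := h
    have : eC (((M * y : ℤ) : ℝ) / M) = 1 := by
      rw [← eC_intCast y]; congr 1; push_cast; field_simp
    simp only [this, one_pow, Finset.sum_const, Finset.card_range, nsmul_eq_mul, mul_one]
  · have h1 : eC ((x : ℝ) / M) ≠ 1 := by
      rw [Ne, eC_eq_one_iff]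
      rintro ⟨n, hn⟩
      rw [div_eq_iff hM'] at hn
      exact h ⟨n, by rw [mul_comm]; exact_mod_cast hn⟩
    rw [geom_sum_eq h1, ← eC_natCast_mul, mul_div_cancel₀ _ hM', eC_intCast, sub_self, zero_div]

/-- Parseval's identity on `ℤ / M`, for coefficients supported on a set injecting into it. -/
theorem sum_range_norm_sq_sum_eC {M : ℕ} (hM : 0 < M) {K : Finset ℕ}
    (hK : ∀ k ∈ K, ∀ k' ∈ K, (M : ℤ) ∣ k - k' → k = k') (u : ℕ → ℂ) :
    ∑ n ∈ Finset.range M, ‖∑ k ∈ K, u k * eC (n * (k / M))‖ ^ 2 = M * ∑ k ∈ K, ‖u k‖ ^ 2 := by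
  have h1 : ∀ n : ℕ, ((‖∑ k ∈ K, u k * eC (n * (k / M))‖ ^ 2 : ℝ) : ℂ) =
      ∑ k ∈ K, ∑ k' ∈ K, u k * conj (u k') * eC (n * (((k - k' : ℤ) : ℝ) / M)) := by
    intro n
    rw [← Complex.normSq_eq_norm_sq, Complex.normSq_eq_conj_mul_self, mul_comm, map_sum,
      Finset.sum_mul_sum]
    refine Finset.sum_congr rfl fun k _ => Finset.sum_congr rfl fun k' _ => ?_
    rw [map_mul, conj_eC, show (n : ℝ) * (((k - k' : ℤ) : ℝ) / M) = n * (k / M) + -(n * (k' / M)) by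
      push_cast; ring, eC_add]
    ring
  have h2 : ((∑ n ∈ Finset.range M, ‖∑ k ∈ K, u k * eC (n * (k / M))‖ ^ 2 : ℝ) : ℂ) =
      ((M * ∑ k ∈ K, ‖u k‖ ^ 2 : ℝ) : ℂ) := by
    rw [Complex.ofReal_sum, Finset.sum_congr rfl fun n _ => h1 n, Finset.sum_comm]
    rw [Complex.ofReal_mul, Complex.ofReal_sum, Finset.mul_sum]
    refine Finset.sum_congr rfl fun k hk => ?_
    rw [Finset.sum_comm]
    simp only [← Finset.mul_sum, sum_range_eC_div hM]
    rw [Finset.sum_eq_single k]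
    · rw [sub_self, if_pos (dvd_zero _), ← Complex.normSq_eq_norm_sq, ← Complex.mul_conj]
      push_cast; ring
    · intro k' hk' hne
      rw [if_neg fun h => hne (hK k hk k' hk' h).symm, mul_zero]
    · exact fun h => absurd hk h
  exact_mod_cast h2

/-- Parseval's identity restricted to the multiples of `d`. -/
theorem sum_range_filter_dvd_norm_sq_sum_eC {M d : ℕ} (hM : 0 < M) (hd : d ∣ M) {K : Finset ℕ}
    (hK : ∀ k ∈ K, ∀ k' ∈ K, ((M / d : ℕ) : ℤ) ∣ k - k' → k = k') (u : ℕ → ℂ) :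
    ∑ n ∈ (Finset.range M).filter (d ∣ ·), ‖∑ k ∈ K, u k * eC (n * (k / M))‖ ^ 2 =
      M / d * ∑ k ∈ K, ‖u k‖ ^ 2 := by
  obtain ⟨m, rfl⟩ := hd
  have hd0 : 0 < d := Nat.pos_of_mul_pos_right hM
  have hm0 : 0 < m := Nat.pos_of_mul_pos_left hM
  rw [Nat.mul_div_cancel_left _ hd0] at hK
  have hd' : (d : ℝ) ≠ 0 := by exact_mod_cast hd0.ne'
  have hm' : (m : ℝ) ≠ 0 := by exact_mod_cast hm0.ne'
  have h := sum_range_norm_sq_sum_eC hm0 hK u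
  rw [show ((d * m : ℕ) : ℝ) / d = m by push_cast; field_simp, ← h]
  symm
  refine Finset.sum_nbij (d * ·) ?_ ?_ ?_ ?_
  · intro n hn
    simp only [Finset.mem_filter, Finset.mem_range] at hn ⊢
    exact ⟨Nat.mul_lt_mul_of_pos_left hn hd0, dvd_mul_right _ _⟩
  · intro a _ b _ hab
    exact Nat.eq_of_mul_eq_mul_left hd0 hab
  · rintro n hn
    simp only [Finset.coe_filter, Finset.mem_range, Set.mem_ofPred_eq] at hn
    obtain ⟨hn, y, rfl⟩ := hn
    exact ⟨y, by simpa using Nat.lt_of_mul_lt_mul_left hn, rfl⟩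
  · intro n _
    refine congrArg (fun z : ℂ => ‖z‖ ^ 2) (Finset.sum_congr rfl fun k _ => ?_)
    congr 2
    push_cast
    field_simp

end Parseval

section MajorArcs
open Real ComplexConjugate

/-- The point `α` lies within `Q / N` of a fraction with denominator at most `Q`. -/
def IsMajorArc (N : ℕ) (Q α : ℝ) : Prop :=
  ∃ (q : ℕ) (a : ℤ), 0 < q ∧ (q : ℝ) ≤ Q ∧ |α - a / q| ≤ Q / N

noncomputable instance (N : ℕ) (Q : ℝ) : DecidablePred (IsMajorArc N Q) := fun _ =>
  Classical.propDecidable _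

theorem coprime_of_forall_prime_gt {d q : ℕ} {Q : ℝ} (hd : ∀ p, p.Prime → p ∣ d → Q < p)
    (hq : 0 < q) (hqQ : (q : ℝ) ≤ Q) : d.Coprime q := by
  by_contra h
  obtain ⟨p, hp, h1, h2⟩ := Nat.Prime.not_coprime_iff_dvd.1 h
  have : (p : ℝ) ≤ q := by exact_mod_cast Nat.le_of_dvd hq h2
  exact absurd (hd p hp h1) (not_lt.2 (this.trans hqQ))

/-- Major-arc points of `(1/M)ℤ` are distinct modulo `1/d` when `d` has no small prime factor. -/
theorem eq_of_isMajorArc_of_dvd_sub {N M d k k' : ℕ} {Q : ℝ} (hM : 0 < M) (hdM : d ∣ M)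
    (hd : ∀ p, p.Prime → p ∣ d → Q < p) (hN : 2 * Q ^ 3 * d < N)
    (hk : k < M) (hk' : k' < M) (h1 : IsMajorArc N Q (k / M)) (h2 : IsMajorArc N Q (k' / M))
    (h : ((M / d : ℕ) : ℤ) ∣ (k : ℤ) - k') : k = k' := by
  obtain ⟨q, a, hq, hqQ, ha⟩ := h1
  obtain ⟨q', a', hq', hqQ', ha'⟩ := h2
  obtain ⟨m, rfl⟩ := hdM
  have hd0 : 0 < d := Nat.pos_of_mul_pos_right hM
  have hm0 : 0 < m := Nat.pos_of_mul_pos_left hM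
  rw [Nat.mul_div_cancel_left _ hd0] at h
  obtain ⟨b, hb⟩ := h
  have hqr : (0 : ℝ) < q := by exact_mod_cast hq
  have hqr' : (0 : ℝ) < q' := by exact_mod_cast hq'
  have hdr : (0 : ℝ) < d := by exact_mod_cast hd0
  have hmr : (0 : ℝ) < m := by exact_mod_cast hm0
  have hQ : 0 < Q := hqr.trans_le hqQ
  have hNr : (0 : ℝ) < N := lt_of_le_of_lt (by positivity) hN
  have hbr : (k : ℝ) - k' = m * b := by exact_mod_cast hb
  set x : ℤ := b * (q * q') - d * (a * q' - a' * q) with hx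
  have hxr : (x : ℝ) = (d * q * q') * ((k / ((d * m : ℕ) : ℝ) - a / q) -
      (k' / ((d * m : ℕ) : ℝ) - a' / q')) := by
    have : (k : ℝ) = k' + m * b := by linarith
    rw [hx, this]; push_cast; field_simp; ring
  have hx1 : |(x : ℝ)| < 1 := by
    rw [hxr, abs_mul, abs_of_pos (by positivity)]
    calc _ ≤ (d * q * q') * (Q / N + Q / N) := by
          gcongr; exact (abs_sub _ _).trans (add_le_add ha ha')
      _ ≤ (d * Q * Q) * (Q / N + Q / N) := by gcongr
      _ = (2 * Q ^ 3 * d) / N := by ring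
      _ < 1 := (div_lt_one hNr).2 hN
  have hx0 : x = 0 := by
    rw [← Int.abs_lt_one_iff]; exact_mod_cast hx1
  have hdvd : (d : ℤ) ∣ b := by
    have hc : IsCoprime (d : ℤ) ((q : ℤ) * q') :=
      IsCoprime.mul_right (Nat.isCoprime_iff_coprime.2 (coprime_of_forall_prime_gt hd hq hqQ))
        (Nat.isCoprime_iff_coprime.2 (coprime_of_forall_prime_gt hd hq' hqQ'))
    exact hc.dvd_of_dvd_mul_right ⟨a * q' - a' * q, by linarith⟩
  obtain ⟨c, rfl⟩ := hdvd
  have : (k : ℤ) - k' = 0 := by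
    refine Int.eq_zero_of_abs_lt_dvd (m := ((d * m : ℕ) : ℤ)) ⟨c, by rw [hb]; push_cast; ring⟩ ?_
    rw [abs_lt]; constructor <;> omega
  omega

theorem sum_sq_log_primes_le {N : ℕ} (hN : 4 ≤ N) :
    ∑ p ∈ (Finset.Ioc N (4 * N)).filter Nat.Prime, Real.log p ^ 2 ≤ 16 * (N * Real.log N) := by
  have hl : 0 ≤ Real.log N := Real.log_natCast_nonneg N
  have h4 : Real.log 4 ≤ 2 := by
    rw [show (4 : ℝ) = 2 ^ 2 by norm_num, Real.log_pow]; have := Real.log_two_lt_d9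
    push_cast; linarith
  calc _ ≤ ∑ p ∈ (Finset.Ioc N (4 * N)).filter Nat.Prime, 2 * Real.log N * Real.log p := by
        refine Finset.sum_le_sum fun p hp => ?_
        simp only [Finset.mem_filter, Finset.mem_Ioc] at hp
        rw [sq]
        refine mul_le_mul_of_nonneg_right (le_trans (Real.log_le_log ?_ ?_) (log_four_mul_le hN))
          (Real.log_natCast_nonneg p)
        · exact_mod_cast hp.2.pos
        · exact_mod_cast hp.1.2
    _ = 2 * Real.log N * ∑ p ∈ (Finset.Ioc N (4 * N)).filter Nat.Prime, Real.log p := by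
        rw [Finset.mul_sum]
    _ ≤ 2 * Real.log N * Chebyshev.theta (4 * N : ℕ) := by
        gcongr
        rw [Chebyshev.theta_eq_sum_primesLE_log]
        refine Finset.sum_le_sum_of_subset_of_nonneg (fun p hp => ?_)
          fun p _ _ => Real.log_natCast_nonneg p
        simp only [Finset.mem_filter, Finset.mem_Ioc] at hp
        exact Nat.mem_primesLE.2 ⟨hp.1.2, hp.2⟩
    _ ≤ 2 * Real.log N * (2 * (4 * N : ℕ)) := by
        gcongr
        exact (Chebyshev.theta_le_log4_mul_x (by positivity)).trans (by gcongr)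
    _ = _ := by push_cast; ring

/-- Large-sieve-type inequality on the major arcs, from an upper-bound sieve. -/
theorem sum_norm_sq_primes_le : ∃ C : ℝ, 0 < C ∧ ∀ (N M : ℕ) (z Q : ℝ) (K : Finset ℕ) (u : ℕ → ℂ),
    2 ≤ z → z ≤ N → 4 * N < M → (∀ d, 0 < d → d ≤ N → d ∣ M) → 2 * Q ^ 3 * z ^ 6 < N →
    0 < Q → z ^ 6 ≤ N → (∀ k ∈ K, k < M ∧ IsMajorArc N Q (k / M)) →
    ∑ p ∈ (Finset.Ioc N (4 * N)).filter Nat.Prime, ‖∑ k ∈ K, u k * eC (p * (k / M))‖ ^ 2 ≤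
      C * M * sieveDensity ((Nat.primesLE ⌊z⌋₊).filter fun p : ℕ => Q < p) *
        ∑ k ∈ K, ‖u k‖ ^ 2 := by
  obtain ⟨C, hC, H⟩ := fundamental_lemma
  refine ⟨1 + C, by positivity, fun N M z Q K u hz hzN hNM hM hQN hQ hzN6 hK => ?_⟩
  set P := (Nat.primesLE ⌊z⌋₊).filter fun p : ℕ => Q < p
  have hM0 : 0 < M := by omega
  have hP : ∀ p ∈ P, p.Prime := fun p hp => (Nat.mem_primesLE.1 (Finset.mem_filter.1 hp).1).2
  have hPQ : ∀ p ∈ P, Q < p := fun p hp => (Finset.mem_filter.1 hp).2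
  have hPz : ∀ p ∈ P, (p : ℝ) ≤ z := fun p hp =>
    (Nat.cast_le.2 (Nat.mem_primesLE.1 (Finset.mem_filter.1 hp).1).1).trans
      (Nat.floor_le (by linarith))
  obtain ⟨U, V, hU, -, hUV, hU1, -⟩ := H 0 z P hz hP hPz
  obtain ⟨c, -, hc, hUc⟩ := hU
  set g : ℕ → ℝ := fun n => ‖∑ k ∈ K, u k * eC (n * (k / M))‖ ^ 2
  set B := ∑ k ∈ K, ‖u k‖ ^ 2
  have hB : 0 ≤ B := Finset.sum_nonneg fun _ _ => sq_nonneg _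
  have hg : ∀ n, 0 ≤ g n := fun _ => sq_nonneg _
  set y : ℕ → ℕ → ℝ := fun n p => if p ∣ n then 1 else 0
  have hD : ∀ D ∈ P.powerset, c D * ∑ n ∈ Finset.range M, (∏ p ∈ D, y n p) * g n =
      c D * (M / (∏ p ∈ D, p : ℕ) * B) := by
    intro D hD
    rw [Finset.mem_powerset] at hD
    rcases eq_or_ne (c D) 0 with h0 | h0
    · simp [h0]
    congr 1
    have hDp : ∀ p ∈ D, p.Prime := fun p hp => hP p (hD hp)
    have hDz : ((∏ p ∈ D, p : ℕ) : ℝ) ≤ z ^ 6 := by simpa using hc D hD h0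
    have hDpos : 0 < ∏ p ∈ D, p := Finset.prod_pos fun p hp => (hDp p hp).pos
    have hDM : (∏ p ∈ D, p) ∣ M := hM _ hDpos (by exact_mod_cast hDz.trans hzN6)
    rw [← sum_range_filter_dvd_norm_sq_sum_eC hM0 hDM, Finset.sum_filter]
    · refine Finset.sum_congr rfl fun n _ => ?_
      rw [prod_ite_one_zero]
      simp only [forall_dvd_iff_prod_dvd hDp, g]
      split_ifs <;> simp
    · intro k hk k' hk' h
      refine eq_of_isMajorArc_of_dvd_sub hM0 hDM (fun p hp hpD => ?_) (lt_of_le_of_lt ?_ hQN)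
        (hK k hk).1 (hK k' hk').1 (hK k hk).2 (hK k' hk').2 h
      · obtain ⟨r, hr, hpr⟩ := (hp.prime.dvd_finsetProd_iff _).1 hpD
        rw [(Nat.prime_dvd_prime_iff_eq hp (hDp r hr)).1 hpr]
        exact hPQ r (hD hr)
      · gcongr
  calc _ = ∑ p ∈ (Finset.Ioc N (4 * N)).filter Nat.Prime, (∏ r ∈ P, (1 - y p r)) * g p := by
        refine Finset.sum_congr rfl fun p hp => ?_
        simp only [Finset.mem_filter, Finset.mem_Ioc] at hp
        rw [prod_one_sub_ite, if_pos, one_mul]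
        intro r hr hrp
        rw [Nat.prime_dvd_prime_iff_eq (hP r hr) hp.2] at hrp
        have : (p : ℝ) ≤ N := hrp ▸ (hPz r hr).trans hzN
        exact absurd (Nat.cast_le.1 this) (not_le.2 hp.1.1)
    _ ≤ ∑ n ∈ Finset.range M, (∏ r ∈ P, (1 - y n r)) * g n := by
        refine Finset.sum_le_sum_of_subset_of_nonneg (fun p hp => ?_) fun n _ _ => ?_
        · simp only [Finset.mem_filter, Finset.mem_Ioc] at hp
          exact Finset.mem_range.2 (by omega)
        · rw [prod_one_sub_ite]
          refine mul_nonneg ?_ (hg n)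
          split_ifs <;> norm_num
    _ ≤ ∑ n ∈ Finset.range M, U (y n) * g n := by
        refine Finset.sum_le_sum fun n _ => mul_le_mul_of_nonneg_right ?_ (hg n)
        refine (hUV (y n) (fun p => ?_) fun p => ?_).2 <;> simp only [y] <;> split_ifs <;> norm_num
    _ = ∑ D ∈ P.powerset, c D * ∑ n ∈ Finset.range M, (∏ p ∈ D, y n p) * g n := by
        simp only [hUc, Finset.sum_mul, Finset.mul_sum]
        rw [Finset.sum_comm]
        simp only [mul_assoc]
    _ = M * B * U (fun p => (p : ℝ)⁻¹) := by
        rw [Finset.sum_congr rfl hD, hUc, Finset.mul_sum]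
        refine Finset.sum_congr rfl fun D _ => ?_
        rw [Finset.prod_inv_distrib]; push_cast; ring
    _ ≤ M * B * ((1 + C / 2 ^ 0) * ∏ p ∈ P, (1 - (p : ℝ)⁻¹)) := by gcongr
    _ = _ := by rw [sieveDensity]; ring

theorem sum_norm_sq_primeExpSum_major_le {ε : ℝ} (hε : 0 < ε) : ∃ C : ℝ, 0 < C ∧ ∀ᶠ N : ℕ in atTop,
    ∀ (M : ℕ) (Q : ℝ), 4 * N < M → (∀ d, 0 < d → d ≤ N → d ∣ M) → 1 ≤ Q → Q ≤ Real.log N ^ 8 →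
    ∑ k ∈ (Finset.range M).filter (fun k : ℕ => IsMajorArc N Q (k / M)),
      ‖primeExpSum N (k / M)‖ ^ 2 ≤ C * N * M * Q ^ ε := by
  obtain ⟨C₁, hC₁, H₁⟩ := sum_norm_sq_primes_le
  obtain ⟨C₂, hC₂, H₂⟩ := inv_sieveDensity_primesLE_le_rpow hε
  have e1 : ∀ᶠ N : ℕ in atTop, Real.log N ^ 24 ≤ 1 / 4 * (N : ℝ) ^ (1 / 2 : ℝ) :=
    eventually_log_pow_le (by norm_num) (by norm_num)
  have e1' : ∀ᶠ N : ℕ in atTop, Real.log N ^ 8 ≤ 1 * (N : ℝ) ^ (1 / 24 : ℝ) :=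
    eventually_log_pow_le (by norm_num) (by norm_num)
  have e2 : ∀ᶠ N : ℕ in atTop, (2 : ℝ) ≤ (N : ℝ) ^ (1 / 24 : ℝ) :=
    ((tendsto_rpow_atTop (by norm_num)).comp tendsto_natCast_atTop_atTop).eventually_ge_atTop 2
  refine ⟨16 * C₁ * 24 * C₂, by positivity, ?_⟩
  filter_upwards [e1, e1', e2, eventually_ge_atTop 4] with N e1 e1' e2 e4 M Q hNM hM hQ1 hQ
  have hN4 : (4 : ℝ) ≤ N := by exact_mod_cast e4
  have hN0 : (0 : ℝ) < N := by linarith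
  have hN1 : (1 : ℝ) ≤ N := by linarith
  set L := Real.log N
  have hL : 0 < L := Real.log_pos (by linarith)
  set z := (N : ℝ) ^ (1 / 24 : ℝ) with hz
  have hz6 : z ^ 6 = (N : ℝ) ^ (1 / 4 : ℝ) := by
    rw [hz, ← Real.rpow_natCast, ← Real.rpow_mul hN0.le]; norm_num
  have hzN6 : z ^ 6 ≤ N := by
    rw [hz6]; exact Real.rpow_le_self_of_one_le hN1 (by norm_num)
  have hzN : z ≤ N := Real.rpow_le_self_of_one_le hN1 (by norm_num)
  have hQN : 2 * Q ^ 3 * z ^ 6 < N := by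
    calc 2 * Q ^ 3 * z ^ 6 ≤ 2 * (L ^ 8) ^ 3 * (N : ℝ) ^ (1 / 2 : ℝ) := by
          rw [hz6]; gcongr
          norm_num
      _ = 2 * L ^ 24 * (N : ℝ) ^ (1 / 2 : ℝ) := by ring
      _ ≤ 2 * (1 / 4 * (N : ℝ) ^ (1 / 2 : ℝ)) * (N : ℝ) ^ (1 / 2 : ℝ) := by gcongr
      _ = 1 / 2 * ((N : ℝ) ^ (1 / 2 : ℝ) * (N : ℝ) ^ (1 / 2 : ℝ)) := by ring
      _ = 1 / 2 * N := by rw [← Real.rpow_add hN0]; norm_num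
      _ < N := by linarith
  set K := (Finset.range M).filter (fun k : ℕ => IsMajorArc N Q (k / M)) with hKdef
  set A := (Finset.Ioc N (4 * N)).filter Nat.Prime
  set B := ∑ k ∈ K, ‖primeExpSum N (k / M)‖ ^ 2
  have hB : 0 ≤ B := Finset.sum_nonneg fun _ _ => sq_nonneg _
  set u : ℕ → ℂ := fun k => conj (primeExpSum N (k / M))
  set g : ℕ → ℝ := fun p => ‖∑ k ∈ K, u k * eC (p * (k / M))‖
  have hu : ∑ k ∈ K, ‖u k‖ ^ 2 = B := Finset.sum_congr rfl fun k _ => by rw [RCLike.norm_conj]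
  set P := (Nat.primesLE ⌊z⌋₊).filter fun p : ℕ => Q < p
  have hP : ∀ p ∈ P, p.Prime := fun p hp => (Nat.mem_primesLE.1 (Finset.mem_filter.1 hp).1).2
  have hbound := H₁ N M z Q K u e2 hzN hNM hM hQN (by linarith) hzN6 fun k hk => by
    simpa [hKdef] using hk
  rw [hu] at hbound
  have hdual : B ≤ ∑ p ∈ A, Real.log p * g p := by
    have h1 : (B : ℂ) = ∑ p ∈ A, (Real.log p : ℂ) * ∑ k ∈ K, u k * eC (p * (k / M)) := by
      simp only [B, Complex.ofReal_sum, Finset.mul_sum]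
      rw [Finset.sum_comm]
      refine Finset.sum_congr rfl fun k _ => ?_
      rw [← Complex.normSq_eq_norm_sq, Complex.normSq_eq_conj_mul_self]
      conv_lhs => rw [primeExpSum]
      rw [Finset.mul_sum]
      refine Finset.sum_congr rfl fun p _ => ?_
      simp only [u, primeExpSum]; ring
    have h2 : B = ‖(B : ℂ)‖ := by rw [Complex.norm_real, Real.norm_of_nonneg hB]
    rw [h2, h1]
    refine (norm_sum_le _ _).trans (le_of_eq (Finset.sum_congr rfl fun p _ => ?_))
    rw [norm_mul, Complex.norm_real, Real.norm_of_nonneg (Real.log_natCast_nonneg p)]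
  have hdens : L * sieveDensity P ≤ 24 * C₂ * Q ^ ε := by
    have hQf : ⌊Q⌋₊ ≠ 0 := (Nat.floor_pos.2 hQ1).ne'
    have hQz : ⌊Q⌋₊ ≤ ⌊z⌋₊ := Nat.floor_le_floor (hQ.trans (by linarith))
    have hun : Nat.primesLE ⌊z⌋₊ = P ∪ Nat.primesLE ⌊Q⌋₊ := by
      ext p
      simp only [P, Finset.mem_union, Finset.mem_filter, Nat.mem_primesLE]
      have : Q < p ↔ ⌊Q⌋₊ < p := (Nat.floor_lt (by linarith)).symm
      rw [this]
      constructor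
      · rintro ⟨h1, h2⟩
        rcases lt_or_ge ⌊Q⌋₊ p with h | h
        · exact Or.inl ⟨⟨h1, h2⟩, h⟩
        · exact Or.inr ⟨h, h2⟩
      · rintro (⟨h, -⟩ | ⟨h1, h2⟩)
        · exact h
        · exact ⟨h1.trans hQz, h2⟩
    have hdisj : Disjoint P (Nat.primesLE ⌊Q⌋₊) := by
      rw [Finset.disjoint_left]
      intro p hp hp'
      have h1 := (Finset.mem_filter.1 hp).2
      have h2 : (p : ℝ) ≤ ⌊Q⌋₊ := Nat.cast_le.2 (Nat.mem_primesLE.1 hp').1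
      exact absurd (h2.trans (Nat.floor_le (by linarith))) (not_le.2 h1)
    have hposQ : 0 < sieveDensity (Nat.primesLE ⌊Q⌋₊) :=
      sieveDensity_pos fun p hp => (Nat.mem_primesLE.1 hp).2
    have h1 := log_mul_sieveDensity_primesLE_le ⌊z⌋₊
    rw [hun, sieveDensity_union hdisj] at h1
    have h2 : L = 24 * Real.log z := by
      rw [hz, Real.log_rpow hN0]; ring
    have h3 : Real.log z ≤ Real.log (⌊z⌋₊ + 1) :=
      Real.log_le_log (by linarith) (Nat.lt_floor_add_one z).le
    have hpos := sieveDensity_pos hP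
    calc L * sieveDensity P
        = 24 * (Real.log z * (sieveDensity P * sieveDensity (Nat.primesLE ⌊Q⌋₊))) *
          (sieveDensity (Nat.primesLE ⌊Q⌋₊))⁻¹ := by rw [h2]; field_simp
      _ ≤ 24 * 1 * (C₂ * (⌊Q⌋₊ : ℝ) ^ ε) := by
          gcongr
          · exact le_trans (by gcongr) h1
          · exact H₂ _ hQf
      _ ≤ 24 * 1 * (C₂ * Q ^ ε) := by gcongr; exact Nat.floor_le (by linarith)
      _ = _ := by ring
  have hsq : B * B ≤ (16 * (N * L)) * (C₁ * M * sieveDensity P * B) := by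
    calc B * B ≤ (∑ p ∈ A, Real.log p * g p) ^ 2 := by rw [← sq]; gcongr
      _ ≤ (∑ p ∈ A, Real.log p ^ 2) * ∑ p ∈ A, g p ^ 2 := Finset.sum_mul_sq_le_sq_mul_sq _ _ _
      _ ≤ _ := by
        gcongr
        exact sum_sq_log_primes_le e4
  rcases hB.eq_or_lt with h0 | h0
  · rw [← h0]; positivity
  have h5 : B ≤ 16 * (N * L) * (C₁ * M * sieveDensity P) :=
    le_of_mul_le_mul_right (hsq.trans (le_of_eq (by ring))) h0
  calc B ≤ 16 * N * C₁ * M * (L * sieveDensity P) := h5.trans (le_of_eq (by ring))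
    _ ≤ 16 * N * C₁ * M * (24 * C₂ * Q ^ ε) := by gcongr
    _ = _ := by ring

end MajorArcs

section FourthMoment
open Real

theorem IsMajorArc.mono {N : ℕ} {Q Q' α : ℝ} (h : IsMajorArc N Q α) (hQ : Q ≤ Q') :
    IsMajorArc N Q' α := by
  obtain ⟨q, a, hq, hqQ, ha⟩ := h
  exact ⟨q, a, hq, hqQ.trans hQ, ha.trans (by gcongr)⟩

theorem sum_norm_sq_primeExpSum_le {N M : ℕ} (hN : 4 ≤ N) (hM : 4 * N < M) :
    ∑ k ∈ Finset.range M, ‖primeExpSum N (k / M)‖ ^ 2 ≤ 16 * (N * Real.log N) * M := by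
  have hM0 : 0 < M := by omega
  have h := sum_range_norm_sq_sum_eC hM0 (K := (Finset.Ioc N (4 * N)).filter Nat.Prime)
    (fun p hp p' hp' h => ?_) fun p => (Real.log p : ℂ)
  · have h1 : ∀ k : ℕ, primeExpSum N (k / M) = ∑ p ∈ (Finset.Ioc N (4 * N)).filter Nat.Prime,
        (Real.log p : ℂ) * eC (k * (p / M)) := fun k =>
      Finset.sum_congr rfl fun p _ => by congr 2; ring
    simp only [h1, h]
    rw [mul_comm]
    gcongr
    refine le_trans (le_of_eq (Finset.sum_congr rfl fun p _ => ?_)) (sum_sq_log_primes_le hN)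
    rw [Complex.norm_real, Real.norm_eq_abs, sq_abs]
  · simp only [Finset.mem_filter, Finset.mem_Ioc] at hp hp'
    have := Int.eq_zero_of_abs_lt_dvd h (by rw [abs_lt]; constructor <;> omega)
    omega

/-- Pointwise bounds for the exponential sum over primes, from Dirichlet approximation. -/
theorem norm_primeExpSum_le_or : ∃ C : ℝ, 0 < C ∧ ∀ᶠ N : ℕ in atTop, ∀ α : ℝ,
    ‖primeExpSum N α‖ ≤ C * N * Real.log N ^ (-(3 / 4) : ℝ) ∨
    ∃ R : ℝ, 1 ≤ R ∧ R ≤ Real.log N ^ 8 ∧ IsMajorArc N R α ∧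
      ‖primeExpSum N α‖ ≤ C * N * R ^ (-(1 / 32) : ℝ) := by
  obtain ⟨C₁, hC₁, H₁⟩ := norm_primeExpSum_le
  obtain ⟨C₂, hC₂, H₂⟩ := norm_primeExpSum_minor_le
  have e1 : ∀ᶠ N : ℕ in atTop, Real.log N ^ 8 ≤ 1 * (N : ℝ) ^ (1 : ℝ) :=
    eventually_log_pow_le (by norm_num) (by norm_num)
  have e3 : ∀ᶠ N : ℕ in atTop, 1 ≤ Real.log N :=
    (Real.tendsto_log_atTop.comp tendsto_natCast_atTop_atTop).eventually_ge_atTop 1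
  refine ⟨C₁ + C₂, by positivity, ?_⟩
  filter_upwards [H₁, H₂, e1, e3, eventually_gt_atTop 0] with N H₁ H₂ e1 e3 hN α
  rw [one_mul, Real.rpow_one] at e1
  have hN0 : (0 : ℝ) < N := by exact_mod_cast hN
  set L := Real.log N
  have hL0 : 0 < L := by linarith
  set n := ⌊N / L ^ 8⌋₊
  have hn : 0 < n := Nat.floor_pos.2 ((one_le_div (by positivity)).2 e1)
  obtain ⟨r, hr, hrn⟩ := Real.exists_rat_abs_sub_le_and_den_le α hn
  set q := r.den
  have hq : 0 < q := r.den_pos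
  have hq0 : (0 : ℝ) < q := by exact_mod_cast hq
  have hqn : (q : ℝ) ≤ N / L ^ 8 := (Nat.cast_le.2 hrn).trans (Nat.floor_le (by positivity))
  have hcop : IsCoprime r.num q := by
    rw [Int.isCoprime_iff_gcd_eq_one]; exact r.reduced
  rw [show (r : ℝ) = r.num / q from Rat.cast_def r] at hr
  have hα : |α - r.num / q| ≤ L ^ 8 / (N * q) := by
    refine hr.trans ?_
    have : N / L ^ 8 ≤ (n : ℝ) + 1 := (Nat.lt_floor_add_one _).le
    calc (1 : ℝ) / ((n + 1) * q) ≤ 1 / ((N / L ^ 8) * q) := by gcongr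
      _ = _ := by field_simp
  rcases le_or_gt (L ^ 8) q with h | h
  · left
    have hα' : |α - r.num / q| ≤ 1 / q ^ 2 := by
      refine hα.trans ?_
      rw [div_le_div_iff₀ (by positivity) (by positivity)]
      rw [le_div_iff₀ (by positivity)] at hqn
      calc L ^ 8 * (q : ℝ) ^ 2 = (q * L ^ 8) * q := by ring
        _ ≤ (N : ℝ) * q := by gcongr
        _ = _ := by ring
    refine (H₂ q r.num α hq hcop hα' h hqn).trans ?_
    gcongr; linarith
  · right
    set β := α - r.num / q
    set R := q * max 1 (N * |β|) with hR
    have hq1 : (1 : ℝ) ≤ q := by exact_mod_cast hq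
    have hqR : q ≤ R := le_mul_of_one_le_right hq0.le (le_max_left _ _)
    have hβ : N * q * |β| ≤ L ^ 8 := by
      rw [le_div_iff₀ (by positivity)] at hα
      linarith
    have hRL : R ≤ L ^ 8 := by
      rw [hR, mul_max_of_nonneg _ _ hq0.le, mul_one]
      exact max_le h.le (le_trans (le_of_eq (by ring)) hβ)
    refine ⟨R, hq1.trans hqR, hRL, ⟨q, r.num, hq, hqR, ?_⟩, ?_⟩
    · change |β| ≤ _
      rw [le_div_iff₀ hN0]
      calc |β| * N ≤ 1 * max 1 (N * |β|) := by rw [mul_comm, one_mul]; exact le_max_right _ _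
        _ ≤ R := by rw [hR]; gcongr
    · have h1 := H₁ q r.num β R hq hcop hR hRL
      rw [show (r.num : ℝ) / q + β = α by simp only [β]; ring] at h1
      refine h1.trans ?_
      have : 0 ≤ R := by linarith
      gcongr; linarith

theorem sum_norm_pow_four_primeExpSum_minor_le {ε : ℝ} (hε : 0 < ε) : ∃ Q : ℕ, 0 < Q ∧
    ∀ᶠ N : ℕ in atTop, ∀ M : ℕ, 4 * N < M → (∀ d, 0 < d → d ≤ N → d ∣ M) →
    ∑ k ∈ (Finset.range M).filter (fun k : ℕ => ¬ IsMajorArc N Q (k / M)),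
      ‖primeExpSum N (k / M)‖ ^ 4 ≤ ε * N ^ 3 * M := by
  obtain ⟨C₁, hC₁, H₁⟩ := norm_primeExpSum_le_or
  obtain ⟨C₂, hC₂, H₂⟩ := sum_norm_sq_primeExpSum_major_le (ε := 1 / 32) (by norm_num)
  set r : ℝ := (2 : ℝ) ^ (-(1 / 32) : ℝ) with hr
  have hr0 : 0 < r := by positivity
  have hr1 : r < 1 := Real.rpow_lt_one_of_one_lt_of_neg (by norm_num) (by norm_num)
  have hr1' : 0 < 1 - r := by linarith
  have hrr : ∀ n : ℕ, ((2 : ℝ) ^ n) ^ (-(1 / 16) : ℝ) * ((2 : ℝ) ^ (n + 1)) ^ (1 / 32 : ℝ) ≤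
      2 * r ^ n := by
    intro n
    rw [hr, ← Real.rpow_natCast, ← Real.rpow_natCast, ← Real.rpow_mul (by norm_num),
      ← Real.rpow_mul (by norm_num), ← Real.rpow_natCast, ← Real.rpow_mul (by norm_num),
      ← Real.rpow_add (by norm_num)]
    nth_rewrite 2 [← Real.rpow_one (2 : ℝ)]
    rw [← Real.rpow_add (by norm_num)]
    refine Real.rpow_le_rpow_of_exponent_le (by norm_num) ?_
    push_cast; linarith
  obtain ⟨k₀, hk₀⟩ := exists_pow_lt_of_lt_one
    (show 0 < ε / 2 / (C₁ ^ 2 * C₂ * 2 / (1 - r)) by positivity) hr1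
  rw [lt_div_iff₀ (by positivity)] at hk₀
  have e2 : ∀ᶠ N : ℕ in atTop, C₁ ^ 2 * 16 * Real.log N ^ (-(1 / 2) : ℝ) ≤ ε / 2 := by
    have h1 : Tendsto (fun N : ℕ => C₁ ^ 2 * 16 * Real.log N ^ (-(1 / 2) : ℝ)) atTop
        (nhds (C₁ ^ 2 * 16 * 0)) :=
      ((tendsto_rpow_neg_atTop (by norm_num)).comp
        (Real.tendsto_log_atTop.comp tendsto_natCast_atTop_atTop)).const_mul _
    rw [mul_zero] at h1
    exact h1.eventually_le_const (by positivity)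
  refine ⟨2 ^ k₀, by positivity, ?_⟩
  filter_upwards [H₁, H₂, e2, eventually_ge_atTop 4,
    (Real.tendsto_log_atTop.comp tendsto_natCast_atTop_atTop).eventually_ge_atTop 1]
    with N H₁ H₂ e2 hN4 hL1 M hNM hM
  simp only [Function.comp_apply] at hL1
  set L := Real.log N
  have hL0 : 0 < L := by linarith
  have hN0 : (0 : ℝ) < N := by exact_mod_cast (show 0 < N by omega)
  set s : ℕ → ℝ := fun k => ‖primeExpSum N (k / M)‖
  have hs : ∀ k, 0 ≤ s k := fun k => norm_nonneg _
  set J := ⌊L ^ 8⌋₊ + 1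
  set T : ℕ → ℝ := fun n => min (2 ^ (n + 1)) (L ^ 8)
  have hpt : ∀ k : ℕ, ¬ IsMajorArc N ((2 ^ k₀ : ℕ) : ℝ) (k / M) → s k ^ 4 ≤
      C₁ ^ 2 * N ^ 2 * (L ^ (-(3 / 2) : ℝ) * s k ^ 2) + ∑ n ∈ Finset.Ico k₀ J,
        C₁ ^ 2 * N ^ 2 * ((2 : ℝ) ^ n) ^ (-(1 / 16) : ℝ) *
          (if IsMajorArc N (T n) (k / M) then s k ^ 2 else 0) := by
    intro k hk
    have hnn : ∀ n ∈ Finset.Ico k₀ J, 0 ≤ C₁ ^ 2 * N ^ 2 * ((2 : ℝ) ^ n) ^ (-(1 / 16) : ℝ) *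
        (if IsMajorArc N (T n) (k / M) then s k ^ 2 else 0) := by
      intro n _
      have : 0 ≤ if IsMajorArc N (T n) (k / M) then s k ^ 2 else 0 := by
        split_ifs; exacts [sq_nonneg _, le_rfl]
      positivity
    rcases H₁ (k / M) with h | ⟨R, hR1, hRL, hRm, h⟩
    · refine le_add_of_le_of_nonneg ?_ (Finset.sum_nonneg hnn)
      calc s k ^ 4 = s k ^ 2 * s k ^ 2 := by ring
        _ ≤ (C₁ * N * L ^ (-(3 / 4) : ℝ)) ^ 2 * s k ^ 2 := by gcongr
        _ = _ := by
          rw [mul_pow, mul_pow, ← Real.rpow_natCast (L ^ (-(3 / 4) : ℝ)), ← Real.rpow_mul hL0.le]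
          norm_num; ring
    · refine le_add_of_nonneg_of_le (by positivity) ?_
      obtain ⟨n, hn1, hn2⟩ := exists_nat_pow_near hR1 (one_lt_two (α := ℝ))
      have hkn : k₀ ≤ n := by
        by_contra hlt
        refine hk (hRm.mono (hn2.le.trans ?_))
        push_cast
        exact pow_le_pow_right₀ (by norm_num) (by omega)
      have hnJ : n < J := by
        have : n ≤ ⌊L ^ 8⌋₊ := Nat.le_floor (by
          have : (n : ℝ) ≤ 2 ^ n := by exact_mod_cast (Nat.lt_two_pow_self).le
          linarith)
        omega
      refine le_trans ?_ (Finset.single_le_sum hnn (Finset.mem_Ico.2 ⟨hkn, hnJ⟩))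
      rw [if_pos (hRm.mono (le_min hn2.le hRL))]
      calc s k ^ 4 = s k ^ 2 * s k ^ 2 := by ring
        _ ≤ (C₁ * N * R ^ (-(1 / 32) : ℝ)) ^ 2 * s k ^ 2 := by gcongr
        _ = C₁ ^ 2 * N ^ 2 * R ^ (-(1 / 16) : ℝ) * s k ^ 2 := by
          rw [mul_pow, mul_pow, ← Real.rpow_natCast (R ^ (-(1 / 32) : ℝ)),
            ← Real.rpow_mul (by linarith)]
          norm_num
        _ ≤ _ := by
          have := Real.rpow_le_rpow_of_nonpos (by positivity) hn1
            (show (-(1 / 16) : ℝ) ≤ 0 by norm_num)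
          gcongr
  have hmaj : ∀ n, C₁ ^ 2 * N ^ 2 * ((2 : ℝ) ^ n) ^ (-(1 / 16) : ℝ) *
      ∑ k ∈ Finset.range M, (if IsMajorArc N (T n) (k / M) then s k ^ 2 else 0) ≤
      C₁ ^ 2 * C₂ * 2 * N ^ 3 * M * r ^ n := by
    intro n
    rw [← Finset.sum_filter]
    have hT1 : 1 ≤ T n := le_min (one_le_pow₀ (by norm_num)) (one_le_pow₀ hL1)
    calc _ ≤ C₁ ^ 2 * N ^ 2 * ((2 : ℝ) ^ n) ^ (-(1 / 16) : ℝ) *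
          (C₂ * N * M * ((2 : ℝ) ^ (n + 1)) ^ (1 / 32 : ℝ)) := by
          gcongr
          refine (H₂ M (T n) hNM hM hT1 (min_le_right _ _)).trans ?_
          gcongr
          exact min_le_left _ _
      _ = C₁ ^ 2 * C₂ * N ^ 3 * M * (((2 : ℝ) ^ n) ^ (-(1 / 16) : ℝ) *
          ((2 : ℝ) ^ (n + 1)) ^ (1 / 32 : ℝ)) := by ring
      _ ≤ C₁ ^ 2 * C₂ * N ^ 3 * M * (2 * r ^ n) := mul_le_mul_of_nonneg_left (hrr n) (by positivity)
      _ = _ := by ring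
  have hgeom : ∑ n ∈ Finset.Ico k₀ J, r ^ n ≤ r ^ k₀ / (1 - r) :=
    geom_sum_Ico_le_of_lt_one hr0.le hr1
  calc _ ≤ ∑ k ∈ (Finset.range M).filter (fun k : ℕ => ¬ IsMajorArc N (2 ^ k₀ : ℕ) (k / M)), _ :=
        Finset.sum_le_sum fun k hk => hpt k (Finset.mem_filter.1 hk).2
    _ ≤ ∑ k ∈ Finset.range M, _ := by
        refine Finset.sum_le_sum_of_subset_of_nonneg (Finset.filter_subset _ _) fun k _ _ => ?_
        refine add_nonneg (by positivity) (Finset.sum_nonneg fun n _ => mul_nonneg (by positivity) ?_)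
        split_ifs; exacts [sq_nonneg _, le_rfl]
    _ = C₁ ^ 2 * N ^ 2 * (L ^ (-(3 / 2) : ℝ) * ∑ k ∈ Finset.range M, s k ^ 2) +
        ∑ n ∈ Finset.Ico k₀ J, C₁ ^ 2 * N ^ 2 * ((2 : ℝ) ^ n) ^ (-(1 / 16) : ℝ) *
          ∑ k ∈ Finset.range M, (if IsMajorArc N (T n) (k / M) then s k ^ 2 else 0) := by
        rw [Finset.sum_add_distrib, ← Finset.mul_sum, ← Finset.mul_sum, Finset.sum_comm]
        simp only [Finset.mul_sum]
    _ ≤ C₁ ^ 2 * N ^ 2 * (L ^ (-(3 / 2) : ℝ) * (16 * (N * L) * M)) +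
        ∑ n ∈ Finset.Ico k₀ J, C₁ ^ 2 * C₂ * 2 * N ^ 3 * M * r ^ n := by
        refine add_le_add ?_ (Finset.sum_le_sum fun n _ => hmaj n)
        gcongr
        exact sum_norm_sq_primeExpSum_le hN4 hNM
    _ = (C₁ ^ 2 * 16 * L ^ (-(1 / 2) : ℝ)) * (N ^ 3 * M) +
        C₁ ^ 2 * C₂ * 2 * N ^ 3 * M * ∑ n ∈ Finset.Ico k₀ J, r ^ n := by
        rw [← Finset.mul_sum, show (-(1 / 2) : ℝ) = -(3 / 2) + 1 by norm_num, Real.rpow_add hL0,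
          Real.rpow_one]
        ring
    _ ≤ ε / 2 * (N ^ 3 * M) + C₁ ^ 2 * C₂ * 2 * N ^ 3 * M * (r ^ k₀ / (1 - r)) := by gcongr
    _ = ε / 2 * (N ^ 3 * M) + (r ^ k₀ * (C₁ ^ 2 * C₂ * 2 / (1 - r))) * (N ^ 3 * M) := by ring
    _ ≤ ε / 2 * (N ^ 3 * M) + ε / 2 * (N ^ 3 * M) := by gcongr
    _ = _ := by ring

end FourthMoment

section LocalCount
open Nat

theorem totient_factorial_eq (n : ℕ) : (φ (n !) : ℝ) = n ! * sieveDensity n.primesLE := by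
  have hpf : (n !).primeFactors = n.primesLE := by
    ext p
    rw [Nat.mem_primeFactors, Nat.mem_primesLE]
    exact ⟨fun h => ⟨(h.1.dvd_factorial).1 h.2.1, h.1⟩,
      fun h => ⟨h.2, (h.2.dvd_factorial).2 h.1, n.factorial_ne_zero⟩⟩
  have h := congrArg (fun x : ℚ => (x : ℝ)) (Nat.totient_eq_mul_prod_factors (n !))
  rw [hpf] at h
  push_cast at h
  exact h

/-- The normalised local factor at `p` in the binary additive problem. -/
noncomputable def localFactor (p : ℕ) : ℝ := if p = 2 then 2 else 1 - 1 / ((p : ℝ) - 1) ^ 2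

theorem one_add_inv_le_prod_localFactor {n : ℕ} (hn : 2 ≤ n) :
    n / ((n : ℝ) - 1) ≤ ∏ p ∈ n.primesLE, localFactor p := by
  induction n, hn using Nat.le_induction with
  | base =>
    rw [show Nat.primesLE 2 = {2} by decide]
    norm_num [localFactor]
  | succ n hn ih =>
    have hn' : (2 : ℝ) ≤ n := by exact_mod_cast hn
    have h1 : 0 < (n : ℝ) - 1 := by linarith
    rw [Nat.primesLE_succ]
    split_ifs with hp
    · rw [Finset.prod_insert (fun h => by have := (Nat.mem_primesLE.1 h).1; omega), localFactor,
        if_neg (by omega)]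
      have h2 : 0 ≤ 1 - 1 / ((n + 1 : ℕ) - 1 : ℝ) ^ 2 := by
        rw [sub_nonneg, div_le_one (by push_cast; nlinarith)]
        push_cast; nlinarith
      refine le_trans (le_of_eq ?_) (mul_le_mul_of_nonneg_left ih h2)
      push_cast
      rw [add_sub_cancel_right]
      field_simp
      ring
    · refine le_trans ?_ ih
      rw [div_le_div_iff₀ (by push_cast; linarith) h1]
      push_cast
      nlinarith

/-- Residues modulo `p` avoiding `0` and `m`. -/
def goodResidues (m p : ℕ) : Finset ℕ := (Finset.range p).filter fun b => b ≠ 0 ∧ b ≠ m % p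

theorem mul_localFactor_le_card_goodResidues {m p : ℕ} (hm : Even m) (hp : p.Prime) :
    p * (1 - (p : ℝ)⁻¹) ^ 2 * localFactor p ≤ (goodResidues m p).card := by
  have hp2 : (2 : ℝ) ≤ p := by exact_mod_cast hp.two_le
  rcases eq_or_ne p 2 with rfl | h2
  · have : goodResidues m 2 = {1} := by
      ext b
      simp only [goodResidues, Finset.mem_filter, Finset.mem_range, Finset.mem_singleton]
      have := Nat.even_iff.1 hm
      omega
    rw [this]
    norm_num [localFactor]
  · have h3 : (3 : ℝ) ≤ p := by exact_mod_cast (lt_of_le_of_ne hp.two_le (Ne.symm h2))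
    have h1 : p - 2 ≤ (goodResidues m p).card := by
      have : goodResidues m p = (Finset.range p) \ {0, m % p} := by
        ext b; simp [goodResidues]
      rw [this]
      refine le_trans ?_ (Finset.le_card_sdiff _ _)
      rw [Finset.card_range]
      exact Nat.sub_le_sub_left Finset.card_le_two _
    refine le_trans (le_of_eq ?_) ((Nat.cast_le (α := ℝ)).2 h1)
    rw [Nat.cast_sub hp.two_le, localFactor, if_neg h2]
    have : (p : ℝ) - 1 ≠ 0 := by linarith
    field_simp
    push_cast; ring

theorem card_good_ge (Q m : ℕ) (hQ : 2 ≤ Q) (hm : Even m) :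
    (∏ p ∈ Q.primesLE, p : ℕ) * sieveDensity Q.primesLE ^ 2 ≤
      (((Finset.range (∏ p ∈ Q.primesLE, p)).filter fun a =>
        ∀ p ∈ Q.primesLE, a % p ∈ goodResidues m p).card : ℝ) := by
  have hP : ∀ p ∈ Q.primesLE, p.Prime := fun p hp => (Nat.mem_primesLE.1 hp).2
  have h1 : (Q.primesLE.pi (goodResidues m)).card ≤
      ((Finset.range (∏ p ∈ Q.primesLE, p)).filter fun a =>
        ∀ p ∈ Q.primesLE, a % p ∈ goodResidues m p).card := by
    refine Finset.card_le_card_of_surjOn (fun a p _ => a % p) fun f hf => ?_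
    rw [Finset.mem_coe, Finset.mem_pi] at hf
    classical
    set g : ℕ → ℕ := fun p => if h : p ∈ Q.primesLE then f p h else 0
    have hs : ∀ p ∈ Q.primesLE, (fun p : ℕ => p) p ≠ 0 := fun p hp => (hP p hp).ne_zero
    have pp : (Q.primesLE : Set ℕ).Pairwise (Function.onFun Nat.Coprime fun p : ℕ => p) :=
      fun p hp p' hp' h => (Nat.coprime_primes (hP p hp) (hP p' hp')).2 h
    have h2 := (Nat.chineseRemainderOfFinset g (fun p => p) Q.primesLE hs pp).2
    have h3 := Nat.chineseRemainderOfFinset_lt_prod g (fun p => p) hs pp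
    set a : ℕ := (Nat.chineseRemainderOfFinset g (fun p => p) Q.primesLE hs pp : ℕ)
    have h4 : ∀ p (hp : p ∈ Q.primesLE), a % p = f p hp := by
      intro p hp
      have h5 := h2 p hp
      have h6 : g p = f p hp := dif_pos hp
      have h7 : f p hp < p := by
        have := hf p hp
        simp only [goodResidues, Finset.mem_filter, Finset.mem_range] at this
        exact this.1
      rw [h6, Nat.ModEq, Nat.mod_eq_of_lt h7] at h5
      exact h5
    refine ⟨a, ?_, ?_⟩
    · simp only [Finset.coe_filter, Finset.mem_range, Set.mem_ofPred_eq]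
      exact ⟨h3, fun p hp => by rw [h4 p hp]; exact hf p hp⟩
    · funext p hp
      exact h4 p hp
  have h2 : (1 : ℝ) ≤ ∏ p ∈ Q.primesLE, localFactor p := by
    refine le_trans ?_ (one_add_inv_le_prod_localFactor hQ)
    have : (2 : ℝ) ≤ Q := by exact_mod_cast hQ
    rw [one_le_div (by linarith)]; linarith
  refine le_trans ?_ ((Nat.cast_le (α := ℝ)).2 h1)
  rw [Finset.card_pi]
  push_cast
  have h0 : 0 ≤ (∏ p ∈ Q.primesLE, (p : ℝ)) * sieveDensity Q.primesLE ^ 2 := by positivity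
  refine (le_mul_of_one_le_right h0 h2).trans ?_
  rw [sieveDensity, ← Finset.prod_pow, ← Finset.prod_mul_distrib, ← Finset.prod_mul_distrib]
  refine Finset.prod_le_prod (fun p hp => ?_) fun p hp =>
    mul_localFactor_le_card_goodResidues hm (hP p hp)
  have : (2 : ℝ) ≤ p := by exact_mod_cast (hP p hp).two_le
  have : 0 ≤ localFactor p := by
    rw [localFactor]
    split_ifs
    · norm_num
    · rw [sub_nonneg, div_le_one (by nlinarith)]; nlinarith
  positivity

theorem count_mul_of_periodic {w : ℕ} (π : ℕ → Prop) [DecidablePred π] (h : Function.Periodic π w)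
    (k : ℕ) : Nat.count π (k * w) = k * Nat.count π w := by
  induction k with
  | zero => simp
  | succ k ih =>
    have : (fun j => π (k * w + j)) = π := by
      funext j
      rw [add_comm]
      exact h.nat_mul k j
    rw [Nat.add_mul, Nat.add_mul, Nat.count_add, ih, one_mul, one_mul]
    congr 1
    simp only [this]

/-- In a long interval, `a` and `m - a` are simultaneously coprime to `Q!` as often as expected. -/
theorem card_good_Ico_ge (Q m : ℕ) (hQ : 2 ≤ Q) (hm : Even m) (u k : ℕ) :
    k * (∏ p ∈ Q.primesLE, p : ℕ) * sieveDensity Q.primesLE ^ 2 ≤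
      (((Finset.Ico u (u + k * ∏ p ∈ Q.primesLE, p)).filter fun a =>
        ∀ p ∈ Q.primesLE, a % p ∈ goodResidues m p).card : ℝ) := by
  set w := ∏ p ∈ Q.primesLE, p
  set π : ℕ → Prop := fun a => ∀ p ∈ Q.primesLE, a % p ∈ goodResidues m p
  have hper : Function.Periodic π w := by
    intro a
    refine propext (forall₂_congr fun p hp => ?_)
    obtain ⟨c, hc⟩ : p ∣ w := Finset.dvd_prod_of_mem _ hp
    rw [hc, Nat.add_mul_mod_self_left]
  have hper' : Function.Periodic π (k * w) := hper.nat_mul k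
  rw [Nat.filter_Ico_card_eq_of_periodic _ _ _ hper', count_mul_of_periodic π hper,
    Nat.count_eq_card_filter_range, mul_assoc]
  push_cast
  gcongr
  exact_mod_cast card_good_ge Q m hQ hm

end LocalCount

section Averaging
open Real Polynomial

/-- The generating polynomial of the primes in `(N, 4 * N]` with logarithmic weights. -/
noncomputable def primePoly (N : ℕ) : ℝ[X] :=
  ∑ p ∈ (Finset.Ioc N (4 * N)).filter Nat.Prime, monomial p (Real.log p)

/-- The averaging kernel over `0, W, …, (J - 1) W`. -/
noncomputable def avgPoly (W J : ℕ) : ℝ[X] := C (J : ℝ)⁻¹ * ∑ j ∈ Finset.range J, X ^ (W * j)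

theorem aeval_primePoly (N : ℕ) (α : ℝ) : aeval (eC α) (primePoly N) = primeExpSum N α := by
  rw [primePoly, map_sum, primeExpSum]
  refine Finset.sum_congr rfl fun p _ => ?_
  rw [aeval_monomial, eC_natCast_mul]; rfl

theorem coeff_primePoly (N n : ℕ) : (primePoly N).coeff n =
    if n ∈ (Finset.Ioc N (4 * N)).filter Nat.Prime then Real.log n else 0 := by
  rw [primePoly, finsetSum_coeff]
  simp only [coeff_monomial]
  rw [Finset.sum_ite_eq' _ n fun p : ℕ => Real.log p]

theorem coeff_primePoly_nonneg (N n : ℕ) : 0 ≤ (primePoly N).coeff n := by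
  rw [coeff_primePoly]
  split_ifs
  exacts [Real.log_natCast_nonneg n, le_rfl]

theorem natDegree_primePoly_le (N : ℕ) : (primePoly N).natDegree ≤ 4 * N := by
  refine natDegree_sum_le_of_forall_le _ _ fun p hp => (natDegree_monomial_le _).trans ?_
  simp only [Finset.mem_filter, Finset.mem_Ioc] at hp
  exact hp.1.2

theorem natDegree_avgPoly_le (W J : ℕ) : (avgPoly W J).natDegree ≤ W * J := by
  refine (natDegree_C_mul_le _ _).trans (natDegree_sum_le_of_forall_le _ _ fun j hj => ?_)
  rw [natDegree_X_pow]
  exact Nat.mul_le_mul_left _ (Finset.mem_range.1 hj).le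

theorem sum_range_norm_sq_aeval_eC {M : ℕ} (hM : 0 < M) {P : ℝ[X]} (hP : P.natDegree < M) :
    ∑ k ∈ Finset.range M, ‖aeval (eC (k / M)) P‖ ^ 2 =
      M * ∑ m ∈ Finset.range M, P.coeff m ^ 2 := by
  have h := sum_range_norm_sq_sum_eC hM (K := Finset.range M) (fun k hk k' hk' h => ?_)
    fun m => (P.coeff m : ℂ)
  · have h1 : ∀ k : ℕ, aeval (eC (k / M)) P =
        ∑ m ∈ Finset.range M, (P.coeff m : ℂ) * eC (k * (m / M)) := by
      intro k
      rw [aeval_eq_sum_range' hP]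
      refine Finset.sum_congr rfl fun m _ => ?_
      rw [← eC_natCast_mul, Complex.real_smul]
      congr 2; ring
    simp only [h1, h]
    congr 1
    refine Finset.sum_congr rfl fun m _ => ?_
    rw [Complex.norm_real, Real.norm_eq_abs, sq_abs]
  · rw [Finset.mem_range] at hk hk'
    have := Int.eq_zero_of_abs_lt_dvd h (by rw [abs_lt]; constructor <;> omega)
    omega

theorem aeval_avgPoly (W J : ℕ) (α : ℝ) : aeval (eC α) (avgPoly W J) =
    (J : ℂ)⁻¹ * ∑ j ∈ Finset.range J, eC ((W * j : ℕ) * α) := by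
  rw [avgPoly, map_mul, aeval_C, map_sum]
  simp only [map_pow, aeval_X, eC_natCast_mul, map_inv₀, map_natCast]

theorem norm_aeval_avgPoly_le (W J : ℕ) (α : ℝ) : ‖aeval (eC α) (avgPoly W J)‖ ≤ 1 := by
  rw [aeval_avgPoly, norm_mul, norm_inv, Complex.norm_natCast]
  have : ‖∑ j ∈ Finset.range J, eC ((W * j : ℕ) * α)‖ ≤ J := by
    refine (norm_sum_le _ _).trans (le_of_eq ?_)
    simp [norm_eC]
  calc (J : ℝ)⁻¹ * _ ≤ (J : ℝ)⁻¹ * J := by gcongr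
    _ ≤ 1 := inv_mul_le_one

theorem norm_aeval_avgPoly_sub_one_le {W J N Q : ℕ} {α : ℝ} (hJ : 0 < J)
    (hW : ∀ q, 0 < q → q ≤ Q → q ∣ W) (h : IsMajorArc N Q α) :
    ‖aeval (eC α) (avgPoly W J) - 1‖ ≤ 7 * (W * J * (Q / N)) := by
  obtain ⟨q, a, hq, hqQ, ha⟩ := h
  have hJ0 : (0 : ℝ) < J := by exact_mod_cast hJ
  obtain ⟨w, rfl⟩ := hW q hq (by exact_mod_cast hqQ)
  have hq0 : (q : ℝ) ≠ 0 := by exact_mod_cast hq.ne'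
  have h1 : ∀ j ∈ Finset.range J, ‖eC ((q * w * j : ℕ) * α) - 1‖ ≤
      7 * ((q * w : ℕ) * J * (Q / N)) := by
    intro j hj
    have h2 : eC ((q * w * j : ℕ) * α) = eC ((q * w * j : ℕ) * (α - a / q)) := by
      rw [show ((q * w * j : ℕ) : ℝ) * α = (q * w * j : ℕ) * (α - a / q) + ((w * j * a : ℤ) : ℝ) by
        push_cast; field_simp; ring, eC_add, eC_intCast, mul_one]
    rw [h2]
    refine (norm_eC_sub_one_le _).trans ?_
    rw [abs_mul, abs_of_nonneg (by positivity)]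
    have : (j : ℝ) ≤ J := by exact_mod_cast (Finset.mem_range.1 hj).le
    rw [Nat.cast_mul (q * w) j]
    gcongr
  have h3 : aeval (eC α) (avgPoly (q * w) J) - 1 =
      (J : ℂ)⁻¹ * ∑ j ∈ Finset.range J, (eC ((q * w * j : ℕ) * α) - 1) := by
    rw [aeval_avgPoly, Finset.sum_sub_distrib]
    have : (J : ℂ) ≠ 0 := by exact_mod_cast hJ.ne'
    simp only [Finset.sum_const, Finset.card_range, nsmul_eq_mul, mul_one]
    rw [mul_sub, inv_mul_cancel₀ this]
  rw [h3, norm_mul, norm_inv, Complex.norm_natCast, inv_mul_le_iff₀ hJ0]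
  refine (norm_sum_le _ _).trans ((Finset.sum_le_sum h1).trans (le_of_eq ?_))
  rw [Finset.sum_const, Finset.card_range, nsmul_eq_mul]

theorem coeff_primePoly_mul_avgPoly (N W J n : ℕ) : (primePoly N * avgPoly W J).coeff n =
    (J : ℝ)⁻¹ * ∑ j ∈ Finset.range J,
      if W * j ≤ n then (primePoly N).coeff (n - W * j) else 0 := by
  rw [avgPoly, mul_left_comm, coeff_C_mul, Finset.mul_sum, finsetSum_coeff]
  simp only [coeff_mul_X_pow']

theorem coeff_primePoly_mul_avgPoly_nonneg (N W J n : ℕ) :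
    0 ≤ (primePoly N * avgPoly W J).coeff n := by
  rw [coeff_primePoly_mul_avgPoly]
  refine mul_nonneg (by positivity) (Finset.sum_nonneg fun j _ => ?_)
  split_ifs
  exacts [coeff_primePoly_nonneg _ _, le_rfl]

theorem sum_log_le_coeff {N W J n : ℕ} (hW : 0 < W) (hn : N + W * J ≤ n) (hn4 : n ≤ 4 * N) :
    (J : ℝ)⁻¹ * ∑ p ∈ (Finset.Ioc (n - W * J) n).filter (fun p => p.Prime ∧ p ≡ n [MOD W]),
      Real.log p ≤ (primePoly N * avgPoly W J).coeff n := by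
  rw [coeff_primePoly_mul_avgPoly]
  gcongr
  set B := (Finset.Ioc (n - W * J) n).filter (fun p => p.Prime ∧ p ≡ n [MOD W])
  have hB : ∀ p ∈ B, n - W * J < p ∧ p ≤ n ∧ p.Prime ∧ W * ((n - p) / W) = n - p := by
    intro p hp
    simp only [B, Finset.mem_filter, Finset.mem_Ioc] at hp
    exact ⟨hp.1.1, hp.1.2, hp.2.1, Nat.mul_div_cancel' ((Nat.modEq_iff_dvd' hp.1.2).1 hp.2.2)⟩
  calc ∑ p ∈ B, Real.log p
      = ∑ p ∈ B, (fun j => if W * j ≤ n then (primePoly N).coeff (n - W * j) else 0)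
          ((n - p) / W) := by
        refine Finset.sum_congr rfl fun p hp => ?_
        obtain ⟨h1, h2, h3, h4⟩ := hB p hp
        simp only [h4]
        rw [if_pos (by omega), Nat.sub_sub_self h2, coeff_primePoly, if_pos]
        simp only [Finset.mem_filter, Finset.mem_Ioc]
        exact ⟨⟨by omega, by omega⟩, h3⟩
    _ = ∑ j ∈ B.image fun p => (n - p) / W,
          if W * j ≤ n then (primePoly N).coeff (n - W * j) else 0 := by
        rw [Finset.sum_image]
        intro p hp p' hp' h
        obtain ⟨-, h2, -, h4⟩ := hB p hp
        obtain ⟨-, h2', -, h4'⟩ := hB p' hp'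
        simp only at h
        rw [h] at h4
        omega
    _ ≤ _ := by
        refine Finset.sum_le_sum_of_subset_of_nonneg (fun j hj => ?_) fun j _ _ => ?_
        · obtain ⟨p, hp, rfl⟩ := Finset.mem_image.1 hj
          obtain ⟨h1, h2, -, -⟩ := hB p hp
          rw [Finset.mem_range, Nat.div_lt_iff_lt_mul hW, mul_comm]
          omega
        · split_ifs
          exacts [coeff_primePoly_nonneg _ _, le_rfl]

/-- The averaged prime weight is bounded below on the residues coprime to `W`. -/
theorem exists_le_coeff_primePoly_mul_avgPoly : ∃ c : ℝ, 0 < c ∧ ∀ (W : ℕ) (η : ℝ), 0 < W → 0 < η →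
    η ≤ 1 → ∀ᶠ N : ℕ in atTop, ∀ n, N + W * ⌊η * N / W⌋₊ ≤ n → n ≤ 4 * N → n.Coprime W →
      c * W / W.totient ≤ (primePoly N * avgPoly W ⌊η * N / W⌋₊).coeff n := by
  obtain ⟨c, hc, H⟩ := exists_sum_log_progression_ge
  refine ⟨c / 8, by positivity, fun W η hW hη hη1 => ?_⟩
  have hW0 : (0 : ℝ) < W := by exact_mod_cast hW
  have hev : ∀ᶠ y : ℝ in atTop, ∀ b ∈ (Finset.range W).filter fun b => b.Coprime W,
      c * (η / 8) * y / W.totient ≤ ∑ p ∈ (Finset.Ioc ⌊y⌋₊ ⌊(1 + η / 8) * y⌋₊).filter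
        (fun p => p.Prime ∧ p ≡ b [MOD W]), Real.log p := by
    rw [Filter.eventually_all_finset]
    intro b hb
    exact H W b hW (Finset.mem_filter.1 hb).2 (η / 8) (by positivity) (by linarith)
  obtain ⟨Y, hY⟩ := eventually_atTop.1 hev
  have e1 : ∀ᶠ N : ℕ in atTop, Y ≤ N := tendsto_natCast_atTop_atTop.eventually_ge_atTop Y
  have e2 : ∀ᶠ N : ℕ in atTop, 2 * W / η ≤ N := tendsto_natCast_atTop_atTop.eventually_ge_atTop _
  filter_upwards [e1, e2, eventually_gt_atTop 0] with N e1 e2 hN n hn hn4 hcop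
  have hN0 : (0 : ℝ) < N := by exact_mod_cast hN
  set J := ⌊η * N / W⌋₊
  rw [div_le_iff₀ hη] at e2
  have hJle : (J : ℝ) ≤ η * N / W := Nat.floor_le (by positivity)
  have hJge : η * N / W - 1 < J := by
    have := Nat.lt_floor_add_one (η * N / W); linarith
  have hJ0 : (0 : ℝ) < J := by
    refine lt_of_le_of_lt ?_ hJge
    rw [sub_nonneg, le_div_iff₀ hW0]; linarith
  have hWJ : η * N / 2 ≤ W * J := by
    have : W * (η * N / W - 1) ≤ W * J := by gcongr
    rw [mul_sub, mul_div_cancel₀ _ hW0.ne'] at this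
    linarith
  refine le_trans ?_ (sum_log_le_coeff hW hn hn4)
  have hφ : (0 : ℝ) < W.totient := by exact_mod_cast Nat.totient_pos.2 hW
  have hy : (N : ℝ) ≤ (n - W * J : ℕ) := by exact_mod_cast (by omega : N ≤ n - W * J)
  have h1 := hY (n - W * J : ℕ) (e1.trans hy) (n % W) (by
    simp only [Finset.mem_filter, Finset.mem_range]
    refine ⟨Nat.mod_lt _ hW, ?_⟩
    rw [Nat.Coprime, ← Nat.gcd_rec, Nat.gcd_comm]
    exact hcop)
  rw [Nat.floor_natCast] at h1
  have hsub : ((n - W * J : ℕ) : ℝ) = n - W * J := by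
    rw [Nat.cast_sub (by omega)]; push_cast; rfl
  have hn4' : (n : ℝ) ≤ 4 * N := by exact_mod_cast hn4
  have hup : ⌊(1 + η / 8) * ((n - W * J : ℕ) : ℝ)⌋₊ ≤ n := by
    refine Nat.floor_le_of_le ?_
    rw [hsub]
    have : η / 8 * (n - W * J) ≤ η / 8 * (4 * N) := by
      gcongr; nlinarith
    linarith only [this, hWJ]
  calc c / 8 * W / W.totient ≤ (J : ℝ)⁻¹ * (c * (η / 8) * (n - W * J : ℕ) / W.totient) := by
        rw [le_inv_mul_iff₀ hJ0, mul_div_assoc', div_le_div_iff_of_pos_right hφ]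
        rw [le_div_iff₀ hW0] at hJle
        calc J * (c / 8 * W) = c / 8 * (J * W) := by ring
          _ ≤ c / 8 * (η * N) := by gcongr
          _ ≤ c / 8 * (η * (n - W * J : ℕ)) := by gcongr
          _ = _ := by ring
    _ ≤ _ := by
        gcongr
        refine h1.trans (Finset.sum_le_sum_of_subset_of_nonneg (fun p hp => ?_) fun p _ _ =>
          Real.log_natCast_nonneg p)
        simp only [Finset.mem_filter, Finset.mem_Ioc] at hp ⊢
        exact ⟨⟨hp.1.1, hp.1.2.trans hup⟩, hp.2.1, hp.2.2.trans (Nat.mod_modEq n W)⟩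

end Averaging

section BinaryGoldbach
open Real Polynomial

theorem norm_primeExpSum_le_eight_mul (N : ℕ) (α : ℝ) : ‖primeExpSum N α‖ ≤ 8 * N := by
  have h1 : ‖primeExpSum N α‖ ≤ Chebyshev.theta ((4 * N : ℕ) : ℝ) := by
    rw [Chebyshev.theta, Nat.floor_natCast, primeExpSum]
    refine (norm_sum_le _ _).trans ?_
    refine le_trans (Finset.sum_le_sum (g := fun p : ℕ => Real.log p) fun p _ => ?_)
      (Finset.sum_le_sum_of_subset_of_nonneg ?_ fun p _ _ => Real.log_natCast_nonneg p)
    · rw [norm_mul, norm_eC, mul_one, Complex.norm_real,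
        Real.norm_of_nonneg (Real.log_natCast_nonneg p)]
    · exact Finset.filter_subset_filter _ (Finset.Ioc_subset_Ioc_left (Nat.zero_le _))
  refine h1.trans ((Chebyshev.theta_le_log4_mul_x (Nat.cast_nonneg _)).trans ?_)
  have h4 : Real.log 4 ≤ 2 := by
    rw [show (4 : ℝ) = 2 ^ 2 by norm_num, Real.log_pow]
    have := Real.log_two_lt_d9
    push_cast; linarith
  push_cast
  have : (0 : ℝ) ≤ N := Nat.cast_nonneg N
  nlinarith

theorem coprime_factorial_of_mod_mem_goodResidues {Q m a : ℕ} (ham : a ≤ m)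
    (h : ∀ p ∈ Q.primesLE, a % p ∈ goodResidues m p) :
    a.Coprime Q.factorial ∧ (m - a).Coprime Q.factorial := by
  have key : ∀ p, p.Prime → p ∣ Q.factorial → ¬p ∣ a ∧ ¬p ∣ m - a := by
    intro p hp hpQ
    have h1 := h p (Nat.mem_primesLE.2 ⟨(hp.dvd_factorial).1 hpQ, hp⟩)
    simp only [goodResidues, Finset.mem_filter, Finset.mem_range] at h1
    exact ⟨fun h2 => h1.2.1 (Nat.mod_eq_zero_of_dvd h2),
      fun h2 => h1.2.2 ((Nat.modEq_iff_dvd' ham).2 h2)⟩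
  exact ⟨Nat.coprime_of_dvd fun p hp h1 h2 => (key p hp h2).1 h1,
    Nat.coprime_of_dvd fun p hp h1 h2 => (key p hp h2).2 h1⟩

/-- A polynomial that is large on residues coprime to `Q!` has a square with large coefficients. -/
theorem le_coeff_sq_of_le_coeff {F : ℝ[X]} (hF : ∀ n, 0 ≤ F.coeff n) {Q A B m k : ℕ} {c : ℝ}
    (hc : 0 ≤ c) (hQ : 2 ≤ Q) (hm : Even m) (hmB : m ≤ B)
    (h : ∀ n, A ≤ n → n ≤ B → n.Coprime Q.factorial →
      c * Q.factorial / Q.factorial.totient ≤ F.coeff n)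
    (hk : 2 * A + k * ∏ p ∈ Q.primesLE, p ≤ m + 1) :
    c ^ 2 * (k * ∏ p ∈ Q.primesLE, p : ℕ) ≤ (F ^ 2).coeff m := by
  set w := ∏ p ∈ Q.primesLE, p
  have hφ : (0 : ℝ) < Q.factorial.totient := by
    exact_mod_cast Nat.totient_pos.2 Q.factorial_pos
  have hd : sieveDensity Q.primesLE ≠ 0 :=
    (sieveDensity_pos fun p hp => (Nat.mem_primesLE.1 hp).2).ne'
  have hf : (Q.factorial : ℝ) ≠ 0 := by exact_mod_cast Q.factorial_ne_zero
  set t : ℝ := c * Q.factorial / Q.factorial.totient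
  have ht : t = c / sieveDensity Q.primesLE := by
    simp only [t]
    rw [totient_factorial_eq]
    field_simp
  have ht0 : 0 ≤ t := by positivity
  rw [sq F, coeff_mul, Finset.Nat.sum_antidiagonal_eq_sum_range_succ_mk]
  set G := (Finset.Ico A (A + k * w)).filter fun a => ∀ p ∈ Q.primesLE, a % p ∈ goodResidues m p
  have hcard : k * w * sieveDensity Q.primesLE ^ 2 ≤ (G.card : ℝ) :=
    card_good_Ico_ge Q m hQ hm A k
  calc c ^ 2 * ((k * w : ℕ) : ℝ) = (k * w * sieveDensity Q.primesLE ^ 2) * t ^ 2 := by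
        rw [ht]; push_cast; field_simp
    _ ≤ G.card * t ^ 2 := by gcongr
    _ = ∑ a ∈ G, t ^ 2 := by rw [Finset.sum_const, nsmul_eq_mul]
    _ ≤ ∑ a ∈ G, F.coeff a * F.coeff (m - a) := by
        refine Finset.sum_le_sum fun a ha => ?_
        simp only [G, Finset.mem_filter, Finset.mem_Ico] at ha
        have hcop := coprime_factorial_of_mod_mem_goodResidues (by omega) ha.2
        rw [sq]
        exact mul_le_mul (h a (by omega) (by omega) hcop.1) (h _ (by omega) (by omega) hcop.2) ht0
          (hF a)
    _ ≤ _ := by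
        refine Finset.sum_le_sum_of_subset_of_nonneg (fun a ha => ?_) fun a _ _ =>
          mul_nonneg (hF _) (hF _)
        simp only [G, Finset.mem_filter, Finset.mem_Ico] at ha
        rw [Finset.mem_range]
        omega

theorem coeff_primePoly_sq_eq_zero {N m : ℕ}
    (h : ¬∃ p q, p.Prime ∧ q.Prime ∧ N < p ∧ N < q ∧ p + q = m) : (primePoly N ^ 2).coeff m = 0 := by
  rw [sq, coeff_mul]
  refine Finset.sum_eq_zero fun x hx => ?_
  rw [Finset.HasAntidiagonal.mem_antidiagonal] at hx
  by_contra hne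
  obtain ⟨h1, h2⟩ := mul_ne_zero_iff.1 hne
  rw [coeff_primePoly, ne_eq, ite_eq_right_iff, Classical.not_imp] at h1 h2
  simp only [Finset.mem_filter, Finset.mem_Ioc] at h1 h2
  exact h ⟨x.1, x.2, h1.1.2, h2.1.2, h1.1.1.1, h2.1.1.1, hx⟩

/-- The averaged polynomial approximates the prime polynomial squared in mean square. -/
theorem sum_coeff_sq_sub_sq_le {N M W J Q : ℕ} {η ε C : ℝ} (hN : 0 < N) (hJ : 0 < J) (hη : 0 ≤ η)
    (hWJ : (W : ℝ) * J ≤ η * N) (hW : ∀ q, 0 < q → q ≤ Q → q ∣ W)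
    (hM : 2 * (4 * N + W * J) < M)
    (hminor : ∑ k ∈ (Finset.range M).filter (fun k : ℕ => ¬IsMajorArc N Q (k / M)),
      ‖primeExpSum N (k / M)‖ ^ 4 ≤ ε * N ^ 3 * M)
    (hmajor : ∑ k ∈ (Finset.range M).filter (fun k : ℕ => IsMajorArc N Q (k / M)),
      ‖primeExpSum N (k / M)‖ ^ 2 ≤ C * N * M) :
    ∑ m ∈ Finset.range M,
      ((primePoly N ^ 2).coeff m - ((primePoly N * avgPoly W J) ^ 2).coeff m) ^ 2 ≤
        (16 * ε + 64 * C * (14 * (η * Q)) ^ 2) * N ^ 3 := by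
  have hN0 : (0 : ℝ) < N := by exact_mod_cast hN
  have hM0 : (0 : ℝ) < M := by exact_mod_cast (by omega : 0 < M)
  set D := primePoly N ^ 2 - (primePoly N * avgPoly W J) ^ 2
  have hdeg : D.natDegree < M := by
    refine (natDegree_sub_le _ _).trans_lt (max_lt ?_ ?_)
    · refine natDegree_pow_le.trans_lt ?_
      have := natDegree_primePoly_le N
      omega
    · refine natDegree_pow_le.trans_lt ?_
      have h1 := natDegree_primePoly_le N
      have h2 := natDegree_avgPoly_le W J
      have h3 := natDegree_mul_le (p := primePoly N) (q := avgPoly W J)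
      omega
  have hB := sum_range_norm_sq_aeval_eC (by omega : 0 < M) hdeg
  set κ : ℝ → ℂ := fun α => aeval (eC α) (avgPoly W J)
  have hD : ∀ α : ℝ, ‖aeval (eC α) D‖ ^ 2 =
      ‖primeExpSum N α‖ ^ 4 * (‖κ α - 1‖ * ‖1 + κ α‖) ^ 2 := by
    intro α
    simp only [D, map_sub, map_pow, map_mul, aeval_primePoly]
    rw [show primeExpSum N α ^ 2 - (primeExpSum N α * aeval (eC α) (avgPoly W J)) ^ 2 =
      -(primeExpSum N α ^ 2 * ((κ α - 1) * (1 + κ α))) by simp only [κ]; ring]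
    rw [norm_neg, norm_mul, norm_pow, norm_mul]
    ring
  have hplus : ∀ α : ℝ, ‖1 + κ α‖ ≤ 2 := by
    intro α
    have := norm_add_le 1 (κ α)
    have h2 : ‖κ α‖ ≤ 1 := norm_aeval_avgPoly_le W J α
    rw [norm_one] at this
    linarith
  have hmin : ∑ k ∈ (Finset.range M).filter (fun k : ℕ => ¬IsMajorArc N Q (k / M)),
      ‖aeval (eC (k / M)) D‖ ^ 2 ≤ 16 * (ε * N ^ 3 * M) := by
    refine le_trans (Finset.sum_le_sum fun k hk => ?_)
      ((Finset.mul_sum _ _ _).symm.le.trans (mul_le_mul_of_nonneg_left hminor (by norm_num)))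
    have h2 : ‖κ (k / M) - 1‖ ≤ 2 := by
      have h3 := norm_sub_le (κ (k / M)) 1
      have h4 : ‖κ (k / M)‖ ≤ 1 := norm_aeval_avgPoly_le W J _
      rw [norm_one] at h3
      linarith
    rw [hD, mul_comm]
    refine mul_le_mul_of_nonneg_right ?_ (by positivity)
    calc (‖κ (k / M) - 1‖ * ‖1 + κ (k / M)‖) ^ 2 ≤ (2 * 2) ^ 2 := by
          gcongr
          exact hplus _
      _ = 16 := by norm_num
  have hmaj : ∑ k ∈ (Finset.range M).filter (fun k : ℕ => IsMajorArc N Q (k / M)),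
      ‖aeval (eC (k / M)) D‖ ^ 2 ≤ 64 * N ^ 2 * (14 * (η * Q)) ^ 2 * (C * N * M) := by
    refine le_trans (Finset.sum_le_sum fun k hk => ?_)
      ((Finset.mul_sum _ _ _).symm.le.trans (mul_le_mul_of_nonneg_left hmajor (by positivity)))
    have h1 := norm_aeval_avgPoly_sub_one_le hJ hW (Finset.mem_filter.1 hk).2
    have h2 : ‖κ (k / M) - 1‖ ≤ 7 * (η * Q) := by
      refine h1.trans ?_
      calc 7 * (W * J * (Q / N) : ℝ) ≤ 7 * (η * N * (Q / N)) := by gcongr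
        _ = 7 * (η * Q) := by field_simp
    have h3 : ‖κ (k / M) - 1‖ * ‖1 + κ (k / M)‖ ≤ 7 * (η * Q) * 2 :=
      mul_le_mul h2 (hplus _) (norm_nonneg _) (by positivity)
    rw [hD]
    have h4 := norm_primeExpSum_le_eight_mul N (k / M)
    calc ‖primeExpSum N (k / M)‖ ^ 4 * (‖κ (k / M) - 1‖ * ‖1 + κ (k / M)‖) ^ 2
        ≤ ‖primeExpSum N (k / M)‖ ^ 4 * (7 * (η * Q) * 2) ^ 2 := by gcongr
      _ = ‖primeExpSum N (k / M)‖ ^ 2 * (14 * (η * Q)) ^ 2 * ‖primeExpSum N (k / M)‖ ^ 2 := by ring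
      _ ≤ (8 * N) ^ 2 * (14 * (η * Q)) ^ 2 * ‖primeExpSum N (k / M)‖ ^ 2 := by gcongr
      _ = _ := by ring
  rw [← Finset.sum_filter_add_sum_filter_not _ fun k : ℕ => IsMajorArc N Q (k / M)] at hB
  have hfin : M * ∑ m ∈ Finset.range M, D.coeff m ^ 2 ≤
      M * ((16 * ε + 64 * C * (14 * (η * Q)) ^ 2) * N ^ 3) := by
    rw [← hB]
    refine (add_le_add hmaj hmin).trans (le_of_eq ?_)
    ring
  simp only [D, coeff_sub] at hfin
  exact le_of_mul_le_mul_left hfin hM0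

end BinaryGoldbach

section AlmostAllEven
open Real Polynomial

open Classical in
/-- Even numbers in `[2 * N, 4 * N]` that are not sums of two primes exceeding `N`. -/
noncomputable def goldbachExceptions (N : ℕ) : Finset ℕ :=
  (Finset.Icc (2 * N) (4 * N)).filter fun m =>
    Even m ∧ ¬∃ p q, p.Prime ∧ q.Prime ∧ N < p ∧ N < q ∧ p + q = m

theorem mem_goldbachExceptions {N m : ℕ} : m ∈ goldbachExceptions N ↔ (2 * N ≤ m ∧ m ≤ 4 * N) ∧
    Even m ∧ ¬∃ p q, p.Prime ∧ q.Prime ∧ N < p ∧ N < q ∧ p + q = m := by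
  classical rw [goldbachExceptions, Finset.mem_filter, Finset.mem_Icc]

/-- The number of exceptions in the binary Goldbach problem with two large primes is `o(N)`. -/
theorem eventually_card_goldbachExceptions_le {ε : ℝ} (hε : 0 < ε) :
    ∀ᶠ N : ℕ in atTop, ((goldbachExceptions N).card : ℝ) ≤ ε * N := by
  obtain ⟨c, hc, hF⟩ := exists_le_coeff_primePoly_mul_avgPoly
  set δ := c ^ 2 * (ε / 16)
  have hδ : 0 < δ := by positivity
  set ε₁ := ε * δ ^ 2 / 34
  have hε₁ : 0 < ε₁ := by positivity
  obtain ⟨Q, hQ, hminor⟩ := sum_norm_pow_four_primeExpSum_minor_le hε₁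
  obtain ⟨C, hC, hmajor⟩ := sum_norm_sq_primeExpSum_major_le (ε := 1) one_pos
  have hQ0 : (0 : ℝ) < Q := by exact_mod_cast hQ
  set R := max Q 2
  set W := R.factorial
  have hWpos : 0 < W := R.factorial_pos
  have hW0 : (0 : ℝ) < W := by exact_mod_cast hWpos
  set w := ∏ p ∈ R.primesLE, p
  have hw : 0 < w := Finset.prod_pos fun p hp => (Nat.mem_primesLE.1 hp).2.pos
  have hWd : ∀ q, 0 < q → q ≤ Q → q ∣ W := fun q h1 h2 =>
    Nat.dvd_factorial h1 (h2.trans (le_max_left _ _))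
  obtain ⟨η, hη, hη1, hηε, hη₁⟩ : ∃ η : ℝ, 0 < η ∧ η ≤ 1 ∧ η ≤ ε / 16 ∧
      64 * (C * Q) * (14 * (η * Q)) ^ 2 ≤ ε₁ := by
    set B := 64 * (C * Q) * (14 * Q) ^ 2
    have hB : 0 < B := by positivity
    refine ⟨min (min 1 (ε / 16)) (ε₁ / B), by positivity, (min_le_left _ _).trans (min_le_left _ _),
      (min_le_left _ _).trans (min_le_right _ _), ?_⟩
    set η := min (min 1 (ε / 16)) (ε₁ / B)
    have h0 : 0 < η := by positivity
    have h1 : η ≤ 1 := (min_le_left _ _).trans (min_le_left _ _)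
    have h2 : η * B ≤ ε₁ := by
      rw [← le_div_iff₀ hB]; exact min_le_right _ _
    calc 64 * (C * Q) * (14 * (η * Q)) ^ 2 = η * (η * B) := by ring
      _ ≤ 1 * (η * B) := by gcongr
      _ ≤ ε₁ := by rw [one_mul]; exact h2
  have e1 : ∀ᶠ N : ℕ in atTop, 16 * w / ε ≤ N := tendsto_natCast_atTop_atTop.eventually_ge_atTop _
  have e2 : ∀ᶠ N : ℕ in atTop, 4 / ε ≤ N := tendsto_natCast_atTop_atTop.eventually_ge_atTop _
  have e3 : ∀ᶠ N : ℕ in atTop, W / η ≤ N := tendsto_natCast_atTop_atTop.eventually_ge_atTop _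
  have e4 : ∀ᶠ N : ℕ in atTop, (Q : ℝ) ≤ Real.log N ^ 8 :=
    ((tendsto_pow_atTop (by norm_num)).comp
      (Real.tendsto_log_atTop.comp tendsto_natCast_atTop_atTop)).eventually_ge_atTop _
  filter_upwards [hF W η hWpos hη hη1, hminor, hmajor, e1, e2, e3, e4, eventually_gt_atTop 0]
    with N hF hminor hmajor e1 e2 e3 e4 hN
  have hN0 : (0 : ℝ) < N := by exact_mod_cast hN
  rw [div_le_iff₀ hε] at e1 e2
  rw [div_le_iff₀ hη] at e3
  set J := ⌊η * N / W⌋₊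
  have hJ : 0 < J := by
    rw [Nat.floor_pos, le_div_iff₀ hW0]; linarith
  have hWJ : (W : ℝ) * J ≤ η * N := by
    rw [mul_comm, ← le_div_iff₀ hW0]; exact Nat.floor_le (by positivity)
  have hWJN : W * J ≤ N := by
    have : (W : ℝ) * J ≤ 1 * N := hWJ.trans (by gcongr)
    rw [one_mul] at this
    exact_mod_cast this
  set M := (10 * N + 1).factorial
  have hM : 10 * N + 1 ≤ M := Nat.self_le_factorial _
  have hMd : ∀ d, 0 < d → d ≤ N → d ∣ M := fun d h1 h2 => Nat.dvd_factorial h1 (by omega)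
  have hmean := sum_coeff_sq_sub_sq_le (C := C * Q) hN hJ hη.le hWJ hWd
    (by omega : 2 * (4 * N + W * J) < M) (hminor M (by omega) hMd)
    ((hmajor M Q (by omega) hMd (by exact_mod_cast hQ) e4).trans (le_of_eq (by
      rw [Real.rpow_one]; ring)))
  set E := (goldbachExceptions N).filter fun m : ℕ => 2 * N + ε / 4 * N ≤ m
  have hlow : ∀ m ∈ E, (δ * N) ^ 2 ≤
      ((primePoly N ^ 2).coeff m - ((primePoly N * avgPoly W J) ^ 2).coeff m) ^ 2 := by
    intro m hm
    rw [Finset.mem_filter, mem_goldbachExceptions] at hm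
    obtain ⟨⟨⟨hm1, hm2⟩, hm3, hm4⟩, hm5⟩ := hm
    rw [coeff_primePoly_sq_eq_zero hm4, zero_sub, neg_sq]
    refine pow_le_pow_left₀ (by positivity) ?_ 2
    set X := m - 2 * (N + W * J)
    have hX : ε / 8 * N ≤ X := by
      have h1 : (m : ℝ) ≤ (X : ℝ) + 2 * (N + W * J) := by
        exact_mod_cast (by omega : m ≤ X + 2 * (N + W * J))
      have h2 : η * N ≤ ε / 16 * N := by gcongr
      linarith only [h1, h2, hWJ, hm5]
    have hX0 : 0 < X := by
      have : (0 : ℝ) < X := lt_of_lt_of_le (by positivity) hX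
      exact_mod_cast this
    have hkw : X < X / w * w + w := by
      have h1 := Nat.div_add_mod X w
      have h2 := Nat.mod_lt X hw
      rw [mul_comm] at h1
      omega
    have hkw' : (X : ℝ) < (X / w * w : ℕ) + w := by exact_mod_cast hkw
    have h3 := le_coeff_sq_of_le_coeff (coeff_primePoly_mul_avgPoly_nonneg N W J) hc.le
      (le_max_right Q 2) hm3 hm2 hF (k := X / w) (by
        change 2 * (N + W * J) + X / w * w ≤ m + 1
        have := Nat.div_mul_le_self X w
        omega)
    refine le_trans ?_ h3
    rw [mul_assoc]
    refine mul_le_mul_of_nonneg_left ?_ (by positivity)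
    linarith only [hkw', hX, e1]
  have hE : (E.card : ℝ) ≤ ε / 2 * N := by
    have h1 : E.card * (δ * N) ^ 2 ≤ (16 * ε₁ + 64 * (C * Q) * (14 * (η * Q)) ^ 2) * N ^ 3 := by
      refine le_trans ?_ hmean
      rw [← nsmul_eq_mul, ← Finset.sum_const]
      refine (Finset.sum_le_sum hlow).trans
        (Finset.sum_le_sum_of_subset_of_nonneg (fun m hm => ?_) fun m _ _ => sq_nonneg _)
      rw [Finset.mem_filter, mem_goldbachExceptions] at hm
      rw [Finset.mem_range]
      omega
    have h2 : E.card * (δ * N) ^ 2 ≤ (ε / 2 * N) * (δ * N) ^ 2 := by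
      calc E.card * (δ * N) ^ 2 ≤ (16 * ε₁ + ε₁) * N ^ 3 := h1.trans (by gcongr)
        _ = _ := by simp only [ε₁]; ring
    exact le_of_mul_le_mul_right h2 (by positivity)
  have hsmall : (((goldbachExceptions N).filter fun m : ℕ => ¬2 * N + ε / 4 * N ≤ m).card : ℝ) ≤
      ε / 4 * N + 1 := by
    have h1 : ((goldbachExceptions N).filter fun m : ℕ => ¬2 * N + ε / 4 * N ≤ m) ⊆
        Finset.Icc (2 * N) (2 * N + ⌊ε / 4 * N⌋₊) := by
      intro m hm
      rw [Finset.mem_filter, mem_goldbachExceptions, not_le] at hm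
      rw [Finset.mem_Icc]
      refine ⟨hm.1.1.1, ?_⟩
      rw [← Nat.sub_le_iff_le_add']
      refine Nat.le_floor ?_
      rw [Nat.cast_sub hm.1.1.1]
      push_cast
      linarith only [hm.2]
    have h2 := Finset.card_le_card h1
    rw [Nat.card_Icc] at h2
    have h3 : (((goldbachExceptions N).filter fun m : ℕ => ¬2 * N + ε / 4 * N ≤ m).card : ℝ) ≤
        ⌊ε / 4 * N⌋₊ + 1 := by
      exact_mod_cast h2.trans (by omega)
    have h4 : (⌊ε / 4 * N⌋₊ : ℝ) ≤ ε / 4 * N := Nat.floor_le (by positivity)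
    linarith only [h3, h4]
  rw [← Finset.card_filter_add_card_filter_not fun m : ℕ => 2 * N + ε / 4 * N ≤ m]
  push_cast
  linarith only [hE, hsmall, e2]

end AlmostAllEven

section GapCount

/-- The additive submonoid of `ℕ` generated by the primes `q ≥ x`. -/
def primeSemigroup (x : ℕ) : AddSubmonoid ℕ := AddSubmonoid.closure {q : ℕ | q.Prime ∧ x ≤ q}

theorem prime_mem_primeSemigroup {x q : ℕ} (hq : q.Prime) (h : x ≤ q) : q ∈ primeSemigroup x :=
  AddSubmonoid.subset_closure ⟨hq, h⟩

theorem of_mem_primeSemigroup {x m : ℕ} (hx : 3 ≤ x) (hm : m ∈ primeSemigroup x) :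
    m = 0 ∨ m.Prime ∧ x ≤ m ∨ 2 * x ≤ m ∧ Even m ∨ 3 * x ≤ m := by
  induction hm using AddSubmonoid.closure_induction with
  | mem q hq => exact Or.inr (Or.inl hq)
  | zero => exact Or.inl rfl
  | add a b _ _ ha hb =>
    rcases ha with rfl | ha | ha | ha
    · rwa [zero_add]
    · rcases hb with rfl | hb | hb | hb
      · exact Or.inr (Or.inl ha)
      · have h1 := ha.1.odd_of_ne_two (by omega)
        have h2 := hb.1.odd_of_ne_two (by omega)
        exact Or.inr (Or.inr (Or.inl ⟨by omega, h1.add_odd h2⟩))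
      all_goals omega
    all_goals
      rcases hb with rfl | hb | hb | hb
      · simp [ha]
      all_goals omega

open Classical in
/-- Even numbers in `[2 * x, 4 * x)` outside the semigroup generated by the primes `q ≥ x`. -/
noncomputable def evenGaps (x : ℕ) : Finset ℕ :=
  (Finset.Ico (2 * x) (4 * x)).filter fun m => Even m ∧ m ∉ primeSemigroup x

theorem mem_evenGaps {x m : ℕ} :
    m ∈ evenGaps x ↔ (2 * x ≤ m ∧ m < 4 * x) ∧ Even m ∧ m ∉ primeSemigroup x := by
  classical rw [evenGaps, Finset.mem_filter, Finset.mem_Ico]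

theorem card_evenGaps_le {x : ℕ} (hx : 0 < x) :
    (evenGaps x).card ≤ (goldbachExceptions (x - 1)).card + 1 := by
  refine (Finset.card_le_card fun m hm => ?_).trans (Finset.card_insert_le (4 * x - 2) _)
  rw [mem_evenGaps] at hm
  obtain ⟨hm, he, hT⟩ := hm
  obtain ⟨k, rfl⟩ := he
  rw [Finset.mem_insert, mem_goldbachExceptions, or_iff_not_imp_left]
  intro hne
  refine ⟨by omega, ⟨k, rfl⟩, ?_⟩
  rintro ⟨p, q, hp, hq, hxp, hxq, h⟩
  refine hT ?_
  rw [← h]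
  exact add_mem (prime_mem_primeSemigroup hp (by omega)) (prime_mem_primeSemigroup hq (by omega))

theorem even_mem_primeSemigroup_of_lt {x m : ℕ} (hx : 8 * (evenGaps x).card + 8 ≤ x)
    (hm : Even m) (h5 : 5 * x ≤ m) (h7 : m < 7 * x) : m ∈ primeSemigroup x := by
  obtain ⟨h, rfl⟩ := hm
  set I := Finset.Ioc (max x (h - 2 * x)) (min (2 * x - 1) (h - x))
  have hI : 2 * (evenGaps x).card < I.card := by
    rw [Nat.card_Ioc]; omega
  set f : ℕ → ℕ := fun b => 2 * b
  set g : ℕ → ℕ := fun b => h + h - 2 * b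
  have hf : (I.filter fun b => f b ∈ evenGaps x).card ≤ (evenGaps x).card := by
    refine Finset.card_le_card_of_injOn f (fun b hb => (Finset.mem_filter.1 hb).2) ?_
    intro a _ b _ hab
    simp only [f] at hab
    omega
  have hg : (I.filter fun b => g b ∈ evenGaps x).card ≤ (evenGaps x).card := by
    refine Finset.card_le_card_of_injOn g (fun b hb => (Finset.mem_filter.1 hb).2) ?_
    intro a ha b hb hab
    simp only [I, Finset.coe_filter, Set.mem_ofPred_eq, Finset.mem_Ioc] at ha hb
    simp only [g] at hab
    omega
  obtain ⟨b, hb, hbn⟩ : ∃ b ∈ I, b ∉ (I.filter fun b => f b ∈ evenGaps x) ∪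
      I.filter fun b => g b ∈ evenGaps x := by
    refine Finset.exists_mem_notMem_of_card_lt_card ?_
    have := Finset.card_union_le (I.filter fun b => f b ∈ evenGaps x)
      (I.filter fun b => g b ∈ evenGaps x)
    omega
  rw [Finset.mem_union, Finset.mem_filter, Finset.mem_filter, mem_evenGaps, mem_evenGaps] at hbn
  push Not at hbn
  have hb' := hb
  simp only [I, Finset.mem_Ioc] at hb'
  have h1 : f b ∈ primeSemigroup x :=
    hbn.1 hb ⟨by simp only [f]; omega, by simp only [f]; omega⟩ ⟨b, two_mul b⟩
  have h2 : g b ∈ primeSemigroup x :=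
    hbn.2 hb ⟨by simp only [g]; omega, by simp only [g]; omega⟩ ⟨h - b, by simp only [g]; omega⟩
  have h3 : h + h = f b + g b := by simp only [f, g]; omega
  rw [h3]
  exact add_mem h1 h2

theorem even_mem_primeSemigroup {x : ℕ} (hp : x.Prime) (hx : 8 * (evenGaps x).card + 8 ≤ x)
    (m : ℕ) (hm : Even m) (h5 : 5 * x ≤ m) : m ∈ primeSemigroup x := by
  induction m using Nat.strong_induction_on with
  | _ m ih =>
    rcases lt_or_ge m (7 * x) with h | h
    · exact even_mem_primeSemigroup_of_lt hx hm h5 h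
    · have h1 := ih (m - 2 * x) (by omega)
        ((Nat.even_sub (by omega)).2 (by simp [hm])) (by omega)
      have hxm := prime_mem_primeSemigroup hp le_rfl
      rw [show m = m - 2 * x + (x + x) by omega]
      exact add_mem h1 (add_mem hxm hxm)

/-- The initial segment `[0, 2 * x)` together with the odd numbers of `[2 * x, 3 * x)`. -/
def mainGaps (x : ℕ) : Finset ℕ :=
  Finset.range (2 * x) ∪ (Finset.range (x / 2)).image fun i => 2 * x + 2 * i + 1

theorem card_mainGaps (x : ℕ) : (mainGaps x).card = 2 * x + x / 2 := by
  rw [mainGaps, Finset.card_union_of_disjoint, Finset.card_range,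
    Finset.card_image_of_injective _ fun a b h => by omega, Finset.card_range]
  rw [Finset.disjoint_left]
  intro m hm hm'
  obtain ⟨i, -, rfl⟩ := Finset.mem_image.1 hm'
  rw [Finset.mem_range] at hm
  omega

theorem gaps_primeSemigroup_subset {x : ℕ} (hp : x.Prime) (hodd : Odd x)
    (hx : 8 * (evenGaps x).card + 8 ≤ x) : {m : ℕ | m ∉ primeSemigroup x} ⊆
      ↑(mainGaps x ∪ ((Finset.range 4 ×ˢ evenGaps x).image fun y => y.1 * x + y.2)) := by
  intro m hm
  rw [Set.mem_ofPred_eq] at hm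
  have hxm := prime_mem_primeSemigroup hp le_rfl
  have hev : ∀ n, 2 * x ≤ n → Even n → n ∉ primeSemigroup x →
      n ∈ evenGaps x ∨ 2 * x ≤ n ∧ n - 2 * x ∈ evenGaps x := by
    intro n h2 he hn
    have h5 : n < 5 * x := by
      by_contra! h
      exact hn (even_mem_primeSemigroup hp hx n he h)
    rcases lt_or_ge n (4 * x) with h4 | h4
    · exact Or.inl (mem_evenGaps.2 ⟨⟨h2, h4⟩, he, hn⟩)
    · refine Or.inr ⟨h2, mem_evenGaps.2 ⟨by omega, (Nat.even_sub h2).2 (by simp [he]), ?_⟩⟩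
      intro h
      refine hn ?_
      rw [show n = n - 2 * x + (x + x) by omega]
      exact add_mem h (add_mem hxm hxm)
  rw [Finset.coe_union, Set.mem_union, or_iff_not_imp_left]
  intro hmain
  simp only [mainGaps, Finset.coe_union, Finset.coe_range, Finset.coe_image, Set.mem_union,
    Set.mem_Iio, Set.mem_image, not_or, not_lt, not_exists, not_and] at hmain
  simp only [Finset.coe_image, Set.mem_image, Finset.mem_coe, Finset.mem_product, Finset.mem_range,
    Prod.exists]
  rcases Nat.even_or_odd m with he | ho
  · rcases hev m hmain.1 he hm with h | ⟨h2, h⟩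
    · exact ⟨0, m, ⟨by norm_num, h⟩, by omega⟩
    · exact ⟨2, m - 2 * x, ⟨by norm_num, h⟩, by omega⟩
  · have h3 : 3 * x ≤ m := by
      by_contra! h3
      obtain ⟨i, rfl⟩ := ho
      obtain ⟨y, rfl⟩ := hodd
      exact hmain.2 (i - (2 * y + 1)) (by omega) (by omega)
    have hmx : m - x ∉ primeSemigroup x := by
      intro h
      refine hm ?_
      rw [show m = m - x + x by omega]
      exact add_mem h hxm
    rcases hev (m - x) (by omega) (Nat.Odd.sub_odd ho hodd) hmx with h | ⟨h2, h⟩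
    · exact ⟨1, m - x, ⟨by norm_num, h⟩, by omega⟩
    · exact ⟨3, m - x - 2 * x, ⟨by norm_num, h⟩, by omega⟩

theorem ncard_gaps_primeSemigroup_le {x : ℕ} (hp : x.Prime) (hodd : Odd x)
    (hx : 8 * (evenGaps x).card + 8 ≤ x) :
    {m : ℕ | m ∉ primeSemigroup x}.ncard ≤ 2 * x + x / 2 + 4 * (evenGaps x).card := by
  refine (Set.ncard_le_ncard (gaps_primeSemigroup_subset hp hodd hx)
    (Finset.finite_toSet _)).trans ?_
  rw [Set.ncard_coe_finset]
  refine (Finset.card_union_le _ _).trans ?_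
  rw [card_mainGaps]
  refine Nat.add_le_add_left (Finset.card_image_le.trans (le_of_eq ?_)) _
  rw [Finset.card_product, Finset.card_range]

theorem le_ncard_gaps_primeSemigroup {x : ℕ} (hx : 3 ≤ x)
    (hfin : {m : ℕ | m ∉ primeSemigroup x}.Finite) :
    2 * x + x / 2 ≤ {m : ℕ | m ∉ primeSemigroup x}.ncard + (Nat.primeCounting (3 * x) + 1) := by
  set P := (3 * x).primesLE
  have hsub : ((mainGaps x \ insert 0 P : Finset ℕ) : Set ℕ) ⊆ {m : ℕ | m ∉ primeSemigroup x} := by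
    intro m hm hmT
    rw [Finset.mem_coe, Finset.mem_sdiff, Finset.mem_insert, Nat.mem_primesLE] at hm
    have h1 : m < 3 * x ∧ (m < 2 * x ∨ ¬Even m) := by
      rcases Finset.mem_union.1 hm.1 with h | h
      · rw [Finset.mem_range] at h
        omega
      · obtain ⟨i, hi, rfl⟩ := Finset.mem_image.1 h
        rw [Finset.mem_range] at hi
        refine ⟨by omega, Or.inr ?_⟩
        rw [Nat.not_even_iff]
        omega
    rcases of_mem_primeSemigroup hx hmT with h | h | h | h
    · exact hm.2 (Or.inl h)
    · exact hm.2 (Or.inr ⟨h1.1.le, h.1⟩)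
    · rcases h1.2 with h2 | h2
      · omega
      · exact h2 h.2
    · omega
  have h1 := Set.ncard_le_ncard hsub hfin
  rw [Set.ncard_coe_finset] at h1
  have h2 := Finset.le_card_sdiff (insert 0 P) (mainGaps x)
  have h3 := Finset.card_insert_le 0 P
  have h4 : P.card = Nat.primeCounting (3 * x) := by
    simp [P]
  rw [card_mainGaps] at h2
  omega

end GapCount

theorem tendsto_nthPrime : Tendsto nthPrime atTop atTop :=
  (Nat.nth_strictMono Nat.infinite_setOfPred_prime).tendsto_atTop.comp (tendsto_sub_atTop_nat 1)

theorem eventually_primeCounting_three_mul_le {ε : ℝ} (hε : 0 < ε) :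
    ∀ᶠ x : ℕ in atTop, (Nat.primeCounting (3 * x) : ℝ) ≤ ε * x := by
  have h3 : Tendsto (fun x : ℕ => ((3 * x : ℕ) : ℝ)) atTop atTop :=
    tendsto_natCast_atTop_atTop.comp (tendsto_id.const_mul_atTop' (by norm_num : 0 < 3))
  have h1 := h3.eventually (Chebyshev.eventually_primeCounting_le one_pos)
  have h2 : ∀ᶠ x : ℕ in atTop, (Real.log 4 + 1) * 3 / ε ≤ Real.log (3 * x : ℕ) :=
    (Real.tendsto_log_atTop.comp h3).eventually_ge_atTop _
  filter_upwards [h1, h2, eventually_gt_atTop 0] with x h1 h2 hx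
  have hx0 : (0 : ℝ) < x := by exact_mod_cast hx
  have hlog : 0 < Real.log (3 * x : ℕ) := by
    refine Real.log_pos ?_
    exact_mod_cast (by omega : 1 < 3 * x)
  rw [Nat.floor_natCast] at h1
  refine h1.trans ?_
  rw [div_le_iff₀ hlog]
  rw [div_le_iff₀ hε] at h2
  push_cast at h2 ⊢
  nlinarith

theorem eventually_card_evenGaps_le {ε : ℝ} (hε : 0 < ε) :
    ∀ᶠ x : ℕ in atTop, ((evenGaps x).card : ℝ) ≤ ε * x := by
  have h1 := (tendsto_sub_atTop_nat 1).eventually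
    (eventually_card_goldbachExceptions_le (half_pos hε))
  have h2 : ∀ᶠ x : ℕ in atTop, 2 / ε ≤ x := tendsto_natCast_atTop_atTop.eventually_ge_atTop _
  filter_upwards [h1, h2, eventually_gt_atTop 0] with x h1 h2 hx
  rw [div_le_iff₀ hε] at h2
  have h3 : ((evenGaps x).card : ℝ) ≤ (goldbachExceptions (x - 1)).card + 1 := by
    exact_mod_cast card_evenGaps_le hx
  have h4 : ((x - 1 : ℕ) : ℝ) ≤ x := by exact_mod_cast Nat.sub_le x 1
  nlinarith

theorem genus_asymptotic :
    Filter.Tendsto (fun n => (genus n : ℝ) / (nthPrime n : ℝ)) Filter.atTop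
      (nhds (5 / 2)) := by
  rw [Metric.tendsto_nhds]
  intro ε hε
  set δ := min (ε / 8) (1 / 16)
  have hδ : 0 < δ := by positivity
  have hδε : δ ≤ ε / 8 := min_le_left _ _
  have hδ1 : δ ≤ 1 / 16 := min_le_right _ _
  have e1 : ∀ᶠ x : ℕ in atTop, 2 / δ ≤ x := tendsto_natCast_atTop_atTop.eventually_ge_atTop _
  filter_upwards [tendsto_nthPrime.eventually (eventually_card_evenGaps_le hδ),
    tendsto_nthPrime.eventually (eventually_primeCounting_three_mul_le hδ),
    tendsto_nthPrime.eventually (eventually_ge_atTop 16),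
    tendsto_nthPrime.eventually e1] with n hgaps hpi hlarge e1
  have hp : (nthPrime n).Prime := Nat.prime_nth_prime (n - 1)
  have hS : genus n = {m : ℕ | m ∉ primeSemigroup (nthPrime n)}.ncard := rfl
  rw [hS]
  set x := nthPrime n
  have hx0 : (0 : ℝ) < x := by exact_mod_cast hp.pos
  have hx16 : (16 : ℝ) ≤ x := by exact_mod_cast hlarge
  rw [div_le_iff₀ hδ] at e1
  have hodd : Odd x := hp.odd_of_ne_two (by omega)
  have hx : 8 * (evenGaps x).card + 8 ≤ x := by
    have : (8 * (evenGaps x).card + 8 : ℝ) ≤ x := by nlinarith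
    exact_mod_cast this
  have hup := ncard_gaps_primeSemigroup_le hp hodd hx
  have hlow := le_ncard_gaps_primeSemigroup (by omega : 3 ≤ x)
    ((Finset.finite_toSet _).subset (gaps_primeSemigroup_subset hp hodd hx))
  set G := {m : ℕ | m ∉ primeSemigroup x}.ncard
  have hup' : 2 * (G : ℝ) ≤ 5 * x + 8 * (evenGaps x).card := by
    exact_mod_cast (by omega : 2 * G ≤ 5 * x + 8 * (evenGaps x).card)
  have hlow' : 5 * (x : ℝ) ≤ 2 * G + 2 * Nat.primeCounting (3 * x) + 3 := by
    exact_mod_cast (by omega : 5 * x ≤ 2 * G + 2 * Nat.primeCounting (3 * x) + 3)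
  have hεx : δ * x ≤ ε / 8 * x := by gcongr
  have hεx0 : 0 < ε * x := by positivity
  rw [Real.dist_eq, abs_lt]
  constructor
  · rw [lt_sub_iff_add_lt, lt_div_iff₀ hx0]
    nlinarith
  · rw [sub_lt_iff_lt_add, div_lt_iff₀ hx0]
    nlinarith
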